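/- Let 1<p≤2 and let U⊂(0,∞) be nonempty with p_cr(U)<p. Then the maximal operator 𝓗^U is bounded on L^p(ℝ²) if and only if 𝔑(U)<∞. -/

import Mathlib

open MeasureTheory Filter Set Topology
open scoped ENNReal NNReal Topology Classical

noncomputable section

/-- The homogeneous curve of degree `b`: `γ_b(t) = c₊ t^b` for `t > 0`,
`γ_b(t) = c₋ (-t)^b` for `t < 0`, `γ_b(0) = 0`. -/
def curve (b cp cm t : ℝ) : ℝ :=
  if 0 < t then cp * t ^ b else if t < 0 then cm * (-t) ^ b else 0

/-- The maximal function along the curve `(t, u γ_b(t))`. -/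
def Mu (b cp cm u : ℝ) (f : ℝ × ℝ → ℝ) (x : ℝ × ℝ) : ℝ :=
  ⨆ R : {R : ℝ // 0 < R},
    ((R : ℝ))⁻¹ * ∫ t in (0:ℝ)..(R : ℝ), |f (x - (t, u * curve b cp cm t))|

/-- The maximal function `𝓜^U f = sup_{u ∈ U} M^{(u)} f`. -/
def calM (b cp cm : ℝ) (U : Set ℝ) (f : ℝ × ℝ → ℝ) (x : ℝ × ℝ) : ℝ :=
  ⨆ u : U, Mu b cp cm (u : ℝ) f x

/-- The Hilbert transform along the curve `(t, u γ_b(t))` (principal value). -/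
def Hu (b cp cm u : ℝ) (f : ℝ × ℝ → ℝ) (x : ℝ × ℝ) : ℝ :=
  limUnder (𝓝[>] (0:ℝ)) fun ε : ℝ =>
    ∫ t in {t : ℝ | ε < |t| ∧ |t| < ε⁻¹}, f (x - (t, u * curve b cp cm t)) / t

/-- The maximal function `𝓗^U f = sup_{u ∈ U} |H^{(u)} f|`, valued in `ℝ≥0∞`. -/
def calH (b cp cm : ℝ) (U : Set ℝ) (f : ℝ × ℝ → ℝ) (x : ℝ × ℝ) : ℝ≥0∞ :=
  ⨆ u : U, ENNReal.ofReal |Hu b cp cm (u : ℝ) f x|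

/-- The `L^p` norm of an `ℝ≥0∞`-valued function on `ℝ²`. -/
def lpN (g : ℝ × ℝ → ℝ≥0∞) (p : ℝ) : ℝ≥0∞ :=
  (∫⁻ x : ℝ × ℝ, g x ^ p) ^ (1 / p)

def eN (p : ℝ) : ℝ≥0∞ := ENNReal.ofReal p

/-- `U^r = r⁻¹ U ∩ [1,2] = {ρ ∈ [1,2] : rρ ∈ U}`. -/
def UrSet (U : Set ℝ) (r : ℝ) : Set ℝ := {ρ : ℝ | ρ ∈ Icc (1:ℝ) 2 ∧ r * ρ ∈ U}

/-- `N(A,δ)`: minimal number of intervals of length `δ` needed to cover `A`. -/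
def covN (A : Set ℝ) (δ : ℝ) : ℕ :=
  sInf {n : ℕ | ∃ F : Finset ℝ, F.card = n ∧ A ⊆ ⋃ a ∈ F, Icc a (a + δ)}

/-- `𝒦_p(U,δ) = δ^{1-1/p} sup_{r>0} N(U^r,δ)^{1/p}`. -/
def Kp (U : Set ℝ) (δ p : ℝ) : ℝ :=
  δ ^ (1 - 1 / p) * ⨆ r : {r : ℝ // 0 < r}, ((covN (UrSet U (r : ℝ)) δ : ℝ)) ^ (1 / p)

/-- `p_cr(U) = 1 + limsup_{δ→0+} sup_{r>0} log N(U^r,δ) / log(1/δ)`. -/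
def pcr (U : Set ℝ) : ℝ :=
  1 + limsup (fun δ : ℝ =>
      (⨆ r : {r : ℝ // 0 < r}, Real.log (covN (UrSet U (r : ℝ)) δ)) / Real.log δ⁻¹)
    (𝓝[>] (0:ℝ))

/-- `𝔑(U) = 1 + #{n ∈ ℤ : [2ⁿ, 2ⁿ⁺¹] ∩ U ≠ ∅}`. -/
def frakN (U : Set ℝ) : ℕ∞ :=
  1 + Set.encard {n : ℤ | (Icc ((2:ℝ) ^ n) ((2:ℝ) ^ (n + 1)) ∩ U).Nonempty}

/-- `√(log 𝔑(U))`, valued in `ℝ≥0∞` (equal to `∞` if `𝔑(U) = ∞`). -/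
def sqrtLogN (U : Set ℝ) : ℝ≥0∞ :=
  if frakN U = ⊤ then ⊤
  else ENNReal.ofReal (Real.sqrt (Real.log ((frakN U).toNat : ℝ)))

/-- The `L^p → L^p` operator norm of `𝓜^U` (smallest admissible constant, possibly `∞`). -/
def opNormM (b cp cm : ℝ) (U : Set ℝ) (p : ℝ) : ℝ≥0∞ :=
  sInf {C : ℝ≥0∞ | ∀ f : SchwartzMap (ℝ × ℝ) ℝ,
    eLpNorm (calM b cp cm U ⇑f) (eN p) volume ≤ C * eLpNorm ⇑f (eN p) volume}

/-- The `L^p → L^p` operator norm of `𝓗^U` (smallest admissible constant, possibly `∞`). -/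
def opNormH (b cp cm : ℝ) (U : Set ℝ) (p : ℝ) : ℝ≥0∞ :=
  sInf {C : ℝ≥0∞ | ∀ f : SchwartzMap (ℝ × ℝ) ℝ,
    lpN (calH b cp cm U ⇑f) p ≤ C * eLpNorm ⇑f (eN p) volume}

/-- `θ_{p,ℓ}`. -/
def theta (p : ℝ) (l : ℕ) : ℝ :=
  if (l : ℝ) ≤ (p - 1)⁻¹ then (p - 1) ^ (3 - 10 / p) else (l : ℝ) ^ (7 * (2 / p - 1))

/-- `Σ_{ℓ≥1} θ_{p,ℓ} 𝒦_p(U, 2^{-ℓ})`, valued in `ℝ≥0∞`. -/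
def KpSum (U : Set ℝ) (p : ℝ) : ℝ≥0∞ :=
  ∑' l : ℕ, ENNReal.ofReal (theta p (l + 1) * Kp U ((2:ℝ) ^ (-((l : ℝ) + 1))) p)

/-- First derivative test: a phase with non-vanishing monotone derivative. -/
theorem norm_integral_exp_le_of_deriv {φ φ' φ'' : ℝ → ℝ} {p q l : ℝ} (hpq : p ≤ q) (hl : 0 < l)
    (h1 : ∀ t ∈ Icc p q, HasDerivAt φ (φ' t) t) (h2 : ∀ t ∈ Icc p q, HasDerivAt φ' (φ'' t) t)
    (hc : ContinuousOn φ'' (Icc p q)) (hb : ∀ t ∈ Icc p q, l ≤ |φ' t|)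
    (hs : (∀ t ∈ Icc p q, 0 ≤ φ'' t) ∨ ∀ t ∈ Icc p q, φ'' t ≤ 0) :
    ‖∫ t in p..q, Complex.exp (Complex.I * (φ t : ℂ))‖ ≤ 4 / l := by
  have hI : uIcc p q = Icc p q := uIcc_of_le hpq
  have hp : p ∈ Icc p q := ⟨le_rfl, hpq⟩
  have hq : q ∈ Icc p q := ⟨hpq, le_rfl⟩
  have hne : ∀ t ∈ Icc p q, φ' t ≠ 0 := fun t ht h0 => by
    have := hb t ht; rw [h0, abs_zero] at this; linarith
  have hc1 : ContinuousOn φ' (Icc p q) := fun t ht => (h2 t ht).continuousAt.continuousWithinAt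
  have hc0 : ContinuousOn φ (Icc p q) := fun t ht => (h1 t ht).continuousAt.continuousWithinAt
  have hinv : ∀ t ∈ Icc p q, HasDerivAt (fun t => (φ' t)⁻¹) (-φ'' t / (φ' t) ^ 2) t :=
    fun t ht => (h2 t ht).inv (hne t ht)
  have hci : ContinuousOn (fun t => -φ'' t / (φ' t) ^ 2) (Icc p q) :=
    hc.neg.div (hc1.pow 2) fun t ht => pow_ne_zero 2 (hne t ht)
  have hii : IntervalIntegrable (fun t => -φ'' t / (φ' t) ^ 2) volume p q :=
    (hI ▸ hci : ContinuousOn _ (uIcc p q)).intervalIntegrable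
  set u : ℝ → ℂ := fun t => -Complex.I * (((φ' t)⁻¹ : ℝ) : ℂ) with hu
  set u' : ℝ → ℂ := fun t => -Complex.I * ((-φ'' t / (φ' t) ^ 2 : ℝ) : ℂ) with hu'
  set v : ℝ → ℂ := fun t => Complex.exp (Complex.I * (φ t : ℂ)) with hv
  set v' : ℝ → ℂ := fun t => Complex.exp (Complex.I * (φ t : ℂ)) * (Complex.I * (φ' t : ℂ)) with hv'
  have hnv : ∀ t, ‖v t‖ = 1 := fun t => by
    simp only [hv]; rw [mul_comm]; exact Complex.norm_exp_ofReal_mul_I _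
  have key := intervalIntegral.integral_mul_deriv_eq_deriv_mul (a := p) (b := q) (u := u) (u' := u')
    (v := v) (v' := v')
    (fun t ht => ((hinv t (hI ▸ ht)).ofReal_comp.const_mul (-Complex.I)))
    (fun t ht => (((h1 t (hI ▸ ht)).ofReal_comp.const_mul Complex.I).cexp))
    (by
      apply ContinuousOn.intervalIntegrable
      rw [hI]
      exact continuousOn_const.mul (Complex.continuous_ofReal.comp_continuousOn hci))
    (by
      apply ContinuousOn.intervalIntegrable
      rw [hI]
      have := Complex.continuous_ofReal.comp_continuousOn hc0
      have h' := Complex.continuous_ofReal.comp_continuousOn hc1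
      exact ((continuousOn_const.mul this).cexp).mul (continuousOn_const.mul h'))
  have e1 : ∫ t in p..q, u t * v' t = ∫ t in p..q, v t := by
    apply intervalIntegral.integral_congr
    intro t ht
    rw [hI] at ht
    have : (φ' t : ℂ) ≠ 0 := by exact_mod_cast hne t ht
    simp only [hu, hv', hv]
    push_cast
    field_simp
    simp
  rw [e1] at key
  have hub : ∀ t ∈ Icc p q, ‖u t * v t‖ ≤ 1 / l := fun t ht => by
    rw [norm_mul, hnv, mul_one]
    simp only [hu, norm_mul, norm_neg, Complex.norm_I, one_mul, Complex.norm_real, norm_inv,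
      Real.norm_eq_abs]
    rw [inv_eq_one_div]
    exact one_div_le_one_div_of_le hl (hb t ht)
  have hig : ‖∫ t in p..q, u' t * v t‖ ≤ 2 / l := by
    have hFT : ∫ t in p..q, (-φ'' t / (φ' t) ^ 2) = (φ' q)⁻¹ - (φ' p)⁻¹ :=
      intervalIntegral.integral_eq_sub_of_hasDerivAt (fun t ht => hinv t (hI ▸ ht)) hii
    have habs : |∫ t in p..q, (-φ'' t / (φ' t) ^ 2)| ≤ 2 / l := by
      rw [hFT]
      have a1 : |(φ' q)⁻¹| ≤ 1 / l := by
        rw [abs_inv, inv_eq_one_div]; exact one_div_le_one_div_of_le hl (hb q hq)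
      have a2 : |(φ' p)⁻¹| ≤ 1 / l := by
        rw [abs_inv, inv_eq_one_div]; exact one_div_le_one_div_of_le hl (hb p hp)
      calc _ ≤ |(φ' q)⁻¹| + |(φ' p)⁻¹| := abs_sub _ _
        _ ≤ 1 / l + 1 / l := add_le_add a1 a2
        _ = 2 / l := by ring
    have hle : ‖∫ t in p..q, u' t * v t‖ ≤ ∫ t in p..q, |(-φ'' t / (φ' t) ^ 2)| := by
      refine (intervalIntegral.norm_integral_le_integral_norm hpq).trans (le_of_eq ?_)
      apply intervalIntegral.integral_congr
      intro t _
      simp only [norm_mul, hnv, mul_one, hu', norm_neg, Complex.norm_I, one_mul,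
        Complex.norm_real, Real.norm_eq_abs]
    refine hle.trans ?_
    rcases hs with hs | hs
    · have : ∫ t in p..q, |(-φ'' t / (φ' t) ^ 2)| = -∫ t in p..q, (-φ'' t / (φ' t) ^ 2) := by
        rw [← intervalIntegral.integral_neg]
        apply intervalIntegral.integral_congr
        intro t ht
        rw [hI] at ht
        apply abs_of_nonpos
        exact div_nonpos_of_nonpos_of_nonneg (by linarith [hs t ht]) (sq_nonneg _)
      rw [this]
      exact (neg_le_abs _).trans habs
    · have : ∫ t in p..q, |(-φ'' t / (φ' t) ^ 2)| = ∫ t in p..q, (-φ'' t / (φ' t) ^ 2) := by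
        apply intervalIntegral.integral_congr
        intro t ht
        rw [hI] at ht
        apply abs_of_nonneg
        exact div_nonneg (by linarith [hs t ht]) (sq_nonneg _)
      rw [this]
      exact (le_abs_self _).trans habs
  change ‖∫ t in p..q, v t‖ ≤ 4 / l
  rw [key]
  calc _ ≤ ‖u q * v q‖ + ‖u p * v p‖ + ‖∫ t in p..q, u' t * v t‖ :=
        (norm_sub_le _ _).trans (add_le_add_left (norm_sub_le _ _) _)
    _ ≤ 1 / l + 1 / l + 2 / l := add_le_add (add_le_add (hub q hq) (hub p hp)) hig
    _ = 4 / l := by ring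

/-- Van der Corput's second derivative test. -/
theorem norm_integral_exp_le_of_deriv2 {φ φ' φ'' : ℝ → ℝ} {p q l : ℝ} (hpq : p ≤ q) (hl : 0 < l)
    (h1 : ∀ t ∈ Icc p q, HasDerivAt φ (φ' t) t) (h2 : ∀ t ∈ Icc p q, HasDerivAt φ' (φ'' t) t)
    (hc : ContinuousOn φ'' (Icc p q))
    (hs : (∀ t ∈ Icc p q, l ≤ φ'' t) ∨ ∀ t ∈ Icc p q, φ'' t ≤ -l) :
    ‖∫ t in p..q, Complex.exp (Complex.I * (φ t : ℂ))‖ ≤ 18 / √l := by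
  have hc1 : ContinuousOn φ' (Icc p q) := fun t ht => (h2 t ht).continuousAt.continuousWithinAt
  have hc0 : ContinuousOn φ (Icc p q) := fun t ht => (h1 t ht).continuousAt.continuousWithinAt
  have hs' : (∀ t ∈ Icc p q, 0 ≤ φ'' t) ∨ ∀ t ∈ Icc p q, φ'' t ≤ 0 :=
    hs.imp (fun h t ht => hl.le.trans (h t ht)) fun h t ht => (h t ht).trans (by linarith)
  obtain ⟨c, hc_mem, hcmin⟩ := isCompact_Icc.exists_isMinOn (nonempty_Icc.2 hpq) hc1.abs
  have hdiff : ∀ x ∈ Icc p q, ∀ y ∈ Icc p q, l * |x - y| ≤ |φ' x - φ' y| := by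
    have main : ∀ x ∈ Icc p q, ∀ y ∈ Icc p q, x < y → l * |x - y| ≤ |φ' x - φ' y| := by
      intro x hx y hy hxy
      have hsub : Icc x y ⊆ Icc p q := Icc_subset_Icc hx.1 hy.2
      obtain ⟨z, hz, hzeq⟩ := exists_hasDerivAt_eq_slope φ' φ'' hxy (hc1.mono hsub)
        (fun t ht => h2 t (hsub (Ioo_subset_Icc_self ht)))
      have hzm := hsub (Ioo_subset_Icc_self hz)
      have hlz : l ≤ |φ'' z| := by
        rcases hs with h | h
        · exact (h z hzm).trans (le_abs_self _)
        · have := h z hzm; exact (by linarith : l ≤ -φ'' z).trans (neg_le_abs _)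
      have : φ' y - φ' x = φ'' z * (y - x) := by
        rw [hzeq]; field_simp [sub_ne_zero.2 hxy.ne']
      rw [abs_sub_comm, abs_sub_comm (φ' x), this, abs_mul]
      exact mul_le_mul_of_nonneg_right hlz (abs_nonneg _)
    intro x hx y hy
    rcases lt_trichotomy x y with h | h | h
    · exact main x hx y hy h
    · simp [h]
    · rw [abs_sub_comm, abs_sub_comm (φ' x)]; exact main y hy x hx h
  have hlow : ∀ t ∈ Icc p q, l * |t - c| / 2 ≤ |φ' t| := fun t ht => by
    have a1 := hdiff t ht c hc_mem
    have a2 : |φ' c| ≤ |φ' t| := hcmin ht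
    have a3 := abs_sub (φ' t) (φ' c)
    linarith
  have hsq : 0 < √l := Real.sqrt_pos.2 hl
  have hsql : √l * √l = l := Real.mul_self_sqrt hl.le
  set h : ℝ := 1 / √l with hh
  have hhpos : 0 < h := by positivity
  have hlh : l * h = √l := by rw [hh, mul_one_div, div_eq_iff hsq.ne']; exact hsql.symm
  set p' := max p (c - h) with hp'
  set q' := min q (c + h) with hq'
  have hpp' : p ≤ p' := le_max_left _ _
  have hp'c : p' ≤ c := max_le hc_mem.1 (by linarith)
  have hcq' : c ≤ q' := le_min hc_mem.2 (by linarith)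
  have hq'q : q' ≤ q := min_le_left _ _
  have hcont : ContinuousOn (fun t => Complex.exp (Complex.I * (φ t : ℂ))) (Icc p q) :=
    (continuousOn_const.mul (Complex.continuous_ofReal.comp_continuousOn hc0)).cexp
  have hii : ∀ x y, x ∈ Icc p q → y ∈ Icc p q →
      IntervalIntegrable (fun t => Complex.exp (Complex.I * (φ t : ℂ))) volume x y := by
    intro x y hx hy
    exact (hcont.mono (uIcc_subset_Icc hx hy)).intervalIntegrable
  have mp : p ∈ Icc p q := ⟨le_rfl, hpq⟩
  have mq : q ∈ Icc p q := ⟨hpq, le_rfl⟩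
  have mp' : p' ∈ Icc p q := ⟨hpp', hp'c.trans hc_mem.2⟩
  have mq' : q' ∈ Icc p q := ⟨hc_mem.1.trans hcq', hq'q⟩
  have hsplit : ∫ t in p..q, Complex.exp (Complex.I * (φ t : ℂ)) =
      (∫ t in p..p', Complex.exp (Complex.I * (φ t : ℂ))) +
      (∫ t in p'..q', Complex.exp (Complex.I * (φ t : ℂ))) +
      ∫ t in q'..q, Complex.exp (Complex.I * (φ t : ℂ)) := by
    rw [intervalIntegral.integral_add_adjacent_intervals (hii _ _ mp mp') (hii _ _ mp' mq'),
      intervalIntegral.integral_add_adjacent_intervals (hii _ _ mp mq') (hii _ _ mq' mq)]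
  have hmid : ‖∫ t in p'..q', Complex.exp (Complex.I * (φ t : ℂ))‖ ≤ 2 / √l := by
    have := intervalIntegral.norm_integral_le_of_norm_le_const (a := p') (b := q') (C := 1)
      (f := fun t => Complex.exp (Complex.I * (φ t : ℂ))) (fun t _ => by
        rw [mul_comm]; exact (Complex.norm_exp_ofReal_mul_I _).le)
    refine this.trans ?_
    rw [abs_of_nonneg (by linarith), one_mul]
    have e1 : c - h ≤ p' := le_max_right _ _
    have e2 : q' ≤ c + h := min_le_right _ _
    have : 2 / √l = 2 * h := by rw [hh]; ring
    linarith
  have hout : ∀ x y, x ∈ Icc p q → y ∈ Icc p q → x ≤ y → (x < y → ∀ t ∈ Icc x y, h ≤ |t - c|) →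
      ‖∫ t in x..y, Complex.exp (Complex.I * (φ t : ℂ))‖ ≤ 8 / √l := by
    intro x y hx hy hxy hd
    rcases hxy.eq_or_lt with rfl | hlt
    · simp; positivity
    have hsub : Icc x y ⊆ Icc p q := Icc_subset_Icc hx.1 hy.2
    have := norm_integral_exp_le_of_deriv (φ := φ) (φ' := φ') (φ'' := φ'') (l := √l / 2) hxy
      (by positivity) (fun t ht => h1 t (hsub ht)) (fun t ht => h2 t (hsub ht)) (hc.mono hsub)
      (fun t ht => by
        refine le_trans ?_ (hlow t (hsub ht))
        rw [← hlh]
        have := mul_le_mul_of_nonneg_left (hd hlt t ht) hl.le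
        linarith) (hs'.imp (fun h t ht => h t (hsub ht)) fun h t ht => h t (hsub ht))
    refine this.trans (le_of_eq ?_)
    field_simp; norm_num
  have hL := hout p p' mp mp' hpp' (fun hlt t ht => by
    have : p' = c - h := by
      rcases max_choice p (c - h) with e | e
      · rw [hp', e] at hlt; exact absurd hlt (lt_irrefl _)
      · rw [hp', e]
    rw [abs_sub_comm]
    exact le_trans (by linarith [ht.2]) (le_abs_self _))
  have hR := hout q' q mq' mq hq'q (fun hlt t ht => by
    have : q' = c + h := by
      rcases min_choice q (c + h) with e | e
      · rw [hq', e] at hlt; exact absurd hlt (lt_irrefl _)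
      · rw [hq', e]
    exact le_trans (by linarith [ht.1]) (le_abs_self _))
  rw [hsplit]
  calc _ ≤ _ + _ + _ := norm_add₃_le
    _ ≤ 8 / √l + 2 / √l + 8 / √l := add_le_add (add_le_add hL hmid) hR
    _ = 18 / √l := by ring

/-- Decay of the oscillatory integral with phase `η₁ t + η₂ t ^ b` on `[1, s] ⊆ [1, 2]`. -/
theorem exists_norm_integral_exp_power_le {b : ℝ} (hb : 1 < b) :
    ∃ C : ℝ, 0 ≤ C ∧ ∀ η₁ η₂ s : ℝ, s ∈ Icc (1:ℝ) 2 →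
      ‖∫ t in (1:ℝ)..s, Complex.exp (Complex.I * ((η₁ * t + η₂ * t ^ b : ℝ) : ℂ))‖ *
        √(|η₁| + |η₂|) ≤ C := by
  set D : ℝ := 2 * b * 2 ^ b with hD
  have hDpos : 0 < D := by positivity
  set E : ℝ := b * (b - 1) / 2 with hE
  have hEpos : 0 < E := by have : 0 < b - 1 := by linarith
                           positivity
  refine ⟨16 + 18 / √E * √(D + 1), by positivity, fun η₁ η₂ s hs => ?_⟩
  set J := ‖∫ t in (1:ℝ)..s, Complex.exp (Complex.I * ((η₁ * t + η₂ * t ^ b : ℝ) : ℂ))‖ with hJ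
  have hJ0 : 0 ≤ J := norm_nonneg _
  have hJ1 : J ≤ 1 := by
    have := intervalIntegral.norm_integral_le_of_norm_le_const (a := 1) (b := s) (C := 1)
      (f := fun t : ℝ => Complex.exp (Complex.I * ((η₁ * t + η₂ * t ^ b : ℝ) : ℂ))) (fun t _ => by
        rw [mul_comm]; exact (Complex.norm_exp_ofReal_mul_I _).le)
    refine this.trans ?_
    rw [one_mul, abs_of_nonneg (by linarith [hs.1])]; linarith [hs.2]
  have d1 : ∀ t ∈ Icc (1:ℝ) s, HasDerivAt (fun t : ℝ => η₁ * t + η₂ * t ^ b)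
      (η₁ + η₂ * (b * t ^ (b - 1))) t := fun t ht => by
    have ht0 : t ≠ 0 := by linarith [ht.1]
    have := ((hasDerivAt_id' t).const_mul η₁).fun_add
      ((Real.hasDerivAt_rpow_const (p := b) (Or.inl ht0)).const_mul η₂)
    simpa using this
  have d2 : ∀ t ∈ Icc (1:ℝ) s, HasDerivAt (fun t : ℝ => η₁ + η₂ * (b * t ^ (b - 1)))
      (η₂ * (b * ((b - 1) * t ^ (b - 2)))) t := fun t ht => by
    have ht0 : t ≠ 0 := by linarith [ht.1]
    have := ((Real.hasDerivAt_rpow_const (p := b - 1) (Or.inl ht0)).const_mul b).const_mul η₂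
    have h2 : b - 1 - 1 = b - 2 := by ring
    rw [h2] at this
    simpa using this.const_add η₁
  have dc : ContinuousOn (fun t : ℝ => η₂ * (b * ((b - 1) * t ^ (b - 2)))) (Icc 1 s) := by
    refine continuousOn_const.mul (continuousOn_const.mul (continuousOn_const.mul ?_))
    exact fun t ht => (Real.continuousAt_rpow_const t _ (Or.inl (by linarith [ht.1]))).continuousWithinAt
  have hpos : ∀ t ∈ Icc (1:ℝ) s, 1 / 2 ≤ t ^ (b - 2) := fun t ht => by
    have ht1 := ht.1
    calc (1:ℝ) / 2 ≤ t⁻¹ := by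
          rw [one_div]; exact inv_anti₀ (by linarith) (by linarith [ht.2, hs.2])
      _ = t ^ (-1 : ℝ) := (Real.rpow_neg_one t).symm
      _ ≤ t ^ (b - 2) := Real.rpow_le_rpow_of_exponent_le ht1 (by linarith)
  rcases le_total (D * |η₂|) |η₁| with hcase | hcase
  · -- non-stationary case
    rcases eq_or_ne η₁ 0 with h0 | h0
    · have h2 : η₂ = 0 := by
        rw [h0, abs_zero] at hcase
        have : |η₂| ≤ 0 := by
          by_contra hcon
          push Not at hcon
          have := mul_pos hDpos hcon
          linarith
        exact abs_eq_zero.1 (le_antisymm this (abs_nonneg _))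
      rw [h0, h2]; simp; positivity
    have hη : 0 < |η₁| := abs_pos.2 h0
    have hJ2 : J ≤ 4 / (|η₁| / 2) := by
      refine norm_integral_exp_le_of_deriv hs.1 (by positivity) d1 d2 dc (fun t ht => ?_) ?_
      · have ht1 := ht.1
        have hb1 : t ^ (b - 1) ≤ 2 ^ b := by
          calc t ^ (b - 1) ≤ 2 ^ (b - 1) :=
                Real.rpow_le_rpow (by linarith) (by linarith [ht.2, hs.2]) (by linarith)
            _ ≤ 2 ^ b := Real.rpow_le_rpow_of_exponent_le (by norm_num) (by linarith)
        have hb2 : |η₂ * (b * t ^ (b - 1))| ≤ |η₁| / 2 := by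
          rw [abs_mul, abs_of_nonneg (by positivity : 0 ≤ b * t ^ (b - 1))]
          have := mul_le_mul_of_nonneg_left hb1 (by positivity : 0 ≤ |η₂| * b)
          calc |η₂| * (b * t ^ (b - 1)) = |η₂| * b * t ^ (b - 1) := by ring
            _ ≤ |η₂| * b * 2 ^ b := this
            _ = D * |η₂| / 2 := by rw [hD]; ring
            _ ≤ _ := by linarith
        have := abs_sub_abs_le_abs_sub η₁ (-(η₂ * (b * t ^ (b - 1))))
        rw [abs_neg, sub_neg_eq_add] at this
        linarith
      · rcases le_total 0 η₂ with h | h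
        · left; intro t ht
          have := hpos t ht
          have hb' : 0 ≤ b - 1 := by linarith
          have : 0 ≤ t ^ (b - 2) := by linarith
          positivity
        · right; intro t ht
          have := hpos t ht
          have hb' : 0 ≤ b - 1 := by linarith
          have : 0 ≤ t ^ (b - 2) := by linarith
          exact mul_nonpos_of_nonpos_of_nonneg h (by positivity)
    have hsum : |η₁| + |η₂| ≤ 2 * |η₁| := by
      have hD1 : 1 ≤ D := by
        have : (1:ℝ) ≤ 2 ^ b := Real.one_le_rpow (by norm_num) (by linarith)
        rw [hD]; nlinarith
      have := mul_le_mul_of_nonneg_right hD1 (abs_nonneg η₂)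
      linarith
    have hJs : J * √(|η₁| + |η₂|) ≤ 16 := by
      rw [← abs_of_nonneg (mul_nonneg hJ0 (Real.sqrt_nonneg _))]
      apply abs_le_of_sq_le_sq _ (by norm_num)
      rw [mul_pow, Real.sq_sqrt (by positivity)]
      have : J ^ 2 ≤ 8 / |η₁| := by
        have : J ^ 2 ≤ J * 1 := by nlinarith
        have h' : 4 / (|η₁| / 2) = 8 / |η₁| := by field_simp; norm_num
        linarith
      calc J ^ 2 * (|η₁| + |η₂|) ≤ 8 / |η₁| * (2 * |η₁|) := by gcongr
        _ = 16 := by field_simp; norm_num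
        _ ≤ 16 ^ 2 := by norm_num
    have : 0 ≤ 18 / √E * √(D + 1) := by positivity
    linarith
  · -- curvature case
    rcases eq_or_ne η₂ 0 with h0 | h0
    · rw [h0, abs_zero, mul_zero] at hcase
      have : η₁ = 0 := abs_eq_zero.1 (le_antisymm hcase (abs_nonneg _))
      rw [h0, this]; simp; positivity
    have hη : 0 < |η₂| := abs_pos.2 h0
    have hJ2 : J ≤ 18 / √(E * |η₂|) := by
      refine norm_integral_exp_le_of_deriv2 hs.1 (by positivity) d1 d2 dc ?_
      have hb' : 0 < b * (b - 1) := by have : 0 < b - 1 := by linarith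
                                       positivity
      rcases le_total 0 η₂ with h | h
      · left; intro t ht
        rw [abs_of_nonneg h]
        have := mul_le_mul_of_nonneg_left (hpos t ht) (mul_nonneg hb'.le h)
        calc E * η₂ = b * (b - 1) * η₂ * (1 / 2) := by rw [hE]; ring
          _ ≤ _ := this
          _ = _ := by ring
      · right; intro t ht
        rw [abs_of_nonpos h]
        have := mul_le_mul_of_nonneg_left (hpos t ht) (mul_nonneg hb'.le (neg_nonneg.2 h))
        have e : E * -η₂ = b * (b - 1) * (-η₂) * (1 / 2) := by rw [hE]; ring
        have e' : η₂ * (b * ((b - 1) * t ^ (b - 2))) = -(b * (b - 1) * (-η₂) * t ^ (b - 2)) := by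
          ring
        rw [e, e']; linarith
    have hsum : √(|η₁| + |η₂|) ≤ √(D + 1) * √|η₂| := by
      rw [← Real.sqrt_mul (by positivity)]
      exact Real.sqrt_le_sqrt (by linarith)
    rw [Real.sqrt_mul hEpos.le] at hJ2
    have hs2 : 0 < √|η₂| := Real.sqrt_pos.2 hη
    have hsE : 0 < √E := Real.sqrt_pos.2 hEpos
    calc J * √(|η₁| + |η₂|) ≤ 18 / (√E * √|η₂|) * (√(D + 1) * √|η₂|) := by gcongr
      _ = 18 / √E * √(D + 1) := by field_simp
      _ ≤ _ := by linarith

/-- The same decay in the presence of a smooth amplitude. -/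
theorem exists_norm_integral_amplitude_exp_power_le {b : ℝ} (hb : 1 < b) {a a' : ℝ → ℝ}
    (ha : ∀ t ∈ Icc (1:ℝ) 2, HasDerivAt a (a' t) t) (ha' : ContinuousOn a' (Icc 1 2)) :
    ∃ C : ℝ, 0 ≤ C ∧ ∀ η₁ η₂ s : ℝ, s ∈ Icc (1:ℝ) 2 →
      ‖∫ t in (1:ℝ)..s, (a t : ℂ) * Complex.exp (Complex.I * ((η₁ * t + η₂ * t ^ b : ℝ) : ℂ))‖ *
        √(|η₁| + |η₂|) ≤ C := by
  obtain ⟨C, hC0, hC⟩ := exists_norm_integral_exp_power_le hb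
  have hac : ContinuousOn a (Icc 1 2) := fun t ht => (ha t ht).continuousAt.continuousWithinAt
  obtain ⟨A, hA⟩ := isCompact_Icc.exists_bound_of_continuousOn hac
  obtain ⟨A', hA'⟩ := isCompact_Icc.exists_bound_of_continuousOn ha'
  have hA0 : 0 ≤ A := (norm_nonneg _).trans (hA 1 (by simp))
  have hA'0 : 0 ≤ A' := (norm_nonneg _).trans (hA' 1 (by simp))
  refine ⟨A * C + A' * C, by positivity, fun η₁ η₂ s hs => ?_⟩
  set e : ℝ → ℂ := fun t => Complex.exp (Complex.I * ((η₁ * t + η₂ * t ^ b : ℝ) : ℂ)) with he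
  set F : ℝ → ℂ := fun t => ∫ r in (1:ℝ)..t, e r with hF
  have hec : Continuous e := by
    have : Continuous fun t : ℝ => η₁ * t + η₂ * t ^ b :=
      (continuous_const.mul continuous_id).add
        (continuous_const.mul (Real.continuous_rpow_const (by linarith)))
    exact (continuous_const.mul (Complex.continuous_ofReal.comp this)).cexp
  have hsub : Icc (1:ℝ) s ⊆ Icc 1 2 := Icc_subset_Icc le_rfl hs.2
  have hI : uIcc (1:ℝ) s = Icc 1 s := uIcc_of_le hs.1
  have hFd : ∀ t, HasDerivAt F (e t) t := fun t =>
    intervalIntegral.integral_hasDerivAt_right (hec.intervalIntegrable _ _)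
      (hec.stronglyMeasurableAtFilter _ _) hec.continuousAt
  have hFc : Continuous F := continuous_iff_continuousAt.2 fun t => (hFd t).continuousAt
  have key := intervalIntegral.integral_mul_deriv_eq_deriv_mul (a := 1) (b := s)
    (u := fun t => (a t : ℂ)) (u' := fun t => (a' t : ℂ)) (v := F) (v' := e)
    (fun t ht => (ha t (hsub (hI ▸ ht))).ofReal_comp) (fun t _ => hFd t)
    (by
      apply ContinuousOn.intervalIntegrable
      rw [hI]
      exact Complex.continuous_ofReal.comp_continuousOn (ha'.mono hsub))
    (hec.intervalIntegrable _ _)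
  have hF1 : F 1 = 0 := by simp [hF]
  rw [hF1, mul_zero, sub_zero] at key
  change ‖∫ t in (1:ℝ)..s, (a t : ℂ) * e t‖ * _ ≤ _
  rw [key]
  set R := √(|η₁| + |η₂|) with hR
  have hR0 : 0 ≤ R := Real.sqrt_nonneg _
  have b1 : ‖(a s : ℂ) * F s‖ * R ≤ A * C := by
    rw [norm_mul, Complex.norm_real, mul_assoc]
    exact mul_le_mul (hA s hs) (hC η₁ η₂ s hs) (by positivity) hA0
  have b2 : ‖∫ t in (1:ℝ)..s, (a' t : ℂ) * F t‖ * R ≤ A' * C := by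
    rcases hR0.eq_or_lt with h | h
    · rw [← h, mul_zero]; positivity
    have : ‖∫ t in (1:ℝ)..s, (a' t : ℂ) * F t‖ ≤ A' * C / R * |s - 1| := by
      apply intervalIntegral.norm_integral_le_of_norm_le_const
      intro t ht
      rw [uIoc_of_le hs.1] at ht
      have htm : t ∈ Icc (1:ℝ) 2 := ⟨ht.1.le, ht.2.trans hs.2⟩
      rw [norm_mul, Complex.norm_real, le_div_iff₀ h, mul_assoc]
      exact mul_le_mul (hA' t htm) (hC η₁ η₂ t htm) (by positivity) hA'0
    have hs1 : |s - 1| ≤ 1 := by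
      rw [abs_of_nonneg (by linarith [hs.1])]; linarith [hs.2]
    calc _ ≤ A' * C / R * |s - 1| * R := by gcongr
      _ ≤ A' * C / R * 1 * R := by gcongr
      _ = A' * C := by field_simp
  calc _ ≤ (‖(a s : ℂ) * F s‖ + ‖∫ t in (1:ℝ)..s, (a' t : ℂ) * F t‖) * R := by
        gcongr; exact norm_sub_le _ _
    _ ≤ _ := by rw [add_mul]; exact add_le_add b1 b2

section Kernel
variable {E : Type*} [NormedAddCommGroup E]

/-- Lipschitz functions decaying in the first variable. -/
def Tame (f : ℝ × ℝ → E) : Prop :=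
  ∃ L : ℝ, (∀ y z, ‖f y - f z‖ ≤ L * ‖y - z‖) ∧ ∀ y, (1 + |y.1|) * ‖f y‖ ≤ L

theorem Tame.continuous {f : ℝ × ℝ → E} (hf : Tame f) : Continuous f := by
  obtain ⟨L, hL, -⟩ := hf
  have : LipschitzWith (Real.toNNReal L) f := LipschitzWith.of_dist_le_mul fun y z => by
    rw [dist_eq_norm, dist_eq_norm]
    exact (hL y z).trans (mul_le_mul_of_nonneg_right (Real.le_coe_toNNReal L) (norm_nonneg _))
  exact this.continuous

variable [NormedSpace ℝ E]

/-- The odd part of `f` along the curve, divided by the parameter. -/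
def oddQuot (b cp cm u : ℝ) (f : ℝ × ℝ → E) (x : ℝ × ℝ) (t : ℝ) : E :=
  t⁻¹ • (f (x - (t, u * (cp * t ^ b))) - f (x - (-t, u * (cm * t ^ b))))

/-- The Hilbert transform along a curve as an absolutely convergent integral. -/
def Hint (b cp cm u : ℝ) (f : ℝ × ℝ → E) (x : ℝ × ℝ) : E :=
  ∫ t in Ioi (0:ℝ), oddQuot b cp cm u f x t

theorem continuousOn_oddQuot {b cp cm u : ℝ} (hb : 1 < b) {f : ℝ × ℝ → E} (hf : Continuous f)
    (x : ℝ × ℝ) : ContinuousOn (oddQuot b cp cm u f x) (Ioi 0) := by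
  have hc : Continuous fun t : ℝ => t ^ b := Real.continuous_rpow_const (by linarith)
  refine ContinuousOn.smul (continuousOn_inv₀.mono fun t ht => (ne_of_gt ht)) ?_
  refine Continuous.continuousOn ?_
  fun_prop

theorem Tame.exists_oddQuot_bound {b cp cm u : ℝ} (hb : 1 < b) {f : ℝ × ℝ → E} (hf : Tame f)
    (x : ℝ × ℝ) : ∃ K : ℝ, 0 ≤ K ∧ ∀ t, 0 < t → ‖oddQuot b cp cm u f x t‖ ≤ K ∧
      ‖oddQuot b cp cm u f x t‖ ≤ K * t ^ (-2 : ℝ) := by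
  obtain ⟨L, hL, hd⟩ := hf
  have hL0 : 0 ≤ L := le_trans (by positivity) (hd 0)
  set W := |u| * (|cp| + |cm|) with hW
  have hW0 : 0 ≤ W := by positivity
  set K := 2 * L * (1 + |x.1|) + L * (2 + W) with hK
  have hK1 : 0 ≤ L * |x.1| := by positivity
  have hK2 : 0 ≤ L * W := by positivity
  have hK0 : 0 ≤ K := by positivity
  have hfar : ∀ t, 0 < t → ‖oddQuot b cp cm u f x t‖ ≤ 2 * L * (1 + |x.1|) * t ^ (-2 : ℝ) := by
    intro t ht
    have h1 : ∀ y : ℝ × ℝ, |x.1 - y.1| = t → ‖f y‖ ≤ L * (1 + |x.1|) * t⁻¹ := by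
      intro y hy
      have h2 : t ≤ (1 + |x.1|) * (1 + |y.1|) := by
        have := abs_sub x.1 y.1
        nlinarith [abs_nonneg x.1, abs_nonneg y.1]
      have h3 := hd y
      rw [← div_eq_mul_inv, le_div_iff₀ ht]
      calc ‖f y‖ * t ≤ ‖f y‖ * ((1 + |x.1|) * (1 + |y.1|)) := by gcongr
        _ = (1 + |y.1|) * ‖f y‖ * (1 + |x.1|) := by ring
        _ ≤ L * (1 + |x.1|) := by gcongr
    have e1 := h1 (x - (t, u * (cp * t ^ b))) (by simp [abs_of_pos ht])
    have e2 := h1 (x - (-t, u * (cm * t ^ b))) (by simp [abs_of_pos ht])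
    have e3 : t ^ (-2 : ℝ) = t⁻¹ * t⁻¹ := by
      rw [Real.rpow_neg ht.le, Real.rpow_two, sq, mul_inv]
    rw [oddQuot, norm_smul, norm_inv, Real.norm_eq_abs, abs_of_pos ht, e3]
    calc _ ≤ t⁻¹ * (L * (1 + |x.1|) * t⁻¹ + L * (1 + |x.1|) * t⁻¹) := by
          gcongr; exact (norm_sub_le _ _).trans (add_le_add e1 e2)
      _ = _ := by ring
  refine ⟨K, hK0, fun t ht => ⟨?_, ?_⟩⟩
  · rcases le_total t 1 with h | h
    · have h1 := hL (x - (t, u * (cp * t ^ b))) (x - (-t, u * (cm * t ^ b)))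
      have htb : t ^ b ≤ t := by
        calc t ^ b ≤ t ^ (1:ℝ) := Real.rpow_le_rpow_of_exponent_ge ht h hb.le
          _ = t := Real.rpow_one t
      have h2 : ‖x - (t, u * (cp * t ^ b)) - (x - (-t, u * (cm * t ^ b)))‖ ≤ (2 + W) * t := by
        have e : x - (t, u * (cp * t ^ b)) - (x - (-t, u * (cm * t ^ b))) =
          (-2 * t, u * (cm - cp) * t ^ b) := by ext <;> simp <;> ring
        rw [e, Prod.norm_def]
        have h0 : 0 ≤ t ^ b := by positivity
        apply max_le
        · simp only [Real.norm_eq_abs, abs_mul, abs_neg, abs_of_pos ht]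
          norm_num; nlinarith
        · simp only [Real.norm_eq_abs, abs_mul, abs_of_nonneg h0]
          have : |cm - cp| ≤ |cp| + |cm| := by rw [add_comm]; exact abs_sub _ _
          calc |u| * |cm - cp| * t ^ b ≤ |u| * (|cp| + |cm|) * t := by gcongr
            _ ≤ _ := by rw [← hW]; nlinarith
      rw [oddQuot, norm_smul, norm_inv, Real.norm_eq_abs, abs_of_pos ht]
      calc _ ≤ t⁻¹ * (L * ((2 + W) * t)) := by
            gcongr; exact h1.trans (by gcongr)
        _ = L * (2 + W) := by field_simp
        _ ≤ K := by rw [hK]; nlinarith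
    · have h1 : t ^ (-2 : ℝ) ≤ 1 := Real.rpow_le_one_of_one_le_of_nonpos h (by norm_num)
      calc _ ≤ _ := hfar t ht
        _ ≤ 2 * L * (1 + |x.1|) * 1 := by gcongr
        _ ≤ K := by rw [hK]; nlinarith
  · refine (hfar t ht).trans ?_
    gcongr
    rw [hK]; nlinarith

theorem Tame.integrableOn_oddQuot {b cp cm u : ℝ} (hb : 1 < b) {f : ℝ × ℝ → E} (hf : Tame f)
    (x : ℝ × ℝ) : IntegrableOn (oddQuot b cp cm u f x) (Ioi 0) := by
  obtain ⟨K, hK0, hK⟩ := hf.exists_oddQuot_bound (b := b) (cp := cp) (cm := cm) (u := u) hb x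
  have hc := continuousOn_oddQuot (cp := cp) (cm := cm) (u := u) hb hf.continuous x
  rw [← Ioc_union_Ioi_eq_Ioi (zero_le_one (α := ℝ))]
  refine IntegrableOn.union ?_ ?_
  · refine Integrable.mono' (integrableOn_const (C := K) (by simp))
      ((hc.mono Ioc_subset_Ioi_self).aestronglyMeasurable measurableSet_Ioc) ?_
    filter_upwards [ae_restrict_mem measurableSet_Ioc] with t ht using (hK t ht.1).1
  · have h2 : IntegrableOn (fun t : ℝ => K * t ^ (-2 : ℝ)) (Ioi 1) :=
      (integrableOn_Ioi_rpow_of_lt (by norm_num) one_pos).const_mul K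
    refine Integrable.mono' h2 ((hc.mono fun t ht => ?_).aestronglyMeasurable measurableSet_Ioi) ?_
    · exact lt_trans one_pos (mem_Ioi.1 ht)
    · filter_upwards [ae_restrict_mem measurableSet_Ioi] with t ht
      exact (hK t (lt_trans one_pos (mem_Ioi.1 ht))).2

theorem Tame.tendsto_integral_Ioo {b cp cm u : ℝ} (hb : 1 < b) {f : ℝ × ℝ → E} (hf : Tame f)
    (x : ℝ × ℝ) {ι : Type*} {l : Filter ι} [l.IsCountablyGenerated] {p q : ι → ℝ}
    (hp : Tendsto p l (𝓝 0)) (hp0 : ∀ᶠ i in l, 0 ≤ p i) (hq : Tendsto q l atTop) :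
    Tendsto (fun i => ∫ t in Ioo (p i) (q i), oddQuot b cp cm u f x t) l
      (𝓝 (Hint b cp cm u f x)) := by
  have hcov : AECover (volume.restrict (Ioi (0:ℝ))) l (fun i => Ioo (p i) (q i)) := by
    constructor
    · filter_upwards [ae_restrict_mem measurableSet_Ioi] with t ht
      filter_upwards [hp.eventually_lt_const ht, hq.eventually_gt_atTop t] with i h1 h2
      exact ⟨h1, h2⟩
    · intro i; exact measurableSet_Ioo
  have := hcov.integral_tendsto_of_countably_generated
    (hf.integrableOn_oddQuot (cp := cp) (cm := cm) (u := u) hb x)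
  refine this.congr' ?_
  filter_upwards [hp0] with i hi
  rw [Measure.restrict_restrict measurableSet_Ioo]
  congr 2
  ext t; simp only [mem_inter_iff, mem_Ioo, mem_Ioi]
  exact ⟨fun h => h.1, fun h => ⟨h, lt_of_le_of_lt hi h.1⟩⟩

end Kernel

theorem setIntegral_curve_eq {b cp cm u : ℝ} (hb : 1 < b) {f : ℝ × ℝ → ℝ} (hf : Continuous f)
    (x : ℝ × ℝ) {ε : ℝ} (hε : 0 < ε) :
    ∫ t in {t : ℝ | ε < |t| ∧ |t| < ε⁻¹}, f (x - (t, u * curve b cp cm t)) / t =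
      ∫ t in Ioo ε ε⁻¹, oddQuot b cp cm u f x t := by
  have hset : {t : ℝ | ε < |t| ∧ |t| < ε⁻¹} = Ioo ε ε⁻¹ ∪ Neg.neg ⁻¹' Ioo ε ε⁻¹ := by
    ext t
    simp only [mem_ofPred_eq, mem_union, mem_Ioo, mem_preimage]
    rcases le_total 0 t with h | h
    · rw [abs_of_nonneg h]
      constructor
      · exact Or.inl
      · rintro (h' | h')
        · exact h'
        · linarith [h'.1]
    · rw [abs_of_nonpos h]
      constructor
      · exact Or.inr
      · rintro (h' | h')
        · linarith [h'.1]
        · exact h'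
  have hc : Continuous fun t : ℝ => t ^ b := Real.continuous_rpow_const (by linarith)
  have c1 : ContinuousOn (fun t : ℝ => f (x - (t, u * (cp * t ^ b))) / t) (Icc ε ε⁻¹) :=
    ContinuousOn.div (Continuous.continuousOn (by fun_prop)) continuousOn_id
      fun t ht => (lt_of_lt_of_le hε ht.1).ne'
  have c2 : ContinuousOn (fun t : ℝ => f (x - (-t, u * (cm * t ^ b))) / (-t)) (Icc ε ε⁻¹) :=
    ContinuousOn.div (Continuous.continuousOn (by fun_prop)) continuousOn_id.neg
      fun t ht => by have := (lt_of_lt_of_le hε ht.1).ne'; simpa using this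
  have i1 : IntegrableOn (fun t : ℝ => f (x - (t, u * (cp * t ^ b))) / t) (Ioo ε ε⁻¹) :=
    (c1.integrableOn_Icc).mono_set Ioo_subset_Icc_self
  have i2 : IntegrableOn (fun t : ℝ => f (x - (-t, u * (cm * t ^ b))) / (-t)) (Ioo ε ε⁻¹) :=
    (c2.integrableOn_Icc).mono_set Ioo_subset_Icc_self
  have e1 : EqOn (fun t : ℝ => f (x - (t, u * curve b cp cm t)) / t)
      (fun t : ℝ => f (x - (t, u * (cp * t ^ b))) / t) (Ioo ε ε⁻¹) := fun t ht => by
    have : 0 < t := hε.trans ht.1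
    simp [curve, this]
  have e2 : EqOn (fun t : ℝ => f (x - (-t, u * curve b cp cm (-t))) / (-t))
      (fun t : ℝ => f (x - (-t, u * (cm * t ^ b))) / (-t)) (Ioo ε ε⁻¹) := fun t ht => by
    have h : 0 < t := hε.trans ht.1
    have : ¬ 0 < -t := by linarith
    have h3 : ¬ t < 0 := by linarith
    simp [curve, h, h3]
  have hneg := (Measure.measurePreserving_neg (volume : Measure ℝ))
  have hemb : MeasurableEmbedding (Neg.neg : ℝ → ℝ) := (MeasurableEquiv.neg ℝ).measurableEmbedding
  have hn1 : ∫ t in Neg.neg ⁻¹' Ioo ε ε⁻¹, f (x - (t, u * curve b cp cm t)) / t =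
      ∫ t in Ioo ε ε⁻¹, f (x - (-t, u * curve b cp cm (-t))) / (-t) := by
    rw [← hneg.setIntegral_preimage_emb hemb]
    simp
  have hn2 : IntegrableOn (fun t : ℝ => f (x - (t, u * curve b cp cm t)) / t)
      (Neg.neg ⁻¹' Ioo ε ε⁻¹) := by
    have := (hneg.integrableOn_comp_preimage hemb (s := Ioo ε ε⁻¹)
      (f := fun t : ℝ => f (x - (-t, u * curve b cp cm (-t))) / (-t))).2
      ((integrableOn_congr_fun e2 measurableSet_Ioo).2 i2)
    simpa [Function.comp_def] using this
  rw [hset, setIntegral_union _ (measurableSet_Ioo.preimage measurable_neg)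
    ((integrableOn_congr_fun e1 measurableSet_Ioo).2 i1) hn2, hn1,
    setIntegral_congr_fun measurableSet_Ioo e1, setIntegral_congr_fun measurableSet_Ioo e2,
    ← integral_add i1 i2]
  · refine setIntegral_congr_fun measurableSet_Ioo fun t ht => ?_
    simp only [oddQuot, smul_eq_mul, div_neg]
    ring
  · rw [Set.disjoint_left]
    intro t ht ht'
    have h1 := ht.1
    have h2 : ε < -t := ht'.1
    linarith

theorem Tame.Hu_eq {b cp cm u : ℝ} (hb : 1 < b) {f : ℝ × ℝ → ℝ} (hf : Tame f) (x : ℝ × ℝ) :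
    Hu b cp cm u f x = Hint b cp cm u f x := by
  refine Tendsto.limUnder_eq ?_
  have h1 : Tendsto (fun ε : ℝ => ε) (𝓝[>] 0) (𝓝 0) := tendsto_id.mono_left nhdsWithin_le_nhds
  have := hf.tendsto_integral_Ioo (cp := cp) (cm := cm) (u := u) hb x h1
    (eventually_nhdsWithin_of_forall fun ε hε => le_of_lt hε) tendsto_inv_nhdsGT_zero
  refine this.congr' (eventually_nhdsWithin_of_forall fun ε hε => ?_)
  exact (setIntegral_curve_eq hb hf.continuous x hε).symm

theorem SchwartzMap.tame {E : Type*} [NormedAddCommGroup E] [NormedSpace ℝ E]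
    (f : SchwartzMap (ℝ × ℝ) E) : Tame (f : ℝ × ℝ → E) := by
  obtain ⟨C0, hC0⟩ := f.decay 0 1
  obtain ⟨C1, hC1⟩ := f.decay 0 0
  obtain ⟨C2, hC2⟩ := f.decay 1 0
  have hlip : ∀ y z, ‖f y - f z‖ ≤ C0 * ‖y - z‖ := by
    intro y z
    refine Convex.norm_image_sub_le_of_norm_fderiv_le (𝕜 := ℝ) (s := univ)
      (fun x _ => f.differentiableAt) (fun x _ => ?_) convex_univ (mem_univ _) (mem_univ _)
    have := hC0.2 x
    rw [pow_zero, one_mul, norm_iteratedFDeriv_one] at this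
    exact this
  refine ⟨max C0 (C1 + C2), fun y z => (hlip y z).trans ?_, fun y => ?_⟩
  · gcongr; exact le_max_left _ _
  · refine le_trans ?_ (le_max_right _ _)
    have h1 := hC1.2 y
    have h2 := hC2.2 y
    rw [norm_iteratedFDeriv_zero, pow_zero, one_mul] at h1
    rw [norm_iteratedFDeriv_zero, pow_one] at h2
    have h3 : |y.1| ≤ ‖y‖ := norm_fst_le y
    nlinarith [norm_nonneg (f y)]

/-- The character `x ↦ e^{i x·ξ}` of the plane. -/
def ex (ξ x : ℝ × ℝ) : ℂ := Complex.exp (Complex.I * ((x.1 * ξ.1 + x.2 * ξ.2 : ℝ) : ℂ))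

/-- The `ℓ¹` norm of a frequency. -/
def nrm (ξ : ℝ × ℝ) : ℝ := |ξ.1| + |ξ.2|

/-- The nonisotropic dilations. -/
def dil (b l : ℝ) (ξ : ℝ × ℝ) : ℝ × ℝ := (l * ξ.1, l ^ b * ξ.2)

/-- A bump weight, comparable to `min (√x) (1 / √x)`. -/
def wt (x : ℝ) : ℝ := √x / (1 + x)

theorem norm_ex (ξ x : ℝ × ℝ) : ‖ex ξ x‖ = 1 := by
  rw [ex, mul_comm]; exact Complex.norm_exp_ofReal_mul_I _

theorem ex_add_right (ξ x y : ℝ × ℝ) : ex ξ (x + y) = ex ξ x * ex ξ y := by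
  rw [ex, ex, ex, ← Complex.exp_add]; congr 1; push_cast [Prod.fst_add, Prod.snd_add]; ring

theorem ex_add_left (ξ η x : ℝ × ℝ) : ex (ξ + η) x = ex ξ x * ex η x := by
  rw [ex, ex, ex, ← Complex.exp_add]; congr 1; push_cast [Prod.fst_add, Prod.snd_add]; ring

theorem continuous_ex : Continuous fun p : (ℝ × ℝ) × (ℝ × ℝ) => ex p.1 p.2 := by
  unfold ex; fun_prop

theorem continuous_ex_right (ξ : ℝ × ℝ) : Continuous (ex ξ) := by
  unfold ex; fun_prop

theorem norm_ex_sub_le (ξ x y : ℝ × ℝ) :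
    ‖ex ξ x - ex ξ y‖ ≤ |(x.1 - y.1) * ξ.1 + (x.2 - y.2) * ξ.2| := by
  have h : ex ξ x - ex ξ y = ex ξ y * (ex ξ (x - y) - 1) := by
    rw [mul_sub, ← ex_add_right]; simp
  rw [h, norm_mul, norm_ex, one_mul, ex]
  refine Real.norm_exp_I_mul_ofReal_sub_one_le.trans (le_of_eq ?_)
  simp

theorem nrm_nonneg (ξ : ℝ × ℝ) : 0 ≤ nrm ξ := by unfold nrm; positivity

theorem nrm_pos {ξ : ℝ × ℝ} (h : ξ ≠ 0) : 0 < nrm ξ := by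
  unfold nrm
  rcases ne_or_eq ξ.1 0 with h1 | h1
  · have := abs_pos.2 h1; positivity
  · rcases ne_or_eq ξ.2 0 with h2 | h2
    · have := abs_pos.2 h2; positivity
    · exact absurd (Prod.ext h1 h2) h

theorem dil_mul {b l k : ℝ} (hl : 0 ≤ l) (hk : 0 ≤ k) (ξ : ℝ × ℝ) :
    dil b (l * k) ξ = dil b l (dil b k ξ) := by
  unfold dil; rw [Real.mul_rpow hl hk]; ext <;> simp <;> ring

theorem dil_one (b : ℝ) (ξ : ℝ × ℝ) : dil b 1 ξ = ξ := by
  unfold dil; simp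

theorem two_mul_nrm_le {b : ℝ} (hb : 1 < b) (ξ : ℝ × ℝ) : 2 * nrm ξ ≤ nrm (dil b 2 ξ) := by
  have h : (2:ℝ) ≤ 2 ^ b := by
    calc (2:ℝ) = 2 ^ (1:ℝ) := (Real.rpow_one 2).symm
      _ ≤ _ := Real.rpow_le_rpow_of_exponent_le (by norm_num) hb.le
  unfold nrm dil
  rw [abs_mul, abs_mul, abs_two, abs_of_nonneg (by positivity : (0:ℝ) ≤ 2 ^ b)]
  nlinarith [abs_nonneg ξ.2]

theorem two_mul_nrm_zpow_le {b : ℝ} (hb : 1 < b) (j : ℤ) (ξ : ℝ × ℝ) :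
    2 * nrm (dil b (2 ^ j) ξ) ≤ nrm (dil b (2 ^ (j + 1)) ξ) := by
  rw [zpow_add₀ two_ne_zero, zpow_one, mul_comm ((2:ℝ) ^ j), dil_mul (by norm_num) (by positivity)]
  exact two_mul_nrm_le hb _

theorem wt_nonneg {x : ℝ} (hx : 0 ≤ x) : 0 ≤ wt x := by unfold wt; positivity

theorem wt_le_sqrt {x : ℝ} (hx : 0 ≤ x) : wt x ≤ √x := by
  unfold wt
  exact div_le_self (Real.sqrt_nonneg _) (by linarith)

theorem wt_le_inv_sqrt {x : ℝ} (hx : 0 < x) : wt x ≤ (√x)⁻¹ := by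
  unfold wt
  have := Real.sqrt_pos.2 hx
  rw [div_le_iff₀ (by positivity), inv_mul_eq_div, le_div_iff₀ this, Real.mul_self_sqrt hx.le]
  linarith

theorem le_wt_of_le {x y C : ℝ} (hx : 0 ≤ x) (hC : 0 ≤ C) (h1 : y ≤ C * x)
    (h2 : y * √x ≤ C) : y ≤ 2 * C * wt x := by
  unfold wt
  rw [mul_div_assoc', le_div_iff₀ (by positivity)]
  set r := √x with hr
  have hr0 : 0 ≤ r := Real.sqrt_nonneg _
  have hx' : x = r ^ 2 := (Real.sq_sqrt hx).symm
  rw [hx'] at h1 ⊢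
  rcases le_total r 1 with h | h
  · have a1 : r ^ 2 ≤ r := by nlinarith
    have a2 : C * r ^ 2 ≤ C * r := mul_le_mul_of_nonneg_left a1 hC
    rcases le_total y 0 with hy | hy
    · have : y * (1 + r ^ 2) ≤ 0 := mul_nonpos_of_nonpos_of_nonneg hy (by positivity)
      have : 0 ≤ 2 * C * r := by positivity
      linarith
    · have : y * r ^ 2 ≤ y := by nlinarith
      nlinarith
  · have hrpos : 0 < r := by linarith
    have a0 : 0 ≤ C * r := by positivity
    rcases le_total y 0 with hy | hy
    · have : y * (1 + r ^ 2) ≤ 0 := mul_nonpos_of_nonpos_of_nonneg hy (by positivity)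
      have : 0 ≤ 2 * C * r := by positivity
      linarith
    · have a1 : y * r ^ 2 ≤ C * r := by nlinarith
      have a2 : y ≤ C * r := by nlinarith
      linarith

theorem wt_le_sub {x y : ℝ} (hx : 0 ≤ x) (hxy : 2 * x ≤ y) :
    wt x ≤ 8 * (√y / (1 + √y) - √x / (1 + √x)) := by
  unfold wt
  set r := √x with hr
  have hr0 : 0 ≤ r := Real.sqrt_nonneg _
  have hx' : x = r ^ 2 := (Real.sq_sqrt hx).symm
  have hs : 7 / 5 * r ≤ √y := by
    apply Real.le_sqrt_of_sq_le; nlinarith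
  have h1 : 7 / 5 * r / (1 + 7 / 5 * r) ≤ √y / (1 + √y) := by
    rw [div_le_div_iff₀ (by positivity) (by positivity)]; nlinarith
  refine le_trans ?_ (mul_le_mul_of_nonneg_left (sub_le_sub_right h1 _) (by norm_num))
  rw [hx', div_sub_div _ _ (by positivity) (by positivity), mul_div_assoc',
    div_le_div_iff₀ (by positivity) (by positivity)]
  have : 0 ≤ r * (11 / 5 + 9 / 5 * r ^ 2 - 12 / 5 * r) := by
    apply mul_nonneg hr0; nlinarith [sq_nonneg (r - 2 / 3)]
  nlinarith

theorem sum_Ico_wt_le {a : ℤ → ℝ} (ha : ∀ j, 0 ≤ a j) (h2 : ∀ j, 2 * a j ≤ a (j + 1)) (m : ℤ)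
    (n : ℕ) : ∑ j ∈ Finset.Ico m (m + n), wt (a j) ≤
      8 * (√(a (m + n)) / (1 + √(a (m + n))) - √(a m) / (1 + √(a m))) := by
  induction n with
  | zero => simp
  | succ n ih =>
    have : Finset.Ico m (m + (n + 1 : ℕ)) = insert (m + n) (Finset.Ico m (m + n)) := by
      ext k; simp; omega
    rw [this, Finset.sum_insert (by simp)]
    have h := wt_le_sub (ha (m + n)) (h2 (m + n))
    have e : m + ((n + 1 : ℕ) : ℤ) = m + n + 1 := by push_cast; ring
    rw [e]
    linarith

theorem sum_wt_le {a : ℤ → ℝ} (ha : ∀ j, 0 ≤ a j) (h2 : ∀ j, 2 * a j ≤ a (j + 1))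
    (F : Finset ℤ) : ∑ j ∈ F, wt (a j) ≤ 8 := by
  obtain ⟨m, hm⟩ : ∃ m : ℕ, F ⊆ Finset.Ico (-m : ℤ) (-m + (2 * m : ℕ)) := by
    refine ⟨F.sup (fun j => j.natAbs + 1), fun j hj => ?_⟩
    have : j.natAbs + 1 ≤ F.sup (fun j => j.natAbs + 1) :=
      Finset.le_sup (f := fun j : ℤ => j.natAbs + 1) hj
    simp only [Finset.mem_Ico]
    omega
  refine (Finset.sum_le_sum_of_subset_of_nonneg hm fun j _ _ => wt_nonneg (ha j)).trans ?_
  refine (sum_Ico_wt_le ha h2 _ _).trans ?_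
  have h1 : √(a (-m + (2 * m : ℕ))) / (1 + √(a (-m + (2 * m : ℕ)))) ≤ 1 := by
    rw [div_le_one (by positivity)]; linarith
  have h3 : 0 ≤ √(a (-m)) / (1 + √(a (-m))) := by positivity
  linarith

theorem sum_wt_nrm_le {b : ℝ} (hb : 1 < b) {c : ℝ} (hc : 0 ≤ c) (ξ : ℝ × ℝ) (F : Finset ℤ) :
    ∑ j ∈ F, wt (c * nrm (dil b (2 ^ j) ξ)) ≤ 8 := by
  refine sum_wt_le (a := fun j => c * nrm (dil b (2 ^ j) ξ))
    (fun j => mul_nonneg hc (nrm_nonneg _)) (fun j => ?_) F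
  have := mul_le_mul_of_nonneg_left (two_mul_nrm_zpow_le hb j ξ) hc
  linarith

theorem nrm_dil_le_of_le_one {b l : ℝ} (hb : 1 < b) (h0 : 0 < l) (h1 : l ≤ 1) (ξ : ℝ × ℝ) :
    nrm (dil b l ξ) ≤ l * nrm ξ := by
  have h : l ^ b ≤ l := by
    calc l ^ b ≤ l ^ (1:ℝ) := Real.rpow_le_rpow_of_exponent_ge h0 h1 hb.le
      _ = l := Real.rpow_one l
  unfold nrm dil
  rw [abs_mul, abs_mul, abs_of_pos h0, abs_of_nonneg (by positivity : (0:ℝ) ≤ l ^ b)]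
  nlinarith [abs_nonneg ξ.2]

theorem le_nrm_dil_of_one_le {b l : ℝ} (hb : 1 < b) (h1 : 1 ≤ l) (ξ : ℝ × ℝ) :
    l * nrm ξ ≤ nrm (dil b l ξ) := by
  have h : l ≤ l ^ b := by
    calc l = l ^ (1:ℝ) := (Real.rpow_one l).symm
      _ ≤ l ^ b := Real.rpow_le_rpow_of_exponent_le h1 hb.le
  unfold nrm dil
  rw [abs_mul, abs_mul, abs_of_pos (by linarith : 0 < l),
    abs_of_nonneg (by linarith : (0:ℝ) ≤ l ^ b)]
  nlinarith [abs_nonneg ξ.2]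

theorem sqrt_two_pow (n : ℕ) : √((2:ℝ) ^ n) = √2 ^ n := by
  have : (2:ℝ) ^ n = (√2 ^ n) ^ 2 := by
    rw [← pow_mul, mul_comm, pow_mul, Real.sq_sqrt (by norm_num)]
  rw [this, Real.sqrt_sq (by positivity)]

theorem wt_nrm_zpow_le {b : ℝ} (hb : 1 < b) {R : ℝ} (hR : 1 ≤ R) {ξ : ℝ × ℝ} (h1 : R⁻¹ ≤ nrm ξ)
    (h2 : nrm ξ ≤ R) (j : ℤ) :
    wt (nrm (dil b (2 ^ j) ξ)) ≤ √R * (1 / √2) ^ j.natAbs := by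
  have hR0 : 0 < R := by linarith
  have hs2 : (√2 : ℝ) ≠ 0 := by positivity
  rcases le_total 0 j with hj | hj
  · obtain ⟨n, rfl⟩ := Int.eq_ofNat_of_zero_le hj
    have hle : 2 ^ n * R⁻¹ ≤ nrm (dil b (2 ^ (n:ℤ)) ξ) := by
      refine le_trans ?_ (le_nrm_dil_of_one_le hb (one_le_zpow₀ (by norm_num) hj) ξ)
      rw [zpow_natCast]; gcongr
    have hpos : 0 < 2 ^ n * R⁻¹ := by positivity
    refine (wt_le_inv_sqrt (hpos.trans_le hle)).trans ?_
    calc _ ≤ (√(2 ^ n * R⁻¹))⁻¹ := by gcongr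
      _ = _ := by
        rw [Real.sqrt_mul (by positivity), Real.sqrt_inv, mul_inv, inv_inv, mul_comm, one_div,
          Int.natAbs_natCast, inv_pow, sqrt_two_pow]
  · obtain ⟨n, hn⟩ := Int.eq_ofNat_of_zero_le (neg_nonneg.2 hj)
    obtain rfl : j = -(n:ℤ) := by omega
    have hle : nrm (dil b (2 ^ (-(n:ℤ))) ξ) ≤ (2 ^ n)⁻¹ * R := by
      refine (nrm_dil_le_of_le_one hb (by positivity) (zpow_le_one_of_nonpos₀ (by norm_num) hj)
        ξ).trans ?_
      rw [zpow_neg, zpow_natCast]; gcongr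
    refine (wt_le_sqrt (nrm_nonneg _)).trans ?_
    calc _ ≤ √((2 ^ n)⁻¹ * R) := Real.sqrt_le_sqrt hle
      _ = _ := by
        rw [Real.sqrt_mul (by positivity), Real.sqrt_inv, mul_comm, one_div,
          Int.natAbs_neg, Int.natAbs_natCast, inv_pow, sqrt_two_pow]

theorem summable_natAbs_pow : Summable fun j : ℤ => (1 / √2 : ℝ) ^ j.natAbs := by
  have h1 : (1 / √2 : ℝ) < 1 := by
    rw [div_lt_one (by positivity)]
    exact Real.lt_sqrt_of_sq_lt (by norm_num)
  have := summable_geometric_of_lt_one (by positivity : (0:ℝ) ≤ 1 / √2) h1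
  refine Summable.of_nat_of_neg ?_ ?_ <;> simpa using this

section

theorem exists_norm_integral_rpow_ex_le {b : ℝ} (hb : 1 < b) (e : ℝ) {c : ℝ} (hc : c ≠ 0) :
    ∃ C : ℝ, 0 ≤ C ∧ ∀ σ c' s : ℝ, |σ| = 1 → |c| ≤ |c'| → s ∈ Icc (1:ℝ) 2 → ∀ ξ : ℝ × ℝ,
      ‖∫ t in (1:ℝ)..s, ((t ^ e : ℝ) : ℂ) * ex ξ (σ * t, c' * t ^ b)‖ * √(nrm ξ) ≤ C := by
  obtain ⟨C, hC0, hC⟩ := exists_norm_integral_amplitude_exp_power_le hb (a := fun t => t ^ e)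
    (a' := fun t => e * t ^ (e - 1))
    (fun t ht => Real.hasDerivAt_rpow_const (Or.inl (by linarith [ht.1])))
    (continuousOn_const.mul fun t ht =>
      (Real.continuousAt_rpow_const t _ (Or.inl (by linarith [ht.1]))).continuousWithinAt)
  have hc0 : 0 < |c| := abs_pos.2 hc
  refine ⟨√(1 + |c|⁻¹) * C, by positivity, fun σ c' s hσ hcc hs ξ => ?_⟩
  have h1 := hC (σ * ξ.1) (c' * ξ.2) s hs
  have e1 : ∀ t : ℝ, ex ξ (σ * t, c' * t ^ b) =
      Complex.exp (Complex.I * ((σ * ξ.1 * t + c' * ξ.2 * t ^ b : ℝ) : ℂ)) := fun t => by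
    unfold ex; congr 3; ring
  simp only [e1]
  have h2 : √(nrm ξ) ≤ √(1 + |c|⁻¹) * √(|σ * ξ.1| + |c' * ξ.2|) := by
    rw [← Real.sqrt_mul (by positivity)]
    apply Real.sqrt_le_sqrt
    rw [abs_mul, abs_mul, hσ, one_mul]
    have h3 : |ξ.2| ≤ |c|⁻¹ * (|c'| * |ξ.2|) := by
      rw [inv_mul_eq_div, le_div_iff₀ hc0]; nlinarith [abs_nonneg ξ.2]
    have h4 : 0 ≤ |c|⁻¹ * |ξ.1| := by positivity
    have h5 : 0 ≤ |c'| * |ξ.2| := by positivity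
    unfold nrm; nlinarith
  calc _ ≤ _ * (√(1 + |c|⁻¹) * √(|σ * ξ.1| + |c' * ξ.2|)) := by gcongr
    _ = √(1 + |c|⁻¹) * (_ * √(|σ * ξ.1| + |c' * ξ.2|)) := by ring
    _ ≤ _ := by gcongr

/-- The symbol of the piece `1 < |t| < s` of the Hilbert transform along the curve. -/
def sgm (b cp cm s : ℝ) (ξ : ℝ × ℝ) : ℂ := ∫ t in (1:ℝ)..s, oddQuot b cp cm 1 (ex ξ) 0 t

/-- The symbol of the Hilbert transform along the curve. -/
def symb (b cp cm : ℝ) (ξ : ℝ × ℝ) : ℂ := ∑' j : ℤ, sgm b cp cm 2 (dil b (2 ^ j) ξ)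

variable {b cp cm : ℝ}

theorem oddQuot_ex (u : ℝ) (ξ x : ℝ × ℝ) (t : ℝ) :
    oddQuot b cp cm u (ex ξ) x t = ex ξ x * oddQuot b cp cm 1 (ex (ξ.1, u * ξ.2)) 0 t := by
  have h : ∀ y z : ℝ, ex ξ (x - (y, u * z)) = ex ξ x * ex (ξ.1, u * ξ.2) (0 - (y, 1 * z)) := by
    intro y z
    unfold ex; rw [← Complex.exp_add]; congr 1; push_cast [Prod.fst_sub, Prod.snd_sub]; simp; ring
  unfold oddQuot
  rw [h, h, ← mul_sub, mul_smul_comm]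

theorem oddQuot_ex_dil {l t : ℝ} (hl : 0 < l) (ht : 0 ≤ t) (ξ : ℝ × ℝ) :
    oddQuot b cp cm 1 (ex ξ) 0 (l * t) = l⁻¹ • oddQuot b cp cm 1 (ex (dil b l ξ)) 0 t := by
  unfold oddQuot
  rw [smul_smul, mul_inv, Real.mul_rpow hl.le ht]
  congr 2 <;> (unfold ex dil; congr 3; simp; ring)

theorem oddQuot_intervalIntegrable (hb : 1 < b) {E : Type*} [NormedAddCommGroup E]
    [NormedSpace ℝ E] {f : ℝ × ℝ → E} (hf : Continuous f) (u : ℝ) (x : ℝ × ℝ) {p q : ℝ}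
    (hp : 0 < p) (hq : 0 < q) :
    IntervalIntegrable (oddQuot b cp cm u f x) volume p q := by
  refine ((continuousOn_oddQuot hb hf x).mono fun t ht => ?_).intervalIntegrable
  exact lt_of_lt_of_le (lt_min hp hq) ht.1

theorem integral_oddQuot_ex_dil {l p q : ℝ} (hl : 0 < l) (hp : 0 ≤ p) (hpq : p ≤ q)
    (ξ : ℝ × ℝ) : ∫ t in (l * p)..(l * q), oddQuot b cp cm 1 (ex ξ) 0 t =
      ∫ t in p..q, oddQuot b cp cm 1 (ex (dil b l ξ)) 0 t := by
  have h := intervalIntegral.integral_comp_mul_left (a := p) (b := q)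
    (fun t => oddQuot b cp cm 1 (ex ξ) 0 t) hl.ne'
  have h2 : ∫ t in p..q, oddQuot b cp cm 1 (ex ξ) 0 (l * t) =
      ∫ t in p..q, l⁻¹ • oddQuot b cp cm 1 (ex (dil b l ξ)) 0 t := by
    apply intervalIntegral.integral_congr
    intro t ht
    rw [uIcc_of_le hpq] at ht
    exact oddQuot_ex_dil hl (hp.trans ht.1) ξ
  rw [h, intervalIntegral.integral_smul] at h2
  exact smul_right_injective ℂ (inv_ne_zero hl.ne') h2

theorem exists_norm_sgm_le (hb : 1 < b) (hcp : cp ≠ 0) (hcm : cm ≠ 0) :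
    ∃ C : ℝ, 0 ≤ C ∧ ∀ s ∈ Icc (1:ℝ) 2, ∀ ξ, ‖sgm b cp cm s ξ‖ ≤ C * wt (nrm ξ) := by
  obtain ⟨C₁, h1, H1⟩ := exists_norm_integral_rpow_ex_le hb (-1) hcp
  obtain ⟨C₂, h2, H2⟩ := exists_norm_integral_rpow_ex_le hb (-1) hcm
  set D : ℝ := 2 + 2 ^ b * (|cp| + |cm|) with hD
  have hD0 : 0 ≤ D := by positivity
  refine ⟨2 * (C₁ + C₂ + 2 * D), by positivity, fun s hs ξ => ?_⟩
  refine le_wt_of_le (nrm_nonneg ξ) (by positivity) ?_ ?_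
  · have hbd : ∀ t ∈ uIoc 1 s, ‖oddQuot b cp cm 1 (ex ξ) 0 t‖ ≤ 2 * D * nrm ξ := by
      intro t ht
      rw [uIoc_of_le hs.1] at ht
      have t1 : 1 ≤ t := ht.1.le
      have t2 : t ≤ 2 := ht.2.trans hs.2
      have tb : t ^ b ≤ 2 ^ b := Real.rpow_le_rpow (by linarith) t2 (by linarith)
      have tb0 : 0 ≤ t ^ b := by positivity
      unfold oddQuot
      rw [norm_smul, norm_inv, Real.norm_eq_abs, abs_of_pos (by linarith : 0 < t)]
      have hi : t⁻¹ ≤ 1 := inv_le_one_of_one_le₀ t1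
      have hh := norm_ex_sub_le ξ (0 - (t, 1 * (cp * t ^ b))) (0 - (-t, 1 * (cm * t ^ b)))
      have h3 : |((0:ℝ × ℝ) - (t, 1 * (cp * t ^ b))).1 - ((0:ℝ × ℝ) - (-t, 1 * (cm * t ^ b))).1|
          ≤ 2 * D := by
        simp only [Prod.fst_sub, Prod.fst_zero]
        rw [abs_le]; constructor
        · have : 0 ≤ 2 ^ b * (|cp| + |cm|) := by positivity
          linarith
        · have : 0 ≤ 2 ^ b * (|cp| + |cm|) := by positivity
          linarith
      have h4 : |((0:ℝ × ℝ) - (t, 1 * (cp * t ^ b))).2 - ((0:ℝ × ℝ) - (-t, 1 * (cm * t ^ b))).2|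
          ≤ 2 * D := by
        have e : ((0:ℝ × ℝ) - (t, 1 * (cp * t ^ b))).2 - ((0:ℝ × ℝ) - (-t, 1 * (cm * t ^ b))).2
          = t ^ b * (cm - cp) := by simp; ring
        rw [e, abs_mul, abs_of_nonneg tb0]
        have : |cm - cp| ≤ |cp| + |cm| := by rw [add_comm]; exact abs_sub _ _
        calc t ^ b * |cm - cp| ≤ 2 ^ b * (|cp| + |cm|) := by gcongr
          _ ≤ 2 * D := by rw [hD]; nlinarith [show 0 ≤ 2 ^ b * (|cp| + |cm|) by positivity]
      calc _ ≤ 1 * (2 * D * |ξ.1| + 2 * D * |ξ.2|) := by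
            gcongr
            refine hh.trans ((abs_add_le _ _).trans ?_)
            rw [abs_mul, abs_mul]; gcongr
        _ = 2 * D * nrm ξ := by unfold nrm; ring
    refine (intervalIntegral.norm_integral_le_of_norm_le_const hbd).trans ?_
    have : |s - 1| ≤ 1 := by rw [abs_of_nonneg] <;> linarith [hs.1, hs.2]
    have h0 := nrm_nonneg ξ
    calc _ ≤ 2 * D * nrm ξ * 1 := by gcongr
      _ ≤ _ := by nlinarith
  · have e : sgm b cp cm s ξ = (∫ t in (1:ℝ)..s, ((t ^ (-1:ℝ) : ℝ) : ℂ) * ex ξ (-1 * t, (-cp) * t ^ b))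
        - ∫ t in (1:ℝ)..s, ((t ^ (-1:ℝ) : ℝ) : ℂ) * ex ξ (1 * t, (-cm) * t ^ b) := by
      have hi : ∀ σ c' : ℝ, IntervalIntegrable
          (fun t : ℝ => ((t ^ (-1:ℝ) : ℝ) : ℂ) * ex ξ (σ * t, c' * t ^ b)) volume 1 s := by
        intro σ c'
        apply ContinuousOn.intervalIntegrable
        rw [uIcc_of_le hs.1]
        have hcb : Continuous fun t : ℝ => t ^ b := Real.continuous_rpow_const (by linarith)
        refine ContinuousOn.mul (Complex.continuous_ofReal.comp_continuousOn fun t ht =>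
          (Real.continuousAt_rpow_const t _ (Or.inl (by linarith [ht.1]))).continuousWithinAt) ?_
        exact ((continuous_ex_right ξ).comp (by fun_prop)).continuousOn
      rw [← intervalIntegral.integral_sub (hi _ _) (hi _ _)]
      apply intervalIntegral.integral_congr
      intro t ht
      simp only [oddQuot, Real.rpow_neg_one, ← mul_sub]
      rw [Complex.real_smul]
      congr 3 <;> (ext <;> simp)
    rw [e]
    have g1 := H1 (-1) (-cp) s (by simp) (by simp) hs ξ
    have g2 := H2 1 (-cm) s (by simp) (by simp) hs ξ
    calc _ ≤ (‖∫ t in (1:ℝ)..s, ((t ^ (-1:ℝ) : ℝ) : ℂ) * ex ξ (-1 * t, (-cp) * t ^ b)‖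
        + ‖∫ t in (1:ℝ)..s, ((t ^ (-1:ℝ) : ℝ) : ℂ) * ex ξ (1 * t, (-cm) * t ^ b)‖) * √(nrm ξ) := by
          gcongr; exact norm_sub_le _ _
      _ ≤ C₁ + C₂ := by rw [add_mul]; exact add_le_add g1 g2
      _ ≤ _ := by linarith

theorem summable_norm_sgm (hb : 1 < b) (hcp : cp ≠ 0) (hcm : cm ≠ 0) {s : ℝ}
    (hs : s ∈ Icc (1:ℝ) 2) (ξ : ℝ × ℝ) :
    Summable fun j : ℤ => ‖sgm b cp cm s (dil b (2 ^ j) ξ)‖ := by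
  obtain ⟨C, hC, h⟩ := exists_norm_sgm_le hb hcp hcm
  refine summable_of_sum_le (c := C * 8) (fun _ => norm_nonneg _) fun F => ?_
  calc _ ≤ ∑ j ∈ F, C * wt (1 * nrm (dil b (2 ^ j) ξ)) :=
        Finset.sum_le_sum fun j _ => by rw [one_mul]; exact h s hs _
    _ ≤ _ := by
      rw [← Finset.mul_sum]; gcongr; exact sum_wt_nrm_le hb zero_le_one ξ F

theorem exists_norm_sum_sgm_le (hb : 1 < b) (hcp : cp ≠ 0) (hcm : cm ≠ 0) :
    ∃ C : ℝ, 0 ≤ C ∧ ∀ ξ, ∀ F : Finset ℤ, ‖∑ j ∈ F, sgm b cp cm 2 (dil b (2 ^ j) ξ)‖ ≤ C := by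
  obtain ⟨C, hC, h⟩ := exists_norm_sgm_le hb hcp hcm
  refine ⟨C * 8, by positivity, fun ξ F => (norm_sum_le _ _).trans ?_⟩
  calc _ ≤ ∑ j ∈ F, C * wt (1 * nrm (dil b (2 ^ j) ξ)) :=
        Finset.sum_le_sum fun j _ => by rw [one_mul]; exact h 2 (by norm_num) _
    _ ≤ _ := by
      rw [← Finset.mul_sum]; gcongr; exact sum_wt_nrm_le hb zero_le_one ξ F

theorem hasSum_symb (hb : 1 < b) (hcp : cp ≠ 0) (hcm : cm ≠ 0) (ξ : ℝ × ℝ) :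
    HasSum (fun j : ℤ => sgm b cp cm 2 (dil b (2 ^ j) ξ)) (symb b cp cm ξ) :=
  (summable_norm_sgm hb hcp hcm (by norm_num) ξ).of_norm.hasSum

theorem tendsto_Ico_neg_atTop :
    Tendsto (fun J : ℕ => Finset.Ico (-(J:ℤ)) J) atTop atTop := by
  refine tendsto_atTop_finset_of_monotone ?_ fun j => ⟨j.natAbs + 1, ?_⟩
  · intro J K hJK
    apply Finset.Ico_subset_Ico <;> omega
  · simp only [Finset.mem_Ico]; omega

theorem exists_norm_symb_le (hb : 1 < b) (hcp : cp ≠ 0) (hcm : cm ≠ 0) :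
    ∃ C : ℝ, 0 ≤ C ∧ ∀ ξ, ‖symb b cp cm ξ‖ ≤ C := by
  obtain ⟨C, hC, h⟩ := exists_norm_sum_sgm_le hb hcp hcm
  exact ⟨C, hC, fun ξ => le_of_tendsto (hasSum_symb hb hcp hcm ξ).norm
    (Eventually.of_forall fun F => h ξ F)⟩

theorem integral_oddQuot_eq_sum (hb : 1 < b) {E : Type*} [NormedAddCommGroup E]
    [NormedSpace ℝ E] {f : ℝ × ℝ → E} (hf : Continuous f) (u : ℝ) (x : ℝ × ℝ) (J : ℕ) :
    ∫ t in ((2:ℝ) ^ (-(J:ℤ)))..(2 ^ (J:ℤ)), oddQuot b cp cm u f x t =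
      ∑ j ∈ Finset.Ico (-(J:ℤ)) J, ∫ t in ((2:ℝ) ^ j)..(2 ^ (j + 1)), oddQuot b cp cm u f x t := by
  have main : ∀ (m : ℤ) (n : ℕ), ∫ t in ((2:ℝ) ^ m)..(2 ^ (m + n)), oddQuot b cp cm u f x t =
      ∑ j ∈ Finset.Ico m (m + n), ∫ t in ((2:ℝ) ^ j)..(2 ^ (j + 1)), oddQuot b cp cm u f x t := by
    intro m n
    induction n with
    | zero => simp
    | succ n ih =>
      have : Finset.Ico m (m + (n + 1 : ℕ)) = insert (m + n) (Finset.Ico m (m + n)) := by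
        ext k; simp; omega
      rw [this, Finset.sum_insert (by simp), ← ih,
        show m + ((n + 1 : ℕ) : ℤ) = m + n + 1 by push_cast; ring]
      refine Eq.trans ?_ (add_comm _ _)
      exact (intervalIntegral.integral_add_adjacent_intervals
        (oddQuot_intervalIntegrable hb hf u x (by positivity) (by positivity))
        (oddQuot_intervalIntegrable hb hf u x (by positivity) (by positivity))).symm
  have := main (-(J:ℤ)) (2 * J)
  rwa [show -(J:ℤ) + ((2 * J : ℕ) : ℤ) = J by push_cast; ring] at this

theorem integral_oddQuot_ex (hb : 1 < b) (u : ℝ) (ξ x : ℝ × ℝ) (J : ℕ) :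
    ∫ t in ((2:ℝ) ^ (-(J:ℤ)))..(2 ^ (J:ℤ)), oddQuot b cp cm u (ex ξ) x t =
      ex ξ x * ∑ j ∈ Finset.Ico (-(J:ℤ)) J, sgm b cp cm 2 (dil b (2 ^ j) (ξ.1, u * ξ.2)) := by
  simp only [oddQuot_ex u ξ x, intervalIntegral.integral_const_mul]
  rw [integral_oddQuot_eq_sum hb (continuous_ex_right _)]
  congr 1
  refine Finset.sum_congr rfl fun j _ => ?_
  rw [sgm, ← integral_oddQuot_ex_dil (by positivity) zero_le_one one_le_two, mul_one,
    zpow_add₀ two_ne_zero, zpow_one]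

theorem sgm_dil_sub (hb : 1 < b) {l : ℝ} (hl : l ∈ Icc (1:ℝ) 2) (ξ : ℝ × ℝ) :
    sgm b cp cm 2 (dil b l ξ) - sgm b cp cm 2 ξ = sgm b cp cm l (dil b 2 ξ) - sgm b cp cm l ξ := by
  have hl0 : 0 < l := by linarith [hl.1]
  have hi : ∀ p q : ℝ, 0 < p → 0 < q →
      IntervalIntegrable (oddQuot b cp cm 1 (ex ξ) 0) volume p q := fun p q hp hq =>
    oddQuot_intervalIntegrable hb (continuous_ex_right ξ) 1 0 hp hq
  have e1 : sgm b cp cm 2 (dil b l ξ) = ∫ t in l..(l * 2), oddQuot b cp cm 1 (ex ξ) 0 t := by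
    have := integral_oddQuot_ex_dil (b := b) (cp := cp) (cm := cm) hl0 zero_le_one one_le_two ξ
    rw [mul_one] at this; exact this.symm
  have e2 : sgm b cp cm l (dil b 2 ξ) = ∫ t in 2..(2 * l), oddQuot b cp cm 1 (ex ξ) 0 t := by
    have := integral_oddQuot_ex_dil (b := b) (cp := cp) (cm := cm) two_pos zero_le_one hl.1 ξ
    rw [mul_one] at this; exact this.symm
  rw [e1, e2, sgm, sgm, mul_comm 2 l, sub_eq_sub_iff_add_eq_add,
    add_comm, intervalIntegral.integral_add_adjacent_intervals (hi _ _ one_pos hl0)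
      (hi _ _ hl0 (by positivity)), add_comm,
    intervalIntegral.integral_add_adjacent_intervals (hi _ _ one_pos two_pos)
      (hi _ _ two_pos (by positivity))]

theorem symb_dil_of_mem (hb : 1 < b) (hcp : cp ≠ 0) (hcm : cm ≠ 0) {l : ℝ}
    (hl : l ∈ Icc (1:ℝ) 2) (ξ : ℝ × ℝ) : symb b cp cm (dil b l ξ) = symb b cp cm ξ := by
  have hl0 : 0 ≤ l := by linarith [hl.1]
  have hs := (summable_norm_sgm hb hcp hcm hl ξ).of_norm
  have hs2 : Summable fun j : ℤ => sgm b cp cm l (dil b (2 ^ (j + 1)) ξ) :=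
    (Equiv.addRight (1:ℤ)).summable_iff (f := fun j : ℤ => sgm b cp cm l (dil b (2 ^ j) ξ)) |>.2 hs
  have h1 := (hasSum_symb hb hcp hcm (dil b l ξ)).sub (hasSum_symb hb hcp hcm ξ)
  have h2 : HasSum (fun j : ℤ => sgm b cp cm l (dil b (2 ^ (j + 1)) ξ) -
      sgm b cp cm l (dil b (2 ^ j) ξ)) 0 := by
    have e := hs2.hasSum.sub hs.hasSum
    have e2 := Equiv.tsum_eq (Equiv.addRight (1:ℤ)) fun j : ℤ => sgm b cp cm l (dil b (2 ^ j) ξ)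
    simp only [Equiv.coe_addRight] at e2
    rwa [e2, sub_self] at e
  have h3 : (fun j : ℤ => sgm b cp cm 2 (dil b (2 ^ j) (dil b l ξ)) -
      sgm b cp cm 2 (dil b (2 ^ j) ξ)) = fun j : ℤ => sgm b cp cm l (dil b (2 ^ (j + 1)) ξ) -
      sgm b cp cm l (dil b (2 ^ j) ξ) := by
    funext j
    rw [← dil_mul (by positivity) hl0, mul_comm, dil_mul hl0 (by positivity), sgm_dil_sub hb hl,
      zpow_add₀ two_ne_zero, zpow_one, mul_comm ((2:ℝ) ^ j), dil_mul (by norm_num) (by positivity)]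
  rw [h3] at h1
  exact sub_eq_zero.1 (h1.unique h2)

theorem symb_dil (hb : 1 < b) (hcp : cp ≠ 0) (hcm : cm ≠ 0) {l : ℝ} (hl : 0 < l)
    (ξ : ℝ × ℝ) : symb b cp cm (dil b l ξ) = symb b cp cm ξ := by
  have h2 : ∀ ξ, symb b cp cm (dil b 2 ξ) = symb b cp cm ξ := fun ξ =>
    symb_dil_of_mem hb hcp hcm (by norm_num) ξ
  have hn : ∀ (n : ℕ) (ξ), symb b cp cm (dil b (2 ^ n) ξ) = symb b cp cm ξ := by
    intro n
    induction n with
    | zero => intro ξ; rw [pow_zero, dil_one]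
    | succ n ih => intro ξ; rw [pow_succ, dil_mul (by positivity) (by norm_num), ih, h2]
  obtain ⟨n, hn1, hn2⟩ := exists_mem_Ico_zpow hl (one_lt_two (α := ℝ))
  set l' : ℝ := l / 2 ^ n with hl'
  have hpos : (0:ℝ) < 2 ^ n := by positivity
  have m1 : l' ∈ Icc (1:ℝ) 2 := by
    rw [hl', mem_Icc, le_div_iff₀ hpos, div_le_iff₀ hpos, one_mul]
    refine ⟨hn1, ?_⟩
    rw [zpow_add₀ two_ne_zero, zpow_one] at hn2
    linarith
  have el : l = 2 ^ n * l' := by rw [hl']; field_simp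
  have hz : ∀ ξ, symb b cp cm (dil b (2 ^ n) ξ) = symb b cp cm ξ := by
    intro ξ
    rcases le_total 0 n with h | h
    · obtain ⟨k, rfl⟩ := Int.eq_ofNat_of_zero_le h
      rw [zpow_natCast]; exact hn k ξ
    · obtain ⟨k, hk⟩ := Int.eq_ofNat_of_zero_le (neg_nonneg.2 h)
      rw [← hn k (dil b (2 ^ n) ξ), ← dil_mul (by positivity) (by positivity), ← zpow_natCast,
        ← zpow_add₀ two_ne_zero, ← hk, neg_add_cancel, zpow_zero, dil_one]
  rw [el, dil_mul (by positivity) (by linarith [m1.1]), hz, symb_dil_of_mem hb hcp hcm m1]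

theorem continuous_sgm (hb : 1 < b) : Continuous (sgm b cp cm 2) := by
  refine continuous_iff_continuousAt.2 fun ξ => ?_
  refine intervalIntegral.continuousAt_of_dominated_interval (bound := fun _ => 2) ?_ ?_ ?_ ?_
  · refine Eventually.of_forall fun η => ?_
    exact (oddQuot_intervalIntegrable hb (continuous_ex_right η) 1 0 one_pos
      two_pos).def'.aestronglyMeasurable
  · refine Eventually.of_forall fun η => Eventually.of_forall fun t ht => ?_
    rw [uIoc_of_le one_le_two] at ht
    unfold oddQuot
    rw [norm_smul, norm_inv, Real.norm_eq_abs, abs_of_pos (by linarith [ht.1] : 0 < t)]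
    have hi : t⁻¹ ≤ 1 := inv_le_one_of_one_le₀ ht.1.le
    have h2 : ‖ex η (0 - (t, 1 * (cp * t ^ b))) - ex η (0 - (-t, 1 * (cm * t ^ b)))‖ ≤ 2 :=
      (norm_sub_le _ _).trans (by rw [norm_ex, norm_ex]; norm_num)
    have := mul_le_mul hi h2 (norm_nonneg _) zero_le_one
    linarith
  · simp
  · refine Eventually.of_forall fun t _ => Continuous.continuousAt ?_
    unfold oddQuot ex; fun_prop

theorem continuousAt_symb (hb : 1 < b) (hcp : cp ≠ 0) (hcm : cm ≠ 0) {ξ : ℝ × ℝ}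
    (hξ : ξ ≠ 0) : ContinuousAt (symb b cp cm) ξ := by
  obtain ⟨C, hC, h⟩ := exists_norm_sgm_le hb hcp hcm
  have hn := nrm_pos hξ
  set R := max 1 (max (2 * nrm ξ) (2 * (nrm ξ)⁻¹)) with hR
  have hR1 : 1 ≤ R := le_max_left _ _
  have hcn : Continuous nrm := by unfold nrm; fun_prop
  have hdil : ∀ l : ℝ, Continuous (dil b l) := fun l => by unfold dil; fun_prop
  have hopen : IsOpen {η : ℝ × ℝ | R⁻¹ < nrm η ∧ nrm η < R} :=
    (isOpen_lt continuous_const hcn).inter (isOpen_lt hcn continuous_const)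
  have hmem : ξ ∈ {η : ℝ × ℝ | R⁻¹ < nrm η ∧ nrm η < R} := by
    have g1 : 2 * nrm ξ ≤ R := (le_max_left _ _).trans (le_max_right _ _)
    have g2 : 2 * (nrm ξ)⁻¹ ≤ R := (le_max_right _ _).trans (le_max_right _ _)
    refine ⟨?_, by linarith⟩
    apply inv_lt_of_inv_lt₀ hn
    have := inv_pos.2 hn
    linarith
  refine ContinuousOn.continuousAt ?_ (hopen.mem_nhds hmem)
  refine continuousOn_tsum (u := fun j : ℤ => C * (√R * (1 / √2) ^ j.natAbs))
    (fun j => ((continuous_sgm hb).comp (hdil _)).continuousOn)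
    ((summable_natAbs_pow.mul_left _).mul_left _) fun j η hη => ?_
  refine (h 2 (by norm_num) _).trans ?_
  gcongr
  exact wt_nrm_zpow_le hb hR1 hη.1.le hη.2.le j

theorem tendsto_integral_oddQuot_ex (hb : 1 < b) (hcp : cp ≠ 0) (hcm : cm ≠ 0) (u : ℝ)
    (ξ x : ℝ × ℝ) : Tendsto (fun J : ℕ =>
      ∫ t in ((2:ℝ) ^ (-(J:ℤ)))..(2 ^ (J:ℤ)), oddQuot b cp cm u (ex ξ) x t) atTop
      (𝓝 (ex ξ x * symb b cp cm (ξ.1, u * ξ.2))) := by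
  simp only [integral_oddQuot_ex hb]
  exact ((hasSum_symb hb hcp hcm _).comp tendsto_Ico_neg_atTop).const_mul _

theorem sin_integral_ge {p q : ℝ} (hp : 0 < p) (hp1 : p ≤ 1) (hq : 2 ≤ q) :
    (1 - Real.cos 1) / 4 - p ≤ ∫ t in p..q, Real.sin t / t := by
  have hpq : p ≤ q := by linarith
  have hpos : ∀ t ∈ uIcc p q, t ≠ 0 := fun t ht => by
    rw [uIcc_of_le hpq] at ht; linarith [ht.1]
  have hsc : ContinuousOn (fun t => Real.sin t / t) (uIcc p q) :=
    Real.continuous_sin.continuousOn.div continuousOn_id hpos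
  have hcc : ContinuousOn (fun t => (1 - Real.cos t) / t ^ 2) (uIcc p q) :=
    (continuous_const.sub Real.continuous_cos).continuousOn.div (continuousOn_id.pow 2)
      fun t ht => pow_ne_zero 2 (hpos t ht)
  have hd : ∀ t ∈ uIcc p q, HasDerivAt (fun t => (1 - Real.cos t) / t)
      (Real.sin t / t - (1 - Real.cos t) / t ^ 2) t := fun t ht => by
    have h0 := hpos t ht
    refine (((Real.hasDerivAt_cos t).const_sub 1).fun_div (hasDerivAt_id' t) h0).congr_deriv ?_
    field_simp
  have h1 := intervalIntegral.integral_eq_sub_of_hasDerivAt hd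
    (hsc.intervalIntegrable.sub hcc.intervalIntegrable)
  rw [intervalIntegral.integral_sub hsc.intervalIntegrable hcc.intervalIntegrable] at h1
  have h2 : (1 - Real.cos 1) / 4 ≤ ∫ t in p..q, (1 - Real.cos t) / t ^ 2 := by
    have hsub : ∀ x y, x ∈ Icc p q → y ∈ Icc p q →
        IntervalIntegrable (fun t => (1 - Real.cos t) / t ^ 2) volume x y := fun x y hx hy =>
      (hcc.mono (by rw [uIcc_of_le hpq]; exact uIcc_subset_Icc hx hy)).intervalIntegrable
    have mp : p ∈ Icc p q := ⟨le_rfl, hpq⟩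
    have m1 : (1:ℝ) ∈ Icc p q := ⟨hp1, by linarith⟩
    have m2 : (2:ℝ) ∈ Icc p q := ⟨by linarith, hq⟩
    have mq : q ∈ Icc p q := ⟨hpq, le_rfl⟩
    rw [← intervalIntegral.integral_add_adjacent_intervals (hsub _ _ mp m1) (hsub _ _ m1 mq),
      ← intervalIntegral.integral_add_adjacent_intervals (hsub _ _ m1 m2) (hsub _ _ m2 mq)]
    have nn : ∀ t : ℝ, 0 ≤ (1 - Real.cos t) / t ^ 2 := fun t =>
      div_nonneg (by linarith [Real.cos_le_one t]) (sq_nonneg t)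
    have a1 := intervalIntegral.integral_nonneg (μ := volume) hp1 fun t _ => nn t
    have a2 := intervalIntegral.integral_nonneg (μ := volume) hq fun t _ => nn t
    have a3 : (1 - Real.cos 1) / 4 ≤ ∫ t in (1:ℝ)..2, (1 - Real.cos t) / t ^ 2 := by
      have := intervalIntegral.integral_mono_on (μ := volume) (one_le_two (α := ℝ))
        (f := fun _ => (1 - Real.cos 1) / 4) (by simp) (hsub _ _ m1 m2) fun t ht => by
          have hc1 : Real.cos t ≤ Real.cos 1 := by
            apply Real.cos_le_cos_of_nonneg_of_le_pi zero_le_one _ ht.1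
            linarith [ht.2, Real.pi_gt_three]
          have ht1 := ht.1
          have ht2 := ht.2
          have hc2 := Real.cos_le_one 1
          rw [div_le_div_iff₀ (by norm_num) (by positivity)]
          have : t ^ 2 ≤ 4 := by nlinarith
          nlinarith
      simpa using this.trans_eq' (by simp; norm_num)
    linarith
  have h3 : (1 - Real.cos p) / p ≤ p := by
    rw [div_le_iff₀ hp]
    have := Real.one_sub_sq_div_two_le_cos (x := p)
    nlinarith
  have h4 : 0 ≤ (1 - Real.cos q) / q := div_nonneg (by linarith [Real.cos_le_one q]) (by linarith)
  linarith

theorem oddQuot_ex_fst (σ t : ℝ) (hσ : σ = 1 ∨ σ = -1) :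
    oddQuot b cp cm 1 (ex (σ, 0)) 0 t = ((-2 * σ * (Real.sin t / t) : ℝ) : ℂ) * Complex.I := by
  have e1 : ex (σ, 0) (0 - (t, 1 * (cp * t ^ b))) = Complex.exp (-(σ * t : ℝ) * Complex.I) := by
    unfold ex; congr 1; push_cast; simp; ring
  have e2 : ex (σ, 0) (0 - (-t, 1 * (cm * t ^ b))) = Complex.exp ((σ * t : ℝ) * Complex.I) := by
    unfold ex; congr 1; push_cast; simp; ring
  have e3 : Complex.exp (-(σ * t : ℝ) * Complex.I) - Complex.exp ((σ * t : ℝ) * Complex.I) =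
      (-2 * Real.sin (σ * t) : ℝ) * Complex.I := by
    rw [Complex.exp_mul_I, Complex.exp_mul_I, Complex.cos_neg, Complex.sin_neg]
    push_cast; ring
  have e4 : Real.sin (σ * t) = σ * Real.sin t := by
    rcases hσ with rfl | rfl <;> simp
  unfold oddQuot
  rw [e1, e2, e3, e4, Complex.real_smul]
  push_cast; ring

theorem symb_fst_ne (hb : 1 < b) (hcp : cp ≠ 0) (hcm : cm ≠ 0) :
    symb b cp cm (1, 0) ≠ symb b cp cm (-1, 0) := by
  have key : ∀ σ : ℝ, σ = 1 ∨ σ = -1 → Tendsto (fun J : ℕ =>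
      -2 * σ * ∫ t in ((2:ℝ) ^ (-(J:ℤ)))..(2 ^ (J:ℤ)), Real.sin t / t) atTop
      (𝓝 (symb b cp cm (σ, 0)).im) := by
    intro σ hσ
    have := (Complex.continuous_im.tendsto _).comp
      (tendsto_integral_oddQuot_ex hb hcp hcm 1 (σ, 0) 0)
    have e0 : ex (σ, 0) 0 = 1 := by simp [ex]
    simp only [e0, one_mul, mul_zero] at this
    refine this.congr fun J => ?_
    simp only [Function.comp_apply, oddQuot_ex_fst σ _ hσ, intervalIntegral.integral_mul_const]
    rw [intervalIntegral.integral_ofReal, intervalIntegral.integral_const_mul]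
    simp
  have h1 := key 1 (Or.inl rfl)
  have h2 := key (-1) (Or.inr rfl)
  set S : ℕ → ℝ := fun J => ∫ t in ((2:ℝ) ^ (-(J:ℤ)))..(2 ^ (J:ℤ)), Real.sin t / t with hS
  intro heq
  rw [heq] at h1
  have h3 : Tendsto (fun J => 4 * S J) atTop (𝓝 0) := by
    have := h2.sub h1
    rw [sub_self] at this
    refine this.congr fun J => by simp only [hS]; ring
  have hcos : Real.cos 1 < 1 := by
    have := Real.cos_lt_cos_of_nonneg_of_le_pi le_rfl
      (by linarith [Real.pi_gt_three] : (1:ℝ) ≤ Real.pi) one_pos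
    rwa [Real.cos_zero] at this
  have h4 : Tendsto (fun J : ℕ => 4 * ((1 - Real.cos 1) / 4 - (2:ℝ) ^ (-(J:ℤ)))) atTop
      (𝓝 (4 * ((1 - Real.cos 1) / 4 - 0))) := by
    refine (tendsto_const_nhds.sub ?_).const_mul 4
    have := tendsto_pow_atTop_nhds_zero_of_lt_one (by norm_num : (0:ℝ) ≤ 2⁻¹) (by norm_num)
    refine this.congr fun J => by rw [zpow_neg, zpow_natCast, inv_pow]
  have h5 := le_of_tendsto_of_tendsto h4 h3 (by
    filter_upwards [eventually_ge_atTop 1] with J hJ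
    have hJ' : (1:ℤ) ≤ J := by exact_mod_cast hJ
    have g1 : (2:ℝ) ^ (-(J:ℤ)) ≤ 1 := zpow_le_one_of_nonpos₀ (by norm_num) (by omega)
    have g2 : (2:ℝ) ≤ 2 ^ (J:ℤ) := by
      calc (2:ℝ) = 2 ^ (1:ℤ) := by norm_num
        _ ≤ _ := zpow_le_zpow_right₀ (by norm_num) hJ'
    have := sin_integral_ge (by positivity) g1 g2
    simp only [hS]; linarith)
  linarith

end

section

theorem SchwartzMap.exists_ex_repr (f : SchwartzMap (ℝ × ℝ) ℂ) :
    ∃ g : ℝ × ℝ → ℂ, Integrable g ∧ Continuous g ∧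
      (∀ ζ, ∫ x, f x * ex (-ζ) x = ((2 * Real.pi) ^ 2 : ℝ) * g ζ) ∧
      ∀ x, f x = ∫ ζ, g ζ * ex ζ x := by
  open scoped FourierTransform in
  let e : WithLp 2 (ℝ × ℝ) ≃L[ℝ] ℝ × ℝ := WithLp.prodContinuousLinearEquiv 2 ℝ ℝ ℝ
  let F : SchwartzMap (WithLp 2 (ℝ × ℝ)) ℂ := SchwartzMap.compCLMOfContinuousLinearEquiv ℂ e f
  have hF : ∀ v, F v = f (WithLp.ofLp v) := fun v => rfl
  have hmp := WithLp.volume_preserving_toLp (ℝ) (ℝ)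
  have hemb : MeasurableEmbedding (WithLp.toLp 2 : ℝ × ℝ → WithLp 2 (ℝ × ℝ)) :=
    (WithLp.prodContinuousLinearEquiv 2 ℝ ℝ ℝ).symm.toHomeomorph.measurableEmbedding
  have hpi : (2 * Real.pi) ≠ 0 := by positivity
  let G : ℝ × ℝ → ℂ := fun ζ => 𝓕 F (WithLp.toLp 2 ((2 * Real.pi)⁻¹ • ζ))
  have hGc : Continuous G := by
    refine (𝓕 F).continuous.comp ?_
    exact (WithLp.prodContinuousLinearEquiv 2 ℝ ℝ ℝ).symm.continuous.comp (continuous_const_smul _)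
  have hGi : Integrable G := by
    have h1 : Integrable (fun ζ : ℝ × ℝ => 𝓕 F (WithLp.toLp 2 ζ)) :=
      (hmp.integrable_comp_emb hemb).2 (𝓕 F).integrable
    exact (integrable_comp_smul_iff (μ := (volume : Measure (ℝ × ℝ))) (fun ζ : ℝ × ℝ => 𝓕 F (WithLp.toLp 2 ζ)) (inv_ne_zero hpi)).2 h1
  refine ⟨fun ζ => (((2 * Real.pi) ^ 2)⁻¹ : ℝ) * G ζ, hGi.const_mul _, continuous_const.mul hGc,
    fun ζ => ?_, fun x => ?_⟩
  · rw [← mul_assoc, ← Complex.ofReal_mul, mul_inv_cancel₀ (pow_ne_zero 2 hpi), Complex.ofReal_one,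
      one_mul]
    simp only [G]
    rw [SchwartzMap.fourier_coe, Real.fourier_eq', ← hmp.integral_comp hemb]
    refine integral_congr_ae (Eventually.of_forall fun y => ?_)
    simp only [hF, smul_eq_mul]
    rw [mul_comm]
    congr 1
    unfold ex
    congr 1
    simp only [WithLp.prod_inner_apply, Prod.smul_fst, Prod.smul_snd, smul_eq_mul,
      RCLike.inner_apply, Prod.fst_neg, Prod.snd_neg, conj_trivial]
    push_cast
    have : (Real.pi : ℂ) ≠ 0 := by exact_mod_cast Real.pi_ne_zero
    field_simp
    try ring
  · have h2 : f x = 𝓕⁻ (𝓕 F) (WithLp.toLp 2 x) := by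
      rw [FourierTransform.fourierInv_fourier_eq]; rfl
    rw [h2, SchwartzMap.fourierInv_coe, Real.fourierInv_eq', ← hmp.integral_comp hemb]
    have h3 := Measure.integral_comp_inv_smul (volume : Measure (ℝ × ℝ)) (fun ζ : ℝ × ℝ =>
      𝓕 F (WithLp.toLp 2 ζ) * ex ((2 * Real.pi) • ζ) x) (2 * Real.pi)
    have h4 : ∫ ζ, (((2 * Real.pi) ^ 2)⁻¹ : ℝ) * G ζ * ex ζ x = (((2 * Real.pi) ^ 2)⁻¹ : ℝ) *
        ∫ ζ : ℝ × ℝ, 𝓕 F (WithLp.toLp 2 ((2 * Real.pi)⁻¹ • ζ)) *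
          ex ((2 * Real.pi) • (2 * Real.pi)⁻¹ • ζ) x := by
      rw [← integral_const_mul]
      simp only [G, mul_assoc, smul_inv_smul₀ hpi]
    rw [h4, h3]
    have hd : Module.finrank ℝ (ℝ × ℝ) = 2 := by simp
    rw [hd, abs_of_nonneg (by positivity), Complex.real_smul, ← mul_assoc, ← Complex.ofReal_mul,
      inv_mul_cancel₀ (pow_ne_zero 2 hpi), Complex.ofReal_one, one_mul]
    refine integral_congr_ae (Eventually.of_forall fun y => ?_)
    simp only [smul_eq_mul]
    rw [mul_comm]
    congr 1
    unfold ex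
    congr 1
    simp only [WithLp.prod_inner_apply, Prod.smul_fst, Prod.smul_snd, smul_eq_mul,
      RCLike.inner_apply, conj_trivial]
    push_cast
    ring

variable {b cp cm : ℝ}

theorem contDiff_ex (ξ : ℝ × ℝ) : ContDiff ℝ (⊤ : ℕ∞) (ex ξ) := by
  have h : ContDiff ℝ (⊤ : ℕ∞) fun x : ℝ × ℝ => x.1 * ξ.1 + x.2 * ξ.2 := by fun_prop
  exact Complex.contDiff_exp.comp (contDiff_const.mul (Complex.ofRealCLM.contDiff.comp h))

theorem stronglyMeasurable_symb (hb : 1 < b) (hcp : cp ≠ 0) (hcm : cm ≠ 0) :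
    StronglyMeasurable (symb b cp cm) := by
  refine stronglyMeasurable_of_tendsto atTop (f := fun (J : ℕ) ξ =>
    ∑ j ∈ Finset.Ico (-(J:ℤ)) J, sgm b cp cm 2 (dil b (2 ^ j) ξ)) (fun J => ?_)
    (tendsto_pi_nhds.2 fun ξ => (hasSum_symb hb hcp hcm ξ).comp tendsto_Ico_neg_atTop)
  refine Continuous.stronglyMeasurable (continuous_finsetSum _ fun j _ => ?_)
  refine (continuous_sgm hb).comp ?_
  unfold dil; fun_prop

theorem Hint_eq_integral_symb (hb : 1 < b) (hcp : cp ≠ 0) (hcm : cm ≠ 0) (u : ℝ)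
    {f g : ℝ × ℝ → ℂ} (hf : Tame f) (hg : Integrable g) (hfg : ∀ x, f x = ∫ ζ, g ζ * ex ζ x)
    (x : ℝ × ℝ) :
    Hint b cp cm u f x = ∫ ζ, g ζ * (ex ζ x * symb b cp cm (ζ.1, u * ζ.2)) := by
  have hgex : ∀ y, Integrable fun ζ => g ζ * ex ζ y := fun y =>
    hg.mul_bdd (c := 1) ((continuous_ex.comp (Continuous.prodMk_left y)).aestronglyMeasurable)
      (Eventually.of_forall fun ζ => (norm_ex ζ y).le)
  have h1 : ∀ t, oddQuot b cp cm u f x t = ∫ ζ, g ζ * oddQuot b cp cm u (ex ζ) x t := by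
    intro t
    unfold oddQuot
    rw [hfg, hfg, ← integral_sub (hgex _) (hgex _), ← integral_smul]
    refine integral_congr_ae (Eventually.of_forall fun ζ => ?_)
    simp only [Complex.real_smul]; ring
  have hpos : ∀ J : ℕ, (0:ℝ) < 2 ^ (-(J:ℤ)) := fun J => by positivity
  have hle : ∀ J : ℕ, (2:ℝ) ^ (-(J:ℤ)) ≤ 2 ^ (J:ℤ) := fun J =>
    zpow_le_zpow_right₀ one_le_two (by omega)
  have h2 : ∀ J : ℕ, ∫ t in ((2:ℝ) ^ (-(J:ℤ)))..(2 ^ (J:ℤ)), oddQuot b cp cm u f x t =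
      ∫ ζ, g ζ * ∫ t in ((2:ℝ) ^ (-(J:ℤ)))..(2 ^ (J:ℤ)), oddQuot b cp cm u (ex ζ) x t := by
    intro J
    simp only [h1]
    simp only [← intervalIntegral.integral_const_mul]
    rw [intervalIntegral.integral_of_le (hle J)]
    simp only [intervalIntegral.integral_of_le (hle J)]
    refine integral_integral_swap ?_
    have hK : Integrable (fun p : ℝ × (ℝ × ℝ) => (2 * (2:ℝ) ^ (J:ℤ)) * ‖g p.2‖)
        ((volume.restrict (Ioc ((2:ℝ) ^ (-(J:ℤ))) (2 ^ (J:ℤ)))).prod volume) := by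
      have := (hg.norm.comp_snd (volume.restrict (Ioc ((2:ℝ) ^ (-(J:ℤ))) (2 ^ (J:ℤ))))).const_mul
        (2 * (2:ℝ) ^ (J:ℤ))
      exact this
    refine hK.mono' ?_ ?_
    · have hm : Measurable fun p : ℝ × (ℝ × ℝ) => oddQuot b cp cm u (ex p.2) x p.1 := by
        unfold oddQuot ex
        fun_prop
      exact (hg.aestronglyMeasurable.comp_snd).mul hm.aestronglyMeasurable
    · have : ∀ᵐ p : ℝ × (ℝ × ℝ) ∂((volume.restrict (Ioc ((2:ℝ) ^ (-(J:ℤ)))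
          (2 ^ (J:ℤ)))).prod volume), p.1 ∈ Ioc ((2:ℝ) ^ (-(J:ℤ))) (2 ^ (J:ℤ)) :=
        Measure.quasiMeasurePreserving_fst.ae (ae_restrict_mem measurableSet_Ioc)
      filter_upwards [this] with p hp
      simp only [Function.uncurry]
      rw [norm_mul, mul_comm]
      refine mul_le_mul_of_nonneg_right ?_ (norm_nonneg _)
      unfold oddQuot
      have hp0 : 0 < p.1 := (hpos J).trans hp.1
      rw [norm_smul, norm_inv, Real.norm_of_nonneg hp0.le, mul_comm]
      refine mul_le_mul ?_ ?_ (by positivity) (by norm_num)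
      · refine (norm_sub_le _ _).trans ?_
        rw [norm_ex, norm_ex]; norm_num
      · rw [show (2:ℝ) ^ (J:ℤ) = (2 ^ (-(J:ℤ)))⁻¹ by rw [zpow_neg, inv_inv]]
        exact inv_anti₀ (hpos J) hp.1.le
  obtain ⟨C, hC0, hC⟩ := exists_norm_sum_sgm_le (b := b) (cp := cp) (cm := cm) hb hcp hcm
  have h3 : Tendsto (fun J : ℕ => ∫ t in ((2:ℝ) ^ (-(J:ℤ)))..(2 ^ (J:ℤ)),
      oddQuot b cp cm u f x t) atTop
      (𝓝 (∫ ζ, g ζ * (ex ζ x * symb b cp cm (ζ.1, u * ζ.2)))) := by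
    simp only [h2]
    refine tendsto_integral_of_dominated_convergence (fun ζ => ‖g ζ‖ * C) (fun J => ?_)
      (hg.norm.mul_const C) (fun J => Eventually.of_forall fun ζ => ?_)
      (Eventually.of_forall fun ζ => ?_)
    · refine hg.aestronglyMeasurable.mul ?_
      simp only [integral_oddQuot_ex hb]
      refine Continuous.aestronglyMeasurable ?_
      refine (continuous_ex.comp (Continuous.prodMk_left x)).mul
        (continuous_finsetSum _ fun j _ => (continuous_sgm hb).comp ?_)
      unfold dil; fun_prop
    · rw [norm_mul, integral_oddQuot_ex hb, norm_mul, norm_ex, one_mul]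
      exact mul_le_mul_of_nonneg_left (hC _ _) (norm_nonneg _)
    · exact (tendsto_integral_oddQuot_ex hb hcp hcm u ζ x).const_mul _
  have h4 : Tendsto (fun J : ℕ => ∫ t in ((2:ℝ) ^ (-(J:ℤ)))..(2 ^ (J:ℤ)),
      oddQuot b cp cm u f x t) atTop (𝓝 (Hint b cp cm u f x)) := by
    have h2t : Tendsto (fun J : ℕ => (2:ℝ) ^ (J:ℤ)) atTop atTop := by
      simp only [zpow_natCast]; exact tendsto_pow_atTop_atTop_of_one_lt one_lt_two
    have := hf.tendsto_integral_Ioo (cp := cp) (cm := cm) (u := u) hb x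
      (p := fun J : ℕ => (2:ℝ) ^ (-(J:ℤ))) (q := fun J : ℕ => (2:ℝ) ^ (J:ℤ)) (l := atTop)
      (by simp only [zpow_neg]; exact h2t.inv_tendsto_atTop)
      (Eventually.of_forall fun J => (hpos J).le) h2t
    refine this.congr fun J => ?_
    rw [intervalIntegral.integral_of_le (hle J), integral_Ioc_eq_integral_Ioo]
  exact tendsto_nhds_unique h4 h3

/-- On a function modulated at a high frequency the Hilbert transform acts, uniformly, as
multiplication by its symbol. -/
theorem eventually_norm_Hint_sub_le (hb : 1 < b) (hcp : cp ≠ 0) (hcm : cm ≠ 0) (u : ℝ)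
    {G : ℝ × ℝ → ℂ} (hG : ContDiff ℝ (⊤ : ℕ∞) G) (hGc : HasCompactSupport G) {ξ : ℝ × ℝ}
    (hξ : (ξ.1, u * ξ.2) ≠ 0) {ε : ℝ} (hε : 0 < ε) :
    ∀ᶠ i : ℕ in atTop, ∀ x, ‖Hint b cp cm u (fun y => G y * ex (dil b (2 ^ i) ξ) y) x -
      symb b cp cm (ξ.1, u * ξ.2) * (G x * ex (dil b (2 ^ i) ξ) x)‖ ≤ ε := by
  obtain ⟨g, hg, -, -, hGg⟩ := (hGc.toSchwartzMap hG).exists_ex_repr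
  replace hGg : ∀ x, G x = ∫ ζ, g ζ * ex ζ x := hGg
  have hgex : ∀ y, Integrable fun ζ => g ζ * ex ζ y := fun y =>
    hg.mul_bdd (c := 1) ((continuous_ex.comp (Continuous.prodMk_left y)).aestronglyMeasurable)
      (Eventually.of_forall fun ζ => (norm_ex ζ y).le)
  obtain ⟨C, hC0, hC⟩ := exists_norm_symb_le (b := b) (cp := cp) (cm := cm) hb hcp hcm
  set D : ℕ → ℝ × ℝ → ℂ := fun i ζ =>
    symb b cp cm ((ζ + dil b (2 ^ i) ξ).1, u * (ζ + dil b (2 ^ i) ξ).2) -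
      symb b cp cm (ξ.1, u * ξ.2) with hD
  have hDm : ∀ i, AEStronglyMeasurable (D i) := fun i => by
    refine StronglyMeasurable.aestronglyMeasurable (StronglyMeasurable.sub ?_
      stronglyMeasurable_const)
    exact (stronglyMeasurable_symb hb hcp hcm).comp_measurable (by fun_prop)
  have hD2 : ∀ i ζ, ‖D i ζ‖ ≤ 2 * C := fun i ζ =>
    (norm_sub_le _ _).trans (by linarith [hC ((ζ + dil b (2 ^ i) ξ).1,
      u * (ζ + dil b (2 ^ i) ξ).2), hC (ξ.1, u * ξ.2)])
  have key : ∀ (i : ℕ) x, Hint b cp cm u (fun y => G y * ex (dil b (2 ^ i) ξ) y) x -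
      symb b cp cm (ξ.1, u * ξ.2) * (G x * ex (dil b (2 ^ i) ξ) x) =
      ∫ ζ, g ζ * (ex (ζ + dil b (2 ^ i) ξ) x * D i ζ) := by
    intro i x
    set η := dil b (2 ^ i) ξ with hη
    have hex := contDiff_ex η
    have hT : Tame (fun y => G y * ex η y) :=
      ((hGc.mul_right (f' := ex η)).toSchwartzMap (hG.mul hex)).tame
    have hrep : ∀ x, G x * ex η x = ∫ ζ, g (ζ - η) * ex ζ x := by
      intro x
      rw [← integral_add_right_eq_self _ η, hGg, ← integral_mul_const]
      refine integral_congr_ae (Eventually.of_forall fun ζ => ?_)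
      simp only [add_sub_cancel_right, ex_add_left]; ring
    rw [Hint_eq_integral_symb hb hcp hcm u hT (hg.comp_sub_right η) hrep,
      ← integral_add_right_eq_self _ η, hGg, ← integral_mul_const, ← integral_const_mul,
      ← integral_sub]
    · refine integral_congr_ae (Eventually.of_forall fun ζ => ?_)
      simp only [add_sub_cancel_right, hD, ex_add_left]; ring
    · simp only [add_sub_cancel_right]
      refine hg.mul_bdd (c := C) ?_ (Eventually.of_forall fun ζ => ?_)
      · refine AEStronglyMeasurable.mul ?_ (StronglyMeasurable.aestronglyMeasurable ?_)
        · exact ((continuous_ex.comp (Continuous.prodMk_left x)).comp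
            (continuous_add_const η)).aestronglyMeasurable
        · exact (stronglyMeasurable_symb hb hcp hcm).comp_measurable (by fun_prop)
      · rw [norm_mul, norm_ex, one_mul]; exact hC _
    · exact ((hgex x).mul_const _).const_mul _
  have hlim : Tendsto (fun i => ∫ ζ, ‖g ζ‖ * ‖D i ζ‖) atTop (𝓝 0) := by
    have : (0:ℝ) = ∫ ζ : ℝ × ℝ, ‖g ζ‖ * 0 := by simp
    rw [this]
    refine tendsto_integral_of_dominated_convergence (fun ζ => ‖g ζ‖ * (2 * C))
      (fun i => hg.norm.aestronglyMeasurable.mul (hDm i).norm) (hg.norm.mul_const _)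
      (fun i => Eventually.of_forall fun ζ => ?_) (Eventually.of_forall fun ζ => ?_)
    · rw [norm_mul, norm_norm, norm_norm]
      exact mul_le_mul_of_nonneg_left (hD2 i ζ) (norm_nonneg _)
    · refine Tendsto.const_mul _ ?_
      have h1 : ∀ i : ℕ, D i ζ = symb b cp cm (ξ.1 + ((2:ℝ)⁻¹ ^ i) * ζ.1,
          u * (ξ.2 + ((2:ℝ)⁻¹ ^ i) ^ b * ζ.2)) - symb b cp cm (ξ.1, u * ξ.2) := by
        intro i
        have hi : (0:ℝ) < 2 ^ i := by positivity
        simp only [hD]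
        rw [← symb_dil hb hcp hcm hi (ξ.1 + ((2:ℝ)⁻¹ ^ i) * ζ.1,
          u * (ξ.2 + ((2:ℝ)⁻¹ ^ i) ^ b * ζ.2))]
        congr 2
        have e1 : (2:ℝ) ^ i * (2:ℝ)⁻¹ ^ i = 1 := by rw [← mul_pow]; norm_num
        have e2 : ((2:ℝ) ^ i) ^ b * ((2:ℝ)⁻¹ ^ i) ^ b = 1 := by
          rw [← Real.mul_rpow hi.le (by positivity), e1, Real.one_rpow]
        simp only [dil, Prod.fst_add, Prod.snd_add]
        ext
        · linear_combination -ζ.1 * e1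
        · linear_combination -u * ζ.2 * e2
      simp only [h1]
      rw [← norm_zero (E := ℂ), ← sub_self (symb b cp cm (ξ.1, u * ξ.2))]
      refine (Tendsto.sub_const ?_ _).norm
      refine (continuousAt_symb hb hcp hcm hξ).tendsto.comp ?_
      have p1 : Tendsto (fun i : ℕ => (2:ℝ)⁻¹ ^ i) atTop (𝓝 0) :=
        tendsto_pow_atTop_nhds_zero_of_lt_one (by norm_num) (by norm_num)
      have p2 : Tendsto (fun i : ℕ => ((2:ℝ)⁻¹ ^ i) ^ b) atTop (𝓝 0) := by
        have := p1.rpow_const (p := b) (Or.inr (by linarith))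
        rwa [Real.zero_rpow (by linarith)] at this
      refine Tendsto.prodMk_nhds ?_ ?_
      · simpa using (p1.mul_const ζ.1).const_add ξ.1
      · simpa using ((p2.mul_const ζ.2).const_add ξ.2).const_mul u
  filter_upwards [hlim.eventually (gt_mem_nhds hε)] with i hi x
  rw [key]
  refine (norm_integral_le_integral_norm _).trans (le_trans (le_of_eq ?_) hi.le)
  refine integral_congr_ae (Eventually.of_forall fun ζ => ?_)
  simp only [norm_mul, norm_ex, one_mul]

end

theorem tendsto_integral_abs_translate_sub {h : ℝ × ℝ → ℝ} (hh : Continuous h)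
    (hc : HasCompactSupport h) :
    Tendsto (fun t : ℝ => ∫ x, |h (x + (t, 0)) - h x|) (𝓝 0) (𝓝 0) := by
  have hk : IsCompact (tsupport h ∪ (fun p : (ℝ × ℝ) × ℝ => p.1 - (p.2, 0)) ''
      (tsupport h ×ˢ Icc (-1:ℝ) 1)) :=
    hc.isCompact.union ((hc.isCompact.prod isCompact_Icc).image (by fun_prop))
  have := continuousOn_integral_of_compact_support (μ := (volume : Measure (ℝ × ℝ)))
    (s := Icc (-1:ℝ) 1) (f := fun t x => |h (x + (t, 0)) - h x|) hk
    (Continuous.continuousOn (by simp only [Function.uncurry_def]; fun_prop)) (by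
      intro t x ht hx
      rw [mem_union, not_or] at hx
      have h1 : h x = 0 := image_eq_zero_of_notMem_tsupport hx.1
      have h2 : h (x + (t, 0)) = 0 := by
        by_contra h0
        refine hx.2 ⟨(x + (t, 0), t), ⟨subset_tsupport _ h0, ht⟩, by simp⟩
      simp [h1, h2])
  have h2 := (this.continuousAt (Icc_mem_nhds (by norm_num) (by norm_num : (0:ℝ) < 1))).tendsto
  simpa [show ((0:ℝ), (0:ℝ)) = 0 from rfl] using h2

/-- A Riemann–Lebesgue lemma: fast periodic functions converge weakly to their mean. -/
theorem tendsto_integral_smul_periodic {E : Type*} [NormedAddCommGroup E] [NormedSpace ℝ E]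
    [CompleteSpace E] {h : ℝ × ℝ → ℝ} (hh : Continuous h) (hc : HasCompactSupport h) {P : ℝ → E}
    (hP : Continuous P) (hper : Function.Periodic P (2 * Real.pi)) {l k : ℕ → ℝ}
    (hl : Tendsto (fun m => |l m|) atTop atTop) :
    Tendsto (fun m => ∫ x : ℝ × ℝ, h x • P (x.1 * l m + x.2 * k m)) atTop
      (𝓝 ((∫ x, h x) • ((2 * Real.pi)⁻¹ • ∫ t in (0:ℝ)..(2 * Real.pi), P t))) := by
  have hpi : 0 < 2 * Real.pi := by positivity
  have hi : Integrable h := hh.integrable_of_hasCompactSupport hc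
  obtain ⟨M, hM⟩ : ∃ M, ∀ t, ‖P t‖ ≤ M := by
    obtain ⟨M, hM⟩ := isCompact_Icc.exists_bound_of_continuousOn
      (s := Icc (0:ℝ) (2 * Real.pi)) hP.continuousOn
    refine ⟨M, fun t => ?_⟩
    obtain ⟨y, hy, hy2⟩ := hper.exists_mem_Ico₀ hpi t
    rw [hy2]; exact hM y ⟨hy.1, hy.2.le⟩
  have hM0 : 0 ≤ M := (norm_nonneg _).trans (hM 0)
  set D : ℝ → ℝ := fun t => ∫ x, |h (x + (t, 0)) - h x| with hD
  have key : ∀ m, l m ≠ 0 → ∀ δ : ℝ, (∀ t, |t| ≤ 2 * Real.pi / |l m| → D t ≤ δ) →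
      ‖(∫ x : ℝ × ℝ, h x • P (x.1 * l m + x.2 * k m)) -
        (∫ x, h x) • ((2 * Real.pi)⁻¹ • ∫ t in (0:ℝ)..(2 * Real.pi), P t)‖ ≤ M * δ := by
    intro m hm δ hδ
    set φ : ℝ × ℝ → ℝ := fun x => x.1 * l m + x.2 * k m with hφ
    have hφc : Continuous φ := by fun_prop
    have e1 : ∀ τ : ℝ, ∫ x, h x • P (φ x) = ∫ x, h (x + (τ / l m, 0)) • P (φ x + τ) := by
      intro τ
      rw [← integral_add_right_eq_self (fun x => h x • P (φ x)) (τ / l m, (0:ℝ))]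
      refine integral_congr_ae (Eventually.of_forall fun x => ?_)
      have : φ (x + (τ / l m, 0)) = φ x + τ := by
        simp only [hφ, Prod.fst_add, Prod.snd_add]; field_simp; ring
      simp only [this]
    have e2 : (∫ x, h x) • (∫ t in (0:ℝ)..(2 * Real.pi), P t) =
        ∫ τ in (0:ℝ)..(2 * Real.pi), ∫ x, h x • P (φ x + τ) := by
      rw [← integral_smul_const]
      have : ∀ x, (∫ t in (0:ℝ)..(2 * Real.pi), P t) =
          ∫ τ in (0:ℝ)..(2 * Real.pi), P (φ x + τ) := fun x => by
        rw [intervalIntegral.integral_comp_add_left, add_zero]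
        have := hper.intervalIntegral_add_eq 0 (φ x)
        rwa [zero_add] at this
      conv_lhs => enter [2, x]; rw [this x, ← intervalIntegral.integral_smul]
      simp only [intervalIntegral.integral_of_le hpi.le]
      refine integral_integral_swap ?_
      have : Integrable (fun p : (ℝ × ℝ) × ℝ => |h p.1| * M)
          (volume.prod (volume.restrict (Ioc 0 (2 * Real.pi)))) :=
        (hi.abs.comp_fst _).mul_const M
      refine this.mono' ?_ (Eventually.of_forall fun p => ?_)
      · refine Continuous.aestronglyMeasurable ?_
        simp only [Function.uncurry_def]; fun_prop
      · simp only [Function.uncurry, norm_smul, Real.norm_eq_abs]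
        exact mul_le_mul_of_nonneg_left (hM _) (abs_nonneg _)
    have e3 : ∀ τ : ℝ, ∫ x, h x • P (φ x + τ) = (∫ x, h x • P (φ x)) -
        ∫ x, (h (x + (τ / l m, 0)) - h x) • P (φ x + τ) := by
      intro τ
      have i1 : ∀ f : ℝ × ℝ → ℝ, Integrable f → Integrable fun x => f x • P (φ x + τ) :=
        fun f hf => Integrable.mono' (hf.norm.mul_const M) (hf.aestronglyMeasurable.smul
          (Continuous.aestronglyMeasurable (by fun_prop))) (Eventually.of_forall fun x => by
            rw [norm_smul]; exact mul_le_mul_of_nonneg_left (hM _) (norm_nonneg _))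
      simp only [sub_smul]
      rw [e1 τ, integral_sub (i1 _ (hi.comp_add_right _)) (i1 _ hi)]
      abel
    have e4 : (∫ x, h x • P (φ x)) - (∫ x, h x) • ((2 * Real.pi)⁻¹ •
        ∫ t in (0:ℝ)..(2 * Real.pi), P t) = (2 * Real.pi)⁻¹ • ∫ τ in (0:ℝ)..(2 * Real.pi),
          ((∫ x, h x • P (φ x)) - ∫ x, h x • P (φ x + τ)) := by
      rw [intervalIntegral.integral_sub (by simp), ← e2]
      · rw [intervalIntegral.integral_const, sub_zero, smul_sub, inv_smul_smul₀ hpi.ne',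
          smul_comm]
      · refine Continuous.intervalIntegrable ?_ _ _
        refine continuous_of_dominated (bound := fun x => |h x| * M) (fun τ => ?_) (fun τ =>
          Eventually.of_forall fun x => ?_) (hi.abs.mul_const M) (Eventually.of_forall fun x => ?_)
        · exact Continuous.aestronglyMeasurable (by fun_prop)
        · rw [norm_smul]; exact mul_le_mul_of_nonneg_left (hM _) (abs_nonneg _)
        · fun_prop
    rw [e4, norm_smul, norm_inv, Real.norm_of_nonneg hpi.le]
    have e5 : ∀ τ ∈ uIoc 0 (2 * Real.pi),
        ‖(∫ x, h x • P (φ x)) - ∫ x, h x • P (φ x + τ)‖ ≤ M * δ := by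
      intro τ hτ
      rw [uIoc_of_le hpi.le] at hτ
      rw [e3, sub_sub_cancel]
      have hs : ∀ x, ‖(h (x + (τ / l m, 0)) - h x) • P (φ x + τ)‖ ≤
          M * |h (x + (τ / l m, 0)) - h x| := fun x => by
        rw [norm_smul, mul_comm]; exact mul_le_mul_of_nonneg_right (hM _) (norm_nonneg _)
      refine (norm_integral_le_of_norm_le (((hi.comp_add_right _).sub hi).abs.const_mul M)
        (Eventually.of_forall hs)).trans ?_
      rw [integral_const_mul]
      refine mul_le_mul_of_nonneg_left (hδ _ ?_) hM0
      rw [abs_div, abs_of_pos hτ.1]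
      gcongr
      exact hτ.2
    have := intervalIntegral.norm_integral_le_of_norm_le_const e5
    rw [sub_zero, abs_of_pos hpi] at this
    calc _ ≤ (2 * Real.pi)⁻¹ * (M * δ * (2 * Real.pi)) := by gcongr
      _ = M * δ := by field_simp
  rw [tendsto_iff_norm_sub_tendsto_zero]
  rw [Metric.tendsto_nhds]
  intro ε hε
  have hD0 := tendsto_integral_abs_translate_sub hh hc
  obtain ⟨r, hr, hr2⟩ := Metric.eventually_nhds_iff.1
    (hD0.eventually (gt_mem_nhds (show 0 < ε / (M + 1) by positivity)))
  filter_upwards [hl.eventually_gt_atTop (2 * Real.pi / r)] with m hm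
  have hm0 : 0 < |l m| := lt_trans (by positivity) hm
  have := key m (abs_pos.1 hm0) (ε / (M + 1)) fun t ht => (hr2 (by
    rw [Real.dist_eq, sub_zero]
    refine ht.trans_lt ?_
    rw [div_lt_iff₀ hm0, mul_comm r]
    exact (div_lt_iff₀ hr).1 hm)).le
  rw [Real.dist_eq, sub_zero, abs_of_nonneg (norm_nonneg _)]
  refine this.trans_lt ?_
  rw [← mul_div_assoc, div_lt_iff₀ (by positivity)]
  nlinarith

/-- Smooth compactly supported functions on the plane. -/
def TestFn {E : Type*} [NormedAddCommGroup E] [NormedSpace ℝ E] (F : ℝ × ℝ → E) : Prop :=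
  ContDiff ℝ (⊤ : ℕ∞) F ∧ HasCompactSupport F

theorem TestFn.mk_of_zero {E E' : Type*} [NormedAddCommGroup E] [NormedSpace ℝ E]
    [NormedAddCommGroup E'] [NormedSpace ℝ E'] {G : ℝ × ℝ → E} {F : ℝ × ℝ → E'}
    (hG : TestFn G) (hF : ContDiff ℝ (⊤ : ℕ∞) F) (h : ∀ x, G x = 0 → F x = 0) : TestFn F :=
  ⟨hF, hG.2.mono fun x hx h0 => hx (h x h0)⟩

theorem TestFn.integrable_of_zero {E E' : Type*} [NormedAddCommGroup E] [NormedSpace ℝ E]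
    [NormedAddCommGroup E'] {G : ℝ × ℝ → E} {F : ℝ × ℝ → E'}
    (hG : TestFn G) (hF : Continuous F) (h : ∀ x, G x = 0 → F x = 0) : Integrable F :=
  hF.integrable_of_hasCompactSupport (hG.2.mono fun x hx h0 => hx (h x h0))

theorem abs_integral_re_mul_le {X : ℝ × ℝ → ℂ} (hX : Integrable X) (z : ℂ) :
    |∫ x, (z * X x).re| ≤ ‖z‖ * ‖∫ x, X x‖ := by
  have h : ∫ x, (z * X x).re = (z * ∫ x, X x).re := by
    rw [← integral_const_mul]; exact integral_re (hX.const_mul z)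
  rw [h, ← norm_mul]
  exact Complex.abs_re_le_norm _

theorem ex_re (ξ x : ℝ × ℝ) : (ex ξ x).re = Real.cos (x.1 * ξ.1 + x.2 * ξ.2) := by
  rw [ex, mul_comm, Complex.exp_ofReal_mul_I_re]

/-- The properties of the extremal function built from a binary tree of scales: `F` is the
function, `D i` the part of `G` on which the `i`-th operator is used, and `S` is comparable to the
square of the `L²` norm of `F`. -/
structure IsTree (T : ℕ → (ℝ × ℝ → ℂ) → ℝ × ℝ → ℂ) (N : ℕ) (α β : ℂ) (A c q η : ℝ) (n a : ℕ)
    (G : ℝ × ℝ → ℝ) (H : Finset (ℝ × ℝ → ℝ)) (ε : ℝ) (F : ℝ × ℝ → ℂ) (D : ℕ → ℝ × ℝ → ℝ)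
    (S : ℝ) : Prop where
  contDiff : ContDiff ℝ (⊤ : ℕ∞) F
  zero : ∀ x, G x = 0 → F x = 0
  cont : ∀ i, Continuous (D i)
  nonneg : ∀ i x, 0 ≤ D i x
  sum_eq : ∀ x, ∑ i ∈ Finset.Ico a (a + 2 ^ n), D i x = G x
  le_mass : n * q ^ n * (∫ x, G x ^ 2) - ε ≤ S
  sq_le : ∫ x, (F x).re ^ 2 ≤ S + ε
  gain : A * c * S - ε - η * n ^ 2 * (∫ x, G x) ≤
    ∫ x, ∑ i ∈ Finset.Ico a (a + 2 ^ n), D i x * (T i F x).re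
  left : ∀ i, i < a → ∀ x, ‖T i F x - α * F x‖ ≤ η * n * G x + ε
  right : ∀ i, a + 2 ^ n ≤ i → i < N → ∀ x, ‖T i F x - β * F x‖ ≤ η * n * G x + ε
  test : ∀ h ∈ H, ‖∫ x, (h x : ℂ) * F x‖ ≤ ε

section
variable {T : ℕ → (ℝ × ℝ → ℂ) → ℝ × ℝ → ℂ} {N : ℕ} {α β : ℂ} {A c q η : ℝ} {s : ℝ → ℝ}
  {e : ℕ → ℕ → ℝ × ℝ}

theorem exists_root_freq (hs : ContDiff ℝ (⊤ : ℕ∞) s)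
    (hc : c ≤ (2 * Real.pi)⁻¹ * ∫ t in (0:ℝ)..(2 * Real.pi), s (Real.cos t) * Real.cos t)
    (hq : q ≤ (2 * Real.pi)⁻¹ * ∫ t in (0:ℝ)..(2 * Real.pi),
      (s (Real.cos t) ^ 2 + (1 - s (Real.cos t)) ^ 2))
    (he : ∀ k, Tendsto (fun m => |(e k m).1|) atTop atTop)
    (hT : ∀ k < N, ∀ G : ℝ × ℝ → ℂ, TestFn G → ∀ ε > 0, ∀ᶠ m in atTop, ∀ i < N, ∀ x,
      ‖T i (fun y => G y * ex (e k m) y) x - (if i ≤ k then α else β) * (G x * ex (e k m) x)‖ ≤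
        η * ‖G x‖ + ε)
    {G : ℝ × ℝ → ℝ} (hG : TestFn G) (hG0 : ∀ x, 0 ≤ G x) {w : ℂ} (hw : ‖w‖ = 1) {k : ℕ} (hk : k < N)
    (H : Finset (ℝ × ℝ → ℝ)) (hH : ∀ h ∈ H, Continuous h) {ε : ℝ} (hε : 0 < ε) :
    ∃ ξ : ℝ × ℝ, (∀ i < N, ∀ x, ‖T i (fun y => w * G y * ex ξ y) x -
        (if i ≤ k then α else β) * (w * G x * ex ξ x)‖ ≤ η * G x + ε) ∧
      (c * (∫ x, G x ^ 2) - ε ≤ ∫ x, G x ^ 2 * (s (ex ξ x).re * (ex ξ x).re)) ∧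
      (q * (∫ x, G x ^ 2) - ε ≤ ∫ x, G x ^ 2 * (s (ex ξ x).re ^ 2 + (1 - s (ex ξ x).re) ^ 2)) ∧
      (‖∫ x, ((G x ^ 2 : ℝ) : ℂ) * ex ξ x‖ ≤ ε) ∧
      ∀ h ∈ H, ‖∫ x, (h x : ℂ) * (w * G x * ex ξ x)‖ ≤ ε := by
  have hper : Function.Periodic Real.cos (2 * Real.pi) := Real.cos_periodic
  have hGc : Continuous G := hG.1.continuous
  have hwG : TestFn (fun x => w * (G x : ℂ)) :=
    hG.mk_of_zero (contDiff_const.mul (Complex.ofRealCLM.contDiff.comp hG.1)) (by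
      intro x hx; simp [hx])
  have h0 := hT k hk _ hwG ε hε
  have hG2 : Continuous fun x => G x ^ 2 := hGc.pow 2
  have hG2s : HasCompactSupport fun x => G x ^ 2 :=
    hG.2.mono fun x hx h0 => hx (by simp [h0])
  have hI0 : 0 ≤ ∫ x, G x ^ 2 := integral_nonneg fun x => sq_nonneg _
  have h1 := tendsto_integral_smul_periodic hG2 hG2s (P := fun t => s (Real.cos t) * Real.cos t)
    (by have := hs.continuous; fun_prop) (fun t => by simp only [hper t]) (l := fun m => (e k m).1)
    (k := fun m => (e k m).2) (he k)
  have h2 := tendsto_integral_smul_periodic hG2 hG2s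
    (P := fun t => s (Real.cos t) ^ 2 + (1 - s (Real.cos t)) ^ 2)
    (by have := hs.continuous; fun_prop) (fun t => by simp only [hper t]) (l := fun m => (e k m).1)
    (k := fun m => (e k m).2) (he k)
  have hPc : Continuous fun t : ℝ => Complex.exp (Complex.I * (t : ℂ)) := by fun_prop
  have hPp : Function.Periodic (fun t : ℝ => Complex.exp (Complex.I * (t : ℂ))) (2 * Real.pi) := by
    intro t
    simp only
    rw [← Complex.exp_periodic (Complex.I * (t : ℂ))]
    congr 1; push_cast; ring
  have hP0 : ∫ t in (0:ℝ)..(2 * Real.pi), Complex.exp (Complex.I * (t : ℂ)) = 0 := by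
    rw [integral_exp_mul_complex Complex.I_ne_zero]
    have : Complex.exp (Complex.I * ((2 * Real.pi : ℝ) : ℂ)) = 1 := by
      rw [← Complex.exp_two_pi_mul_I]; congr 1; push_cast; ring
    rw [this]; simp
  have h3 : ∀ {h : ℝ × ℝ → ℝ}, Continuous h → (∀ x, G x = 0 → h x = 0) → ∀ᶠ m in atTop,
      ‖∫ x, (h x : ℂ) * ex (e k m) x‖ ≤ ε := by
    intro h hh hz
    have := tendsto_integral_smul_periodic hh (hG.2.mono fun x hx h0 => hx (hz x h0)) hPc hPp
      (l := fun m => (e k m).1) (k := fun m => (e k m).2) (he k)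
    rw [hP0, smul_zero, smul_zero] at this
    have := this.norm
    rw [norm_zero] at this
    filter_upwards [this.eventually (gt_mem_nhds hε)] with m hm
    refine le_trans (le_of_eq ?_) hm.le
    simp only [Complex.real_smul, ex]
  have h4 : ∀ᶠ m in atTop, ∀ h ∈ H, ‖∫ x, ((h x * G x : ℝ) : ℂ) * ex (e k m) x‖ ≤ ε :=
    (Filter.eventually_all_finset H).2 fun h hh =>
      h3 ((hH h hh).mul hGc) (fun x hx => by simp [hx])
  have h5 := h3 hG2 (fun x hx => by simp [hx])
  have h1' := h1.eventually (lt_mem_nhds (show c * (∫ x, G x ^ 2) - ε < _ by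
    simp only [smul_eq_mul]
    nlinarith [mul_le_mul_of_nonneg_left hc hI0]))
  have h2' := h2.eventually (lt_mem_nhds (show q * (∫ x, G x ^ 2) - ε < _ by
    simp only [smul_eq_mul]
    nlinarith [mul_le_mul_of_nonneg_left hq hI0]))
  obtain ⟨m, m0, m1, m2, m4, m5⟩ := (h0.and (h1'.and (h2'.and (h4.and h5)))).exists
  refine ⟨e k m, fun i hi x => ?_, ?_, ?_, m5, fun h hh => ?_⟩
  · have := m0 i hi x
    rwa [norm_mul, hw, one_mul, Complex.norm_real, Real.norm_of_nonneg (hG0 x)] at this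
  · simp only [ex_re]; exact m1.le
  · simp only [ex_re]; exact m2.le
  · have : ∀ x, (h x : ℂ) * (w * G x * ex (e k m) x) = w * (((h x * G x : ℝ) : ℂ) * ex (e k m) x) :=
      fun x => by push_cast; ring
    simp only [this]
    rw [integral_const_mul, norm_mul, hw, one_mul]
    exact m4 h hh

end

section
variable {T : ℕ → (ℝ × ℝ → ℂ) → ℝ × ℝ → ℂ} {N : ℕ} {α β : ℂ} {A c q η : ℝ} {s : ℝ → ℝ}
  {e : ℕ → ℕ → ℝ × ℝ}

theorem isTree_zero (hadd : ∀ i F F', TestFn F → TestFn F' →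
      ∀ x, T i (fun y => F y + F' y) x = T i F x + T i F' x)
    {G : ℝ × ℝ → ℝ} (hG : TestFn G) (hG0 : ∀ x, 0 ≤ G x) (a : ℕ) (H : Finset (ℝ × ℝ → ℝ))
    {ε : ℝ} (hε : 0 < ε) :
    IsTree T N α β A c q η 0 a G H ε (fun _ => 0) (fun _ => G) 0 := by
  have hT0 : ∀ i x, T i (fun _ => 0) x = 0 := by
    intro i x
    have hz : TestFn (fun _ : ℝ × ℝ => (0:ℂ)) := hG.mk_of_zero contDiff_const fun _ _ => rfl
    have := hadd i _ _ hz hz x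
    simp only [add_zero] at this
    exact left_eq_add.1 this
  constructor
  · exact contDiff_const
  · exact fun _ _ => rfl
  · exact fun _ => hG.1.continuous
  · exact fun _ => hG0
  · intro x; simp
  · simp [hε.le]
  · simp [hε.le]
  · simp [hT0, hε.le]
  · intro i _ x; simp [hT0, hε.le]
  · intro i _ _ x; simp [hT0, hε.le]
  · intro h _; simp [hε.le]

set_option maxHeartbeats 1000000 in
theorem IsTree.succ (hadd : ∀ i F F', TestFn F → TestFn F' →
      ∀ x, T i (fun y => F y + F' y) x = T i F x + T i F' x)
    (hcont : ∀ i F, TestFn F → Continuous (T i F))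
    (hs : ContDiff ℝ (⊤ : ℕ∞) s) (hs0 : ∀ t, 0 ≤ s t) (hs1 : ∀ t, s t ≤ 1)
    (hη : 0 ≤ η) (hq0 : 0 ≤ q) (hq1 : q ≤ 1) (hA : 0 < A) {n a : ℕ}
    {G : ℝ × ℝ → ℝ} (hG : TestFn G) (hG0 : ∀ x, 0 ≤ G x) (hG1 : ∀ x, G x ≤ 1)
    {w : ℂ} (hw : ‖w‖ = 1) (hwA : (α - β) * w = (A : ℂ)) (hN : a + 2 ^ (n + 1) ≤ N)
    {H : Finset (ℝ × ℝ → ℝ)} (hH : ∀ h ∈ H, Continuous h)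
    {ε : ℝ} (hε : 0 < ε) {ξ : ℝ × ℝ}
    (r0 : ∀ i < N, ∀ x, ‖T i (fun y => w * G y * ex ξ y) x -
        (if i ≤ a + 2 ^ n - 1 then α else β) * (w * G x * ex ξ x)‖ ≤ η * G x + ε)
    (r1 : c * (∫ x, G x ^ 2) - ε ≤ ∫ x, G x ^ 2 * (s (ex ξ x).re * (ex ξ x).re))
    (r2 : q * (∫ x, G x ^ 2) - ε ≤
      ∫ x, G x ^ 2 * (s (ex ξ x).re ^ 2 + (1 - s (ex ξ x).re) ^ 2))
    (r3 : ‖∫ x, ((G x ^ 2 : ℝ) : ℂ) * ex ξ x‖ ≤ ε)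
    (r4 : ∀ h ∈ H, ‖∫ x, (h x : ℂ) * (w * G x * ex ξ x)‖ ≤ ε)
    {Hl Hr : Finset (ℝ × ℝ → ℝ)} {Fl Fr : ℝ × ℝ → ℂ} {Dl Dr : ℕ → ℝ × ℝ → ℝ} {Sl Sr : ℝ}
    (hl : IsTree T N α β A c q η n a (fun x => G x * s (ex ξ x).re) Hl ε Fl Dl Sl)
    (hr : IsTree T N α β A c q η n (a + 2 ^ n) (fun x => G x * (1 - s (ex ξ x).re)) Hr ε Fr Dr Sr)
    (hHl : H ⊆ Hl) (hHr : H ⊆ Hr)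
    (hl1 : (fun x => G x * (1 - s (ex ξ x).re)) ∈ Hl)
    (hl2 : (fun x => (w * G x * ex ξ x).re) ∈ Hl)
    (hr1 : (fun x => G x * s (ex ξ x).re) ∈ Hr) (hr2 : (fun x => (w * G x * ex ξ x).re) ∈ Hr)
    (hr3 : (fun x => (Fl x).re) ∈ Hr) {ε' : ℝ}
    (hε' : (n + 10 + A + 2 * ‖α‖ + 2 * ‖β‖ + 3 * ∫ x, G x) * ε ≤ ε') :
    IsTree T N α β A c q η (n + 1) a G H ε' (fun x => w * G x * ex ξ x + (Fl x + Fr x))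
      (fun i => if i < a + 2 ^ n then Dl i else Dr i) ((∫ x, G x ^ 2) + Sl + Sr) := by
  set sg : ℝ × ℝ → ℝ := fun x => s (ex ξ x).re with hsg
  set F0 : ℝ × ℝ → ℂ := fun x => w * G x * ex ξ x with hF0
  have hex : ContDiff ℝ (⊤ : ℕ∞) (fun x => (ex ξ x).re) :=
    Complex.reCLM.contDiff.comp (contDiff_ex ξ)
  have hsgd : ContDiff ℝ (⊤ : ℕ∞) sg := hs.comp hex
  have hsg0 : ∀ x, 0 ≤ sg x := fun x => hs0 _
  have hsg1 : ∀ x, sg x ≤ 1 := fun x => hs1 _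
  have hGC : ContDiff ℝ (⊤ : ℕ∞) (fun x => (G x : ℂ)) := Complex.ofRealCLM.contDiff.comp hG.1
  have hF0t : TestFn F0 := hG.mk_of_zero ((contDiff_const.mul hGC).mul (contDiff_ex ξ))
    fun x hx => by simp [hF0, hx]
  have zl : ∀ x, G x = 0 → Fl x = 0 := fun x hx => hl.zero x (by simp [hx])
  have zr : ∀ x, G x = 0 → Fr x = 0 := fun x hx => hr.zero x (by simp [hx])
  have z0 : ∀ x, G x = 0 → F0 x = 0 := fun x hx => by simp [hF0, hx]
  have hFl : TestFn Fl := hG.mk_of_zero hl.contDiff zl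
  have hFr : TestFn Fr := hG.mk_of_zero hr.contDiff zr
  have hFlr : TestFn (fun x => Fl x + Fr x) :=
    hG.mk_of_zero (hl.contDiff.add hr.contDiff) fun x hx => by simp [zl x hx, zr x hx]
  have hTF : ∀ i x, T i (fun x => F0 x + (Fl x + Fr x)) x = T i F0 x + (T i Fl x + T i Fr x) :=
    fun i x => by rw [hadd i _ _ hF0t hFlr, hadd i _ _ hFl hFr]
  have cG := hG.1.continuous
  have cs := hsgd.continuous
  have c0 := hF0t.1.continuous
  have cl := hFl.1.continuous
  have cr := hFr.1.continuous
  have ce := continuous_ex_right ξ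
  have I : ∀ {E : Type} [NormedAddCommGroup E] {f : ℝ × ℝ → E}, Continuous f →
      (∀ x, G x = 0 → f x = 0) → Integrable f := fun hf h => hG.integrable_of_zero hf h
  have hn0 : 0 < 2 ^ n := by positivity
  have hsum : ∀ (f : ℕ → ℝ), ∑ i ∈ Finset.Ico a (a + 2 ^ (n + 1)), f i =
      ∑ i ∈ Finset.Ico a (a + 2 ^ n), f i +
        ∑ i ∈ Finset.Ico (a + 2 ^ n) (a + 2 ^ n + 2 ^ n), f i := fun f => by
    rw [pow_succ, mul_two, ← add_assoc, Finset.sum_Ico_consecutive] <;> omega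
  have hsumD : ∀ (f : ℕ → ℝ) x,
      ∑ i ∈ Finset.Ico a (a + 2 ^ (n + 1)), (if i < a + 2 ^ n then Dl i else Dr i) x * f i =
      ∑ i ∈ Finset.Ico a (a + 2 ^ n), Dl i x * f i +
        ∑ i ∈ Finset.Ico (a + 2 ^ n) (a + 2 ^ n + 2 ^ n), Dr i x * f i := fun f x => by
    rw [hsum]
    congr 1 <;> refine Finset.sum_congr rfl fun i hi => ?_
    · rw [if_pos (Finset.mem_Ico.1 hi).2]
    · rw [if_neg (not_lt.2 (Finset.mem_Ico.1 hi).1)]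
  have hI0 : 0 ≤ ∫ x, G x := integral_nonneg hG0
  have hα := norm_nonneg α
  have hβ := norm_nonneg β
  have hn : (0:ℝ) ≤ n := n.cast_nonneg
  have hp1 : 0 ≤ n * ε := by positivity
  have hp2 : 0 ≤ A * ε := by positivity
  have hp3 : 0 ≤ ‖α‖ * ε := by positivity
  have hp4 : 0 ≤ ‖β‖ * ε := by positivity
  have hp5 : 0 ≤ (∫ x, G x) * ε := by positivity
  have zG : ∀ x, G x = 0 → ∀ i ∈ Finset.Ico a (a + 2 ^ n), Dl i x = 0 := fun x hx i hi => by
    have := hl.sum_eq x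
    rw [hx, zero_mul] at this
    exact (Finset.sum_eq_zero_iff_of_nonneg fun j _ => hl.nonneg j x).1 this i hi
  have zG' : ∀ x, G x = 0 → ∀ i ∈ Finset.Ico (a + 2 ^ n) (a + 2 ^ n + 2 ^ n), Dr i x = 0 :=
    fun x hx i hi => by
      have := hr.sum_eq x
      rw [hx, zero_mul] at this
      exact (Finset.sum_eq_zero_iff_of_nonneg fun j _ => hr.nonneg j x).1 this i hi
  constructor
  · exact hF0t.1.add (hl.contDiff.add hr.contDiff)
  · intro x hx; simp [hx, zl x hx, zr x hx]
  · intro i; split_ifs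
    · exact hl.cont i
    · exact hr.cont i
  · intro i x; split_ifs
    · exact hl.nonneg i x
    · exact hr.nonneg i x
  · intro x
    have := hsumD (fun _ => 1) x
    simp only [mul_one] at this
    rw [this, hl.sum_eq, hr.sum_eq]; ring
  · have h1 := hl.le_mass
    have h2 := hr.le_mass
    have e1 : (∫ x, (G x * sg x) ^ 2) + ∫ x, (G x * (1 - sg x)) ^ 2 =
        ∫ x, G x ^ 2 * (sg x ^ 2 + (1 - sg x) ^ 2) := by
      rw [← integral_add (I (by fun_prop) fun x hx => by simp [hx])
        (I (by fun_prop) fun x hx => by simp [hx])]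
      exact integral_congr_ae (Eventually.of_forall fun x => by simp only; ring)
    have hQ : 0 ≤ ∫ x, G x ^ 2 := integral_nonneg fun x => sq_nonneg _
    have hqn : q ^ n ≤ 1 := pow_le_one₀ hq0 hq1
    have hqn0 : 0 ≤ q ^ n := pow_nonneg hq0 n
    have hqn1 : q ^ (n + 1) ≤ 1 := pow_le_one₀ hq0 hq1
    have e2 : n * q ^ n * (q * (∫ x, G x ^ 2) - ε) ≤
        n * q ^ n * ((∫ x, (G x * sg x) ^ 2) + ∫ x, (G x * (1 - sg x)) ^ 2) := by
      rw [e1]; exact mul_le_mul_of_nonneg_left r2 (by positivity)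
    have e3 : n * ε * q ^ n ≤ n * ε * 1 := mul_le_mul_of_nonneg_left hqn hp1
    have e4 : q ^ (n + 1) * (∫ x, G x ^ 2) ≤ 1 * ∫ x, G x ^ 2 :=
      mul_le_mul_of_nonneg_right hqn1 hQ
    push_cast
    rw [pow_succ] at e4 ⊢
    nlinarith
  · have p : ∀ x, (F0 x + (Fl x + Fr x)).re ^ 2 = (F0 x).re ^ 2 + (Fl x).re ^ 2 + (Fr x).re ^ 2 +
        2 * ((1 * (((F0 x).re : ℂ) * Fl x)).re + (1 * (((F0 x).re : ℂ) * Fr x)).re +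
          (1 * (((Fl x).re : ℂ) * Fr x)).re) := fun x => by
      simp only [one_mul, Complex.re_ofReal_mul, Complex.add_re]; ring
    have re0 : Continuous fun x => (F0 x).re := Complex.continuous_re.comp c0
    have rel : Continuous fun x => (Fl x).re := Complex.continuous_re.comp cl
    have rer : Continuous fun x => (Fr x).re := Complex.continuous_re.comp cr
    have j1 : Integrable fun x => ((F0 x).re : ℂ) * Fl x :=
      I (by fun_prop) fun x hx => by simp [zl x hx]
    have j2 : Integrable fun x => ((F0 x).re : ℂ) * Fr x :=
      I (by fun_prop) fun x hx => by simp [zr x hx]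
    have j3 : Integrable fun x => ((Fl x).re : ℂ) * Fr x :=
      I (by fun_prop) fun x hx => by simp [zr x hx]
    have k1 : Integrable fun x => (F0 x).re ^ 2 := I (by fun_prop) fun x hx => by simp [z0 x hx]
    have k2 : Integrable fun x => (Fl x).re ^ 2 := I (by fun_prop) fun x hx => by simp [zl x hx]
    have k3 : Integrable fun x => (Fr x).re ^ 2 := I (by fun_prop) fun x hx => by simp [zr x hx]
    have R : ∀ {f : ℝ × ℝ → ℂ}, Integrable f → Integrable fun x => (1 * f x).re := fun hf => by
      simp only [one_mul]; exact hf.re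
    rw [show (∫ x, (w * G x * ex ξ x + (Fl x + Fr x)).re ^ 2) = _ from
        integral_congr_ae (Eventually.of_forall p),
      integral_add ((k1.fun_add k2).fun_add k3) (((R j1).fun_add (R j2)).fun_add (R j3) |>.const_mul 2),
      integral_const_mul, integral_add ((R j1).fun_add (R j2)) (R j3), integral_add (R j1) (R j2),
      integral_add (k1.fun_add k2) k3, integral_add k1 k2]
    have b1 := (abs_le.1 ((abs_integral_re_mul_le j1 1).trans
      (mul_le_mul_of_nonneg_left (hl.test _ hl2) (norm_nonneg _)))).2
    have b2 := (abs_le.1 ((abs_integral_re_mul_le j2 1).trans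
      (mul_le_mul_of_nonneg_left (hr.test _ hr2) (norm_nonneg _)))).2
    have b3 := (abs_le.1 ((abs_integral_re_mul_le j3 1).trans
      (mul_le_mul_of_nonneg_left (hr.test _ hr3) (norm_nonneg _)))).2
    rw [norm_one, one_mul] at b1 b2 b3
    have b4 : ∫ x, (F0 x).re ^ 2 ≤ ∫ x, G x ^ 2 := by
      refine integral_mono k1 (I (by fun_prop) fun x hx => by simp [hx]) fun x => ?_
      have : |(F0 x).re| ≤ G x := by
        refine (Complex.abs_re_le_norm _).trans (le_of_eq ?_)
        simp only [hF0]
        rw [norm_mul, norm_mul, hw, norm_ex, Complex.norm_real, Real.norm_of_nonneg (hG0 x)]; ring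
      exact sq_le_sq' (abs_le.1 this).1 (abs_le.1 this).2
    have := hl.sq_le
    have := hr.sq_le
    nlinarith
  · set BL : ℝ × ℝ → ℝ := fun x => ∑ i ∈ Finset.Ico a (a + 2 ^ n), Dl i x * (T i Fl x).re with hBL
    set BR : ℝ × ℝ → ℝ := fun x =>
      ∑ i ∈ Finset.Ico (a + 2 ^ n) (a + 2 ^ n + 2 ^ n), Dr i x * (T i Fr x).re with hBR
    have cT : ∀ i {F}, TestFn F → Continuous fun x => (T i F x).re := fun i F hF =>
      Complex.continuous_re.comp (hcont i F hF)
    have iBL : Integrable BL := I (continuous_finsetSum _ fun i _ => (hl.cont i).mul (cT i hFl))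
      fun x hx => Finset.sum_eq_zero fun i hi => by rw [zG x hx i hi, zero_mul]
    have iBR : Integrable BR := I (continuous_finsetSum _ fun i _ => (hr.cont i).mul (cT i hFr))
      fun x hx => Finset.sum_eq_zero fun i hi => by rw [zG' x hx i hi, zero_mul]
    set K := η * (n + 1) + 2 * ε with hK
    have hpt : ∀ x, A * (G x ^ 2 * (sg x * (ex ξ x).re)) +
        (β * w * (((G x ^ 2 : ℝ) : ℂ) * ex ξ x)).re + (α * (((G x * sg x : ℝ) : ℂ) * Fr x)).re +
        (β * (((G x * (1 - sg x) : ℝ) : ℂ) * Fl x)).re + BL x + BR x - K * G x ≤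
        ∑ i ∈ Finset.Ico a (a + 2 ^ (n + 1)), (if i < a + 2 ^ n then Dl i else Dr i) x *
          (T i (fun x => F0 x + (Fl x + Fr x)) x).re := by
      intro x
      have hre : ∀ {z z' : ℂ} {d : ℝ}, ‖z - z'‖ ≤ d → z'.re - d ≤ z.re := fun {z z' d} h => by
        have := (abs_le.1 ((Complex.abs_re_le_norm (z - z')).trans h)).1
        rw [Complex.sub_re] at this; linarith
      have ng : 0 ≤ η * n := by positivity
      have g1 : η * G x ≤ η * 1 := mul_le_mul_of_nonneg_left (hG1 x) hη
      have g2 : η * n * (G x * sg x) ≤ η * n * 1 :=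
        mul_le_mul_of_nonneg_left (mul_le_one₀ (hG1 x) (hsg0 x) (hsg1 x)) ng
      have g3 : η * n * (G x * (1 - sg x)) ≤ η * n * 1 :=
        mul_le_mul_of_nonneg_left (mul_le_one₀ (hG1 x) (by linarith [hsg1 x])
          (by linarith [hsg0 x])) ng
      have uL : ∀ i ∈ Finset.Ico a (a + 2 ^ n), Dl i x * ((α * F0 x).re + (α * Fr x).re - K) +
          Dl i x * (T i Fl x).re ≤ Dl i x * (T i (fun x => F0 x + (Fl x + Fr x)) x).re := by
        intro i hi
        rw [← mul_add]
        refine mul_le_mul_of_nonneg_left ?_ (hl.nonneg i x)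
        have hi2 := (Finset.mem_Ico.1 hi).2
        have t0 := r0 i (by rw [pow_succ] at hN; omega) x
        rw [if_pos (by omega)] at t0
        have q0 : (α * F0 x).re - (η * G x + ε) ≤ (T i F0 x).re := hre t0
        have q1 : (α * Fr x).re - (η * n * (G x * (1 - sg x)) + ε) ≤ (T i Fr x).re :=
          hre (hr.left i hi2 x)
        rw [hTF, Complex.add_re, Complex.add_re]
        linarith
      have uR : ∀ i ∈ Finset.Ico (a + 2 ^ n) (a + 2 ^ n + 2 ^ n),
          Dr i x * ((β * F0 x).re + (β * Fl x).re - K) +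
          Dr i x * (T i Fr x).re ≤ Dr i x * (T i (fun x => F0 x + (Fl x + Fr x)) x).re := by
        intro i hi
        rw [← mul_add]
        refine mul_le_mul_of_nonneg_left ?_ (hr.nonneg i x)
        have hi1 := (Finset.mem_Ico.1 hi).1
        have hi2 := (Finset.mem_Ico.1 hi).2
        have hiN : i < N := by rw [pow_succ] at hN; omega
        have t0 := r0 i hiN x
        rw [if_neg (by omega)] at t0
        have q0 : (β * F0 x).re - (η * G x + ε) ≤ (T i F0 x).re := hre t0
        have q1 : (β * Fl x).re - (η * n * (G x * sg x) + ε) ≤ (T i Fl x).re :=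
          hre (hl.right i hi1 hiN x)
        rw [hTF, Complex.add_re, Complex.add_re]
        linarith
      rw [hsumD]
      refine le_trans (le_of_eq ?_) (add_le_add (Finset.sum_le_sum uL) (Finset.sum_le_sum uR))
      rw [Finset.sum_add_distrib, Finset.sum_add_distrib, ← Finset.sum_mul, ← Finset.sum_mul,
        hl.sum_eq, hr.sum_eq]
      have w1 : (α * F0 x).re = A * (G x * (ex ξ x).re) + (β * F0 x).re := by
        have : α * F0 x = ((A * G x : ℝ) : ℂ) * ex ξ x + β * F0 x := by
          simp only [hF0]; push_cast; rw [← hwA]; ring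
        rw [this, Complex.add_re, Complex.re_ofReal_mul]; ring
      have w2 : (β * w * (((G x ^ 2 : ℝ) : ℂ) * ex ξ x)).re = G x * (β * F0 x).re := by
        rw [← Complex.re_ofReal_mul]; congr 1; simp only [hF0]; push_cast; ring
      have w3 : (α * (((G x * sg x : ℝ) : ℂ) * Fr x)).re = G x * sg x * (α * Fr x).re := by
        rw [← Complex.re_ofReal_mul]; congr 1; ring
      have w4 : (β * (((G x * (1 - sg x) : ℝ) : ℂ) * Fl x)).re =
          G x * (1 - sg x) * (β * Fl x).re := by
        rw [← Complex.re_ofReal_mul]; congr 1; ring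
      rw [w1, w2, w3, w4]
      simp only [hBL, hBR]
      ring
    have cre : Continuous fun x => (ex ξ x).re := hex.continuous
    have j1 : Integrable fun x => G x ^ 2 * (sg x * (ex ξ x).re) :=
      I (by fun_prop) fun x hx => by simp [hx]
    have j2 : Integrable fun x => ((G x ^ 2 : ℝ) : ℂ) * ex ξ x :=
      I (by fun_prop) fun x hx => by simp [hx]
    have j3 : Integrable fun x => ((G x * sg x : ℝ) : ℂ) * Fr x :=
      I (by fun_prop) fun x hx => by simp [hx]
    have j4 : Integrable fun x => ((G x * (1 - sg x) : ℝ) : ℂ) * Fl x :=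
      I (by fun_prop) fun x hx => by simp [hx]
    have jG : Integrable G := I cG fun x hx => hx
    have R : ∀ {f : ℝ × ℝ → ℂ} (z : ℂ), Integrable f → Integrable fun x => (z * f x).re :=
      fun z hf => (hf.const_mul z).re
    have jT : Integrable fun x => ∑ i ∈ Finset.Ico a (a + 2 ^ (n + 1)),
        (if i < a + 2 ^ n then Dl i else Dr i) x *
          (T i (fun x => F0 x + (Fl x + Fr x)) x).re := by
      refine I (continuous_finsetSum _ fun i _ => ?_) fun x hx => ?_
      · have hF : TestFn fun x => F0 x + (Fl x + Fr x) :=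
          hG.mk_of_zero (hF0t.1.add hFlr.1) fun x hx => by simp [z0 x hx, zl x hx, zr x hx]
        refine Continuous.mul ?_ (cT i hF)
        split_ifs
        · exact hl.cont i
        · exact hr.cont i
      · rw [hsumD, Finset.sum_eq_zero fun i hi => by rw [zG x hx i hi, zero_mul],
          Finset.sum_eq_zero fun i hi => by rw [zG' x hx i hi, zero_mul], add_zero]
    have i1 := j1.const_mul A
    have i2 := i1.add (R (β * w) j2)
    have i3 := i2.add (R α j3)
    have i4 := i3.add (R β j4)
    have i5 := i4.add iBL
    have i6 := i5.add iBR
    have hm := integral_mono (i6.sub (jG.const_mul K)) jT hpt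
    rw [integral_sub' i6 (jG.const_mul K)] at hm
    have hm2 := integral_add' i5 iBR
    have hm3 := integral_add' i4 iBL
    have hm4 := integral_add' i3 (R β j4)
    have hm5 := integral_add' i2 (R α j3)
    have hm6 := integral_add' i1 (R (β * w) j2)
    have hm7 := integral_const_mul (μ := volume) A fun x => G x ^ 2 * (sg x * (ex ξ x).re)
    have hm8 := integral_const_mul (μ := volume) K G
    rw [hm2, hm3, hm4, hm5, hm6, hm7, hm8] at hm
    have b2 := (abs_le.1 ((abs_integral_re_mul_le j2 (β * w)).trans
      (mul_le_mul_of_nonneg_left r3 (norm_nonneg _)))).1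
    have b3 := (abs_le.1 ((abs_integral_re_mul_le j3 α).trans
      (mul_le_mul_of_nonneg_left (hr.test _ hr1) (norm_nonneg _)))).1
    have b4 := (abs_le.1 ((abs_integral_re_mul_le j4 β).trans
      (mul_le_mul_of_nonneg_left (hl.test _ hl1) (norm_nonneg _)))).1
    rw [norm_mul, hw, mul_one] at b2
    have b5 : A * c * Sl - ε - η * n ^ 2 * (∫ x, G x * sg x) ≤ ∫ x, BL x := hl.gain
    have b6 : A * c * Sr - ε - η * n ^ 2 * (∫ x, G x * (1 - sg x)) ≤ ∫ x, BR x := hr.gain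
    have b7 : A * (c * (∫ x, G x ^ 2) - ε) ≤ A * ∫ x, G x ^ 2 * (sg x * (ex ξ x).re) :=
      mul_le_mul_of_nonneg_left r1 hA.le
    have b8 : (∫ x, G x * sg x) + ∫ x, G x * (1 - sg x) = ∫ x, G x := by
      rw [← integral_add (I (by fun_prop) fun x hx => by simp [hx])
        (I (by fun_prop) fun x hx => by simp [hx])]
      exact integral_congr_ae (Eventually.of_forall fun x => by simp only; ring)
    have b9 : η * n ^ 2 * (∫ x, G x * sg x) + η * n ^ 2 * (∫ x, G x * (1 - sg x)) =
      η * n ^ 2 * ∫ x, G x := by rw [← b8]; ring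
    have b10 : 0 ≤ η * n * ∫ x, G x := by positivity
    refine le_trans ?_ hm
    simp only [hK, Nat.cast_add, Nat.cast_one]
    linarith only [b2, b3, b4, b5, b6, b7, b9, b10, hε', hp1, hp2, hp3, hp4, hp5, hε]
  · intro i hi x
    have h0 := r0 i (by omega) x
    rw [if_pos (by omega)] at h0
    have h1 := hl.left i hi x
    have h2 := hr.left i (by omega) x
    rw [hTF]
    have : T i F0 x + (T i Fl x + T i Fr x) - α * (F0 x + (Fl x + Fr x)) =
      (T i F0 x - α * F0 x) + ((T i Fl x - α * Fl x) + (T i Fr x - α * Fr x)) := by ring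
    rw [this]
    refine (norm_add_le_of_le h0 (norm_add_le_of_le h1 h2)).trans ?_
    push_cast
    nlinarith
  · intro i hi hiN x
    rw [pow_succ] at hi
    have h0 := r0 i hiN x
    rw [if_neg (by omega)] at h0
    have h1 := hl.right i (by omega) hiN x
    have h2 := hr.right i (by omega) hiN x
    rw [hTF]
    have : T i F0 x + (T i Fl x + T i Fr x) - β * (F0 x + (Fl x + Fr x)) =
      (T i F0 x - β * F0 x) + ((T i Fl x - β * Fl x) + (T i Fr x - β * Fr x)) := by ring
    rw [this]
    refine (norm_add_le_of_le h0 (norm_add_le_of_le h1 h2)).trans ?_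
    push_cast
    nlinarith
  · intro h hh
    have ch := hH h hh
    have i0 : Integrable fun x => (h x : ℂ) * F0 x :=
      I (by fun_prop) fun x hx => by simp [z0 x hx]
    have i1 : Integrable fun x => (h x : ℂ) * Fl x :=
      I (by fun_prop) fun x hx => by simp [zl x hx]
    have i2 : Integrable fun x => (h x : ℂ) * Fr x :=
      I (by fun_prop) fun x hx => by simp [zr x hx]
    have e0 : (∫ x, (h x : ℂ) * (F0 x + (Fl x + Fr x))) =
        (∫ x, (h x : ℂ) * F0 x) + ((∫ x, (h x : ℂ) * Fl x) + ∫ x, (h x : ℂ) * Fr x) := by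
      rw [← integral_add i1 i2, ← integral_add i0 (i1.fun_add i2)]
      exact integral_congr_ae (Eventually.of_forall fun x => by simp only; ring)
    change ‖∫ x, (h x : ℂ) * (F0 x + (Fl x + Fr x))‖ ≤ ε'
    rw [e0]
    refine (norm_add_le_of_le (r4 h hh) (norm_add_le_of_le (hl.test h (hHl hh))
      (hr.test h (hHr hh)))).trans ?_
    nlinarith

end

section
variable {T : ℕ → (ℝ × ℝ → ℂ) → ℝ × ℝ → ℂ} {N : ℕ} {α β : ℂ} {A c q η : ℝ} {s : ℝ → ℝ}
  {e : ℕ → ℕ → ℝ × ℝ}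

theorem exists_isTree (hadd : ∀ i F F', TestFn F → TestFn F' →
      ∀ x, T i (fun y => F y + F' y) x = T i F x + T i F' x)
    (hcont : ∀ i F, TestFn F → Continuous (T i F))
    (hs : ContDiff ℝ (⊤ : ℕ∞) s) (hs0 : ∀ t, 0 ≤ s t) (hs1 : ∀ t, s t ≤ 1)
    (hc : c ≤ (2 * Real.pi)⁻¹ * ∫ t in (0:ℝ)..(2 * Real.pi), s (Real.cos t) * Real.cos t)
    (hq : q ≤ (2 * Real.pi)⁻¹ * ∫ t in (0:ℝ)..(2 * Real.pi),
      (s (Real.cos t) ^ 2 + (1 - s (Real.cos t)) ^ 2))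
    (hη : 0 ≤ η) (hq0 : 0 ≤ q) (hq1 : q ≤ 1) (hA : 0 < A)
    (he : ∀ k, Tendsto (fun m => |(e k m).1|) atTop atTop)
    (hT : ∀ k < N, ∀ G : ℝ × ℝ → ℂ, TestFn G → ∀ ε > 0, ∀ᶠ m in atTop, ∀ i < N, ∀ x,
      ‖T i (fun y => G y * ex (e k m) y) x - (if i ≤ k then α else β) * (G x * ex (e k m) x)‖ ≤
        η * ‖G x‖ + ε)
    {w : ℂ} (hw : ‖w‖ = 1) (hwA : (α - β) * w = (A : ℂ)) (n : ℕ) :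
    ∀ (a : ℕ), a + 2 ^ n ≤ N → ∀ G : ℝ × ℝ → ℝ, TestFn G → (∀ x, 0 ≤ G x) → (∀ x, G x ≤ 1) →
      ∀ H : Finset (ℝ × ℝ → ℝ), (∀ h ∈ H, Continuous h) → ∀ ε > 0,
      ∃ F D S, IsTree T N α β A c q η n a G H ε F D S := by
  induction n with
  | zero => exact fun a _ G hG hG0 _ H _ ε hε => ⟨_, _, _, isTree_zero hadd hG hG0 a H hε⟩
  | succ n ih =>
    intro a hN G hG hG0 hG1 H hH ε' hε'
    have hI0 : 0 ≤ ∫ x, G x := integral_nonneg hG0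
    set B := n + 10 + A + 2 * ‖α‖ + 2 * ‖β‖ + 3 * ∫ x, G x with hB
    have hB0 : 0 < B := by positivity
    have hε : 0 < ε' / B := by positivity
    have h2 : 0 < 2 ^ n := by positivity
    rw [pow_succ] at hN
    obtain ⟨ξ, r0, r1, r2, r3, r4⟩ := exists_root_freq hs hc hq he hT hG hG0 hw
      (k := a + 2 ^ n - 1) (by omega) H hH hε
    have hsg : ContDiff ℝ (⊤ : ℕ∞) fun x => s (ex ξ x).re :=
      hs.comp (Complex.reCLM.contDiff.comp (contDiff_ex ξ))
    have cG := hG.1.continuous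
    have cs := hsg.continuous
    have ce := continuous_ex_right ξ
    have tl : TestFn fun x => G x * s (ex ξ x).re :=
      hG.mk_of_zero (hG.1.mul hsg) fun x hx => by simp [hx]
    have tr : TestFn fun x => G x * (1 - s (ex ξ x).re) :=
      hG.mk_of_zero (hG.1.mul (contDiff_const.sub hsg)) fun x hx => by simp [hx]
    have c0 : Continuous fun x => (w * G x * ex ξ x).re :=
      Complex.continuous_re.comp (by fun_prop)
    obtain ⟨Fl, Dl, Sl, hl⟩ := ih a (by omega) _ tl (fun x => mul_nonneg (hG0 x) (hs0 _))
      (fun x => mul_le_one₀ (hG1 x) (hs0 _) (hs1 _))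
      (insert (fun x => G x * (1 - s (ex ξ x).re)) (insert (fun x => (w * G x * ex ξ x).re) H))
      (by simp only [Finset.mem_insert, forall_eq_or_imp]; exact ⟨tr.1.continuous, c0, hH⟩) _ hε
    have cl : Continuous fun x => (Fl x).re := Complex.continuous_re.comp hl.contDiff.continuous
    obtain ⟨Fr, Dr, Sr, hr⟩ := ih (a + 2 ^ n) (by omega) _ tr
      (fun x => mul_nonneg (hG0 x) (sub_nonneg.2 (hs1 _)))
      (fun x => mul_le_one₀ (hG1 x) (sub_nonneg.2 (hs1 _)) (by linarith [hs0 (ex ξ x).re]))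
      (insert (fun x => G x * s (ex ξ x).re) (insert (fun x => (w * G x * ex ξ x).re)
        (insert (fun x => (Fl x).re) H)))
      (by simp only [Finset.mem_insert, forall_eq_or_imp]; exact ⟨tl.1.continuous, c0, cl, hH⟩) _ hε
    exact ⟨_, _, _, IsTree.succ hadd hcont hs hs0 hs1 hη hq0 hq1 hA hG hG0 hG1 hw hwA
      (by rw [pow_succ]; exact hN) hH hε r0 r1 r2 r3 r4 hl hr
      (fun h hh => by simp [hh]) (fun h hh => by simp [hh]) (by simp) (by simp) (by simp)
      (by simp) (by simp) (mul_div_cancel₀ _ hB0.ne').le⟩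

end

theorem ae_cos_ne_zero : ∀ᵐ t : ℝ, Real.cos t ≠ 0 := by
  have : {t : ℝ | Real.cos t = 0} ⊆ range fun k : ℤ => (2 * (k : ℝ) + 1) * Real.pi / 2 := by
    intro t ht
    obtain ⟨k, hk⟩ := Real.cos_eq_zero_iff.1 ht
    exact ⟨k, hk.symm⟩
  exact compl_mem_ae_iff.2 (measure_mono_null this ((countable_range _).measure_zero volume))

/-- Smooth cutoffs which nearly split the circle into the halves `cos > 0` and `cos < 0`. -/
theorem exists_cutoff : ∃ c > 0, ∀ q < 1, ∃ s : ℝ → ℝ, ContDiff ℝ (⊤ : ℕ∞) s ∧ (∀ t, 0 ≤ s t) ∧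
    (∀ t, s t ≤ 1) ∧
    c ≤ (2 * Real.pi)⁻¹ * ∫ t in (0:ℝ)..(2 * Real.pi), s (Real.cos t) * Real.cos t ∧
    q ≤ (2 * Real.pi)⁻¹ * ∫ t in (0:ℝ)..(2 * Real.pi),
      (s (Real.cos t) ^ 2 + (1 - s (Real.cos t)) ^ 2) := by
  have hpi := Real.pi_pos
  have hpos : 0 < ∫ t in (0:ℝ)..(2 * Real.pi), max (Real.cos t) 0 :=
    intervalIntegral.integral_pos (by positivity) (by fun_prop) (fun t _ => le_max_right _ _)
      ⟨0, ⟨le_rfl, by positivity⟩, by simp⟩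
  set s : ℕ → ℝ → ℝ := fun m t => Real.smoothTransition (1 / 2 + m * t) with hs
  have sc : ∀ m, ContDiff ℝ (⊤ : ℕ∞) (s m) := fun m =>
    Real.smoothTransition.contDiff.comp (contDiff_const.add (contDiff_const.mul contDiff_id))
  have s0 : ∀ m t, 0 ≤ s m t := fun m t => Real.smoothTransition.nonneg _
  have s1 : ∀ m t, s m t ≤ 1 := fun m t => Real.smoothTransition.le_one _
  have lim : ∀ t, t ≠ 0 → Tendsto (fun m => s m t) atTop (𝓝 (if 0 < t then 1 else 0)) := by
    intro t ht
    have : ∀ᶠ m : ℕ in atTop, 1 / 2 ≤ m * |t| := by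
      have := (tendsto_natCast_atTop_atTop (R := ℝ)).atTop_mul_const (abs_pos.2 ht)
      exact this.eventually_ge_atTop _
    refine tendsto_const_nhds.congr' ?_
    filter_upwards [this] with m hm
    split_ifs with h
    · rw [abs_of_pos h] at hm
      exact (Real.smoothTransition.one_of_one_le (by linarith)).symm
    · rw [abs_of_nonpos (not_lt.1 h)] at hm
      exact (Real.smoothTransition.zero_of_nonpos (by linarith)).symm
  have l1 : Tendsto (fun m => (2 * Real.pi)⁻¹ * ∫ t in (0:ℝ)..(2 * Real.pi),
      s m (Real.cos t) * Real.cos t) atTop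
      (𝓝 ((2 * Real.pi)⁻¹ * ∫ t in (0:ℝ)..(2 * Real.pi), max (Real.cos t) 0)) := by
    refine Tendsto.const_mul _ (intervalIntegral.tendsto_integral_filter_of_dominated_convergence
      (fun _ => 1) (Eventually.of_forall fun m => ?_) (Eventually.of_forall fun m =>
        Eventually.of_forall fun t _ => ?_) intervalIntegrable_const ?_)
    · exact (((sc m).continuous.comp Real.continuous_cos).mul
        Real.continuous_cos).aestronglyMeasurable
    · rw [Real.norm_eq_abs, abs_mul, abs_of_nonneg (s0 _ _)]
      exact mul_le_one₀ (s1 _ _) (abs_nonneg _) (Real.abs_cos_le_one _)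
    · filter_upwards [ae_cos_ne_zero] with t ht _
      convert (lim _ ht).mul_const (Real.cos t) using 2
      split_ifs with h
      · rw [one_mul, max_eq_left h.le]
      · rw [zero_mul, max_eq_right (not_lt.1 h)]
  have l2 : Tendsto (fun m => (2 * Real.pi)⁻¹ * ∫ t in (0:ℝ)..(2 * Real.pi),
      (s m (Real.cos t) ^ 2 + (1 - s m (Real.cos t)) ^ 2)) atTop
      (𝓝 ((2 * Real.pi)⁻¹ * ∫ t in (0:ℝ)..(2 * Real.pi), (1:ℝ))) := by
    refine Tendsto.const_mul _ (intervalIntegral.tendsto_integral_filter_of_dominated_convergence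
      (fun _ => 1) (Eventually.of_forall fun m => ?_) (Eventually.of_forall fun m =>
        Eventually.of_forall fun t _ => ?_) intervalIntegrable_const ?_)
    · have := (sc m).continuous
      exact Continuous.aestronglyMeasurable (by fun_prop)
    · rw [Real.norm_eq_abs, abs_of_nonneg (by positivity)]
      nlinarith [s0 m (Real.cos t), s1 m (Real.cos t)]
    · filter_upwards [ae_cos_ne_zero] with t ht _
      have := lim _ ht
      convert (this.pow 2).add ((tendsto_const_nhds.sub this).pow 2) using 2
      split_ifs with h <;> norm_num
  have e1 : (2 * Real.pi)⁻¹ * ∫ t in (0:ℝ)..(2 * Real.pi), (1:ℝ) = 1 := by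
    rw [intervalIntegral.integral_const, smul_eq_mul]; field_simp; ring
  rw [e1] at l2
  set I := (2 * Real.pi)⁻¹ * ∫ t in (0:ℝ)..(2 * Real.pi), max (Real.cos t) 0 with hI
  have hI0 : 0 < I := by positivity
  refine ⟨I / 2, by positivity, fun q hq => ?_⟩
  obtain ⟨m, h1, h2⟩ := ((l1.eventually (lt_mem_nhds (half_lt_self hI0))).and
    (l2.eventually (lt_mem_nhds hq))).exists
  exact ⟨s m, sc m, s0 m, s1 m, h1.le, h2.le⟩

/-- A sequence of finite families of operators which are asymptotically diagonalised by
exponentials, with two different multipliers according to the position of the scale, cannot obey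
a uniform maximal inequality. -/
theorem not_forall_maximal_bound {T : ℕ → ℕ → (ℝ × ℝ → ℂ) → ℝ × ℝ → ℂ} {α β : ℂ}
    {e : ℕ → ℕ → ℕ → ℝ × ℝ} (hαβ : α ≠ β)
    (hadd : ∀ n i F F', TestFn F → TestFn F' →
      ∀ x, T n i (fun y => F y + F' y) x = T n i F x + T n i F' x)
    (hcont : ∀ n i F, TestFn F → Continuous (T n i F))
    (he : ∀ n k, Tendsto (fun m => |(e n k m).1|) atTop atTop)
    (hT : ∀ n, ∀ k < 2 ^ n, ∀ G : ℝ × ℝ → ℂ, TestFn G → ∀ ε > 0, ∀ᶠ m in atTop, ∀ i < 2 ^ n, ∀ x,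
      ‖T n i (fun y => G y * ex (e n k m) y) x -
        (if i ≤ k then α else β) * (G x * ex (e n k m) x)‖ ≤ ((n:ℝ) ^ 2 + 1)⁻¹ * ‖G x‖ + ε)
    {g : ℝ × ℝ → ℝ} (hg : TestFn g) (hg0 : ∀ x, 0 ≤ g x) (hg1 : ∀ x, g x ≤ 1)
    (hgi : 0 < ∫ x, g x ^ 2) (C : ℝ) :
    ¬ ∀ n (F : ℝ × ℝ → ℂ) (D : ℕ → ℝ × ℝ → ℝ), ContDiff ℝ (⊤ : ℕ∞) F → (∀ x, g x = 0 → F x = 0) →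
      (∀ i, Continuous (D i)) → (∀ i x, 0 ≤ D i x) →
      (∀ x, ∑ i ∈ Finset.range (2 ^ n), D i x = g x) →
      ∫ x, ∑ i ∈ Finset.range (2 ^ n), D i x * (T n i F x).re ≤
        C * √(∫ x, (F x).re ^ 2) := by
  intro hB
  obtain ⟨c, hc0, hcut⟩ := exists_cutoff
  set A := ‖α - β‖ with hA
  have hA0 : 0 < A := norm_pos_iff.2 (sub_ne_zero.2 hαβ)
  set w : ℂ := (A : ℂ) / (α - β) with hw
  have hw1 : ‖w‖ = 1 := by
    rw [hw, norm_div, Complex.norm_real, Real.norm_of_nonneg hA0.le, div_self hA0.ne']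
  have hwA : (α - β) * w = (A : ℂ) := mul_div_cancel₀ _ (sub_ne_zero.2 hαβ)
  set Q := ∫ x, g x ^ 2 with hQ
  set I := ∫ x, g x with hI
  have hI0 : 0 ≤ I := integral_nonneg hg0
  have key : ∀ n : ℕ, ∃ S : ℝ, n * (1 / 2) * Q - 1 ≤ S ∧ -1 ≤ S ∧
      A * c * S - 1 - I ≤ |C| * √(S + 1) := by
    intro n
    have hn : (0:ℝ) ≤ n := n.cast_nonneg
    obtain ⟨s, hs, hs0, hs1, h1, h2⟩ := hcut (1 - (2 * (n + 1) : ℝ)⁻¹) (by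
      have : (0:ℝ) < (2 * (n + 1) : ℝ)⁻¹ := by positivity
      linarith)
    have hinv : (2 * (n + 1) : ℝ)⁻¹ ≤ 1 := by
      apply inv_le_one_of_one_le₀; linarith
    have hinv0 : (0:ℝ) < (2 * (n + 1) : ℝ)⁻¹ := by positivity
    obtain ⟨F, D, S, h⟩ := exists_isTree (hadd n) (hcont n) hs hs0 hs1 h1 h2
      (η := ((n:ℝ) ^ 2 + 1)⁻¹) (by positivity) (by linarith) (by linarith) hA0 (he n) (hT n)
      hw1 hwA n 0 (by simp) g hg hg0 hg1 ∅ (by simp) 1 one_pos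
    have hqn : 1 / 2 ≤ (1 - (2 * (n + 1) : ℝ)⁻¹) ^ n := by
      have := one_add_mul_le_pow (a := -(2 * (n + 1) : ℝ)⁻¹) (by linarith) n
      rw [← sub_eq_add_neg] at this
      refine le_trans ?_ this
      have : (n:ℝ) * (2 * (n + 1) : ℝ)⁻¹ ≤ 1 / 2 := by
        rw [← div_eq_mul_inv, div_le_div_iff₀ (by positivity) (by positivity)]; linarith
      linarith
    have hS0 := h.le_mass
    have hsq := h.sq_le
    have hge : 0 ≤ ∫ x, (F x).re ^ 2 := integral_nonneg fun x => sq_nonneg _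
    refine ⟨S, ?_, by linarith, ?_⟩
    · refine le_trans ?_ hS0
      gcongr
    · have h3 := h.gain
      have h4 := hB n F D h.contDiff h.zero h.cont h.nonneg (by
        have := h.sum_eq; simpa only [Finset.range_eq_Ico, zero_add] using this)
      simp only [zero_add, ← Finset.range_eq_Ico] at h3
      have h5 : ((n:ℝ) ^ 2 + 1)⁻¹ * n ^ 2 * I ≤ 1 * I := by
        refine mul_le_mul_of_nonneg_right ?_ hI0
        rw [inv_mul_le_iff₀ (by positivity)]; linarith
      have h6 : C * √(∫ x, (F x).re ^ 2) ≤ |C| * √(S + 1) :=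
        mul_le_mul (le_abs_self C) (Real.sqrt_le_sqrt hsq) (Real.sqrt_nonneg _) (abs_nonneg _)
      linarith
  have hAc : 0 < A * c := by positivity
  obtain ⟨n, hn⟩ := exists_nat_gt ((((A * c)⁻¹ * (1 + I + A * c + |C|)) ^ 2 + 3) / (1 / 2 * Q))
  rw [div_lt_iff₀ (by positivity)] at hn
  obtain ⟨S, hS1, hS2, hS3⟩ := key n
  set r := √(S + 1) with hr
  have hr2 : r ^ 2 = S + 1 := Real.sq_sqrt (by linarith)
  have hr0 : 0 ≤ r := Real.sqrt_nonneg _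
  set M := (A * c)⁻¹ * (1 + I + A * c + |C|) with hM
  have hM' : A * c * M = 1 + I + A * c + |C| := by rw [hM]; field_simp
  have hM0 : 0 ≤ M := by positivity
  have hrM : M ^ 2 + 2 < r ^ 2 := by rw [hr2]; linarith
  have hrM' : M < r := lt_of_pow_lt_pow_left₀ 2 hr0 (by linarith)
  have hr1 : 1 < r := by nlinarith
  have : A * c * r ^ 2 ≤ 1 + I + A * c + |C| * r := by rw [hr2]; linarith
  have h7 : A * c * r * M < A * c * r * r := mul_lt_mul_of_pos_left hrM' (by positivity)
  have h8 : (1 + I + A * c) * 1 ≤ (1 + I + A * c) * r :=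
    mul_le_mul_of_nonneg_left hr1.le (by positivity)
  have h9 : A * c * r * M = (1 + I + A * c + |C|) * r := by rw [← hM']; ring
  nlinarith

section
variable {b cp cm : ℝ}

theorem TestFn.tame {E : Type*} [NormedAddCommGroup E] [NormedSpace ℝ E] {F : ℝ × ℝ → E}
    (hF : TestFn F) : Tame F := (hF.2.toSchwartzMap hF.1).tame

theorem Hint_add (hb : 1 < b) (u : ℝ) {E : Type*} [NormedAddCommGroup E] [NormedSpace ℝ E]
    {F F' : ℝ × ℝ → E} (hF : Tame F) (hF' : Tame F') (x : ℝ × ℝ) :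
    Hint b cp cm u (fun y => F y + F' y) x = Hint b cp cm u F x + Hint b cp cm u F' x := by
  unfold Hint
  rw [← integral_add (hF.integrableOn_oddQuot hb x) (hF'.integrableOn_oddQuot hb x)]
  refine integral_congr_ae (Eventually.of_forall fun t => ?_)
  simp only [oddQuot]
  rw [← smul_add]
  congr 1; abel

theorem re_Hint (hb : 1 < b) (u : ℝ) {F : ℝ × ℝ → ℂ} (hF : Tame F) (x : ℝ × ℝ) :
    (Hint b cp cm u F x).re = Hint b cp cm u (fun y => (F y).re) x := by
  unfold Hint
  have h : ∫ t in Ioi (0:ℝ), (oddQuot b cp cm u F x t).re =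
    (∫ t in Ioi (0:ℝ), oddQuot b cp cm u F x t).re := integral_re (hF.integrableOn_oddQuot hb x)
  rw [← h]
  refine integral_congr_ae (Eventually.of_forall fun t => ?_)
  simp [oddQuot]

theorem TestFn.continuous_Hint (hb : 1 < b) (hcp : cp ≠ 0) (hcm : cm ≠ 0) (u : ℝ)
    {F : ℝ × ℝ → ℂ} (hF : TestFn F) : Continuous (Hint b cp cm u F) := by
  obtain ⟨g, hg, -, -, hGg⟩ := (hF.2.toSchwartzMap hF.1).exists_ex_repr
  replace hGg : ∀ x, F x = ∫ ζ, g ζ * ex ζ x := hGg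
  obtain ⟨C, hC, hCb⟩ := exists_norm_symb_le hb hcp hcm
  rw [show Hint b cp cm u F = _ from funext (Hint_eq_integral_symb hb hcp hcm u hF.tame hg hGg)]
  have hm : Measurable fun ζ : ℝ × ℝ => symb b cp cm (ζ.1, u * ζ.2) :=
    (stronglyMeasurable_symb hb hcp hcm).measurable.comp (by fun_prop)
  refine continuous_of_dominated (bound := fun ζ => ‖g ζ‖ * C) (fun x => ?_)
    (fun x => Eventually.of_forall fun ζ => ?_) (hg.norm.mul_const C)
    (Eventually.of_forall fun ζ => ?_)
  · exact hg.1.mul ((continuous_ex.comp (Continuous.prodMk_left x)).aestronglyMeasurable.mul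
      hm.aestronglyMeasurable)
  · rw [norm_mul, norm_mul, norm_ex, one_mul]
    exact mul_le_mul_of_nonneg_left (hCb _) (norm_nonneg _)
  · exact continuous_const.mul ((continuous_ex_right ζ).mul continuous_const)

/-- The symbol along `{±1} × (0, ∞)` near the two ends. -/
theorem exists_symb_close (hb : 1 < b) (hcp : cp ≠ 0) (hcm : cm ≠ 0) {s : ℝ} (hs : s ≠ 0)
    {η : ℝ} (hη : 0 < η) : ∃ δ > 0, δ < 1 ∧
      (∀ y, 0 < y → y ≤ δ → ‖symb b cp cm (s, y) - symb b cp cm (s, 0)‖ ≤ η) ∧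
      ∀ y, δ⁻¹ ≤ y → ‖symb b cp cm (s, y) - symb b cp cm (0, 1)‖ ≤ η := by
  have hb0 : 0 < b := by linarith
  have c1 : Tendsto (fun y : ℝ => symb b cp cm (s, y)) (𝓝 0) (𝓝 (symb b cp cm (s, 0))) :=
    (continuousAt_symb hb hcp hcm (ξ := (s, 0)) (by simp [hs])).tendsto.comp
      ((Continuous.prodMk_right s).tendsto 0)
  have c2 : Tendsto (fun y : ℝ => symb b cp cm (s, y)) atTop (𝓝 (symb b cp cm (0, 1))) := by
    have h1 : Tendsto (fun y : ℝ => (y ^ (-b⁻¹) * s, (1:ℝ))) atTop (𝓝 (0, 1)) := by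
      refine Tendsto.prodMk_nhds ?_ tendsto_const_nhds
      have := (tendsto_rpow_neg_atTop (inv_pos.2 hb0)).mul_const s
      rwa [zero_mul] at this
    refine ((continuousAt_symb hb hcp hcm (ξ := (0, 1)) (by simp)).tendsto.comp h1).congr' ?_
    filter_upwards [eventually_gt_atTop 0] with y hy
    simp only [Function.comp]
    rw [← symb_dil hb hcp hcm (Real.rpow_pos_of_pos hy (-b⁻¹)) (s, y)]
    congr 1
    simp only [dil]
    rw [← Real.rpow_mul hy.le, neg_mul, inv_mul_cancel₀ hb0.ne', Real.rpow_neg_one,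
      inv_mul_cancel₀ hy.ne']
  obtain ⟨δ1, h1, H1⟩ := Metric.eventually_nhds_iff.1 (c1.eventually (Metric.closedBall_mem_nhds _ hη))
  obtain ⟨R, H2⟩ := eventually_atTop.1 (c2.eventually (Metric.closedBall_mem_nhds _ hη))
  have hR : 0 < |R| + 2 := by positivity
  refine ⟨min (δ1 / 2) (|R| + 2)⁻¹, by positivity, ?_, fun y hy0 hy => ?_, fun y hy => ?_⟩
  · refine (min_le_right _ _).trans_lt (inv_lt_one_of_one_lt₀ ?_)
    linarith [abs_nonneg R]
  · have := H1 (y := y) (by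
      rw [dist_zero_right, Real.norm_of_nonneg hy0.le]
      linarith [hy.trans (min_le_left _ _)])
    rwa [dist_eq_norm] at this
  · have := H2 y (by
      have : (|R| + 2) ≤ (min (δ1 / 2) (|R| + 2)⁻¹)⁻¹ := by
        rw [le_inv_comm₀ hR (by positivity)]
        exact min_le_right _ _
      linarith [le_abs_self R])
    rwa [dist_eq_norm] at this

/-- A family of parameters and frequencies separating the two limits of the symbol. -/
theorem exists_separated (hb : 1 < b) (hcp : cp ≠ 0) (hcm : cm ≠ 0) {U : Set ℝ}
    (hU : U ⊆ Ioi 0) (hfr : frakN U = ⊤) : ∃ s : ℝ, s ≠ 0 ∧ ∃ α β : ℂ, α ≠ β ∧ ∀ η > 0,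
      ∃ u r : ℕ → ℝ, (∀ i, u i ∈ U) ∧
        ∀ i k, ‖symb b cp cm (s, u i * r k) - if i ≤ k then α else β‖ ≤ η := by
  obtain ⟨s, hs, hne⟩ : ∃ s : ℝ, s ≠ 0 ∧ symb b cp cm (s, 0) ≠ symb b cp cm (0, 1) := by
    by_contra! h
    exact symb_fst_ne hb hcp hcm ((h 1 one_ne_zero).trans (h (-1) (by norm_num)).symm)
  have hinf : {n : ℤ | (Icc ((2:ℝ) ^ n) ((2:ℝ) ^ (n + 1)) ∩ U).Nonempty}.Infinite := by
    rw [← Set.encard_eq_top_iff]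
    unfold frakN at hfr
    by_contra h
    exact WithTop.add_ne_top.2 ⟨ENat.one_ne_top, h⟩ hfr
  have hcase : (∀ M, ∃ u ∈ U, M ≤ u) ∨ ∀ M > 0, ∃ u ∈ U, u ≤ M := by
    by_contra! h
    obtain ⟨⟨M, hM⟩, m, hm, hm'⟩ := h
    refine hinf ?_
    obtain ⟨k, hk⟩ : ∃ k : ℕ, (2:ℝ)⁻¹ ^ k < m := exists_pow_lt_of_lt_one hm (by norm_num)
    obtain ⟨l, hl⟩ : ∃ l : ℕ, M < (2:ℝ) ^ l := pow_unbounded_of_one_lt M (by norm_num)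
    refine (Set.finite_Icc (-(k:ℤ) - 1) l).subset fun n hn => ?_
    obtain ⟨u, ⟨h1, h2⟩, hu⟩ := hn
    have h3 := hM u hu
    have h4 := hm' u hu
    have h5 : (2:ℝ) ^ n < 2 ^ (l:ℤ) := by rw [zpow_natCast]; linarith
    have h6 : (2:ℝ) ^ (-(k:ℤ)) < 2 ^ (n + 1) := by
      rw [zpow_neg, zpow_natCast, ← inv_pow]; linarith
    rw [zpow_lt_zpow_iff_right₀ (by norm_num)] at h5 h6
    constructor <;> omega
  refine ⟨s, hs, ?_⟩
  rcases hcase with h | h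
  · refine ⟨_, _, hne, fun η hη => ?_⟩
    obtain ⟨δ, hδ, hδ1, H1, H2⟩ := exists_symb_close hb hcp hcm hs hη
    choose φ hφ hφ' using h
    set u : ℕ → ℝ := fun i => Nat.rec (φ 0) (fun _ v => φ (v * (δ⁻¹ * δ⁻¹))) i with hu
    have huU : ∀ i, u i ∈ U := fun i => by cases i <;> exact hφ _
    have hu0 : ∀ i, 0 < u i := fun i => hU (huU i)
    have hstep : ∀ i, u i * (δ⁻¹ * δ⁻¹) ≤ u (i + 1) := fun i => hφ' _
    have hδi : 1 ≤ δ⁻¹ * δ⁻¹ := one_le_mul_of_one_le_of_one_le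
      ((one_le_inv₀ hδ).2 hδ1.le) ((one_le_inv₀ hδ).2 hδ1.le)
    have hmono : Monotone u := monotone_nat_of_le_succ fun i =>
      (le_mul_of_one_le_right (hu0 i).le hδi).trans (hstep i)
    refine ⟨u, fun k => δ / u k, huU, fun i k => ?_⟩
    have hk := hu0 k
    have hi := hu0 i
    split_ifs with hik
    · refine H1 _ (by positivity) ?_
      rw [mul_div_assoc', div_le_iff₀ hk, mul_comm]
      exact mul_le_mul_of_nonneg_left (hmono hik) hδ.le
    · refine H2 _ ?_
      have := (hstep k).trans (hmono (show k + 1 ≤ i by omega))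
      rw [mul_div_assoc', le_div_iff₀ hk]
      calc δ⁻¹ * u k = (u k * (δ⁻¹ * δ⁻¹)) * δ := by field_simp
        _ ≤ _ := by gcongr
  · refine ⟨_, _, hne.symm, fun η hη => ?_⟩
    obtain ⟨δ, hδ, hδ1, H1, H2⟩ := exists_symb_close hb hcp hcm hs hη
    have h' : ∀ M, ∃ u ∈ U, 0 < M → u ≤ M := fun M => by
      by_cases hM : 0 < M
      · obtain ⟨u, hu, hu'⟩ := h M hM; exact ⟨u, hu, fun _ => hu'⟩
      · obtain ⟨u, hu, -⟩ := h 1 one_pos; exact ⟨u, hu, fun h => absurd h hM⟩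
    choose φ hφ hφ' using h'
    set u : ℕ → ℝ := fun i => Nat.rec (φ 0) (fun _ v => φ (v * (δ * δ))) i with hu
    have huU : ∀ i, u i ∈ U := fun i => by cases i <;> exact hφ _
    have hu0 : ∀ i, 0 < u i := fun i => hU (huU i)
    have hstep : ∀ i, u (i + 1) ≤ u i * (δ * δ) := fun i => hφ' _ (mul_pos (hu0 i) (by positivity))
    have hδi : δ * δ ≤ 1 := mul_le_one₀ hδ1.le hδ.le hδ1.le
    have hmono : Antitone u := antitone_nat_of_succ_le fun i =>
      (hstep i).trans (mul_le_of_le_one_right (hu0 i).le hδi)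
    refine ⟨u, fun k => δ⁻¹ / u k, huU, fun i k => ?_⟩
    have hk := hu0 k
    have hi := hu0 i
    split_ifs with hik
    · refine H2 _ ?_
      rw [mul_div_assoc', le_div_iff₀ hk, mul_comm]
      exact mul_le_mul_of_nonneg_right (hmono hik) (by positivity)
    · refine H1 _ (by positivity) ?_
      have := (hmono (show k + 1 ≤ i by omega)).trans (hstep k)
      rw [mul_div_assoc', div_le_iff₀ hk]
      calc u i * δ⁻¹ ≤ (u k * (δ * δ)) * δ⁻¹ := by gcongr
        _ = _ := by field_simp

end

section
variable {b cp cm : ℝ}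

theorem lintegral_mul_finset_sup_le {p : ℝ} (hb : 1 < b) (hp1 : 1 < p)
    {U : Set ℝ} {C : ℝ} (hC : ∀ f : SchwartzMap (ℝ × ℝ) ℝ,
      lpN (calH b cp cm U ⇑f) p ≤ ENNReal.ofReal C * eLpNorm ⇑f (eN p) volume)
    {g : ℝ × ℝ → ℝ} (hg : Continuous g) {u : ℕ → ℝ} (hu : ∀ i, u i ∈ U)
    (f : SchwartzMap (ℝ × ℝ) ℝ) (hf : ∀ i, Continuous (Hint b cp cm (u i) f)) (s : Finset ℕ) :
    ∫⁻ x, ENNReal.ofReal (g x) * s.sup (fun i => ENNReal.ofReal |Hint b cp cm (u i) f x|) ≤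
      (∫⁻ x, ENNReal.ofReal (g x) ^ (p / (p - 1))) ^ (1 / (p / (p - 1))) *
        (ENNReal.ofReal C * eLpNorm ⇑f (eN p) volume) := by
  have hq : (p / (p - 1)).HolderConjugate p := (Real.HolderConjugate.conjExponent hp1).symm
  refine (ENNReal.lintegral_mul_le_Lp_mul_Lq volume hq
    hg.measurable.ennreal_ofReal.aemeasurable ?_).trans ?_
  · have : Continuous fun x => s.sup (fun i => ENNReal.ofReal |Hint b cp cm (u i) f x|) :=
      Continuous.finset_sup_apply fun i _ => ENNReal.continuous_ofReal.comp (hf i).abs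
    exact this.measurable.aemeasurable
  · refine mul_le_mul_right ((ENNReal.rpow_le_rpow (lintegral_mono fun x => ?_)
      (by positivity)).trans (hC f)) _
    refine ENNReal.rpow_le_rpow (Finset.sup_le fun i _ => ?_) (by linarith)
    rw [← f.tame.Hu_eq hb]
    exact le_iSup (fun v : U => ENNReal.ofReal |Hu b cp cm (v : ℝ) f x|) ⟨u i, hu i⟩

theorem eLpNorm_le_of_support {f : ℝ × ℝ → ℝ} {p : ℝ} (hp1 : 1 < p) (hp2 : p ≤ 2)
    (hf : MemLp f 2 volume) {S : Set (ℝ × ℝ)} (hS : Function.support f ⊆ S) :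
    eLpNorm f (eN p) volume ≤
      ENNReal.ofReal √(∫ x, f x ^ 2) * volume S ^ (1 / p - 1 / 2) := by
  have h := eLpNorm_le_eLpNorm_mul_rpow_measure_univ (μ := volume.restrict S) (p := eN p) (q := 2)
    (by simpa [eN] using ENNReal.ofReal_le_ofReal hp2) hf.1.restrict
  rw [eLpNorm_restrict_eq_of_support_subset hS, eLpNorm_restrict_eq_of_support_subset hS,
    Measure.restrict_apply_univ, hf.eLpNorm_eq_integral_rpow_norm (by simp) (by simp)] at h
  have e : (∫ x, ‖f x‖ ^ (2:ℝ≥0∞).toReal) ^ ((2:ℝ≥0∞).toReal)⁻¹ = √(∫ x, f x ^ 2) := by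
    simp [Real.sqrt_eq_rpow]
  rw [e] at h
  simpa [eN, ENNReal.toReal_ofReal (by linarith : 0 ≤ p)] using h

/-- Necessity of finitely many dyadic scales. -/
theorem frakN_ne_top_of_bound {p : ℝ} (hb : 1 < b) (hcp : cp ≠ 0) (hcm : cm ≠ 0) (hp1 : 1 < p)
    (hp2 : p ≤ 2) {U : Set ℝ} (hU : U ⊆ Ioi 0) {C : ℝ} (hC : ∀ f : SchwartzMap (ℝ × ℝ) ℝ,
      lpN (calH b cp cm U ⇑f) p ≤ ENNReal.ofReal C * eLpNorm ⇑f (eN p) volume) :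
    frakN U ≠ ⊤ := by
  intro hfr
  obtain ⟨s, hs, α, β, hαβ, hsep⟩ := exists_separated hb hcp hcm hU hfr
  choose u r hu hur using fun n : ℕ => hsep ((n:ℝ) ^ 2 + 1)⁻¹ (by positivity)
  let B : ContDiffBump (0 : ℝ × ℝ) := default
  have hBt : TestFn (B : ℝ × ℝ → ℝ) := ⟨B.contDiff, B.hasCompactSupport⟩
  have hBc : Continuous (B : ℝ × ℝ → ℝ) := B.continuous
  have hBi : 0 < ∫ x, B x ^ 2 := by
    refine Continuous.integral_pos_of_hasCompactSupport_nonneg_nonzero (x := 0) (hBc.pow 2) ?_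
      (fun x => sq_nonneg _) ?_
    · exact B.hasCompactSupport.comp_left (g := fun t : ℝ => t ^ 2) (by simp)
    · rw [B.one_of_mem_closedBall (by simp [B.rIn_pos.le])]; simp
  have hsupp : Function.support (B : ℝ × ℝ → ℝ) ⊆ tsupport (B : ℝ × ℝ → ℝ) := subset_tsupport _
  have hvol : volume (tsupport (B : ℝ × ℝ → ℝ)) < ⊤ := B.hasCompactSupport.isCompact.measure_lt_top
  set Q : ℝ≥0∞ := (∫⁻ x, ENNReal.ofReal (B x) ^ (p / (p - 1))) ^ (1 / (p / (p - 1))) with hQ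
  have hq0 : 0 < p / (p - 1) := div_pos (by linarith) (by linarith)
  have hQt : Q < ⊤ := by
    refine ENNReal.rpow_lt_top_of_nonneg (by positivity) (ne_of_lt ?_)
    refine lt_of_le_of_lt (lintegral_mono (g := (tsupport (B : ℝ × ℝ → ℝ)).indicator 1)
      fun x => ?_) (by rwa [lintegral_indicator_one (isClosed_tsupport _).measurableSet])
    by_cases hx : x ∈ tsupport (B : ℝ × ℝ → ℝ)
    · rw [indicator_of_mem hx]
      refine ENNReal.rpow_le_one ?_ hq0.le
      exact ENNReal.ofReal_le_one.2 B.le_one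
    · rw [image_eq_zero_of_notMem_tsupport hx]; simp [hq0]
  set W : ℝ≥0∞ := Q * (ENNReal.ofReal C * volume (tsupport (B : ℝ × ℝ → ℝ)) ^ (1 / p - 1 / 2))
  have hp0 : 0 ≤ 1 / p - 1 / 2 :=
    sub_nonneg.2 (one_div_le_one_div_of_le (by linarith) hp2)
  have hWt : W ≠ ⊤ := ENNReal.mul_ne_top hQt.ne (ENNReal.mul_ne_top ENNReal.ofReal_ne_top
    (ENNReal.rpow_ne_top_of_nonneg hp0 hvol.ne))
  refine not_forall_maximal_bound (T := fun n i => Hint b cp cm (u n i))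
    (e := fun n k m => dil b (2 ^ m) (s, r n k)) hαβ
    (fun n i F F' hF hF' x => Hint_add hb _ hF.tame hF'.tame x)
    (fun n i F hF => hF.continuous_Hint hb hcp hcm _) (fun n k => ?_) ?_ hBt
    (fun x => B.nonneg) (fun x => B.le_one) hBi W.toReal ?_
  · simp only [dil, abs_mul]
    refine Tendsto.atTop_mul_const (abs_pos.2 hs) ?_
    refine tendsto_abs_atTop_atTop.comp (tendsto_pow_atTop_atTop_of_one_lt one_lt_two)
  · intro n k _ G hG ε hε
    have hall : ∀ᶠ m : ℕ in atTop, ∀ i ∈ Finset.range (2 ^ n), ∀ x,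
        ‖Hint b cp cm (u n i) (fun y => G y * ex (dil b (2 ^ m) (s, r n k)) y) x -
          symb b cp cm (s, u n i * r n k) * (G x * ex (dil b (2 ^ m) (s, r n k)) x)‖ ≤ ε := by
      rw [Filter.eventually_all_finset]
      intro i _
      exact eventually_norm_Hint_sub_le hb hcp hcm (u n i) hG.1 hG.2 (ξ := (s, r n k))
        (by simp [hs]) hε
    filter_upwards [hall] with m hm i hi x
    have h1 := hm i (Finset.mem_range.2 hi) x
    have h2 : ‖(symb b cp cm (s, u n i * r n k) - if i ≤ k then α else β) *
        (G x * ex (dil b (2 ^ m) (s, r n k)) x)‖ ≤ ((n:ℝ) ^ 2 + 1)⁻¹ * ‖G x‖ := by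
      rw [norm_mul, norm_mul, norm_ex, mul_one]
      exact mul_le_mul_of_nonneg_right (hur n i k) (norm_nonneg _)
    have h3 := (norm_add_le _ _).trans (add_le_add h1 h2)
    rw [sub_mul, sub_add_sub_cancel] at h3
    linarith
  · intro n F D hF hF0 hDc hD0 hDs
    have hFt : TestFn F := hBt.mk_of_zero hF hF0
    have hRe : TestFn fun x => (F x).re :=
      hBt.mk_of_zero (Complex.reCLM.contDiff.comp hF) fun x hx => by simp [hF0 x hx]
    let f : SchwartzMap (ℝ × ℝ) ℝ := hRe.2.toSchwartzMap hRe.1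
    have hfF : ⇑f = fun x => (F x).re := rfl
    have hre : ∀ i x, (Hint b cp cm (u n i) F x).re = Hint b cp cm (u n i) f x := fun i x =>
      re_Hint hb _ hFt.tame x
    have hfc : ∀ i, Continuous (Hint b cp cm (u n i) f) := fun i => by
      rw [← funext (hre i)]
      exact Complex.continuous_re.comp (hFt.continuous_Hint hb hcp hcm _)
    have h2 : eLpNorm ⇑f (eN p) volume ≤ ENNReal.ofReal √(∫ x, (F x).re ^ 2) *
        volume (tsupport (B : ℝ × ℝ → ℝ)) ^ (1 / p - 1 / 2) := by
      refine eLpNorm_le_of_support hp1 hp2 (f.memLp 2) fun x hx => hsupp fun h0 => hx ?_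
      simp [hfF, hF0 x h0]
    have h1 := lintegral_mul_finset_sup_le hb hp1 hC hBc (hu n) f hfc (Finset.range (2 ^ n))
    have h3 : ∫⁻ x, ENNReal.ofReal
        ‖∑ i ∈ Finset.range (2 ^ n), D i x * (Hint b cp cm (u n i) F x).re‖ ≤
        W * ENNReal.ofReal √(∫ x, (F x).re ^ 2) := by
      refine ((lintegral_mono fun x => ?_).trans h1).trans
        ((mul_le_mul_right (mul_le_mul_right h2 _) _).trans (le_of_eq (by simp only [W]; ring)))
      rw [← hDs x, ENNReal.ofReal_sum_of_nonneg (fun i _ => hD0 i x), Finset.sum_mul]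
      refine (ENNReal.ofReal_le_ofReal (norm_sum_le _ _)).trans ?_
      rw [ENNReal.ofReal_sum_of_nonneg (fun i _ => norm_nonneg _)]
      refine Finset.sum_le_sum fun i hi => ?_
      rw [norm_mul, Real.norm_of_nonneg (hD0 i x), ENNReal.ofReal_mul (hD0 i x), hre, Real.norm_eq_abs]
      exact mul_le_mul_right
        (Finset.le_sup (f := fun i => ENNReal.ofReal |Hint b cp cm (u n i) f x|) hi) _
    refine (Real.le_norm_self _).trans ((norm_integral_le_lintegral_norm _).trans ?_)
    refine (ENNReal.toReal_mono (ENNReal.mul_ne_top hWt ENNReal.ofReal_ne_top) h3).trans (le_of_eq ?_)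
    rw [ENNReal.toReal_mul, ENNReal.toReal_ofReal (Real.sqrt_nonneg _)]

end

/-- Convolution with a kernel on the plane. -/
def cv {E : Type*} [NormedAddCommGroup E] [NormedSpace ℝ E] (k : ℝ × ℝ → ℝ) (f : ℝ × ℝ → E)
    (x : ℝ × ℝ) : E := ∫ y, k (x - y) • f y

/-- Fourier transform of a real kernel. -/
def ft (k : ℝ × ℝ → ℝ) (ζ : ℝ × ℝ) : ℂ := ∫ y, (k y : ℂ) * ex (-ζ) y

theorem ex_neg_left (ζ x : ℝ × ℝ) : ex (-ζ) x = (starRingEnd ℂ) (ex ζ x) := by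
  unfold ex
  rw [← Complex.exp_conj, map_mul, Complex.conj_I, Complex.conj_ofReal]
  congr 1
  simp only [Prod.fst_neg, Prod.snd_neg]
  push_cast; ring

theorem ex_sub_right (ζ x y : ℝ × ℝ) : ex ζ (x - y) = ex ζ x * ex (-ζ) y := by
  rw [sub_eq_add_neg, ex_add_right]
  congr 1
  simp [ex]

theorem integrable_mul_ex_prod {m H : ℝ × ℝ → ℂ} (hm : Integrable m) (hH : Integrable H) :
    Integrable (fun p : (ℝ × ℝ) × (ℝ × ℝ) => H p.1 * m p.2 * ex p.2 p.1) (volume.prod volume) := by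
  refine (hH.mul_prod hm).mul_bdd (c := 1) ?_ (Eventually.of_forall fun p => (norm_ex _ _).le)
  exact (continuous_ex.comp (by fun_prop : Continuous fun p : (ℝ × ℝ) × (ℝ × ℝ) =>
    (p.2, p.1))).aestronglyMeasurable

/-- Parseval's identity for a Fourier pair. -/
theorem integral_norm_sq_eq_of_fourier_pair {H m : ℝ × ℝ → ℂ} (hH : Integrable H)
    (hm : Integrable m) {c : ℝ} (h1 : ∀ x, H x = ∫ ζ, m ζ * ex ζ x)
    (h2 : ∀ ζ, ∫ x, H x * ex (-ζ) x = (c : ℂ) * m ζ) :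
    ∫ x, ‖H x‖ ^ 2 = c * ∫ ζ, ‖m ζ‖ ^ 2 := by
  have hms : Integrable fun ζ => (starRingEnd ℂ) (m ζ) :=
    (Complex.conjCLE.toContinuousLinearMap.integrable_comp hm)
  have hI : Integrable (fun p : (ℝ × ℝ) × (ℝ × ℝ) => H p.1 * (starRingEnd ℂ) (m p.2) * ex (-p.2) p.1)
      (volume.prod volume) := by
    refine (hH.mul_prod hms).mul_bdd (c := 1) ?_ (Eventually.of_forall fun p => (norm_ex _ _).le)
    exact (continuous_ex.comp (by fun_prop : Continuous fun p : (ℝ × ℝ) × (ℝ × ℝ) =>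
      (-p.2, p.1))).aestronglyMeasurable
  have e1 : ∀ x, ((‖H x‖ ^ 2 : ℝ) : ℂ) = ∫ ζ, H x * (starRingEnd ℂ) (m ζ) * ex (-ζ) x := by
    intro x
    simp only [mul_assoc]
    rw [integral_const_mul]
    have : ∫ ζ, (starRingEnd ℂ) (m ζ) * ex (-ζ) x = (starRingEnd ℂ) (H x) := by
      rw [h1 x, ← integral_conj]
      simp only [map_mul, ex_neg_left]
    rw [this, Complex.mul_conj, Complex.normSq_eq_norm_sq]
  have e2 : ∀ ζ, ∫ x, H x * (starRingEnd ℂ) (m ζ) * ex (-ζ) x = ((c * ‖m ζ‖ ^ 2 : ℝ) : ℂ) := by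
    intro ζ
    have : ∀ x, H x * (starRingEnd ℂ) (m ζ) * ex (-ζ) x =
      (starRingEnd ℂ) (m ζ) * (H x * ex (-ζ) x) := fun x => by ring
    simp only [this]
    rw [integral_const_mul, h2, ← Complex.normSq_eq_norm_sq, Complex.ofReal_mul, ← Complex.mul_conj]
    ring
  have h := integral_integral_swap (f := fun x ζ => H x * (starRingEnd ℂ) (m ζ) * ex (-ζ) x) hI
  simp only [← e1, e2] at h
  rw [integral_complex_ofReal, integral_complex_ofReal] at h
  rw [Complex.ofReal_injective h, integral_const_mul]

theorem norm_ft_le (k : ℝ × ℝ → ℝ) (ζ : ℝ × ℝ) : ‖ft k ζ‖ ≤ ∫ y, |k y| := by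
  refine (norm_integral_le_integral_norm _).trans (le_of_eq ?_)
  simp [norm_ex]

theorem continuous_ft {k : ℝ × ℝ → ℝ} (hk : Integrable k) : Continuous (ft k) := by
  refine continuous_of_dominated (bound := fun y => ‖k y‖) (fun ζ => ?_)
    (fun ζ => Eventually.of_forall fun y => ?_) hk.norm (Eventually.of_forall fun y => ?_)
  · exact hk.ofReal.1.mul (continuous_ex_right _).aestronglyMeasurable
  · rw [norm_mul, norm_ex]; simp
  · exact continuous_const.mul (continuous_ex.comp (by fun_prop : Continuous fun ζ : ℝ × ℝ => (-ζ, y)))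

theorem integrable_cv_prod {k : ℝ × ℝ → ℝ} {F : ℝ × ℝ → ℂ} (hk : Integrable k)
    (hF : Integrable F) : Integrable (fun p : (ℝ × ℝ) × (ℝ × ℝ) => k (p.1 - p.2) • F p.2)
      (volume.prod volume) := by
  have := hF.convolution_integrand (ContinuousLinearMap.lsmul ℝ ℝ).flip hk
  simpa using this

theorem cv_eq_integral_ft {k : ℝ × ℝ → ℝ} (hk : Integrable k) {F g : ℝ × ℝ → ℂ}
    (hg : Integrable g) (h : ∀ x, F x = ∫ ζ, g ζ * ex ζ x) (x : ℝ × ℝ) :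
    cv k F x = ∫ ζ, (g ζ * ft k ζ) * ex ζ x := by
  have hkx : Integrable fun y => k (x - y) := hk.comp_sub_left x
  have hI := integrable_mul_ex_prod hg (hkx.ofReal (𝕜 := ℂ))
  unfold cv
  have e1 : ∀ y, k (x - y) • F y = ∫ ζ, ((k (x - y) : ℝ) : ℂ) * g ζ * ex ζ y := by
    intro y
    simp only [mul_assoc]
    rw [integral_const_mul, ← h, Complex.real_smul]
  simp only [e1]
  rw [integral_integral_swap hI]
  refine integral_congr_ae (Eventually.of_forall fun ζ => ?_)
  simp only
  rw [← integral_sub_left_eq_self _ _ x, ft, ← integral_const_mul, ← integral_mul_const]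
  refine integral_congr_ae (Eventually.of_forall fun y => ?_)
  simp only [sub_sub_cancel, ex_sub_right]
  ring

theorem integral_cv_mul_ex {k : ℝ × ℝ → ℝ} (hk : Integrable k) {F : ℝ × ℝ → ℂ}
    (hF : Integrable F) (ζ : ℝ × ℝ) :
    ∫ x, cv k F x * ex (-ζ) x = ft k ζ * ∫ x, F x * ex (-ζ) x := by
  have hI : Integrable (fun p : (ℝ × ℝ) × (ℝ × ℝ) => k (p.1 - p.2) • F p.2 * ex (-ζ) p.1)
      (volume.prod volume) :=
    (integrable_cv_prod hk hF).mul_bdd (c := 1)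
      ((continuous_ex_right _).comp continuous_fst).aestronglyMeasurable
      (Eventually.of_forall fun p => (norm_ex _ _).le)
  simp only [cv, ← integral_mul_const]
  rw [integral_integral_swap hI, ← integral_const_mul]
  refine integral_congr_ae (Eventually.of_forall fun y => ?_)
  simp only
  rw [← integral_add_right_eq_self _ y, ft, ← integral_mul_const]
  refine integral_congr_ae (Eventually.of_forall fun x => ?_)
  simp only [add_sub_cancel_right, ex_add_right, Complex.real_smul]
  ring

theorem SchwartzMap.integral_norm_cv_sq_le {k : ℝ × ℝ → ℝ} (hk : Integrable k) {A : ℝ}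
    (hA : ∀ ζ, ‖ft k ζ‖ ≤ A) (F : SchwartzMap (ℝ × ℝ) ℂ) :
    ∫ x, ‖cv k F x‖ ^ 2 ≤ A ^ 2 * ∫ x, ‖F x‖ ^ 2 := by
  obtain ⟨g, hg, hgc, hg1, hg2⟩ := F.exists_ex_repr
  have hA0 : 0 ≤ A := (norm_nonneg _).trans (hA 0)
  have hF : Integrable F := F.integrable
  have hgk : Integrable fun ζ => g ζ * ft k ζ :=
    hg.mul_bdd (c := A) (continuous_ft hk).aestronglyMeasurable (Eventually.of_forall hA)
  have hcv : Integrable (cv k F) := (integrable_cv_prod hk hF).integral_prod_left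
  have h1 := integral_norm_sq_eq_of_fourier_pair hF hg (c := (2 * Real.pi) ^ 2) hg2 hg1
  have h2 := integral_norm_sq_eq_of_fourier_pair hcv hgk (c := (2 * Real.pi) ^ 2)
    (cv_eq_integral_ft hk hg hg2) (fun ζ => by
      rw [integral_cv_mul_ex hk hF, hg1]; ring)
  rw [h1, h2, mul_left_comm (A ^ 2)]
  refine mul_le_mul_of_nonneg_left ?_ (by positivity)
  rw [← integral_const_mul]
  have hgb : ∀ ζ, ‖g ζ‖ ≤ ((2 * Real.pi) ^ 2)⁻¹ * ∫ x, ‖F x‖ := by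
    intro ζ
    have h3 : ‖((2 * Real.pi) ^ 2 : ℝ) * g ζ‖ ≤ ∫ x, ‖F x‖ := by
      rw [← hg1]
      refine (norm_integral_le_integral_norm _).trans (le_of_eq ?_)
      simp [norm_ex]
    rw [norm_mul, Complex.norm_real, Real.norm_of_nonneg (by positivity)] at h3
    rw [inv_mul_eq_div, le_div_iff₀' (by positivity)]
    exact h3
  refine integral_mono_of_nonneg (Eventually.of_forall fun ζ => by positivity) ?_
    (Eventually.of_forall fun ζ => ?_)
  · have : Integrable fun ζ => ‖g ζ‖ * ‖g ζ‖ := hg.norm.mul_bdd hg.norm.1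
      (Eventually.of_forall fun ζ => by rw [norm_norm]; exact hgb ζ)
    exact (this.congr (Eventually.of_forall fun ζ => by simp [sq])).const_mul _
  · simp only
    rw [norm_mul, mul_pow, mul_comm]
    gcongr
    exact hA ζ

theorem SchwartzMap.lintegral_cv_sq_le {k : ℝ × ℝ → ℝ} (hk : Integrable k) {A : ℝ}
    (hA : ∀ ζ, ‖ft k ζ‖ ≤ A) (f : SchwartzMap (ℝ × ℝ) ℝ) :
    ∫⁻ x, ‖cv k f x‖ₑ ^ 2 ≤ ENNReal.ofReal A ^ 2 * ∫⁻ x, ‖f x‖ₑ ^ 2 := by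
  have hA0 : 0 ≤ A := (norm_nonneg _).trans (hA 0)
  set F : SchwartzMap (ℝ × ℝ) ℂ := f.postcompCLM Complex.ofRealCLM with hF
  have hFf : ∀ x, F x = (f x : ℂ) := fun x => rfl
  have hcv : ∀ x, cv k F x = ((cv k ⇑f x : ℝ) : ℂ) := by
    intro x
    unfold cv
    rw [← integral_complex_ofReal]
    simp [hFf]
  have h := F.integral_norm_cv_sq_le hk hA
  simp only [hcv, hFf, Complex.norm_real] at h
  have hb : ∃ B, ∀ x, ‖cv k f x‖ ≤ B := by
    obtain ⟨g, hg, hgc, hg1, hg2⟩ := F.exists_ex_repr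
    refine ⟨(∫ ζ, ‖g ζ‖) * A, fun x => ?_⟩
    have := cv_eq_integral_ft hk hg hg2 x
    rw [← Complex.norm_real, ← hcv, this, ← integral_mul_const]
    refine (norm_integral_le_integral_norm _).trans (integral_mono_of_nonneg
      (Eventually.of_forall fun _ => norm_nonneg _) (hg.norm.mul_const A)
      (Eventually.of_forall fun ζ => ?_))
    simp only [norm_mul, norm_ex, mul_one]
    gcongr
    exact hA ζ
  have hcvi : Integrable (cv k f) := by
    have : Integrable (cv k F) := (integrable_cv_prod hk F.integrable).integral_prod_left
    rw [funext hcv] at this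
    exact (integrable_norm_iff (by
      exact (Complex.continuous_re.comp_aestronglyMeasurable this.1).congr
        (Eventually.of_forall fun x => Complex.ofReal_re _))).1
      (this.norm.congr (Eventually.of_forall fun x => Complex.norm_real _))
  have hi1 : Integrable fun x => ‖cv k f x‖ ^ 2 := by
    obtain ⟨B, hB⟩ := hb
    have : Integrable fun x => ‖cv k f x‖ * ‖cv k f x‖ := hcvi.norm.mul_bdd hcvi.norm.1
      (Eventually.of_forall fun x => by rw [norm_norm]; exact hB x)
    exact this.congr (Eventually.of_forall fun ζ => by simp [sq])
  have hi2 : Integrable fun x => ‖f x‖ ^ 2 := (f.memLp 2).integrable_norm_pow (by norm_num)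
  have hof := ENNReal.ofReal_le_ofReal h
  rw [ENNReal.ofReal_mul (by positivity), ofReal_integral_eq_lintegral_ofReal hi1
    (Eventually.of_forall fun x => by positivity), ofReal_integral_eq_lintegral_ofReal hi2
    (Eventually.of_forall fun x => by positivity), ENNReal.ofReal_pow hA0] at hof
  simpa only [ENNReal.ofReal_pow (norm_nonneg _), ofReal_norm] using hof

/-- The `L²` bound for convolution with a kernel. -/
theorem lintegral_cv_sq_le {k : ℝ × ℝ → ℝ} (hk : Continuous k) (hkc : HasCompactSupport k) {A : ℝ}
    (hA : ∀ ζ, ‖ft k ζ‖ ≤ A) {f : ℝ × ℝ → ℝ} (hf : MemLp f 2) :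
    ∫⁻ x, ‖cv k f x‖ₑ ^ 2 ≤ ENNReal.ofReal A ^ 2 * ∫⁻ x, ‖f x‖ₑ ^ 2 := by
  have hki : Integrable k := hk.integrable_of_hasCompactSupport hkc
  have hk2 : MemLp k 2 := hk.memLp_of_hasCompactSupport hkc
  have happ : ∀ n : ℕ, ∃ g : SchwartzMap (ℝ × ℝ) ℝ,
      eLpNorm (f - ⇑g) 2 volume ≤ ENNReal.ofReal (1 / ((n:ℝ) + 1)) := by
    intro n
    obtain ⟨g, h1, h2, h3⟩ := hf.exist_eLpNorm_sub_le (by simp) (by simp)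
      (ε := 1 / ((n:ℝ) + 1)) (by positivity)
    exact ⟨h1.toSchwartzMap h2, h3⟩
  choose g hg using happ
  have h0 : Tendsto (fun n => eLpNorm (f - ⇑(g n)) 2 volume) atTop (𝓝 0) := by
    refine tendsto_of_tendsto_of_tendsto_of_le_of_le tendsto_const_nhds ?_ (fun n => zero_le)
      hg
    rw [← ENNReal.ofReal_zero]
    exact ENNReal.tendsto_ofReal tendsto_one_div_add_atTop_nhds_zero_nat
  have hkx : ∀ x, MemLp (fun y => k (x - y)) 2 := fun x =>
    hk2.comp_measurePreserving (Measure.measurePreserving_sub_left volume x)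
  have hig : ∀ x (h : ℝ × ℝ → ℝ), MemLp h 2 → Integrable fun y => k (x - y) • h y :=
    fun x h hh => (hkx x).integrable_mul hh
  have hpt : ∀ x, Tendsto (fun n => cv k (g n) x) atTop (𝓝 (cv k f x)) := by
    intro x
    rw [tendsto_iff_edist_tendsto_0]
    have hb : ∀ n, edist (cv k (g n) x) (cv k f x) ≤
        eLpNorm (fun y => k (x - y)) 2 volume * eLpNorm (f - ⇑(g n)) 2 volume := by
      intro n
      rw [edist_comm, edist_eq_enorm_sub]
      unfold cv
      rw [← integral_sub (hig x _ hf) (hig x _ ((g n).memLp 2))]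
      refine (enorm_integral_le_lintegral_enorm _).trans ?_
      have := eLpNorm_smul_le_mul_eLpNorm (p := 2) (q := 2) (r := 1) (hf.sub ((g n).memLp 2)).1
        (hkx x).1
      rw [eLpNorm_one_eq_lintegral_enorm] at this
      refine le_trans (le_of_eq (lintegral_congr fun y => ?_)) this
      simp [mul_sub]
    refine tendsto_of_tendsto_of_tendsto_of_le_of_le tendsto_const_nhds ?_ (fun n => zero_le) hb
    have := ENNReal.Tendsto.const_mul (a := eLpNorm (fun y => k (x - y)) 2 volume) h0
      (Or.inr (hkx x).2.ne)
    simpa using this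
  have hcont : ∀ n, Measurable (cv k (g n)) := by
    intro n
    have : StronglyMeasurable fun p : (ℝ × ℝ) × (ℝ × ℝ) => k (p.1 - p.2) • (g n) p.2 :=
      (Continuous.smul (hk.comp (by fun_prop)) ((g n).continuous.comp (by fun_prop))).stronglyMeasurable
    exact (this.integral_prod_right (ν := volume)).measurable
  have e : ∀ h : ℝ × ℝ → ℝ, ∫⁻ x, ‖h x‖ₑ ^ 2 = eLpNorm h 2 volume ^ 2 := by
    intro h
    have := eLpNorm_nnreal_pow_eq_lintegral (f := h) (μ := volume) (p := 2) (by simp)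
    simpa using this.symm
  have hlim : Tendsto (fun n => ENNReal.ofReal A ^ 2 *
      (eLpNorm f 2 volume + eLpNorm (f - ⇑(g n)) 2 volume) ^ 2) atTop
      (𝓝 (ENNReal.ofReal A ^ 2 * (eLpNorm f 2 volume + 0) ^ 2)) :=
    ENNReal.Tendsto.const_mul (ENNReal.Tendsto.pow (tendsto_const_nhds.add h0))
      (Or.inr (by simp))
  calc _ = ∫⁻ x, liminf (fun n => ‖cv k (g n) x‖ₑ ^ 2) atTop := by
        refine lintegral_congr fun x => ?_
        exact (ENNReal.Tendsto.pow (hpt x).enorm).liminf_eq.symm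
    _ ≤ liminf (fun n => ∫⁻ x, ‖cv k (g n) x‖ₑ ^ 2) atTop :=
        lintegral_liminf_le fun n => (hcont n).enorm.pow_const _
    _ ≤ liminf (fun n => ENNReal.ofReal A ^ 2 *
        (eLpNorm f 2 volume + eLpNorm (f - ⇑(g n)) 2 volume) ^ 2) atTop := by
        refine liminf_le_liminf (Eventually.of_forall fun n =>
          ((g n).lintegral_cv_sq_le hki hA).trans ?_)
        rw [e]
        gcongr
        calc eLpNorm (g n) 2 volume = eLpNorm (f - (f - ⇑(g n))) 2 volume := by simp
          _ ≤ _ := eLpNorm_sub_le hf.1 (hf.sub ((g n).memLp 2)).1 (by norm_num)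
    _ = _ := by rw [hlim.liminf_eq, add_zero, e]

theorem floor_div_zpow_eq {x y : ℝ} {j k : ℤ} (hjk : j ≤ k) (h : ⌊x / 2 ^ j⌋ = ⌊y / 2 ^ j⌋) :
    ⌊x / 2 ^ k⌋ = ⌊y / 2 ^ k⌋ := by
  obtain ⟨n, rfl⟩ := Int.le.dest hjk
  have key : ∀ z : ℝ, ⌊z / 2 ^ (j + n)⌋ = ⌊z / 2 ^ j⌋ / ((2 ^ n : ℕ) : ℤ) := by
    intro z
    rw [← Int.floor_div_natCast, zpow_add₀ two_ne_zero, zpow_natCast, ← div_div]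
    push_cast; rfl
  rw [key, key, h]

/-- The exponent of the second side of an anisotropic dyadic rectangle. -/
def ysc (b : ℝ) (j : ℤ) : ℤ := ⌊b * j⌋

/-- Anisotropic dyadic rectangles. -/
def cell (b : ℝ) (q : ℤ × ℤ × ℤ) : Set (ℝ × ℝ) :=
  {x | ⌊x.1 / 2 ^ q.1⌋ = q.2.1 ∧ ⌊x.2 / 2 ^ ysc b q.1⌋ = q.2.2}

/-- The index of the dyadic rectangle of a given scale containing a point. -/
def idx (b : ℝ) (j : ℤ) (x : ℝ × ℝ) : ℤ × ℤ × ℤ := (j, ⌊x.1 / 2 ^ j⌋, ⌊x.2 / 2 ^ ysc b j⌋)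

/-- The lower left corner of a dyadic rectangle. -/
def corner (b : ℝ) (q : ℤ × ℤ × ℤ) : ℝ × ℝ := (q.2.1 * 2 ^ q.1, q.2.2 * 2 ^ ysc b q.1)

section
variable {b : ℝ}

theorem mem_cell_iff {q : ℤ × ℤ × ℤ} {x : ℝ × ℝ} : x ∈ cell b q ↔ idx b q.1 x = q := by
  simp [cell, idx, Prod.ext_iff]

theorem cell_eq_prod (q : ℤ × ℤ × ℤ) : cell b q =
    Ico (corner b q).1 ((corner b q).1 + 2 ^ q.1) ×ˢ
      Ico (corner b q).2 ((corner b q).2 + 2 ^ ysc b q.1) := by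
  have key : ∀ (z : ℝ) (j m : ℤ), ⌊z / 2 ^ j⌋ = m ↔ z ∈ Ico ((m:ℝ) * 2 ^ j) (m * 2 ^ j + 2 ^ j) := by
    intro z j m
    have h : (0:ℝ) < 2 ^ j := by positivity
    rw [Int.floor_eq_iff, le_div_iff₀ h, div_lt_iff₀ h, mem_Ico, add_mul, one_mul]
  ext x
  simp only [cell, Set.mem_ofPred_eq, key, mem_prod, corner]

theorem corner_mem_cell (q : ℤ × ℤ × ℤ) : corner b q ∈ cell b q := by
  rw [cell_eq_prod]
  refine ⟨left_mem_Ico.2 ?_, left_mem_Ico.2 ?_⟩ <;> linarith [zpow_pos (two_pos (α := ℝ)) q.1,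
    zpow_pos (two_pos (α := ℝ)) (ysc b q.1)]

theorem measurableSet_cell (q : ℤ × ℤ × ℤ) : MeasurableSet (cell b q) := by
  rw [cell_eq_prod]
  exact measurableSet_Ico.prod measurableSet_Ico

theorem volume_cell (q : ℤ × ℤ × ℤ) :
    volume (cell b q) = ENNReal.ofReal (2 ^ q.1 * 2 ^ ysc b q.1) := by
  rw [cell_eq_prod, Measure.volume_eq_prod, Measure.prod_prod, Real.volume_Ico, Real.volume_Ico,
    add_sub_cancel_left, add_sub_cancel_left, ENNReal.ofReal_mul (by positivity)]

theorem abs_sub_corner_le {q : ℤ × ℤ × ℤ} {x : ℝ × ℝ} (hx : x ∈ cell b q) :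
    |x.1 - (corner b q).1| ≤ 2 ^ q.1 ∧ |x.2 - (corner b q).2| ≤ 2 ^ ysc b q.1 := by
  rw [cell_eq_prod] at hx
  obtain ⟨⟨h1, h2⟩, h3, h4⟩ := hx
  constructor <;> rw [abs_of_nonneg] <;> linarith

theorem ysc_mono (hb : 1 < b) : Monotone (ysc b) := fun i j h =>
  Int.floor_le_floor (mul_le_mul_of_nonneg_left (by exact_mod_cast h) (by linarith))

theorem ysc_succ_le (j : ℤ) : ysc b (j + 1) ≤ ysc b j + (⌊b⌋ + 1) := by
  unfold ysc
  push_cast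
  rw [mul_add, mul_one]
  linarith [Int.le_floor_add_floor (b * j) b]

theorem idx_eq_of_le (hb : 1 < b) {i j : ℤ} (hij : i ≤ j) {x y : ℝ × ℝ} (h : idx b i x = idx b i y) :
    idx b j x = idx b j y := by
  simp only [idx, Prod.mk.injEq, true_and] at h ⊢
  exact ⟨floor_div_zpow_eq hij h.1, floor_div_zpow_eq (ysc_mono hb hij) h.2⟩

theorem mem_cell_idx (j : ℤ) (x : ℝ × ℝ) : x ∈ cell b (idx b j x) := mem_cell_iff.2 rfl

theorem zpow_ysc_le (j : ℤ) : (2:ℝ) ^ ysc b j ≤ ((2:ℝ) ^ j) ^ b := by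
  rw [← Real.rpow_intCast, ← Real.rpow_intCast, ← Real.rpow_mul two_pos.le]
  refine Real.rpow_le_rpow_of_exponent_le one_le_two ?_
  rw [mul_comm (j:ℝ)]
  exact Int.floor_le _

theorem le_zpow_ysc (j : ℤ) : ((2:ℝ) ^ j) ^ b ≤ 2 * (2:ℝ) ^ ysc b j := by
  rw [← zpow_one_add₀ two_ne_zero, ← Real.rpow_intCast, ← Real.rpow_intCast,
    ← Real.rpow_mul two_pos.le]
  refine Real.rpow_le_rpow_of_exponent_le one_le_two ?_
  rw [mul_comm (j:ℝ)]
  push_cast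
  rw [add_comm]
  exact (Int.lt_floor_add_one _).le

/-- The Calderón–Zygmund stopping rectangles of a continuous integrable function. -/
theorem exists_stopping_cells (hb : 1 < b) {f : ℝ × ℝ → ℝ} (hfc : Continuous f)
    (hfi : Integrable f) {α : ℝ} (hα : 0 < α) : ∃ S : Set (ℤ × ℤ × ℤ),
      S.PairwiseDisjoint (cell b) ∧
      (∀ q ∈ S, ENNReal.ofReal α * volume (cell b q) ≤ ∫⁻ x in cell b q, ‖f x‖ₑ) ∧
      (∀ q ∈ S, ∫⁻ x in cell b q, ‖f x‖ₑ ≤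
        ENNReal.ofReal (2 ^ (⌊b⌋ + 2) * α) * volume (cell b q)) ∧
      ∀ x, (∀ q ∈ S, x ∉ cell b q) → |f x| ≤ α := by
  let big : ℤ × ℤ × ℤ → Prop := fun q =>
    ENNReal.ofReal α * volume (cell b q) < ∫⁻ x in cell b q, ‖f x‖ₑ
  refine ⟨{q | big q ∧ ∀ x ∈ cell b q, ∀ j > q.1, ¬ big (idx b j x)}, ?_, fun q hq => hq.1.le, ?_, ?_⟩
  · intro q hq q' hq' hne
    refine Set.disjoint_left.2 fun x hx hx' => ?_
    rcases lt_trichotomy q.1 q'.1 with h | h | h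
    · exact hq.2 x hx _ h ((mem_cell_iff.1 hx').symm ▸ hq'.1)
    · exact hne ((mem_cell_iff.1 hx).symm.trans (h ▸ mem_cell_iff.1 hx'))
    · exact hq'.2 x hx' _ h ((mem_cell_iff.1 hx).symm ▸ hq.1)
  · intro q hq
    set P := idx b (q.1 + 1) (corner b q) with hP
    have hsub : cell b q ⊆ cell b P := fun y hy => mem_cell_iff.2 (by
      rw [hP]
      refine idx_eq_of_le hb (i := q.1) (by simp [idx]) ?_
      rw [mem_cell_iff.1 hy, mem_cell_iff.1 (corner_mem_cell q)])
    refine (lintegral_mono_set hsub).trans ((not_lt.1 (hq.2 _ (corner_mem_cell q) _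
      (lt_add_one _))).trans ?_)
    rw [← hP, volume_cell, volume_cell, ← ENNReal.ofReal_mul hα.le,
      ← ENNReal.ofReal_mul (by positivity)]
    refine ENNReal.ofReal_le_ofReal ?_
    have h1 : (2:ℝ) ^ ysc b (q.1 + 1) ≤ 2 ^ ysc b q.1 * 2 ^ (⌊b⌋ + 1) := by
      rw [← zpow_add₀ two_ne_zero]
      exact zpow_le_zpow_right₀ one_le_two (ysc_succ_le _)
    have h2 : (2:ℝ) ^ (⌊b⌋ + 2) = 2 * 2 ^ (⌊b⌋ + 1) := by
      rw [← zpow_one_add₀ two_ne_zero]; congr 1; ring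
    have h3 : (2:ℝ) ^ P.1 = 2 ^ q.1 * 2 := by
      rw [← zpow_add_one₀ two_ne_zero]; rfl
    have h4 : P.1 = q.1 + 1 := rfl
    rw [h3, h4, h2]
    calc α * (2 ^ q.1 * 2 * 2 ^ ysc b (q.1 + 1)) ≤
        α * (2 ^ q.1 * 2 * (2 ^ ysc b q.1 * 2 ^ (⌊b⌋ + 1))) := by gcongr
      _ = _ := by ring
  · intro x hx
    have hno : ∀ j, ¬ big (idx b j x) := by
      by_contra! hcon
      obtain ⟨j₀, hj₀⟩ := hcon
      have hbdd : ∃ B : ℤ, ∀ j, big (idx b j x) → j ≤ B := by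
        set I := ∫⁻ x, ‖f x‖ₑ with hI
        have hIt : I ≠ ⊤ := hfi.2.ne
        obtain ⟨n, hn⟩ := pow_unbounded_of_one_lt (I.toReal / α) (one_lt_two (α := ℝ))
        refine ⟨n, fun j hj => ?_⟩
        by_contra! hjn
        have hj' : ENNReal.ofReal α * volume (cell b (idx b j x)) < I :=
          lt_of_lt_of_le hj (setLIntegral_le_lintegral _ _)
        rw [volume_cell, ← ENNReal.ofReal_mul hα.le, ENNReal.ofReal_lt_iff_lt_toReal (by positivity)
          hIt] at hj'
        rw [div_lt_iff₀ hα] at hn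
        have h0 : (0:ℤ) ≤ ysc b j := by
          refine Int.floor_nonneg.2 (mul_nonneg (by linarith) ?_)
          exact_mod_cast (Int.natCast_nonneg n).trans hjn.le
        have h1 : (1:ℝ) ≤ 2 ^ ysc b j := one_le_zpow₀ one_le_two h0
        have h2 : (2:ℝ) ^ n ≤ 2 ^ j := by
          rw [← zpow_natCast]; exact zpow_le_zpow_right₀ one_le_two hjn.le
        have h3 : (2:ℝ) ^ n ≤ 2 ^ j * 2 ^ ysc b j := by
          calc (2:ℝ) ^ n = 2 ^ n * 1 := (mul_one _).symm
            _ ≤ _ := by gcongr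
        have : (2:ℝ) ^ n * α ≤ α * (2 ^ j * 2 ^ ysc b j) := by
          rw [mul_comm α]; gcongr
        simp only [idx] at hj'
        linarith
      obtain ⟨B, hB⟩ := hbdd
      obtain ⟨j, hj, hmax⟩ := Int.exists_greatest_of_bdd ⟨B, hB⟩ ⟨j₀, hj₀⟩
      refine hx (idx b j x) ⟨hj, fun y hy k hk hbig => ?_⟩ (mem_cell_idx j x)
      have hk' : j < k := hk
      rw [idx_eq_of_le hb hk'.le (mem_cell_iff.1 hy)] at hbig
      exact (hmax k hbig).not_gt hk'
    by_contra! hfx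
    obtain ⟨α', h1, h2⟩ := exists_between hfx
    obtain ⟨δ, hδ, hball⟩ := Metric.eventually_nhds_iff.1
      ((hfc.abs.tendsto x).eventually (lt_mem_nhds h2))
    obtain ⟨n, hn⟩ := exists_pow_lt_of_lt_one hδ (by norm_num : (1/2:ℝ) < 1)
    set j : ℤ := -(n:ℤ) with hj
    have h2j : (2:ℝ) ^ j = (1/2) ^ n := by rw [hj, zpow_neg, zpow_natCast]; simp
    have h2y : (2:ℝ) ^ ysc b j ≤ 2 ^ j := by
      refine zpow_le_zpow_right₀ one_le_two ?_
      have : ((ysc b j : ℤ) : ℝ) ≤ j := by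
        refine (Int.floor_le _).trans ?_
        rw [hj]; push_cast
        nlinarith [Nat.cast_nonneg (α := ℝ) n]
      exact_mod_cast this
    refine hno j ?_
    have hge : ∀ y ∈ cell b (idx b j x), ENNReal.ofReal α' ≤ ‖f y‖ₑ := by
      intro y hy
      have hx' := mem_cell_idx (b := b) j x
      rw [cell_eq_prod] at hy hx'
      obtain ⟨⟨a1, a2⟩, a3, a4⟩ := hy
      obtain ⟨⟨c1, c2⟩, c3, c4⟩ := hx'
      simp only [show (idx b j x).1 = j from rfl] at *
      rw [← ofReal_norm]
      refine ENNReal.ofReal_le_ofReal (hball ?_).le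
      rw [Prod.dist_eq, Real.dist_eq, Real.dist_eq, max_lt_iff, abs_lt, abs_lt]
      rw [← h2j] at hn
      refine ⟨⟨?_, ?_⟩, ?_, ?_⟩ <;> linarith
    refine lt_of_lt_of_le ?_ (setLIntegral_mono' (measurableSet_cell _) hge)
    rw [setLIntegral_const]
    refine ENNReal.mul_lt_mul_left ?_ ?_ ?_
    · rw [volume_cell]; simpa using (by positivity)
    · rw [volume_cell]; exact ENNReal.ofReal_ne_top
    · exact (ENNReal.ofReal_lt_ofReal_iff (hα.trans h1)).2 h1

end

theorem continuous_cv {k f : ℝ × ℝ → ℝ} (hk : Continuous k) (hkc : HasCompactSupport k)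
    (hf : Integrable f) : Continuous (cv k f) := by
  obtain ⟨C, hC⟩ := hkc.exists_bound_of_continuous hk
  refine continuous_of_dominated (bound := fun y => C * ‖f y‖) (fun x => ?_)
    (fun x => Eventually.of_forall fun y => ?_) (hf.norm.const_mul _)
    (Eventually.of_forall fun y => ?_)
  · exact (hk.comp (by fun_prop)).aestronglyMeasurable.smul hf.1
  · rw [norm_smul]
    exact mul_le_mul_of_nonneg_right (hC _) (norm_nonneg _)
  · exact (hk.comp (by fun_prop)).smul continuous_const

theorem integrable_cv_integrand {k f : ℝ × ℝ → ℝ} (hk : Continuous k) (hkc : HasCompactSupport k)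
    (hf : Integrable f) (x : ℝ × ℝ) : Integrable fun y => k (x - y) * f y := by
  obtain ⟨C, hC⟩ := hkc.exists_bound_of_continuous hk
  exact hf.bdd_mul (c := C) (hk.comp (by fun_prop)).aestronglyMeasurable
    (Eventually.of_forall fun y => hC _)

theorem lintegral_enorm_average_le {f : ℝ × ℝ → ℝ} {s : Set (ℝ × ℝ)} (hs : volume s ≠ 0)
    (hs' : volume s ≠ ⊤) :
    volume s * ‖⨍ y in s, f y‖ₑ ≤ ∫⁻ y in s, ‖f y‖ₑ := by
  rw [setAverage_eq, enorm_smul, ← mul_assoc]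
  have : volume s * ‖(volume.real s)⁻¹‖ₑ = 1 := by
    rw [enorm_inv (by rw [Measure.real]; exact (ENNReal.toReal_pos hs hs').ne'),
      Real.enorm_of_nonneg measureReal_nonneg, Measure.real, ENNReal.ofReal_toReal hs',
      ENNReal.mul_inv_cancel hs hs']
  rw [this, one_mul]
  exact enorm_integral_le_lintegral_enorm _

section
variable {b : ℝ}

theorem volume_cell_ne_zero (q : ℤ × ℤ × ℤ) : volume (cell b q) ≠ 0 := by
  rw [volume_cell]; simpa using (by positivity)

theorem volume_cell_ne_top (q : ℤ × ℤ × ℤ) : volume (cell b q) ≠ ⊤ := by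
  rw [volume_cell]; exact ENNReal.ofReal_ne_top

/-- Replace a function by its averages on a family of rectangles. -/
def cellAvg (b : ℝ) (S : Set (ℤ × ℤ × ℤ)) (f : ℝ × ℝ → ℝ) (x : ℝ × ℝ) : ℝ :=
  if h : ∃ q ∈ S, x ∈ cell b q then ⨍ y in cell b h.choose, f y else f x

theorem cellAvg_of_mem {S : Set (ℤ × ℤ × ℤ)} (hS : S.PairwiseDisjoint (cell b)) (f : ℝ × ℝ → ℝ)
    {q : ℤ × ℤ × ℤ} (hq : q ∈ S) {x : ℝ × ℝ} (hx : x ∈ cell b q) :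
    cellAvg b S f x = ⨍ y in cell b q, f y := by
  have h : ∃ q ∈ S, x ∈ cell b q := ⟨q, hq, hx⟩
  have he : h.choose = q := by
    by_contra hne
    exact Set.disjoint_left.1 (hS h.choose_spec.1 hq hne) h.choose_spec.2 hx
  rw [cellAvg, dif_pos h, he]

theorem cellAvg_of_notMem {S : Set (ℤ × ℤ × ℤ)} (f : ℝ × ℝ → ℝ) {x : ℝ × ℝ}
    (hx : ∀ q ∈ S, x ∉ cell b q) : cellAvg b S f x = f x := by
  rw [cellAvg, dif_neg]
  push Not
  exact hx

theorem aemeasurable_cellAvg {S : Set (ℤ × ℤ × ℤ)} (hS : S.PairwiseDisjoint (cell b))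
    {f : ℝ × ℝ → ℝ} (hf : Continuous f) : AEMeasurable (cellAvg b S f) := by
  let t : Option S → Set (ℝ × ℝ) := fun o => o.elim (⋃ q : S, cell b q)ᶜ fun q => cell b q
  have hu : ⋃ o, t o = univ := by
    rw [iUnion_option]
    exact compl_union_self _
  have hm : MeasurableSet (⋃ q : S, cell b (q : ℤ × ℤ × ℤ)) :=
    MeasurableSet.iUnion fun q => measurableSet_cell _
  rw [← Measure.restrict_univ (μ := volume), ← hu, aemeasurable_iUnion_iff]
  rintro (_ | q)
  · refine hf.aemeasurable.congr ((ae_restrict_mem hm.compl).mono fun x hx => ?_)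
    refine (cellAvg_of_notMem f fun q hq hxq => hx ?_).symm
    exact mem_iUnion.2 ⟨⟨q, hq⟩, hxq⟩
  · refine (aemeasurable_const (b := ⨍ y in cell b q, f y)).congr
      ((ae_restrict_mem (measurableSet_cell _)).mono fun x hx => ?_)
    exact (cellAvg_of_mem hS f q.2 hx).symm

theorem pairwise_disjoint_coe {S : Set (ℤ × ℤ × ℤ)} (hS : S.PairwiseDisjoint (cell b)) :
    Pairwise (Function.onFun Disjoint fun q : S => cell b (q : ℤ × ℤ × ℤ)) :=
  fun q q' h => hS q.2 q'.2 (Subtype.coe_ne_coe.2 h)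

theorem setLIntegral_cellAvg_le {S : Set (ℤ × ℤ × ℤ)} (hS : S.PairwiseDisjoint (cell b))
    {f : ℝ × ℝ → ℝ} {q : ℤ × ℤ × ℤ} (hq : q ∈ S) :
    ∫⁻ x in cell b q, ‖cellAvg b S f x‖ₑ ≤ ∫⁻ x in cell b q, ‖f x‖ₑ := by
  rw [setLIntegral_congr_fun (measurableSet_cell q)
    (fun x hx => by rw [cellAvg_of_mem hS f hq hx]), setLIntegral_const, mul_comm]
  exact lintegral_enorm_average_le (volume_cell_ne_zero q) (volume_cell_ne_top q)

theorem lintegral_cellAvg_le {S : Set (ℤ × ℤ × ℤ)} (hS : S.PairwiseDisjoint (cell b))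
    {f : ℝ × ℝ → ℝ} : ∫⁻ x, ‖cellAvg b S f x‖ₑ ≤ ∫⁻ x, ‖f x‖ₑ := by
  have hm : MeasurableSet (⋃ q : S, cell b (q : ℤ × ℤ × ℤ)) :=
    MeasurableSet.iUnion fun q => measurableSet_cell _
  rw [← lintegral_add_compl _ hm, ← lintegral_add_compl (fun x => ‖f x‖ₑ) hm]
  refine add_le_add ?_ (le_of_eq (setLIntegral_congr_fun hm.compl fun x hx => ?_))
  · rw [lintegral_iUnion (fun q => measurableSet_cell _) (pairwise_disjoint_coe hS),
      lintegral_iUnion (fun q => measurableSet_cell _) (pairwise_disjoint_coe hS)]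
    exact ENNReal.tsum_le_tsum fun q => setLIntegral_cellAvg_le hS q.2
  · rw [cellAvg_of_notMem f fun q hq hxq => hx (mem_iUnion.2 ⟨⟨q, hq⟩, hxq⟩)]

theorem enorm_cellAvg_le {S : Set (ℤ × ℤ × ℤ)} (hS : S.PairwiseDisjoint (cell b))
    {f : ℝ × ℝ → ℝ} {c : ℝ≥0∞} (h1 : ∀ q ∈ S, ∫⁻ x in cell b q, ‖f x‖ₑ ≤ c * volume (cell b q))
    (h2 : ∀ x, (∀ q ∈ S, x ∉ cell b q) → ‖f x‖ₑ ≤ c) (x : ℝ × ℝ) : ‖cellAvg b S f x‖ₑ ≤ c := by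
  by_cases h : ∃ q ∈ S, x ∈ cell b q
  · obtain ⟨q, hq, hx⟩ := h
    rw [cellAvg_of_mem hS f hq hx]
    have := (lintegral_enorm_average_le (f := f) (volume_cell_ne_zero q)
      (volume_cell_ne_top q)).trans (h1 q hq)
    rw [mul_comm c] at this
    exact (ENNReal.mul_le_mul_iff_right (volume_cell_ne_zero q) (volume_cell_ne_top q)).1 this
  · push Not at h
    rw [cellAvg_of_notMem f h]
    exact h2 x h

theorem enorm_cv_sub_cellAvg_le {S : Set (ℤ × ℤ × ℤ)} (hS : S.PairwiseDisjoint (cell b))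
    {k f : ℝ × ℝ → ℝ} (hk : Continuous k) (hkc : HasCompactSupport k)
    (hfi : Integrable f) (hg : Integrable (cellAvg b S f)) (x : ℝ × ℝ) :
    ‖cv k (fun y => f y - cellAvg b S f y) x‖ₑ ≤
      ∑' q : S, ∫⁻ y in cell b q, ‖k (x - y) - k (x - corner b q)‖ₑ * ‖f y - cellAvg b S f y‖ₑ := by
  have hm : MeasurableSet (⋃ q : S, cell b (q : ℤ × ℤ × ℤ)) :=
    MeasurableSet.iUnion fun q => measurableSet_cell _
  have hi : Integrable fun y => f y - cellAvg b S f y := hfi.sub hg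
  have hki : Integrable fun y => k (x - y) * (f y - cellAvg b S f y) :=
    integrable_cv_integrand hk hkc hi x
  have e : cv k (fun y => f y - cellAvg b S f y) x =
      ∫ y in ⋃ q : S, cell b (q : ℤ × ℤ × ℤ), k (x - y) * (f y - cellAvg b S f y) := by
    refine (setIntegral_eq_integral_of_forall_compl_eq_zero fun y hy => ?_).symm
    show k (x - y) * (f y - cellAvg b S f y) = 0
    rw [cellAvg_of_notMem f fun q hq hxq => hy (mem_iUnion.2 ⟨⟨q, hq⟩, hxq⟩), sub_self, mul_zero]
  rw [e, integral_iUnion (fun q => measurableSet_cell _) (pairwise_disjoint_coe hS) hki.integrableOn]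
  refine (enorm_tsum_le_tsum_enorm).trans (ENNReal.tsum_le_tsum fun q => ?_)
  have hz : ∫ y in cell b q, k (x - corner b q) * (f y - cellAvg b S f y) = 0 := by
    rw [integral_const_mul, integral_sub hfi.integrableOn hg.integrableOn,
      setIntegral_congr_fun (measurableSet_cell _) (fun y hy => cellAvg_of_mem hS f q.2 hy),
      setIntegral_const, setAverage_eq, ← smul_assoc, smul_eq_mul (a := volume.real _),
      mul_inv_cancel₀, one_smul, sub_self, mul_zero]
    rw [Measure.real]
    exact (ENNReal.toReal_pos (volume_cell_ne_zero _) (volume_cell_ne_top _)).ne'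
  have e2 : ∫ y in cell b q, k (x - y) * (f y - cellAvg b S f y) =
      ∫ y in cell b q, (k (x - y) - k (x - corner b q)) * (f y - cellAvg b S f y) := by
    rw [← sub_zero (∫ y in cell b q, k (x - y) * (f y - cellAvg b S f y)), ← hz,
      ← integral_sub hki.integrableOn ((hi.const_mul _).integrableOn)]
    simp only [sub_mul]
  rw [e2]
  refine (enorm_integral_le_lintegral_enorm _).trans (le_of_eq ?_)
  simp only [enorm_mul]

/-- The dilate of a rectangle. -/
def cellDil (b R : ℝ) (q : ℤ × ℤ × ℤ) : Set (ℝ × ℝ) :=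
  Icc ((corner b q).1 - (R + 1) * 2 ^ q.1) ((corner b q).1 + (R + 1) * 2 ^ q.1) ×ˢ
    Icc ((corner b q).2 - (R + 1) * (2 ^ q.1) ^ b) ((corner b q).2 + (R + 1) * (2 ^ q.1) ^ b)

theorem measurableSet_cellDil (R : ℝ) (q : ℤ × ℤ × ℤ) : MeasurableSet (cellDil b R q) :=
  measurableSet_Icc.prod measurableSet_Icc

theorem volume_cellDil_le {R : ℝ} (hR : 0 ≤ R) (q : ℤ × ℤ × ℤ) :
    volume (cellDil b R q) ≤ ENNReal.ofReal (8 * (R + 1) ^ 2) * volume (cell b q) := by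
  rw [cellDil, Measure.volume_eq_prod, Measure.prod_prod, Real.volume_Icc, Real.volume_Icc,
    ← Measure.volume_eq_prod, volume_cell, ← ENNReal.ofReal_mul (by nlinarith [zpow_pos (two_pos (α := ℝ)) q.1]),
    ← ENNReal.ofReal_mul (by positivity)]
  refine ENNReal.ofReal_le_ofReal ?_
  have h := le_zpow_ysc (b := b) q.1
  have h0 : (0:ℝ) < 2 ^ q.1 := by positivity
  calc _ = 4 * (R + 1) ^ 2 * 2 ^ q.1 * (2 ^ q.1) ^ b := by ring
    _ ≤ 4 * (R + 1) ^ 2 * 2 ^ q.1 * (2 * 2 ^ ysc b q.1) := by gcongr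
    _ = _ := by ring

theorem setLIntegral_cellDil_compl_le (hb : 1 < b) {K : ℤ → ℝ × ℝ → ℝ} {F : Finset ℤ} {R : ℝ} {B : ℝ≥0∞}
    (hR : 0 ≤ R) (hK : ∀ j, Continuous (K j))
    (hs : ∀ j z, K j z ≠ 0 → |z.1| ≤ R * 2 ^ j ∧ |z.2| ≤ R * (2 ^ j) ^ b)
    (hB : ∀ (i : ℤ) (h : ℝ × ℝ), |h.1| ≤ 2 ^ i → |h.2| ≤ (2 ^ i) ^ b →
      ∑ j ∈ F with i < j, ∫⁻ z, ‖K j (z - h) - K j z‖ₑ ≤ B)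
    {q : ℤ × ℤ × ℤ} {y : ℝ × ℝ} (hy : y ∈ cell b q) :
    ∫⁻ x in (cellDil b R q)ᶜ, ‖∑ j ∈ F, K j (x - y) - ∑ j ∈ F, K j (x - corner b q)‖ₑ ≤ B := by
  have hyc := abs_sub_corner_le hy
  have hyc2 := hyc.2.trans (zpow_ysc_le q.1)
  have h0 : (0:ℝ) < 2 ^ q.1 := by positivity
  have hz : ∀ x ∈ (cellDil b R q)ᶜ, ∀ j ≤ q.1, ∀ w : ℝ × ℝ, |w.1 - (corner b q).1| ≤ 2 ^ q.1 →
      |w.2 - (corner b q).2| ≤ (2 ^ q.1) ^ b → K j (x - w) = 0 := by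
    intro x hx j hj w hw1 hw2
    by_contra hne
    refine hx ?_
    obtain ⟨h1, h2⟩ := hs j _ hne
    have h3 : (2:ℝ) ^ j ≤ 2 ^ q.1 := zpow_le_zpow_right₀ one_le_two hj
    have h4 : ((2:ℝ) ^ j) ^ b ≤ (2 ^ q.1) ^ b := Real.rpow_le_rpow (by positivity) h3 (by linarith)
    have h5 := h1.trans (mul_le_mul_of_nonneg_left h3 hR)
    have h6 := h2.trans (mul_le_mul_of_nonneg_left h4 hR)
    rw [abs_le] at h5 h6 hw1 hw2
    simp only [Prod.fst_sub, Prod.snd_sub] at h5 h6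
    refine ⟨⟨?_, ?_⟩, ?_, ?_⟩ <;> simp only [add_mul, one_mul] <;> linarith
  calc _ ≤ ∫⁻ x in (cellDil b R q)ᶜ, ∑ j ∈ F with q.1 < j,
        ‖K j (x - y) - K j (x - corner b q)‖ₑ := by
        refine setLIntegral_mono' (measurableSet_cellDil R q).compl fun x hx => ?_
        rw [← Finset.sum_sub_distrib]
        refine (enorm_sum_le _ _).trans (le_of_eq ?_)
        rw [Finset.sum_filter]
        refine Finset.sum_congr rfl fun j _ => ?_
        split_ifs with hj
        · rfl
        · rw [hz x hx j (not_lt.1 hj) y hyc.1 hyc2,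
            hz x hx j (not_lt.1 hj) (corner b q) (by simpa using h0.le) (by simp; positivity)]
          simp
    _ ≤ ∫⁻ x, ∑ j ∈ F with q.1 < j, ‖K j (x - y) - K j (x - corner b q)‖ₑ :=
        setLIntegral_le_lintegral _ _
    _ = ∑ j ∈ F with q.1 < j, ∫⁻ x, ‖K j (x - y) - K j (x - corner b q)‖ₑ :=
        lintegral_finsetSum _ fun j _ =>
          (((hK j).comp (by fun_prop)).sub ((hK j).comp (by fun_prop))).enorm.measurable
    _ = ∑ j ∈ F with q.1 < j, ∫⁻ z, ‖K j (z - (y - corner b q)) - K j z‖ₑ := by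
        refine Finset.sum_congr rfl fun j _ => ?_
        rw [← lintegral_sub_right_eq_self
          (fun z => ‖K j (z - (y - corner b q)) - K j z‖ₑ) (corner b q)]
        refine lintegral_congr fun x => ?_
        rw [sub_sub_sub_cancel_right]
    _ ≤ B := hB q.1 _ hyc.1 hyc2

/-- The weak type `(1,1)` inequality at a given height. -/
theorem volume_cv_gt_le (hb : 1 < b) {K : ℤ → ℝ × ℝ → ℝ} {F : Finset ℤ} {R : ℝ} {A B : ℝ≥0∞}
    (hR : 0 ≤ R) (hK : ∀ j, Continuous (K j))
    (hs : ∀ j z, K j z ≠ 0 → |z.1| ≤ R * 2 ^ j ∧ |z.2| ≤ R * (2 ^ j) ^ b)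
    (hB : ∀ (i : ℤ) (h : ℝ × ℝ), |h.1| ≤ 2 ^ i → |h.2| ≤ (2 ^ i) ^ b →
      ∑ j ∈ F with i < j, ∫⁻ z, ‖K j (z - h) - K j z‖ₑ ≤ B)
    {k : ℝ × ℝ → ℝ} (hk : k = fun x => ∑ j ∈ F, K j x) (hkc : HasCompactSupport k)
    (hA : ∀ f : ℝ × ℝ → ℝ, MemLp f 2 → ∫⁻ x, ‖cv k f x‖ₑ ^ 2 ≤ A ^ 2 * ∫⁻ x, ‖f x‖ₑ ^ 2)
    {f : ℝ × ℝ → ℝ} (hfc : Continuous f) (hfi : Integrable f) {α l : ℝ} (hα : 0 < α) (hl : 0 < l) :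
    volume {x | ENNReal.ofReal (2 * l) < ‖cv k f x‖ₑ} ≤
      (A ^ 2 * ENNReal.ofReal (2 ^ (⌊b⌋ + 2) * α) / ENNReal.ofReal l ^ 2 +
        ENNReal.ofReal (8 * (R + 1) ^ 2) / ENNReal.ofReal α +
        2 * B / ENNReal.ofReal l) * ∫⁻ x, ‖f x‖ₑ := by
  obtain ⟨S, hS, hS1, hS2, hS3⟩ := exists_stopping_cells hb hfc hfi hα
  have hkcont : Continuous k := by rw [hk]; exact continuous_finsetSum _ fun j _ => hK j
  set I := ∫⁻ x, ‖f x‖ₑ with hI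
  set g := cellAvg b S f with hg
  set c := ENNReal.ofReal (2 ^ (⌊b⌋ + 2) * α) with hc
  have hC1 : (1:ℝ) ≤ 2 ^ (⌊b⌋ + 2) := by
    refine one_le_zpow₀ one_le_two ?_
    have : 0 ≤ ⌊b⌋ := Int.floor_nonneg.2 (by linarith)
    omega
  have hgm : AEMeasurable g := aemeasurable_cellAvg hS hfc
  have hgI : ∫⁻ x, ‖g x‖ₑ ≤ I := lintegral_cellAvg_le hS
  have hgi : Integrable g := ⟨hgm.aestronglyMeasurable, hgI.trans_lt hfi.2⟩
  have hgb : ∀ x, ‖g x‖ₑ ≤ c := enorm_cellAvg_le hS hS2 fun x hx => by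
    rw [← ofReal_norm]
    refine ENNReal.ofReal_le_ofReal ((hS3 x hx).trans ?_)
    nlinarith
  have hg2 : ∫⁻ x, ‖g x‖ₑ ^ 2 ≤ c * I := by
    calc _ ≤ ∫⁻ x, c * ‖g x‖ₑ := lintegral_mono fun x => by
          rw [sq]; exact mul_le_mul_left (hgb x) _
      _ = c * ∫⁻ x, ‖g x‖ₑ := lintegral_const_mul'' _ hgm.enorm
      _ ≤ _ := mul_le_mul_right hgI _
  have hgL2 : MemLp g 2 := by
    refine ⟨hgm.aestronglyMeasurable, ?_⟩
    have := eLpNorm_nnreal_pow_eq_lintegral (f := g) (μ := volume) (p := 2) (by simp)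
    have h2 : ∫⁻ x, ‖g x‖ₑ ^ 2 < ⊤ :=
      hg2.trans_lt (ENNReal.mul_lt_top ENNReal.ofReal_lt_top hfi.2)
    have h3 : eLpNorm g 2 volume ^ 2 < ⊤ := by
      have : eLpNorm g 2 volume ^ 2 = ∫⁻ x, ‖g x‖ₑ ^ 2 := by simpa using this
      rwa [this]
    exact (ENNReal.pow_lt_top_iff.1 h3).resolve_right (by norm_num)
  set E := ⋃ q : S, cellDil b R (q : ℤ × ℤ × ℤ) with hE
  have hEm : MeasurableSet E := MeasurableSet.iUnion fun q => measurableSet_cellDil R _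
  have hsum : ∑' q : S, ∫⁻ x in cell b (q : ℤ × ℤ × ℤ), ‖f x‖ₑ ≤ I := by
    rw [← lintegral_iUnion (fun q => measurableSet_cell _) (pairwise_disjoint_coe hS)]
    exact setLIntegral_le_lintegral _ _
  have hl' : ENNReal.ofReal l ≠ 0 := by simpa using hl
  have hα' : ENNReal.ofReal α ≠ 0 := by simpa using hα
  have hgood : volume {x | ENNReal.ofReal l ≤ ‖cv k g x‖ₑ} ≤ A ^ 2 * c / ENNReal.ofReal l ^ 2 * I := by
    have h1 : volume {x | ENNReal.ofReal l ^ 2 ≤ ‖cv k g x‖ₑ ^ 2} ≤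
        (∫⁻ x, ‖cv k g x‖ₑ ^ 2) / ENNReal.ofReal l ^ 2 :=
      meas_ge_le_lintegral_div
        ((continuous_cv hkcont hkc hgi).enorm.measurable.pow_const 2).aemeasurable
        (pow_ne_zero 2 hl') (ENNReal.pow_ne_top ENNReal.ofReal_ne_top)
    refine (measure_mono fun x hx => ?_).trans (h1.trans ?_)
    · exact pow_le_pow_left₀ zero_le (mem_ofPred_eq ▸ hx) 2
    · rw [ENNReal.div_eq_inv_mul, ENNReal.div_eq_inv_mul, mul_assoc]
      refine mul_le_mul_right ?_ _
      rw [mul_assoc]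
      exact (hA g hgL2).trans (mul_le_mul_right hg2 _)
  have hstar : volume E ≤ ENNReal.ofReal (8 * (R + 1) ^ 2) / ENNReal.ofReal α * I := by
    refine (measure_iUnion_le _).trans ?_
    refine le_trans (ENNReal.tsum_le_tsum fun q => ?_)
      ((ENNReal.tsum_mul_left).trans_le (mul_le_mul_right hsum _))
    refine (volume_cellDil_le hR _).trans ?_
    rw [ENNReal.div_eq_inv_mul, mul_comm (ENNReal.ofReal α)⁻¹, mul_assoc]
    refine mul_le_mul_right ?_ _
    rw [← ENNReal.div_eq_inv_mul, ENNReal.le_div_iff_mul_le (Or.inl hα')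
      (Or.inl ENNReal.ofReal_ne_top), mul_comm]
    exact hS1 _ q.2
  have hkj : ∀ x, k x = ∑ j ∈ F, K j x := fun x => by rw [hk]
  have hdi : Integrable fun y => f y - g y := hfi.sub hgi
  have hdm : AEMeasurable fun y => f y - g y := hfc.aemeasurable.sub hgm
  have hjoint : ∀ q : S, AEMeasurable (fun p : (ℝ × ℝ) × (ℝ × ℝ) =>
      ‖k (p.1 - p.2) - k (p.1 - corner b q)‖ₑ * ‖f p.2 - g p.2‖ₑ)
      ((volume.restrict Eᶜ).prod (volume.restrict (cell b q))) := fun q =>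
    ((hkcont.comp (by fun_prop)).sub
      (hkcont.comp (by fun_prop))).enorm.measurable.aemeasurable.mul hdm.enorm.restrict.comp_snd
  have hbadint : ∫⁻ x in Eᶜ, ‖cv k (fun y => f y - g y) x‖ₑ ≤ 2 * B * I := by
    calc _ ≤ ∫⁻ x in Eᶜ, ∑' q : S, ∫⁻ y in cell b q,
          ‖k (x - y) - k (x - corner b q)‖ₑ * ‖f y - g y‖ₑ :=
          lintegral_mono fun x => enorm_cv_sub_cellAvg_le hS hkcont hkc hfi hgi x
      _ = ∑' q : S, ∫⁻ x in Eᶜ, ∫⁻ y in cell b q,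
          ‖k (x - y) - k (x - corner b q)‖ₑ * ‖f y - g y‖ₑ := by
          refine lintegral_tsum fun q => ?_
          exact (hjoint q).lintegral_prod_right'
      _ ≤ ∑' q : S, B * ∫⁻ y in cell b q, ‖f y - g y‖ₑ := by
          refine ENNReal.tsum_le_tsum fun q => ?_
          rw [lintegral_lintegral_swap (hjoint q), ← lintegral_const_mul'' _ hdm.enorm.restrict]
          · refine setLIntegral_mono' (measurableSet_cell _) fun y hy => ?_
            rw [lintegral_mul_const' _ _ enorm_ne_top]
            refine mul_le_mul_left ?_ _
            refine le_trans (lintegral_mono_set (compl_subset_compl.2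
              (subset_iUnion (fun q : S => cellDil b R (q : ℤ × ℤ × ℤ)) q))) ?_
            simp only [hkj]
            exact setLIntegral_cellDil_compl_le hb hR hK hs hB hy
      _ ≤ ∑' q : S, B * (2 * ∫⁻ y in cell b q, ‖f y‖ₑ) := by
          refine ENNReal.tsum_le_tsum fun q => mul_le_mul_right ?_ _
          calc _ ≤ ∫⁻ y in cell b q, (‖f y‖ₑ + ‖g y‖ₑ) := lintegral_mono fun y => enorm_sub_le
            _ = (∫⁻ y in cell b q, ‖f y‖ₑ) + ∫⁻ y in cell b q, ‖g y‖ₑ :=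
                lintegral_add_left hfc.enorm.measurable _
            _ ≤ _ := by
                rw [two_mul]
                exact add_le_add_right (setLIntegral_cellAvg_le hS q.2) _
      _ = 2 * B * ∑' q : S, ∫⁻ y in cell b q, ‖f y‖ₑ := by
          rw [← ENNReal.tsum_mul_left]
          exact tsum_congr fun q => by ring
      _ ≤ _ := mul_le_mul_right hsum _
  have hbad : volume ({x | ENNReal.ofReal l ≤ ‖cv k (fun y => f y - g y) x‖ₑ} ∩ Eᶜ) ≤
      2 * B / ENNReal.ofReal l * I := by
    rw [← Measure.restrict_apply' hEm.compl]
    refine (meas_ge_le_lintegral_div (continuous_cv hkcont hkc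
      (hfi.sub hgi)).enorm.measurable.aemeasurable hl' ENNReal.ofReal_ne_top).trans ?_
    rw [ENNReal.div_eq_inv_mul, ENNReal.div_eq_inv_mul, mul_assoc]
    exact mul_le_mul_right hbadint _
  have hsplit : ∀ x, cv k f x = cv k g x + cv k (fun y => f y - g y) x := by
    intro x
    simp only [cv, smul_eq_mul]
    rw [← integral_add (integrable_cv_integrand hkcont hkc hgi x)
      (integrable_cv_integrand hkcont hkc hdi x)]
    refine integral_congr_ae (Eventually.of_forall fun y => ?_)
    ring
  calc _ ≤ volume ({x | ENNReal.ofReal l ≤ ‖cv k g x‖ₑ} ∪ (E ∪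
        ({x | ENNReal.ofReal l ≤ ‖cv k (fun y => f y - g y) x‖ₑ} ∩ Eᶜ))) := by
        refine measure_mono fun x hx => ?_
        by_contra hcon
        simp only [mem_union, mem_inter_iff, mem_compl_iff, Set.mem_ofPred_eq, not_or, not_and,
          not_not, not_le] at hcon hx
        obtain ⟨h1, h2, h3⟩ := hcon
        have h4 := lt_of_not_ge fun h => h2 (h3 h)
        rw [hsplit] at hx
        have := hx.trans_le (enorm_add_le _ _)
        refine (this.trans (ENNReal.add_lt_add h1 h4)).ne ?_
        rw [two_mul, ENNReal.ofReal_add hl.le hl.le]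
    _ ≤ _ := (measure_union_le _ _).trans (add_le_add hgood
        ((measure_union_le _ _).trans (add_le_add hstar hbad)))
    _ = _ := by ring

end

theorem lintegral_Ioo_rpow_sub_two {p r : ℝ} (hp : 1 < p) (hr : 0 ≤ r) :
    ∫⁻ s in Ioo 0 r, ENNReal.ofReal (s ^ (p - 2)) = ENNReal.ofReal (r ^ (p - 1) / (p - 1)) := by
  have hi := (intervalIntegral.intervalIntegrable_rpow' (a := 0) (b := r) (r := p - 2)
    (by linarith)).1
  have hi' := hi.mono_set Ioo_subset_Ioc_self
  rw [← ofReal_integral_eq_lintegral_ofReal hi'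
    ((ae_restrict_mem measurableSet_Ioo).mono fun s hs => Real.rpow_nonneg hs.1.le _),
    ← integral_Ioc_eq_integral_Ioo, ← intervalIntegral.integral_of_le hr,
    integral_rpow (Or.inl (by linarith)), show p - 2 + 1 = p - 1 by ring,
    Real.zero_rpow (by linarith), sub_zero]

theorem lintegral_Ici_rpow_sub_three {p r : ℝ} (hp : p < 2) (hr : 0 < r) :
    ∫⁻ s in Ici r, ENNReal.ofReal (s ^ (p - 3)) = ENNReal.ofReal (r ^ (p - 2) / (2 - p)) := by
  rw [setLIntegral_congr Ioi_ae_eq_Ici.symm, ← ofReal_integral_eq_lintegral_ofReal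
    (integrableOn_Ioi_rpow_of_lt (by linarith) hr)
    ((ae_restrict_mem measurableSet_Ioi).mono fun s hs => Real.rpow_nonneg (hr.trans hs).le _),
    integral_Ioi_rpow_of_lt (by linarith) hr, show p - 3 + 1 = p - 2 by ring, ← neg_sub p 2,
    neg_div, div_neg]

theorem lintegral_rpow_le_of_distribution {p : ℝ} (hp1 : 1 < p) (hp2 : p < 2) {f g : ℝ × ℝ → ℝ}
    (hf : Measurable f) (hg : Measurable g) {a d e : ℝ} (ha : 0 ≤ a) (hd : 0 < d) (he : 0 ≤ e)
    (h : ∀ s > 0, volume {x | s < |g x|} ≤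
      ENNReal.ofReal (a / s) * (∫⁻ x in {x | d * s < |f x|}, ‖f x‖ₑ) +
      ENNReal.ofReal (e / s ^ 2) * ∫⁻ x in {x | |f x| ≤ d * s}, ‖f x‖ₑ ^ 2) :
    ∫⁻ x, ‖g x‖ₑ ^ p ≤
      ENNReal.ofReal (p * (a * d ^ (1 - p) / (p - 1) + e * d ^ (2 - p) / (2 - p))) *
        ∫⁻ x, ‖f x‖ₑ ^ p := by
  have hp0 : 0 < p := by linarith
  have hpow : ∀ (F : ℝ × ℝ → ℝ) x, ‖F x‖ₑ ^ p = ENNReal.ofReal (|F x| ^ p) := fun F x => by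
    rw [← ENNReal.ofReal_rpow_of_nonneg (abs_nonneg _) hp0.le, ← Real.norm_eq_abs, ofReal_norm]
  have hm1 : Measurable fun q : ℝ × (ℝ × ℝ) => {q : ℝ × (ℝ × ℝ) | d * q.1 < |f q.2|}.indicator
      (fun q => ENNReal.ofReal (a * q.1 ^ (p - 2)) * ‖f q.2‖ₑ) q := by
    refine Measurable.indicator ?_ (measurableSet_lt (by fun_prop) (by fun_prop))
    exact (by fun_prop : Measurable fun q : ℝ × (ℝ × ℝ) => ENNReal.ofReal (a * q.1 ^ (p - 2))).mul
      (hf.comp measurable_snd).enorm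
  have hm2 : Measurable fun q : ℝ × (ℝ × ℝ) => {q : ℝ × (ℝ × ℝ) | |f q.2| ≤ d * q.1}.indicator
      (fun q => ENNReal.ofReal (e * q.1 ^ (p - 3)) * ‖f q.2‖ₑ ^ 2) q := by
    refine Measurable.indicator ?_ (measurableSet_le (by fun_prop) (by fun_prop))
    exact (by fun_prop : Measurable fun q : ℝ × (ℝ × ℝ) => ENNReal.ofReal (e * q.1 ^ (p - 3))).mul
      ((hf.comp measurable_snd).enorm.pow_const 2)
  have hlc := lintegral_rpow_eq_lintegral_meas_lt_mul volume
    (Eventually.of_forall fun x => abs_nonneg (g x)) (hg.abs.aemeasurable) hp0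
  simp only [hpow g]
  rw [hlc, ENNReal.ofReal_mul hp0.le, mul_assoc]
  refine mul_le_mul_right ?_ _
  calc _ ≤ ∫⁻ s in Ioi (0:ℝ), ((∫⁻ x, {q : ℝ × (ℝ × ℝ) | d * q.1 < |f q.2|}.indicator
          (fun q => ENNReal.ofReal (a * q.1 ^ (p - 2)) * ‖f q.2‖ₑ) (s, x)) +
        ∫⁻ x, {q : ℝ × (ℝ × ℝ) | |f q.2| ≤ d * q.1}.indicator
          (fun q => ENNReal.ofReal (e * q.1 ^ (p - 3)) * ‖f q.2‖ₑ ^ 2) (s, x)) := by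
        refine setLIntegral_mono' measurableSet_Ioi fun s hs => ?_
        have hs : 0 < s := hs
        have e1 : ∫⁻ x, {q : ℝ × (ℝ × ℝ) | d * q.1 < |f q.2|}.indicator
          (fun q => ENNReal.ofReal (a * q.1 ^ (p - 2)) * ‖f q.2‖ₑ) (s, x) =
            ENNReal.ofReal (a * s ^ (p - 2)) * ∫⁻ x in {x | d * s < |f x|}, ‖f x‖ₑ := by
          rw [← lintegral_const_mul _ hf.enorm, ← lintegral_indicator
            (measurableSet_lt measurable_const hf.abs)]
          rfl
        have e2 : ∫⁻ x, {q : ℝ × (ℝ × ℝ) | |f q.2| ≤ d * q.1}.indicator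
          (fun q => ENNReal.ofReal (e * q.1 ^ (p - 3)) * ‖f q.2‖ₑ ^ 2) (s, x) =
            ENNReal.ofReal (e * s ^ (p - 3)) * ∫⁻ x in {x | |f x| ≤ d * s}, ‖f x‖ₑ ^ 2 := by
          rw [← lintegral_const_mul _ (hf.enorm.pow_const 2), ← lintegral_indicator
            (measurableSet_le hf.abs measurable_const)]
          rfl
        rw [e1, e2]
        refine (mul_le_mul_left (h s hs) _).trans (le_of_eq ?_)
        have h1 : a * s ^ (p - 2) = a / s * s ^ (p - 1) := by
          rw [show p - 1 = p - 2 + 1 by ring, Real.rpow_add_one hs.ne']; field_simp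
        have h2 : e * s ^ (p - 3) = e / s ^ 2 * s ^ (p - 1) := by
          rw [show p - 1 = p - 3 + (2:ℕ) by push_cast; ring, Real.rpow_add_natCast hs.ne']
          field_simp
        rw [h1, h2, ENNReal.ofReal_mul (by positivity), ENNReal.ofReal_mul (by positivity)]
        ring
    _ = (∫⁻ x, ∫⁻ s in Ioi (0:ℝ), {q : ℝ × (ℝ × ℝ) | d * q.1 < |f q.2|}.indicator
          (fun q => ENNReal.ofReal (a * q.1 ^ (p - 2)) * ‖f q.2‖ₑ) (s, x)) +
        ∫⁻ x, ∫⁻ s in Ioi (0:ℝ), {q : ℝ × (ℝ × ℝ) | |f q.2| ≤ d * q.1}.indicator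
          (fun q => ENNReal.ofReal (e * q.1 ^ (p - 3)) * ‖f q.2‖ₑ ^ 2) (s, x) := by
        rw [lintegral_add_left hm1.lintegral_prod_right']
        exact congrArg₂ _ (lintegral_lintegral_swap hm1.aemeasurable)
          (lintegral_lintegral_swap hm2.aemeasurable)
    _ ≤ (∫⁻ x, ENNReal.ofReal (a * d ^ (1 - p) / (p - 1)) * ‖f x‖ₑ ^ p) +
        ∫⁻ x, ENNReal.ofReal (e * d ^ (2 - p) / (2 - p)) * ‖f x‖ₑ ^ p := by
        refine add_le_add (lintegral_mono fun x => ?_) (lintegral_mono fun x => ?_)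
        · rcases eq_or_ne (f x) 0 with hx | hx
          · have : ∀ s, {q : ℝ × (ℝ × ℝ) | d * q.1 < |f q.2|}.indicator
              (fun q => ENNReal.ofReal (a * q.1 ^ (p - 2)) * ‖f q.2‖ₑ) (s, x) = 0 := fun s => by
              rw [Set.indicator_apply]; simp [hx]
            simp [this]
          have hx' : 0 < |f x| := abs_pos.2 hx
          calc _ = ∫⁻ s in Ioi (0:ℝ), (Iio (|f x| / d)).indicator
                (fun s => ENNReal.ofReal a * ‖f x‖ₑ * ENNReal.ofReal (s ^ (p - 2))) s := by
                refine setLIntegral_congr_fun measurableSet_Ioi fun s hs => ?_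
                simp only [Set.indicator_apply, Set.mem_ofPred_eq, mem_Iio, lt_div_iff₀ hd,
                  mul_comm s d, ENNReal.ofReal_mul ha]
                congr 1; ring
            _ = ENNReal.ofReal a * ‖f x‖ₑ * ENNReal.ofReal ((|f x| / d) ^ (p - 1) / (p - 1)) := by
                rw [setLIntegral_indicator measurableSet_Iio, Iio_inter_Ioi,
                  lintegral_const_mul _ (by fun_prop),
                  lintegral_Ioo_rpow_sub_two hp1 (by positivity)]
            _ = _ := by
                rw [hpow, ← ofReal_norm, Real.norm_eq_abs, ← ENNReal.ofReal_mul ha,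
                  ← ENNReal.ofReal_mul (by positivity), ← ENNReal.ofReal_mul
                  (by have : 0 < p - 1 := by linarith
                      positivity), Real.div_rpow hx'.le hd.le]
                congr 1
                rw [Real.rpow_sub_one hx'.ne', ← neg_sub p 1, Real.rpow_neg hd.le]
                field_simp
            _ ≤ _ := le_rfl
        · rcases eq_or_ne (f x) 0 with hx | hx
          · have : ∀ s, {q : ℝ × (ℝ × ℝ) | |f q.2| ≤ d * q.1}.indicator
              (fun q => ENNReal.ofReal (e * q.1 ^ (p - 3)) * ‖f q.2‖ₑ ^ 2) (s, x) = 0 := fun s => by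
              rw [Set.indicator_apply]; simp [hx]
            simp [this]
          have hx' : 0 < |f x| := abs_pos.2 hx
          calc _ = ∫⁻ s in Ioi (0:ℝ), (Ici (|f x| / d)).indicator
                (fun s => ENNReal.ofReal e * ‖f x‖ₑ ^ 2 * ENNReal.ofReal (s ^ (p - 3))) s := by
                refine setLIntegral_congr_fun measurableSet_Ioi fun s hs => ?_
                simp only [Set.indicator_apply, Set.mem_ofPred_eq, mem_Ici, div_le_iff₀ hd,
                  mul_comm s d, ENNReal.ofReal_mul he]
                congr 1; ring
            _ = ENNReal.ofReal e * ‖f x‖ₑ ^ 2 *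
                ENNReal.ofReal ((|f x| / d) ^ (p - 2) / (2 - p)) := by
                rw [setLIntegral_indicator measurableSet_Ici, inter_eq_left.2
                  (Ici_subset_Ioi.2 (by positivity)), lintegral_const_mul _ (by fun_prop),
                  lintegral_Ici_rpow_sub_three hp2 (by positivity)]
            _ = _ := by
                rw [hpow, ← ofReal_norm, Real.norm_eq_abs, ← ENNReal.ofReal_pow hx'.le,
                  ← ENNReal.ofReal_mul he,
                  ← ENNReal.ofReal_mul (by positivity), ← ENNReal.ofReal_mul
                  (by have : 0 < 2 - p := by linarith
                      positivity), Real.div_rpow hx'.le hd.le]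
                congr 1
                rw [← neg_sub p 2, Real.rpow_neg hd.le, show p - 2 = p - (2:ℕ) by norm_num,
                  Real.rpow_sub_natCast hx'.ne']
                field_simp
            _ ≤ _ := le_rfl
    _ = _ := by
        have : Measurable fun x => ‖f x‖ₑ ^ p := hf.enorm.pow_const p
        rw [lintegral_const_mul _ this, lintegral_const_mul _ this, ← add_mul,
          ← ENNReal.ofReal_add]
        · have : 0 < p - 1 := by linarith
          positivity
        · have : 0 < 2 - p := by linarith
          positivity

theorem abs_clamp_le {t : ℝ} (ht : 0 ≤ t) (y : ℝ) : |max (min y t) (-t)| ≤ |y| := by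
  rcases le_total y 0 with h | h
  · rw [min_eq_left (h.trans ht), abs_of_nonpos h, abs_of_nonpos (max_le h (by linarith))]
    linarith [le_max_left y (-t)]
  · rw [abs_of_nonneg h, max_eq_left ((neg_nonpos.2 ht).trans (le_min h ht)),
      abs_of_nonneg (le_min h ht)]
    exact min_le_left _ _

theorem abs_clamp_le_bound {t : ℝ} (ht : 0 ≤ t) (y : ℝ) : |max (min y t) (-t)| ≤ t :=
  abs_le.2 ⟨le_max_right _ _, max_le (min_le_right _ _) (by linarith)⟩

theorem abs_sub_clamp_le {t : ℝ} (ht : 0 ≤ t) (y : ℝ) : |y - max (min y t) (-t)| ≤ |y| := by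
  rcases le_total y 0 with h | h
  · rw [min_eq_left (h.trans ht), abs_of_nonpos h]
    have h1 := max_le h (by linarith : -t ≤ 0)
    rw [abs_of_nonpos (by linarith [le_max_left y (-t)])]
    linarith
  · have h1 := le_min h ht
    rw [abs_of_nonneg h, max_eq_left ((neg_nonpos.2 ht).trans h1),
      abs_of_nonneg (by linarith [min_le_left y t])]
    linarith

theorem clamp_eq_self {t y : ℝ} (h : |y| ≤ t) : max (min y t) (-t) = y := by
  rw [min_eq_left (abs_le.1 h).2, max_eq_left (abs_le.1 h).1]

theorem exists_lintegral_cv_rpow_le {b : ℝ} (hb : 1 < b) {R : ℝ} (hR : 0 ≤ R) {p : ℝ} (hp1 : 1 < p)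
    (hp2 : p ≤ 2) : ∃ C, 0 ≤ C ∧ ∀ (K : ℤ → ℝ × ℝ → ℝ) (F : Finset ℤ) (A B : ℝ),
    (∀ j, Continuous (K j)) →
    (∀ j z, K j z ≠ 0 → |z.1| ≤ R * 2 ^ j ∧ |z.2| ≤ R * (2 ^ j) ^ b) → 0 < A → A ≤ B →
    (∀ (i : ℤ) (h : ℝ × ℝ), |h.1| ≤ 2 ^ i → |h.2| ≤ (2 ^ i) ^ b →
      ∑ j ∈ F with i < j, ∫⁻ z, ‖K j (z - h) - K j z‖ₑ ≤ ENNReal.ofReal B) →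
    HasCompactSupport (fun x => ∑ j ∈ F, K j x) →
    (∀ f : ℝ × ℝ → ℝ, MemLp f 2 → ∫⁻ x, ‖cv (fun x => ∑ j ∈ F, K j x) f x‖ₑ ^ 2 ≤
      ENNReal.ofReal A ^ 2 * ∫⁻ x, ‖f x‖ₑ ^ 2) →
    ∀ f : ℝ × ℝ → ℝ, Continuous f → Integrable f → MemLp f 2 →
      ∫⁻ x, ‖cv (fun x => ∑ j ∈ F, K j x) f x‖ₑ ^ p ≤
        ENNReal.ofReal (C * (B ^ (2 - p) * A ^ (2 * (p - 1)))) * ∫⁻ x, ‖f x‖ₑ ^ p := by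
  rcases eq_or_lt_of_le hp2 with rfl | hp2
  · refine ⟨1, zero_le_one, fun K F A B _ _ hA _ _ _ hL f _ _ hf => ?_⟩
    have := hL f hf
    norm_num
    rwa [ENNReal.ofReal_pow hA.le]
  set c : ℝ := 2 ^ (⌊b⌋ + 2) + 8 * (R + 1) ^ 2 + 2 with hc
  have hc0 : 0 < c := by positivity
  have h1p : 0 < p - 1 := by linarith
  have h2p : 0 < 2 - p := by linarith
  refine ⟨p * (c ^ (2 - p) * (8 / (p - 1) + 4 / (2 - p))), by positivity,
    fun K F A B hK hs hA hAB hB hkc hL f hf hfi hf2 => ?_⟩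
  set k := fun x => ∑ j ∈ F, K j x with hk
  have hB0 : 0 < B := hA.trans_le hAB
  set W := c * B with hW
  have hW0 : 0 < W := by positivity
  have hkcont : Continuous k := continuous_finsetSum _ fun j _ => hK j
  set d := W / A ^ 2 with hd
  have hd0 : 0 < d := by positivity
  have key := lintegral_rpow_le_of_distribution hp1 hp2 hf.measurable
    (continuous_cv hkcont hkc hfi).measurable (a := 8 * W) (d := d) (e := 4 * A ^ 2)
    (by positivity) hd0 (by positivity) ?_
  · refine key.trans (le_of_eq ?_)
    congr 2
    have e1 : 8 * W * d ^ (1 - p) = 8 * (W ^ (2 - p) * A ^ (2 * (p - 1))) := by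
      rw [hd, Real.div_rpow hW0.le (by positivity), ← Real.rpow_natCast A 2, ← Real.rpow_mul hA.le,
        show 2 - p = 1 - p + 1 by ring, Real.rpow_add_one hW0.ne', div_eq_mul_inv,
        ← Real.rpow_neg hA.le]
      push_cast
      rw [show -(2 * (1 - p)) = 2 * (p - 1) by ring]
      ring
    have e2 : 4 * A ^ 2 * d ^ (2 - p) = 4 * (W ^ (2 - p) * A ^ (2 * (p - 1))) := by
      rw [hd, Real.div_rpow hW0.le (by positivity), ← Real.rpow_natCast A 2, ← Real.rpow_mul hA.le,
        div_eq_mul_inv, ← Real.rpow_neg hA.le,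
        show 2 * (p - 1) = ((2:ℕ) : ℝ) + -(((2:ℕ) : ℝ) * (2 - p)) by push_cast; ring,
        Real.rpow_add hA]
      ring
    rw [e1, e2, hW, Real.mul_rpow hc0.le hB0.le]
    ring
  intro s hs0
  set t := d * s with ht
  have ht0 : 0 < t := by positivity
  set f₂ : ℝ × ℝ → ℝ := fun x => max (min (f x) t) (-t) with hf₂
  set f₁ : ℝ × ℝ → ℝ := fun x => f x - f₂ x with hf₁
  have hc2 : Continuous f₂ := (hf.min continuous_const).max continuous_const
  have hc1 : Continuous f₁ := hf.sub hc2
  have hi2 : Integrable f₂ := hfi.mono hc2.aestronglyMeasurable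
    (Eventually.of_forall fun x => abs_clamp_le ht0.le _)
  have hi1 : Integrable f₁ := hfi.sub hi2
  have hL2 : MemLp f₂ 2 := hf2.mono hc2.aestronglyMeasurable
    (Eventually.of_forall fun x => abs_clamp_le ht0.le _)
  have hms : MeasurableSet {x | |f x| ≤ t} := measurableSet_le hf.measurable.abs measurable_const
  have hcs : {x | |f x| ≤ t}ᶜ = {x | t < |f x|} := by ext x; simp
  set I := ∫⁻ x in {x | t < |f x|}, ‖f x‖ₑ with hI
  set J := ∫⁻ x in {x | |f x| ≤ t}, ‖f x‖ₑ ^ 2 with hJ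
  have hI1 : ∫⁻ x, ‖f₁ x‖ₑ ≤ I := by
    rw [hI, ← hcs, ← lintegral_indicator hms.compl]
    refine lintegral_mono fun x => ?_
    by_cases hx : |f x| ≤ t
    · have : f₁ x = 0 := by simp only [hf₁, hf₂, clamp_eq_self hx, sub_self]
      simp [this]
    · rw [Set.indicator_of_mem (by exact hx)]
      exact enorm_le_iff_norm_le.2 (abs_sub_clamp_le ht0.le _)
  have hI2 : ∫⁻ x, ‖f₂ x‖ₑ ^ 2 ≤ J + ENNReal.ofReal t * I := by
    rw [hI, ← hcs, ← lintegral_add_compl _ hms, ← lintegral_const_mul _ hf.measurable.enorm]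
    refine add_le_add (lintegral_mono fun x => ?_) (lintegral_mono fun x => ?_)
    · exact pow_le_pow_left₀ zero_le (enorm_le_iff_norm_le.2 (abs_clamp_le ht0.le _)) 2
    · rw [sq]
      refine mul_le_mul' ?_ (enorm_le_iff_norm_le.2 (abs_clamp_le ht0.le _))
      rw [← ofReal_norm]
      exact ENNReal.ofReal_le_ofReal (abs_clamp_le_bound ht0.le _)
  have hw := volume_cv_gt_le hb hR hK hs hB hk hkc hL hc1 hi1 (α := B * (s / 4) / A ^ 2)
    (l := s / 4) (by positivity) (by positivity)
  have hw1 : volume {x | ENNReal.ofReal (s / 2) < ‖cv k f₁ x‖ₑ} ≤ ENNReal.ofReal (4 * W / s) * I := by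
    rw [show 2 * (s / 4) = s / 2 by ring] at hw
    refine hw.trans (mul_le_mul' ?_ hI1)
    rw [← ENNReal.ofReal_pow hA.le, ← ENNReal.ofReal_pow (by positivity), ← ENNReal.ofReal_mul
      (by positivity), ← ENNReal.ofReal_div_of_pos (by positivity),
      ← ENNReal.ofReal_div_of_pos (by positivity), show (2:ℝ≥0∞) = ENNReal.ofReal 2 by simp,
      ← ENNReal.ofReal_mul (by positivity), ← ENNReal.ofReal_div_of_pos (by positivity),
      ← ENNReal.ofReal_add (by positivity) (by positivity),
      ← ENNReal.ofReal_add (by positivity) (by positivity)]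
    refine ENNReal.ofReal_le_ofReal ?_
    have h3 : A ^ 2 / B ≤ B := by
      rw [div_le_iff₀ hB0]; nlinarith
    have h4 : A ^ 2 * (2 ^ (⌊b⌋ + 2) * (B * (s / 4) / A ^ 2)) / (s / 4) ^ 2 =
      2 ^ (⌊b⌋ + 2) * B * (4 / s) := by field_simp
    have h5 : 8 * (R + 1) ^ 2 / (B * (s / 4) / A ^ 2) = 8 * (R + 1) ^ 2 * (A ^ 2 / B) * (4 / s) := by
      field_simp
    have h6 : 2 * B / (s / 4) = 2 * B * (4 / s) := by field_simp
    rw [h4, h5, h6, hW, hc, ← add_mul, ← add_mul]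
    have h7 : (2 ^ (⌊b⌋ + 2) * B + 8 * (R + 1) ^ 2 * (A ^ 2 / B) + 2 * B) ≤
        (2 ^ (⌊b⌋ + 2) + 8 * (R + 1) ^ 2 + 2) * B := by
      have := mul_le_mul_of_nonneg_left h3 (by positivity : 0 ≤ 8 * (R + 1) ^ 2)
      linarith
    refine (mul_le_mul_of_nonneg_right h7 (by positivity)).trans (le_of_eq ?_)
    ring
  have hw2 : volume {x | ENNReal.ofReal (s / 2) ≤ ‖cv k f₂ x‖ₑ} ≤
      ENNReal.ofReal (4 * A ^ 2 / s ^ 2) * (J + ENNReal.ofReal t * I) := by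
    have h1 : volume {x | ENNReal.ofReal (s / 2) ^ 2 ≤ ‖cv k f₂ x‖ₑ ^ 2} ≤
        (∫⁻ x, ‖cv k f₂ x‖ₑ ^ 2) / ENNReal.ofReal (s / 2) ^ 2 :=
      meas_ge_le_lintegral_div
        ((continuous_cv hkcont hkc hi2).enorm.measurable.pow_const 2).aemeasurable
        (pow_ne_zero 2 (by simpa using hs0)) (ENNReal.pow_ne_top ENNReal.ofReal_ne_top)
    refine (measure_mono fun x hx => ?_).trans (h1.trans ?_)
    · exact pow_le_pow_left₀ zero_le (mem_ofPred_eq ▸ hx) 2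
    · rw [ENNReal.div_eq_inv_mul]
      refine (mul_le_mul_right ((hL f₂ hL2).trans (mul_le_mul_right hI2 _)) _).trans (le_of_eq ?_)
      rw [← mul_assoc, ← ENNReal.div_eq_inv_mul, ← ENNReal.ofReal_pow hA.le,
        ← ENNReal.ofReal_pow (by positivity), ← ENNReal.ofReal_div_of_pos (by positivity)]
      congr 2
      field_simp
      norm_num
  have hsplit : ∀ x, cv k f x = cv k f₁ x + cv k f₂ x := by
    intro x
    simp only [cv, smul_eq_mul]
    rw [← integral_add (integrable_cv_integrand hkcont hkc hi1 x)
      (integrable_cv_integrand hkcont hkc hi2 x)]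
    refine integral_congr_ae (Eventually.of_forall fun y => ?_)
    simp only [hf₁]
    ring
  calc _ ≤ volume ({x | ENNReal.ofReal (s / 2) < ‖cv k f₁ x‖ₑ} ∪
        {x | ENNReal.ofReal (s / 2) ≤ ‖cv k f₂ x‖ₑ}) := by
        refine measure_mono fun x hx => ?_
        by_contra hcon
        simp only [mem_union, Set.mem_ofPred_eq, not_or, not_lt, not_le, ← ofReal_norm] at hcon hx
        rw [ENNReal.ofReal_le_ofReal_iff (by positivity),
          ENNReal.ofReal_lt_ofReal_iff (by positivity), Real.norm_eq_abs, Real.norm_eq_abs] at hcon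
        rw [hsplit] at hx
        linarith [abs_add_le (cv k f₁ x) (cv k f₂ x), hcon.1, hcon.2]
    _ ≤ _ := (measure_union_le _ _).trans (add_le_add hw1 hw2)
    _ = _ := by
        rw [mul_add, ← mul_assoc (ENNReal.ofReal (4 * A ^ 2 / s ^ 2)) (ENNReal.ofReal t),
          ← ENNReal.ofReal_mul (by positivity), add_comm (_ * J),
          ← add_assoc, ← add_mul, ← ENNReal.ofReal_add (by positivity) (by positivity)]
        congr 3
        rw [ht, hd]
        field_simp
        ring

section
variable {E : Type*} [NormedAddCommGroup E] [NormedSpace ℝ E]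

/-- The curve `(± t, u c_± t ^ b)`. -/
def crv (b σ c u t : ℝ) : ℝ × ℝ := (σ * t, u * (c * t ^ b))

/-- Weighted averages over `1 ≤ |t| ≤ 2` along a curve. -/
def cav (b cp cm : ℝ) (ap am : ℝ → ℝ) (u : ℝ) (g : ℝ × ℝ → E) (x : ℝ × ℝ) : E :=
  ∫ t in (1:ℝ)..2, (ap t • g (x - crv b 1 cp u t) + am t • g (x - crv b (-1) cm u t))

variable {b cp cm : ℝ} {ap am : ℝ → ℝ}

theorem continuous_crv (hb : 1 < b) (σ c : ℝ) : Continuous fun q : ℝ × ℝ => crv b σ c q.1 q.2 := by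
  have := Real.continuous_rpow_const (q := b) (by linarith)
  unfold crv
  fun_prop

theorem continuous_cav_integrand (hb : 1 < b) (hap : Continuous ap) (ham : Continuous am)
    {g : ℝ × ℝ → E} (hg : Continuous g) : Continuous fun q : (ℝ × (ℝ × ℝ)) × ℝ =>
      ap q.2 • g (q.1.2 - crv b 1 cp q.1.1 q.2) + am q.2 • g (q.1.2 - crv b (-1) cm q.1.1 q.2) := by
  have h1 := continuous_crv hb 1 cp
  have h2 := continuous_crv hb (-1) cm
  have h1' : Continuous fun q : (ℝ × (ℝ × ℝ)) × ℝ => crv b 1 cp q.1.1 q.2 :=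
    h1.comp (by fun_prop : Continuous fun q : (ℝ × (ℝ × ℝ)) × ℝ => (q.1.1, q.2))
  have h2' : Continuous fun q : (ℝ × (ℝ × ℝ)) × ℝ => crv b (-1) cm q.1.1 q.2 :=
    h2.comp (by fun_prop : Continuous fun q : (ℝ × (ℝ × ℝ)) × ℝ => (q.1.1, q.2))
  fun_prop

theorem continuous_cav (hb : 1 < b) (hap : Continuous ap) (ham : Continuous am)
    {g : ℝ × ℝ → E} (hg : Continuous g) :
    Continuous fun q : ℝ × (ℝ × ℝ) => cav b cp cm ap am q.1 g q.2 :=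
  intervalIntegral.continuous_parametric_intervalIntegral_of_continuous'
    (f := fun (q : ℝ × (ℝ × ℝ)) t => ap t • g (q.2 - crv b 1 cp q.1 t) +
      am t • g (q.2 - crv b (-1) cm q.1 t)) (continuous_cav_integrand hb hap ham hg) 1 2

theorem continuous_cav_right (hb : 1 < b) (hap : Continuous ap) (ham : Continuous am) (u : ℝ)
    {g : ℝ × ℝ → E} (hg : Continuous g) : Continuous (cav b cp cm ap am u g) :=
  (continuous_cav hb hap ham hg).comp (by fun_prop : Continuous fun x : ℝ × ℝ => (u, x))

/-- The size of the support of averages of a function supported in a box of size `ρ`. -/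
def boxR (b cp cm ρ : ℝ) : ℝ := 2 + ρ + 2 * (|cp| + |cm|) * 2 ^ b

theorem abs_crv_le (hb : 1 < b) {σ c u t : ℝ} (hσ : |σ| = 1) (hc : |c| ≤ |cp| + |cm|)
    (hu : u ∈ Icc (1:ℝ) 2) (ht : t ∈ Icc (1:ℝ) 2) :
    |(crv b σ c u t).1| ≤ 2 ∧ |(crv b σ c u t).2| ≤ 2 * (|cp| + |cm|) * 2 ^ b := by
  have ht0 : 0 ≤ t := by linarith [ht.1]
  refine ⟨?_, ?_⟩
  · simp only [crv, abs_mul, hσ, one_mul, abs_of_nonneg ht0]; exact ht.2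
  · simp only [crv, abs_mul, abs_of_nonneg (Real.rpow_nonneg ht0 b)]
    rw [abs_of_nonneg (by linarith [hu.1]), mul_assoc]
    exact mul_le_mul hu.2 (mul_le_mul hc (Real.rpow_le_rpow ht0 ht.2 (by linarith))
      (by positivity) (by positivity)) (by positivity) (by norm_num)

theorem abs_le_of_cav_ne_zero (hb : 1 < b) {ρ : ℝ} {g : ℝ × ℝ → E}
    (hg : ∀ z, g z ≠ 0 → |z.1| ≤ ρ ∧ |z.2| ≤ ρ) {u : ℝ} (hu : u ∈ Icc (1:ℝ) 2)
    {z : ℝ × ℝ} (hz : cav b cp cm ap am u g z ≠ 0) :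
    |z.1| ≤ boxR b cp cm ρ ∧ |z.2| ≤ boxR b cp cm ρ := by
  by_contra hcon
  have hzero : ∀ σ c t, |σ| = 1 → |c| ≤ |cp| + |cm| → t ∈ Icc (1:ℝ) 2 →
      g (z - crv b σ c u t) = 0 := by
    intro σ c t hσ hc ht
    by_contra hne
    refine hcon ?_
    obtain ⟨h1, h2⟩ := abs_crv_le hb hσ hc hu ht
    obtain ⟨h3, h4⟩ := hg _ hne
    have h5 : 0 ≤ 2 * (|cp| + |cm|) * 2 ^ b := by positivity
    rw [abs_le] at h1 h2 h3 h4
    simp only [Prod.fst_sub, Prod.snd_sub] at h3 h4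
    simp only [boxR, abs_le]
    refine ⟨⟨?_, ?_⟩, ?_, ?_⟩ <;> linarith
  refine hz (intervalIntegral.integral_zero_ae (Eventually.of_forall fun t ht => ?_))
  rw [uIoc_of_le one_le_two] at ht
  rw [hzero 1 cp t (by simp) (by simp) ⟨ht.1.le, ht.2⟩,
    hzero (-1) cm t (by simp) (by simp) ⟨ht.1.le, ht.2⟩]
  simp

theorem hasCompactSupport_of_box {F : Type*} [Zero F] {ρ : ℝ} {g : ℝ × ℝ → F}
    (hg : ∀ z, g z ≠ 0 → |z.1| ≤ ρ ∧ |z.2| ≤ ρ) : HasCompactSupport g := by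
  refine HasCompactSupport.intro (isCompact_Icc.prod isCompact_Icc :
    IsCompact (Icc (-ρ) ρ ×ˢ Icc (-ρ) ρ)) fun x hx => ?_
  by_contra hne
  exact hx ⟨abs_le.1 (hg x hne).1, abs_le.1 (hg x hne).2⟩

theorem lintegral_enorm_cav_le (hb : 1 < b) (hap : Continuous ap) (ham : Continuous am) (u : ℝ)
    {g : ℝ × ℝ → E} (hg : Continuous g) {M : ℝ} (hM : ∀ t ∈ Icc (1:ℝ) 2, |ap t| ≤ M ∧ |am t| ≤ M) :
    ∫⁻ x, ‖cav b cp cm ap am u g x‖ₑ ≤ ENNReal.ofReal (2 * M) * ∫⁻ x, ‖g x‖ₑ := by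
  set I := ∫⁻ x, ‖g x‖ₑ with hI
  have hM0 : 0 ≤ M := (abs_nonneg _).trans (hM 1 (by norm_num)).1
  have h0 := (continuous_cav_integrand (cp := cp) (cm := cm) hb hap ham hg).comp
    (by fun_prop : Continuous fun q : (ℝ × ℝ) × ℝ => ((u, q.1), q.2))
  have h1 := continuous_crv hb 1 cp
  have h2 := continuous_crv hb (-1) cm
  calc _ ≤ ∫⁻ x, ∫⁻ t in Ioc (1:ℝ) 2, ‖ap t • g (x - crv b 1 cp u t) +
        am t • g (x - crv b (-1) cm u t)‖ₑ := lintegral_mono fun x => by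
        rw [cav, intervalIntegral.integral_of_le one_le_two]
        exact enorm_integral_le_lintegral_enorm _
    _ = ∫⁻ t in Ioc (1:ℝ) 2, ∫⁻ x, ‖ap t • g (x - crv b 1 cp u t) +
        am t • g (x - crv b (-1) cm u t)‖ₑ :=
        lintegral_lintegral_swap h0.enorm.measurable.aemeasurable
    _ ≤ ∫⁻ t in Ioc (1:ℝ) 2, ENNReal.ofReal (2 * M) * I := by
        refine setLIntegral_mono' measurableSet_Ioc fun t ht => ?_
        obtain ⟨hp, hm⟩ := hM t ⟨ht.1.le, ht.2⟩
        have e : ∀ (a : ℝ) (w : ℝ × ℝ), |a| ≤ M →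
            ∫⁻ x, ‖a‖ₑ * ‖g (x - w)‖ₑ ≤ ENNReal.ofReal M * I := fun a w ha => by
          rw [lintegral_const_mul' _ _ enorm_ne_top,
            lintegral_sub_right_eq_self (fun x => ‖g x‖ₑ) w, ← ofReal_norm]
          exact mul_le_mul_left (ENNReal.ofReal_le_ofReal ha) _
        calc _ ≤ ∫⁻ x, (‖ap t‖ₑ * ‖g (x - crv b 1 cp u t)‖ₑ +
              ‖am t‖ₑ * ‖g (x - crv b (-1) cm u t)‖ₑ) := lintegral_mono fun x => by
              rw [← enorm_smul, ← enorm_smul]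
              exact enorm_add_le _ _
          _ ≤ _ := by
              rw [lintegral_add_left]
              · rw [two_mul, ENNReal.ofReal_add hM0 hM0, add_mul]
                exact add_le_add (e _ _ hp) (e _ _ hm)
              · exact ((hg.comp (by fun_prop)).enorm.measurable).const_mul _
    _ = _ := by
        rw [setLIntegral_const, Real.volume_Ioc]; norm_num

theorem cav_comp_sub (u : ℝ) (g : ℝ × ℝ → E) (h x : ℝ × ℝ) :
    cav b cp cm ap am u g (x - h) = cav b cp cm ap am u (fun y => g (y - h)) x := by
  simp only [cav, sub_right_comm]

theorem intervalIntegrable_cav (hb : 1 < b) (hap : Continuous ap) (ham : Continuous am) (u : ℝ)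
    {g : ℝ × ℝ → E} (hg : Continuous g) (x : ℝ × ℝ) (s t : ℝ) :
    IntervalIntegrable (fun t => ap t • g (x - crv b 1 cp u t) + am t • g (x - crv b (-1) cm u t))
      volume s t :=
  ((continuous_cav_integrand hb hap ham hg).comp
    (by fun_prop : Continuous fun t : ℝ => ((u, x), t))).intervalIntegrable _ _

theorem cav_sub (hb : 1 < b) (hap : Continuous ap) (ham : Continuous am) (u : ℝ)
    {g h : ℝ × ℝ → E} (hg : Continuous g) (hh : Continuous h) (x : ℝ × ℝ) :
    cav b cp cm ap am u (fun y => g y - h y) x =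
      cav b cp cm ap am u g x - cav b cp cm ap am u h x := by
  rw [cav, cav, cav, ← intervalIntegral.integral_sub (intervalIntegrable_cav hb hap ham u hg x _ _)
    (intervalIntegrable_cav hb hap ham u hh x _ _)]
  refine intervalIntegral.integral_congr fun t _ => ?_
  simp only [smul_sub]
  abel

theorem lintegral_enorm_cav_sub_le (hb : 1 < b) (hap : Continuous ap) (ham : Continuous am) (u : ℝ)
    {g : ℝ × ℝ → E} (hg : Continuous g) {M : ℝ} (hM : ∀ t ∈ Icc (1:ℝ) 2, |ap t| ≤ M ∧ |am t| ≤ M)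
    (h : ℝ × ℝ) :
    ∫⁻ x, ‖cav b cp cm ap am u g (x - h) - cav b cp cm ap am u g x‖ₑ ≤
      ENNReal.ofReal (2 * M) * ∫⁻ x, ‖g (x - h) - g x‖ₑ := by
  have hg' : Continuous fun y => g (y - h) := hg.comp (by fun_prop)
  refine le_trans (le_of_eq (lintegral_congr fun x => ?_))
    (lintegral_enorm_cav_le (cp := cp) (cm := cm) hb hap ham u (hg'.sub hg) hM)
  rw [cav_comp_sub, ← cav_sub hb hap ham u hg' hg]
  rfl

theorem integral_cav_smul [CompleteSpace E] (hb : 1 < b) (hap : Continuous ap) (ham : Continuous am)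
    (u : ℝ) {ψ : ℝ × ℝ → ℝ} (hψ : Continuous ψ) (hψc : HasCompactSupport ψ) {h : ℝ × ℝ → E}
    (hh : Continuous h) (x : ℝ × ℝ) :
    ∫ y, cav b cp cm ap am u ψ y • h (x - y) = ∫ w, ψ w • cav b cp cm ap am u h (x - w) := by
  have hc := fun σ c => continuous_crv (b := b) hb σ c
  have hcr : ∀ σ c, Continuous fun t : ℝ => crv b σ c u t := fun σ c =>
    (hc σ c).comp (by fun_prop : Continuous fun t : ℝ => (u, t))
  have key : ∀ (a : ℝ → ℝ) (σ c : ℝ), Continuous a →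
      Integrable (fun q : (ℝ × ℝ) × ℝ => (a q.2 * ψ (q.1 - crv b σ c u q.2)) • h (x - q.1))
        (volume.prod (volume.restrict (Ioc (1:ℝ) 2))) := by
    intro a σ c ha
    have hcont : Continuous fun q : (ℝ × ℝ) × ℝ =>
        (a q.2 * ψ (q.1 - crv b σ c u q.2)) • h (x - q.1) := by
      have := (hcr σ c).comp (continuous_snd (X := ℝ × ℝ))
      simp only [Function.comp_def] at this
      fun_prop
    have hK : IsCompact ((fun q : (ℝ × ℝ) × ℝ => q.1 + crv b σ c u q.2) ''
        (tsupport ψ ×ˢ Icc 1 2)) := by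
      have := (hcr σ c).comp (continuous_snd (X := ℝ × ℝ))
      simp only [Function.comp_def] at this
      exact (hψc.isCompact.prod isCompact_Icc).image (by fun_prop)
    set S := ((fun q : (ℝ × ℝ) × ℝ => q.1 + crv b σ c u q.2) '' (tsupport ψ ×ˢ Icc 1 2)) with hS
    have hig : IntegrableOn (fun q : (ℝ × ℝ) × ℝ =>
        (a q.2 * ψ (q.1 - crv b σ c u q.2)) • h (x - q.1)) (S ×ˢ Icc 1 2)
        (volume.prod volume) := hcont.continuousOn.integrableOn_compact (hK.prod isCompact_Icc)
    have h2 : IntegrableOn (fun q : (ℝ × ℝ) × ℝ =>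
        (a q.2 * ψ (q.1 - crv b σ c u q.2)) • h (x - q.1)) (univ ×ˢ Ioc 1 2)
        (volume.prod volume) := by
      refine (hig.mono_set (prod_mono le_rfl Ioc_subset_Icc_self)).of_forall_sdiff_eq_zero
        (MeasurableSet.univ.prod measurableSet_Ioc) fun q hq => ?_
      have : ψ (q.1 - crv b σ c u q.2) = 0 := by
        by_contra hne
        refine hq.2 ⟨⟨(q.1 - crv b σ c u q.2, q.2), ⟨subset_tsupport _ hne, ?_⟩, ?_⟩, hq.1.2⟩
        · exact Ioc_subset_Icc_self hq.1.2
        · simp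
      rw [this]; simp
    rw [IntegrableOn, ← Measure.prod_restrict, Measure.restrict_univ] at h2
    exact h2
  have hp := key ap 1 cp hap
  have hm := key am (-1) cm ham
  calc _ = ∫ y, ∫ t in Ioc (1:ℝ) 2, ((ap t * ψ (y - crv b 1 cp u t)) • h (x - y) +
        (am t * ψ (y - crv b (-1) cm u t)) • h (x - y)) := by
        refine integral_congr_ae (Eventually.of_forall fun y => ?_)
        simp only
        rw [cav, intervalIntegral.integral_of_le one_le_two, ← integral_smul_const]
        simp only [add_smul, smul_eq_mul]
    _ = ∫ t in Ioc (1:ℝ) 2, ∫ y, ((ap t * ψ (y - crv b 1 cp u t)) • h (x - y) +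
        (am t * ψ (y - crv b (-1) cm u t)) • h (x - y)) :=
        integral_integral_swap (hp.add hm)
    _ = ∫ t in Ioc (1:ℝ) 2, ∫ w, ψ w • (ap t • h (x - w - crv b 1 cp u t) +
        am t • h (x - w - crv b (-1) cm u t)) := by
        refine integral_congr_ae (Eventually.of_forall fun t => ?_)
        have hi : ∀ (a : ℝ) (v : ℝ × ℝ), Integrable fun w => ψ w • a • h (x - w - v) := fun a v =>
          (by fun_prop : Continuous fun w => ψ w • a • h (x - w - v)).integrable_of_hasCompactSupport
            hψc.smul_right
        have e : ∀ (a : ℝ) (v : ℝ × ℝ), (fun w => (a * ψ (w - v)) • h (x - w)) =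
            fun w => (fun w => ψ w • a • h (x - w - v)) (w - v) := fun a v => by
          funext w
          simp only [sub_sub, sub_add_cancel]
          rw [smul_smul, mul_comm]
        have hi' : ∀ (a : ℝ) (v : ℝ × ℝ), Integrable fun w => (a * ψ (w - v)) • h (x - w) :=
          fun a v => by rw [e]; exact (hi a v).comp_sub_right v
        have e' : ∀ (a : ℝ) (v : ℝ × ℝ), ∫ w, (a * ψ (w - v)) • h (x - w) =
            ∫ w, ψ w • a • h (x - w - v) := fun a v => by
          rw [e, integral_sub_right_eq_self (fun w => ψ w • a • h (x - w - v)) v]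
        simp only [smul_add]
        rw [integral_add (hi' _ _) (hi' _ _), e', e', ← integral_add (hi _ _) (hi _ _)]
    _ = ∫ w, ∫ t in Ioc (1:ℝ) 2, ψ w • (ap t • h (x - w - crv b 1 cp u t) +
        am t • h (x - w - crv b (-1) cm u t)) := by
        refine (integral_integral_swap ?_).symm
        have hcont : Continuous fun q : (ℝ × ℝ) × ℝ => ψ q.1 • (ap q.2 • h (x - q.1 - crv b 1 cp u q.2)
            + am q.2 • h (x - q.1 - crv b (-1) cm u q.2)) := by
          have h1 := (hcr 1 cp).comp (continuous_snd (X := ℝ × ℝ))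
          have h2 := (hcr (-1) cm).comp (continuous_snd (X := ℝ × ℝ))
          simp only [Function.comp_def] at h1 h2
          fun_prop
        have h2 : IntegrableOn (fun q : (ℝ × ℝ) × ℝ => ψ q.1 • (ap q.2 • h (x - q.1 - crv b 1 cp u q.2)
            + am q.2 • h (x - q.1 - crv b (-1) cm u q.2))) (univ ×ˢ Ioc 1 2)
            (volume.prod volume) := by
          refine ((hcont.continuousOn.integrableOn_compact (hψc.isCompact.prod isCompact_Icc)).mono_set
            (prod_mono le_rfl Ioc_subset_Icc_self :
              tsupport ψ ×ˢ Ioc (1:ℝ) 2 ⊆ tsupport ψ ×ˢ Icc 1 2)).of_forall_sdiff_eq_zero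
            (MeasurableSet.univ.prod measurableSet_Ioc) fun q hq => ?_
          have : ψ q.1 = 0 := by
            by_contra hne
            exact hq.2 ⟨subset_tsupport _ hne, hq.1.2⟩
          rw [this, zero_smul]
        rw [IntegrableOn, ← Measure.prod_restrict, Measure.restrict_univ] at h2
        exact h2
    _ = _ := by
        refine integral_congr_ae (Eventually.of_forall fun w => ?_)
        simp only
        rw [integral_smul, cav, intervalIntegral.integral_of_le one_le_two]

theorem ft_cav (hb : 1 < b) (hap : Continuous ap) (ham : Continuous am) (u : ℝ)
    {ψ : ℝ × ℝ → ℝ} (hψ : Continuous ψ) (hψc : HasCompactSupport ψ) (ξ : ℝ × ℝ) :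
    ft (cav b cp cm ap am u ψ) ξ = ft ψ ξ * cav b cp cm ap am u (ex ξ) 0 := by
  have h := integral_cav_smul (cp := cp) (cm := cm) hb hap ham u hψ hψc (continuous_ex_right ξ) 0
  have e : ∀ y, ex (-ξ) y = ex ξ (0 - y) := fun y => by simp [ex]
  simp only [ft, e, ← Complex.real_smul]
  rw [h, ← integral_mul_const]
  refine integral_congr_ae (Eventually.of_forall fun w => ?_)
  simp only
  have : cav b cp cm ap am u (ex ξ) (0 - w) = ex ξ (0 - w) * cav b cp cm ap am u (ex ξ) 0 := by
    rw [cav, cav, ← intervalIntegral.integral_const_mul]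
    refine intervalIntegral.integral_congr fun t _ => ?_
    simp only [sub_eq_add_neg, ex_add_right, Complex.real_smul, zero_add]
    ring
  rw [this, Complex.real_smul, Complex.real_smul]
  ring
end

section
/-- Anisotropic `L¹`-normalized rescaling. -/
def scl (l m : ℝ) (g : ℝ × ℝ → ℝ) (z : ℝ × ℝ) : ℝ := (l * m) * g (l * z.1, m * z.2)

theorem continuous_scl (l m : ℝ) {g : ℝ × ℝ → ℝ} (hg : Continuous g) : Continuous (scl l m g) := by
  unfold scl; fun_prop

theorem map_mul_mul_volume {l m : ℝ} (hl : 0 < l) (hm : 0 < m) :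
    Measure.map (fun z : ℝ × ℝ => (l * z.1, m * z.2)) volume =
      ENNReal.ofReal (l * m)⁻¹ • volume := by
  have h := Measure.map_prod_map (volume : Measure ℝ) (volume : Measure ℝ)
    (measurable_const_mul l) (measurable_const_mul m)
  have e : (fun z : ℝ × ℝ => (l * z.1, m * z.2)) = Prod.map (fun x => l * x) fun x => m * x := rfl
  rw [e, Measure.volume_eq_prod, ← h, Real.map_volume_mul_left hl.ne', Real.map_volume_mul_left hm.ne',
    Measure.prod_smul_left, Measure.prod_smul_right, smul_smul, abs_of_pos (inv_pos.2 hl),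
    abs_of_pos (inv_pos.2 hm), ← ENNReal.ofReal_mul (inv_pos.2 hl).le, mul_inv]

theorem measurableEmbedding_mul_mul {l m : ℝ} (hl : 0 < l) (hm : 0 < m) :
    MeasurableEmbedding fun z : ℝ × ℝ => (l * z.1, m * z.2) :=
  ((Homeomorph.mulLeft₀ l hl.ne').prodCongr (Homeomorph.mulLeft₀ m hm.ne')).measurableEmbedding

theorem integral_comp_mul_mul {E : Type*} [NormedAddCommGroup E] [NormedSpace ℝ E] {l m : ℝ}
    (hl : 0 < l) (hm : 0 < m) (g : ℝ × ℝ → E) :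
    ∫ z : ℝ × ℝ, g (l * z.1, m * z.2) = (l * m)⁻¹ • ∫ z, g z := by
  rw [← (measurableEmbedding_mul_mul hl hm).integral_map, map_mul_mul_volume hl hm,
    integral_smul_measure, ENNReal.toReal_ofReal (by positivity)]

theorem lintegral_comp_mul_mul {l m : ℝ} (hl : 0 < l) (hm : 0 < m) (g : ℝ × ℝ → ℝ≥0∞) :
    ∫⁻ z : ℝ × ℝ, g (l * z.1, m * z.2) = ENNReal.ofReal (l * m)⁻¹ * ∫⁻ z, g z := by
  rw [← (measurableEmbedding_mul_mul hl hm).lintegral_map, map_mul_mul_volume hl hm,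
    lintegral_smul_measure, smul_eq_mul]

theorem integral_scl_smul {E : Type*} [NormedAddCommGroup E] [NormedSpace ℝ E] {l m : ℝ}
    (hl : 0 < l) (hm : 0 < m) (g : ℝ × ℝ → ℝ) (F : ℝ × ℝ → E) :
    ∫ z, scl l m g z • F z = ∫ z, g z • F (z.1 / l, z.2 / m) := by
  have h := integral_comp_mul_mul hl hm fun z => (l * m) • g z • F (z.1 / l, z.2 / m)
  rw [integral_smul (l * m) fun z => g z • F (z.1 / l, z.2 / m), smul_smul,
    inv_mul_cancel₀ (by positivity), one_smul] at h
  rw [← h]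
  refine integral_congr_ae (Eventually.of_forall fun z => ?_)
  simp only [scl, smul_smul, mul_div_cancel_left₀ _ hl.ne', mul_div_cancel_left₀ _ hm.ne']

theorem ft_scl {l m : ℝ} (hl : 0 < l) (hm : 0 < m) (g : ℝ × ℝ → ℝ) (ξ : ℝ × ℝ) :
    ft (scl l m g) ξ = ft g (ξ.1 / l, ξ.2 / m) := by
  have h := integral_scl_smul hl hm g (ex (-ξ))
  simp only [Complex.real_smul] at h
  rw [ft, h, ft]
  refine integral_congr_ae (Eventually.of_forall fun z => ?_)
  simp only [ex, Prod.fst_neg, Prod.snd_neg]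
  congr 5 <;> ring

theorem lintegral_enorm_scl_sub {l m : ℝ} (hl : 0 < l) (hm : 0 < m) (g : ℝ × ℝ → ℝ) (h : ℝ × ℝ) :
    ∫⁻ z, ‖scl l m g (z - h) - scl l m g z‖ₑ =
      ∫⁻ z, ‖g (z - (l * h.1, m * h.2)) - g z‖ₑ := by
  have e := lintegral_comp_mul_mul hl hm fun z =>
    ENNReal.ofReal (l * m) * ‖g (z - (l * h.1, m * h.2)) - g z‖ₑ
  rw [lintegral_const_mul' (ENNReal.ofReal (l * m)) (fun z => ‖g (z - (l * h.1, m * h.2)) - g z‖ₑ)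
    ENNReal.ofReal_ne_top, ← mul_assoc, ← ENNReal.ofReal_mul (by positivity), inv_mul_cancel₀ (by positivity), ENNReal.ofReal_one,
    one_mul] at e
  rw [← e]
  refine lintegral_congr fun z => ?_
  have h1 : ENNReal.ofReal (l * m) = ‖l * m‖ₑ := by
    rw [← ofReal_norm, Real.norm_of_nonneg (by positivity)]
  rw [h1, ← enorm_mul]
  simp only [scl, Prod.fst_sub, Prod.snd_sub, Prod.mk_sub_mk]
  congr 1
  ring_nf

/-- A `C¹` bump has `L¹` modulus of continuity `O(min(1, |h|))`. -/
theorem exists_lintegral_sub_le {g : ℝ × ℝ → ℝ} (hg : ContDiff ℝ 1 g) (hgc : HasCompactSupport g) :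
    ∃ C, 0 ≤ C ∧ ∀ h, ∫⁻ z, ‖g (z - h) - g z‖ₑ ≤ ENNReal.ofReal (C * min 1 (nrm h)) := by
  obtain ⟨L, hL⟩ := hg.lipschitzWith_of_hasCompactSupport hgc one_ne_zero
  obtain ⟨ρ, hρ⟩ := hgc.isCompact.isBounded.subset_closedBall 0
  have hig : Integrable g := hg.continuous.integrable_of_hasCompactSupport hgc
  set V := volume.real (Metric.closedBall (0 : ℝ × ℝ) (ρ + 1)) with hV
  set I := ∫ z, ‖g z‖ with hI
  have hI0 : 0 ≤ I := integral_nonneg fun z => norm_nonneg _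
  have hIe : ∫⁻ z, ‖g z‖ₑ = ENNReal.ofReal I := (ofReal_integral_norm_eq_lintegral_enorm hig).symm
  refine ⟨L * V + 2 * I, by positivity, fun h => ?_⟩
  rcases le_total 1 (nrm h) with h1 | h1
  · rw [min_eq_left h1, mul_one]
    calc _ ≤ ∫⁻ z, (‖g (z - h)‖ₑ + ‖g z‖ₑ) := lintegral_mono fun z => enorm_sub_le
      _ = ENNReal.ofReal (2 * I) := by
        rw [lintegral_add_right _ hg.continuous.enorm.measurable,
          lintegral_sub_right_eq_self (fun z => ‖g z‖ₑ) h, hIe, two_mul, ENNReal.ofReal_add hI0 hI0]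
      _ ≤ _ := ENNReal.ofReal_le_ofReal (by nlinarith [show (0:ℝ) ≤ L * V by positivity])
  · rw [min_eq_right h1]
    have hn : ‖h‖ ≤ nrm h := by
      rw [Prod.norm_def, nrm]
      exact max_le (by simp) (by simp)
    calc _ ≤ ∫⁻ z, (Metric.closedBall (0 : ℝ × ℝ) (ρ + 1)).indicator
          (fun _ => ENNReal.ofReal (L * nrm h)) z := lintegral_mono fun z => by
          by_cases hz : z ∈ Metric.closedBall (0 : ℝ × ℝ) (ρ + 1)
          · rw [indicator_of_mem hz, ← ofReal_norm]
            refine ENNReal.ofReal_le_ofReal ((hL.norm_sub_le _ _).trans ?_)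
            rw [sub_sub_cancel_left, norm_neg]
            gcongr
          · have hz' : ρ + 1 < ‖z‖ := by simpa using hz
            have e1 : g z = 0 := by
              by_contra hne
              have := hρ (subset_tsupport _ hne)
              simp only [Metric.mem_closedBall, dist_zero_right] at this
              linarith
            have e2 : g (z - h) = 0 := by
              by_contra hne
              have := hρ (subset_tsupport _ hne)
              simp only [Metric.mem_closedBall, dist_zero_right] at this
              linarith [norm_sub_norm_le z h]
            simp [e1, e2]
      _ = ENNReal.ofReal (L * nrm h * V) := by
          rw [lintegral_indicator measurableSet_closedBall, setLIntegral_const, hV, measureReal_def,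
            ENNReal.ofReal_mul (p := L * nrm h) (mul_nonneg L.2 (nrm_nonneg h)),
            ENNReal.ofReal_toReal (measure_closedBall_lt_top).ne]
      _ ≤ _ := ENNReal.ofReal_le_ofReal (by
          nlinarith [mul_nonneg hI0 (nrm_nonneg h)])

theorem exists_norm_ft_le_min {g : ℝ × ℝ → ℝ} (hg : Continuous g) (hgc : HasCompactSupport g)
    (h0 : ∫ z, g z = 0) : ∃ C, 0 ≤ C ∧ ∀ ζ, ‖ft g ζ‖ ≤ C * min 1 (nrm ζ) := by
  obtain ⟨ρ, hρ⟩ := hgc.isCompact.isBounded.subset_closedBall 0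
  have hig : Integrable g := hg.integrable_of_hasCompactSupport hgc
  set I := ∫ z, |g z| with hI
  have hI0 : 0 ≤ I := integral_nonneg fun z => abs_nonneg _
  refine ⟨I + I * |ρ|, by positivity, fun ζ => ?_⟩
  have hn := nrm_nonneg ζ
  rcases le_total 1 (nrm ζ) with h1 | h1
  · rw [min_eq_left h1]
    refine (norm_ft_le g ζ).trans ?_
    nlinarith [mul_nonneg hI0 (abs_nonneg ρ)]
  · rw [min_eq_right h1]
    have hi1 : Integrable fun y => (g y : ℂ) * ex (-ζ) y :=
      ((Complex.continuous_ofReal.comp hg).mul (continuous_ex_right _)).integrable_of_hasCompactSupport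
        ((hgc.comp_left (g := fun x : ℝ => (x : ℂ)) (by simp)).mul_right)
    have e : ft g ζ = ∫ y, (g y : ℂ) * (ex (-ζ) y - ex (-ζ) 0) := by
      have hi2 : Integrable fun y => (g y : ℂ) * ex (-ζ) 0 := hig.ofReal.mul_const _
      simp only [mul_sub]
      rw [integral_sub hi1 hi2, integral_mul_const, integral_complex_ofReal, h0, ft]
      simp
    rw [e]
    calc _ ≤ ∫ y, |g y| * (|ρ| * nrm ζ) := by
          refine norm_integral_le_of_norm_le (hig.abs.mul_const _) (Eventually.of_forall fun y => ?_)
          rw [norm_mul, Complex.norm_real, Real.norm_eq_abs]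
          by_cases hy : g y = 0
          · simp [hy]
          · refine mul_le_mul_of_nonneg_left ((norm_ex_sub_le _ _ _).trans ?_) (abs_nonneg _)
            have := hρ (subset_tsupport _ hy)
            rw [Metric.mem_closedBall, dist_zero_right, Prod.norm_def, max_le_iff] at this
            have h1 : |y.1| ≤ |ρ| := this.1.trans (le_abs_self _)
            have h2 : |y.2| ≤ |ρ| := this.2.trans (le_abs_self _)
            simp only [Prod.fst_zero, Prod.snd_zero, sub_zero, Prod.fst_neg, Prod.snd_neg]
            refine (abs_add_le _ _).trans ?_
            rw [abs_mul, abs_mul, abs_neg, abs_neg, nrm, mul_add]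
            gcongr
      _ = I * (|ρ| * nrm ζ) := by rw [integral_mul_const]
      _ ≤ _ := by nlinarith [mul_nonneg hI0 hn]
end

section
/-- The `j`-th dyadic dilate of a kernel. -/
def kdil (b : ℝ) (j : ℤ) (k : ℝ × ℝ → ℝ) : ℝ × ℝ → ℝ := scl ((2:ℝ) ^ j)⁻¹ (((2:ℝ) ^ j) ^ b)⁻¹ k

theorem continuous_kdil (b : ℝ) (j : ℤ) {k : ℝ × ℝ → ℝ} (hk : Continuous k) :
    Continuous (kdil b j k) := continuous_scl _ _ hk

theorem ft_kdil (b : ℝ) (j : ℤ) (k : ℝ × ℝ → ℝ) (ξ : ℝ × ℝ) :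
    ft (kdil b j k) ξ = ft k (dil b ((2:ℝ) ^ j) ξ) := by
  rw [kdil, ft_scl (by positivity) (by positivity), dil, div_inv_eq_mul, div_inv_eq_mul, mul_comm,
    mul_comm ξ.2]

theorem abs_le_of_kdil_ne_zero {b : ℝ} {j : ℤ} {k : ℝ × ℝ → ℝ} {R : ℝ}
    (hk : ∀ z, k z ≠ 0 → |z.1| ≤ R ∧ |z.2| ≤ R) {z : ℝ × ℝ} (hz : kdil b j k z ≠ 0) :
    |z.1| ≤ R * (2:ℝ) ^ j ∧ |z.2| ≤ R * ((2:ℝ) ^ j) ^ b := by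
  obtain ⟨h1, h2⟩ := hk _ (right_ne_zero_of_mul hz)
  have p1 : (0:ℝ) < 2 ^ j := by positivity
  have p2 : (0:ℝ) < ((2:ℝ) ^ j) ^ b := by positivity
  rw [abs_mul, abs_inv, abs_of_pos p1, inv_mul_le_iff₀ p1, mul_comm] at h1
  rw [abs_mul, abs_inv, abs_of_pos p2, inv_mul_le_iff₀ p2, mul_comm] at h2
  exact ⟨h1, h2⟩

theorem hasCompactSupport_kdil {b : ℝ} (j : ℤ) {k : ℝ × ℝ → ℝ} {R : ℝ} (hR : 0 ≤ R)
    (hk : ∀ z, k z ≠ 0 → |z.1| ≤ R ∧ |z.2| ≤ R) : HasCompactSupport (kdil b j k) := by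
  refine hasCompactSupport_of_box (ρ := R * (2:ℝ) ^ j + R * ((2:ℝ) ^ j) ^ b) fun z hz => ?_
  obtain ⟨h1, h2⟩ := abs_le_of_kdil_ne_zero hk hz
  exact ⟨h1.trans (le_add_of_nonneg_right (by positivity)),
    h2.trans (le_add_of_nonneg_left (by positivity))⟩

theorem hasCompactSupport_finsetSum {ι : Type*} {K : ι → ℝ × ℝ → ℝ} (F : Finset ι)
    (hK : ∀ j, HasCompactSupport (K j)) : HasCompactSupport fun x => ∑ j ∈ F, K j x := by
  induction F using Finset.induction_on with
  | empty => exact HasCompactSupport.zero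
  | insert j F hj ih =>
    simp only [Finset.sum_insert hj]
    exact (hK j).add ih

theorem ft_finsetSum {ι : Type*} {K : ι → ℝ × ℝ → ℝ} (F : Finset ι)
    (hK : ∀ j, Integrable (K j)) (ξ : ℝ × ℝ) :
    ft (fun x => ∑ j ∈ F, K j x) ξ = ∑ j ∈ F, ft (K j) ξ := by
  simp only [ft, Complex.ofReal_sum, Finset.sum_mul]
  refine integral_finsetSum _ fun j _ => (hK j).ofReal.mul_bdd (c := 1) ?_ ?_
  · exact (continuous_ex_right _).aestronglyMeasurable
  · exact Eventually.of_forall fun y => (norm_ex _ _).le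

theorem sum_filter_lt_geometric_le {q : ℝ} (hq0 : 0 ≤ q) (hq1 : q < 1) (F : Finset ℤ) (i : ℤ) :
    ∑ j ∈ F with i < j, q ^ (j - i).toNat ≤ (1 - q)⁻¹ := by
  rw [← tsum_geometric_of_lt_one hq0 hq1]
  have hinj : Set.InjOn (fun j : ℤ => (j - i).toNat) ({j ∈ F | i < j} : Finset ℤ) := by
    intro x hx y hy hxy
    simp only [Finset.coe_filter, Set.mem_ofPred_eq] at hx hy hxy
    omega
  rw [← Finset.sum_image (f := fun n => q ^ n) hinj]
  exact (summable_geometric_of_lt_one hq0 hq1).sum_le_tsum _ fun n _ => pow_nonneg hq0 n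

theorem min_one_le_rpow {x ε : ℝ} (hx : 0 ≤ x) (h0 : 0 < ε) (h1 : ε ≤ 1) : min 1 x ≤ x ^ ε := by
  rcases le_total 1 x with h | h
  · rw [min_eq_left h]; exact Real.one_le_rpow h h0.le
  · rw [min_eq_right h]
    rcases hx.eq_or_lt with rfl | hx
    · exact Real.rpow_nonneg le_rfl _
    · conv_lhs => rw [← Real.rpow_one x]
      exact Real.rpow_le_rpow_of_exponent_ge hx h h1

theorem nrm_inv_dil_le {b : ℝ} (hb : 1 < b) {i j : ℤ} (hij : i < j) {h : ℝ × ℝ}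
    (h1 : |h.1| ≤ (2:ℝ) ^ i) (h2 : |h.2| ≤ ((2:ℝ) ^ i) ^ b) :
    nrm (((2:ℝ) ^ j)⁻¹ * h.1, (((2:ℝ) ^ j) ^ b)⁻¹ * h.2) ≤ 2 * (1 / 2) ^ (j - i).toNat := by
  have e : ((2:ℝ) ^ j)⁻¹ * (2:ℝ) ^ i = (1 / 2) ^ (j - i).toNat := by
    rw [← zpow_natCast, Int.toNat_of_nonneg (by omega), one_div, inv_zpow', neg_sub,
      zpow_sub₀ two_ne_zero]
    ring
  set q := ((1:ℝ) / 2) ^ (j - i).toNat with hq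
  have hq0 : 0 ≤ q := by positivity
  have hq1 : q ≤ 1 := pow_le_one₀ (by norm_num) (by norm_num)
  have hqb : q ^ b ≤ q := by
    rcases hq0.eq_or_lt with h | h
    · rw [← h, Real.zero_rpow (by linarith)]
    · conv_rhs => rw [← Real.rpow_one q]
      exact Real.rpow_le_rpow_of_exponent_ge h hq1 hb.le
  have e2 : (((2:ℝ) ^ j) ^ b)⁻¹ * ((2:ℝ) ^ i) ^ b = q ^ b := by
    rw [← e, Real.mul_rpow (by positivity) (by positivity), Real.inv_rpow (by positivity)]
  have a1 : |((2:ℝ) ^ j)⁻¹ * h.1| ≤ q := by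
    rw [abs_mul, abs_of_pos (by positivity), ← e]; gcongr
  have a2 : |(((2:ℝ) ^ j) ^ b)⁻¹ * h.2| ≤ q := by
    rw [abs_mul, abs_of_pos (by positivity)]
    refine le_trans ?_ (e2.le.trans hqb)
    gcongr
  simp only [nrm]
  linarith

theorem exists_lintegral_cv_kdil_le {b : ℝ} (hb : 1 < b) {R : ℝ} (hR : 0 ≤ R) {p : ℝ} (hp1 : 1 < p)
    (hp2 : p ≤ 2) {ε : ℝ} (h0 : 0 < ε) (h1 : ε ≤ 1) :
    ∃ C, 0 ≤ C ∧ ∀ (k : ℝ × ℝ → ℝ) (D M c : ℝ) (F : Finset ℤ), Continuous k →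
      (∀ z, k z ≠ 0 → |z.1| ≤ R ∧ |z.2| ≤ R) → 0 < D → 1 ≤ M → 0 ≤ c →
      (∀ ξ, ‖ft k ξ‖ ≤ D * M ^ (-(1/2) : ℝ) * wt (c * nrm ξ)) →
      (∀ h, ∫⁻ z, ‖k (z - h) - k z‖ₑ ≤ ENNReal.ofReal (D * min 1 (M * nrm h))) →
      ∀ f : ℝ × ℝ → ℝ, Continuous f → Integrable f → MemLp f 2 →
        ∫⁻ x, ‖cv (fun x => ∑ j ∈ F, kdil b j k x) f x‖ₑ ^ p ≤
          ENNReal.ofReal (C * D ^ p * M ^ (ε - (p - 1))) * ∫⁻ x, ‖f x‖ₑ ^ p := by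
  obtain ⟨C, hC, H⟩ := exists_lintegral_cv_rpow_le hb hR hp1 hp2
  set q := ((1:ℝ) / 2) ^ ε with hq
  have hq0 : 0 ≤ q := by positivity
  have hq1 : q < 1 := Real.rpow_lt_one (by norm_num) (by norm_num) h0
  set S := 2 * (1 - q)⁻¹ with hS
  have hS0 : 0 ≤ S := mul_nonneg two_pos.le (inv_nonneg.2 (by linarith))
  refine ⟨C * ((8 + S) ^ (2 - p) * 8 ^ (2 * (p - 1))), by positivity,
    fun k D M c F hk hbox hD hM hc hft htr f hf hfi hf2 => ?_⟩
  have hM0 : 0 < M := by linarith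
  have hMe : 1 ≤ M ^ ε := Real.one_le_rpow hM h0.le
  have hMh : M ^ (-(1/2) : ℝ) ≤ 1 := Real.rpow_le_one_of_one_le_of_nonpos hM (by norm_num)
  have hMh0 : 0 < M ^ (-(1/2) : ℝ) := by positivity
  have hcs : ∀ j, HasCompactSupport (kdil b j k) := fun j => hasCompactSupport_kdil j hR hbox
  have hci : ∀ j, Continuous (kdil b j k) := fun j => continuous_kdil b j hk
  have key := H (fun j => kdil b j k) F (8 * D * M ^ (-(1/2) : ℝ)) ((8 + S) * D * M ^ ε) hci
    (fun j z hz => abs_le_of_kdil_ne_zero hbox hz) (by positivity) ?_ ?_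
    (hasCompactSupport_finsetSum F hcs) ?_ f hf hfi hf2
  · refine key.trans (mul_le_mul_left (ENNReal.ofReal_le_ofReal ?_) _)
    have eD : D ^ (2 - p) * D ^ (2 * (p - 1)) = D ^ p := by
      rw [← Real.rpow_add hD]; congr 1; ring
    have eM : M ^ (ε * (2 - p)) * M ^ (-(1/2) * (2 * (p - 1))) ≤ M ^ (ε - (p - 1)) := by
      rw [← Real.rpow_add hM0]
      exact Real.rpow_le_rpow_of_exponent_le hM (by nlinarith)
    rw [Real.mul_rpow (by positivity) (by positivity), Real.mul_rpow (by positivity) hD.le,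
      Real.mul_rpow (by positivity) (by positivity), Real.mul_rpow (by positivity) hD.le,
      ← Real.rpow_mul hM0.le, ← Real.rpow_mul hM0.le, ← eD]
    calc _ = C * ((8 + S) ^ (2 - p) * 8 ^ (2 * (p - 1))) * (D ^ (2 - p) * D ^ (2 * (p - 1))) *
          (M ^ (ε * (2 - p)) * M ^ (-(1/2) * (2 * (p - 1)))) := by ring
      _ ≤ _ := by gcongr
  · calc 8 * D * M ^ (-(1/2) : ℝ) ≤ 8 * D * 1 := by gcongr
      _ ≤ (8 + S) * D * M ^ ε := by gcongr; linarith
  · intro i h hh1 hh2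
    have hterm : ∀ j ∈ ({j ∈ F | i < j} : Finset ℤ), ∫⁻ z, ‖kdil b j k (z - h) - kdil b j k z‖ₑ ≤
        ENNReal.ofReal (2 * D * M ^ ε * q ^ (j - i).toNat) := by
      intro j hj
      rw [Finset.mem_filter] at hj
      rw [kdil, lintegral_enorm_scl_sub (by positivity) (by positivity)]
      refine (htr _).trans (ENNReal.ofReal_le_ofReal ?_)
      have hn := nrm_inv_dil_le hb hj.2 hh1 hh2
      set n := nrm (((2:ℝ) ^ j)⁻¹ * h.1, (((2:ℝ) ^ j) ^ b)⁻¹ * h.2)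
      have hn0 : 0 ≤ n := nrm_nonneg _
      have e1 : min 1 (M * n) ≤ 2 * M ^ ε * q ^ (j - i).toNat := by
        refine (min_one_le_rpow (by positivity) h0 h1).trans ?_
        calc (M * n) ^ ε ≤ (M * (2 * (1 / 2) ^ (j - i).toNat)) ^ ε :=
              Real.rpow_le_rpow (by positivity) (by gcongr) h0.le
          _ = 2 ^ ε * M ^ ε * q ^ (j - i).toNat := by
              rw [Real.mul_rpow hM0.le (by positivity), Real.mul_rpow (by norm_num) (by positivity), hq,
                ← Real.rpow_natCast, ← Real.rpow_natCast, ← Real.rpow_mul (by norm_num),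
                ← Real.rpow_mul (by norm_num), mul_comm ε]
              ring
          _ ≤ _ := by
              gcongr
              calc (2:ℝ) ^ ε ≤ 2 ^ (1:ℝ) := Real.rpow_le_rpow_of_exponent_le one_le_two h1
                _ = 2 := Real.rpow_one 2
      calc D * min 1 (M * n) ≤ D * (2 * M ^ ε * q ^ (j - i).toNat) := by gcongr
        _ = _ := by ring
    refine (Finset.sum_le_sum hterm).trans ?_
    rw [← ENNReal.ofReal_sum_of_nonneg fun j _ => by positivity, ← Finset.mul_sum]
    refine ENNReal.ofReal_le_ofReal ?_
    calc 2 * D * M ^ ε * ∑ j ∈ F with i < j, q ^ (j - i).toNat ≤ 2 * D * M ^ ε * (1 - q)⁻¹ := by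
          gcongr
          exact sum_filter_lt_geometric_le hq0 hq1 F i
      _ = S * D * M ^ ε := by rw [hS]; ring
      _ ≤ _ := by gcongr; linarith
  · intro g hg
    refine lintegral_cv_sq_le (continuous_finsetSum _ fun j _ => hci j)
      (hasCompactSupport_finsetSum F hcs) (fun ζ => ?_) hg
    rw [ft_finsetSum F fun j => (hci j).integrable_of_hasCompactSupport (hcs j)]
    calc _ ≤ ∑ j ∈ F, D * M ^ (-(1/2) : ℝ) * wt (c * nrm (dil b ((2:ℝ) ^ j) ζ)) :=
          norm_sum_le_of_le _ fun j _ => by rw [ft_kdil]; exact hft _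
      _ ≤ D * M ^ (-(1/2) : ℝ) * 8 := by
          rw [← Finset.mul_sum]
          gcongr
          exact sum_wt_nrm_le hb hc ζ F
      _ = _ := by ring
end

section
/-- The power weight `α t ^ e` on `t ≥ 1`, extended continuously. -/
def pw (α e t : ℝ) : ℝ := α * max t 1 ^ e

theorem continuous_pw (α e : ℝ) : Continuous (pw α e) := by
  refine continuous_const.mul ((continuous_id.max continuous_const).rpow_const fun t => Or.inl ?_)
  have : (1:ℝ) ≤ max (id t) 1 := le_max_right _ _
  linarith

theorem pw_of_one_le (α e : ℝ) {t : ℝ} (ht : 1 ≤ t) : pw α e t = α * t ^ e := by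
  rw [pw, max_eq_left ht]

theorem abs_pw_le (α e : ℝ) {t : ℝ} (ht : t ∈ Icc (1:ℝ) 2) : |pw α e t| ≤ |α| * 2 ^ |e| := by
  rw [pw_of_one_le α e ht.1, abs_mul, abs_of_nonneg (Real.rpow_nonneg (by linarith [ht.1]) _)]
  gcongr
  calc t ^ e ≤ t ^ |e| := Real.rpow_le_rpow_of_exponent_le ht.1 (le_abs_self e)
    _ ≤ 2 ^ |e| := Real.rpow_le_rpow (by linarith [ht.1]) ht.2 (abs_nonneg e)

variable {b cp cm : ℝ}

theorem exists_norm_cav_ex_le (hb : 1 < b) (hcp : cp ≠ 0) (hcm : cm ≠ 0) (αp αm e : ℝ) :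
    ∃ C, 0 ≤ C ∧ ∀ u ∈ Icc (1:ℝ) 2, ∀ ξ,
      ‖cav b cp cm (pw αp e) (pw αm e) u (ex ξ) 0‖ * √(nrm ξ) ≤ C := by
  obtain ⟨C₁, h₁, H₁⟩ := exists_norm_integral_rpow_ex_le hb e hcp
  obtain ⟨C₂, h₂, H₂⟩ := exists_norm_integral_rpow_ex_le hb e hcm
  refine ⟨|αp| * C₁ + |αm| * C₂, by positivity, fun u hu ξ => ?_⟩
  have hu0 : 0 ≤ u := by linarith [hu.1]
  have habs : ∀ c : ℝ, |c| ≤ |-(u * c)| := fun c => by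
    rw [abs_neg, abs_mul, abs_of_nonneg hu0]
    nlinarith [abs_nonneg c, hu.1]
  have hcont : ∀ σ c : ℝ, IntervalIntegrable (fun t : ℝ => ((t ^ e : ℝ) : ℂ) * ex ξ (σ * t, c * t ^ b))
      volume 1 2 := fun σ c => by
    refine ContinuousOn.intervalIntegrable ?_
    rw [uIcc_of_le one_le_two]
    refine ContinuousOn.mul (Complex.continuous_ofReal.comp_continuousOn ?_)
      ((continuous_ex_right ξ).comp_continuousOn ?_)
    · exact continuousOn_id.rpow_const fun t ht => Or.inl (by
        have := ht.1; simp only [id]; linarith)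
    · have := Real.continuous_rpow_const (q := b) (by linarith)
      fun_prop
  have e0 : cav b cp cm (pw αp e) (pw αm e) u (ex ξ) 0 =
      αp * (∫ t in (1:ℝ)..2, ((t ^ e : ℝ) : ℂ) * ex ξ ((-1) * t, -(u * cp) * t ^ b)) +
      αm * ∫ t in (1:ℝ)..2, ((t ^ e : ℝ) : ℂ) * ex ξ (1 * t, -(u * cm) * t ^ b) := by
    rw [← intervalIntegral.integral_const_mul, ← intervalIntegral.integral_const_mul,
      ← intervalIntegral.integral_add ((hcont _ _).const_mul _) ((hcont _ _).const_mul _), cav]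
    refine intervalIntegral.integral_congr fun t ht => ?_
    rw [uIcc_of_le one_le_two] at ht
    simp only [pw_of_one_le _ _ ht.1, crv, zero_sub, Prod.neg_mk, Complex.real_smul]
    push_cast
    ring_nf
  rw [e0]
  calc _ ≤ (|αp| * ‖∫ t in (1:ℝ)..2, ((t ^ e : ℝ) : ℂ) * ex ξ ((-1) * t, -(u * cp) * t ^ b)‖ +
        |αm| * ‖∫ t in (1:ℝ)..2, ((t ^ e : ℝ) : ℂ) * ex ξ (1 * t, -(u * cm) * t ^ b)‖) *
        √(nrm ξ) := by
        gcongr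
        refine (norm_add_le _ _).trans_eq ?_
        rw [norm_mul, norm_mul, Complex.norm_real, Complex.norm_real, Real.norm_eq_abs,
          Real.norm_eq_abs]
    _ ≤ _ := by
        rw [add_mul, mul_assoc, mul_assoc]
        gcongr
        · exact H₁ (-1) _ 2 (by simp) (habs cp) (by norm_num) ξ
        · exact H₂ 1 _ 2 (by simp) (habs cm) (by norm_num) ξ

theorem abs_le_of_scl_ne_zero {g : ℝ × ℝ → ℝ} {ρ M : ℝ} (hM : 1 ≤ M)
    (hg : ∀ z, g z ≠ 0 → |z.1| ≤ ρ ∧ |z.2| ≤ ρ) {z : ℝ × ℝ} (hz : scl M M g z ≠ 0) :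
    |z.1| ≤ ρ ∧ |z.2| ≤ ρ := by
  obtain ⟨h1, h2⟩ := hg _ (right_ne_zero_of_mul hz)
  simp only [abs_mul, abs_of_nonneg (zero_le_one.trans hM)] at h1 h2
  exact ⟨(le_mul_of_one_le_left (abs_nonneg _) hM).trans h1,
    (le_mul_of_one_le_left (abs_nonneg _) hM).trans h2⟩

theorem HasCompactSupport.exists_box {g : ℝ × ℝ → ℝ} (hg : HasCompactSupport g) :
    ∃ ρ, 0 ≤ ρ ∧ ∀ z, g z ≠ 0 → |z.1| ≤ ρ ∧ |z.2| ≤ ρ := by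
  obtain ⟨ρ, hρ⟩ := hg.isCompact.isBounded.subset_closedBall 0
  refine ⟨|ρ|, abs_nonneg _, fun z hz => ?_⟩
  have := hρ (subset_tsupport _ hz)
  rw [Metric.mem_closedBall, dist_zero_right, Prod.norm_def, max_le_iff] at this
  exact ⟨this.1.trans (le_abs_self _), this.2.trans (le_abs_self _)⟩

theorem nrm_mul_mul {M : ℝ} (hM : 0 ≤ M) (h : ℝ × ℝ) : nrm (M * h.1, M * h.2) = M * nrm h := by
  simp only [nrm, abs_mul, abs_of_nonneg hM, mul_add]

/-- `L^p` bounds for dyadic sums of averages of a rescaled bump. -/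
theorem exists_lintegral_cv_cav_le (hb : 1 < b) (αp αm e : ℝ) {p : ℝ} (hp1 : 1 < p) (hp2 : p ≤ 2)
    {ε : ℝ} (h0 : 0 < ε) (h1 : ε ≤ 1) {Θ : ℝ × ℝ → ℝ} (hΘ : ContDiff ℝ 1 Θ)
    (hΘc : HasCompactSupport Θ) {D : ℝ} (hD : 0 ≤ D) :
    ∃ C, 0 ≤ C ∧ ∀ (M c u : ℝ) (F : Finset ℤ), 1 ≤ M → 0 ≤ c → u ∈ Icc (1:ℝ) 2 →
      (∀ ξ, ‖ft (cav b cp cm (pw αp e) (pw αm e) u (scl M M Θ)) ξ‖ ≤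
        D * M ^ (-(1/2) : ℝ) * wt (c * nrm ξ)) →
      ∀ f : ℝ × ℝ → ℝ, Continuous f → Integrable f → MemLp f 2 →
        ∫⁻ x, ‖cv (fun x => ∑ j ∈ F, kdil b j (cav b cp cm (pw αp e) (pw αm e) u (scl M M Θ)) x) f x‖ₑ
          ^ p ≤ ENNReal.ofReal (C * M ^ (ε - (p - 1))) * ∫⁻ x, ‖f x‖ₑ ^ p := by
  obtain ⟨ρ, hρ0, hρ⟩ := hΘc.exists_box
  obtain ⟨T, hT0, hT⟩ := exists_lintegral_sub_le hΘ hΘc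
  set R := boxR b cp cm ρ with hR
  have hR0 : 0 ≤ R := by rw [hR, boxR]; positivity
  obtain ⟨C, hC, H⟩ := exists_lintegral_cv_kdil_le hb hR0 hp1 hp2 h0 h1
  set W := max (|αp| * 2 ^ |e|) (|αm| * 2 ^ |e|) with hW
  have hW0 : 0 ≤ W := le_max_of_le_left (by positivity)
  set D' := D + 2 * W * T + 1 with hD'
  have hD'0 : 0 < D' := by positivity
  refine ⟨C * D' ^ p, by positivity, fun M c u F hM hc hu hft f hf hfi hf2 => ?_⟩
  have hM0 : 0 < M := by linarith
  have hs := continuous_scl M M hΘ.continuous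
  refine H (cav b cp cm (pw αp e) (pw αm e) u (scl M M Θ)) D' M c F
    (continuous_cav_right hb (continuous_pw _ _) (continuous_pw _ _) u hs)
    (fun z hz => abs_le_of_cav_ne_zero hb (fun z hz => abs_le_of_scl_ne_zero hM hρ hz) hu hz)
    hD'0 hM hc (fun ξ => (hft ξ).trans ?_) (fun h => ?_) f hf hfi hf2
  · have : 0 ≤ 2 * W * T := by positivity
    have hw := wt_nonneg (mul_nonneg hc (nrm_nonneg ξ))
    gcongr
    linarith
  · refine (lintegral_enorm_cav_sub_le (M := W) hb (continuous_pw _ _) (continuous_pw _ _) u hs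
      (fun t ht => ⟨(abs_pw_le αp e ht).trans (le_max_left _ _),
        (abs_pw_le αm e ht).trans (le_max_right _ _)⟩) h).trans ?_
    rw [lintegral_enorm_scl_sub hM0 hM0]
    refine (mul_le_mul_right (hT _) _).trans ?_
    rw [← ENNReal.ofReal_mul (by positivity), nrm_mul_mul hM0.le, ← mul_assoc]
    refine ENNReal.ofReal_le_ofReal ?_
    have : 0 ≤ min 1 (M * nrm h) := le_min zero_le_one (mul_nonneg hM0.le (nrm_nonneg h))
    gcongr
    linarith

theorem exists_norm_ft_cav_scl_le (hb : 1 < b) (hcp : cp ≠ 0) (hcm : cm ≠ 0) (αp αm e : ℝ)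
    {Θ : ℝ × ℝ → ℝ} (hΘ : Continuous Θ) (hΘc : HasCompactSupport Θ) (hΘ0 : ∫ z, Θ z = 0) :
    ∃ D, 0 ≤ D ∧ ∀ u ∈ Icc (1:ℝ) 2, ∀ M, 1 ≤ M → ∀ ξ,
      ‖ft (cav b cp cm (pw αp e) (pw αm e) u (scl M M Θ)) ξ‖ ≤
        D * M ^ (-(1/2) : ℝ) * wt (M⁻¹ * nrm ξ) := by
  obtain ⟨C₁, h₁, H₁⟩ := exists_norm_cav_ex_le hb hcp hcm αp αm e
  obtain ⟨C₂, h₂, H₂⟩ := exists_norm_ft_le_min hΘ hΘc hΘ0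
  obtain ⟨ρ, -, hρ⟩ := hΘc.exists_box
  refine ⟨2 * (C₂ * C₁), by positivity, fun u hu M hM ξ => ?_⟩
  have hM0 : 0 < M := by linarith
  rw [ft_cav hb (continuous_pw _ _) (continuous_pw _ _) u (continuous_scl M M hΘ)
    (hasCompactSupport_of_box fun z hz => abs_le_of_scl_ne_zero hM hρ hz), norm_mul,
    ft_scl hM0 hM0]
  have hQ := H₁ u hu ξ
  have hP := H₂ (ξ.1 / M, ξ.2 / M)
  have en : nrm (ξ.1 / M, ξ.2 / M) = M⁻¹ * nrm ξ := by
    rw [← nrm_mul_mul (inv_nonneg.2 hM0.le), div_eq_inv_mul, div_eq_inv_mul]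
  rw [en] at hP
  set x := M⁻¹ * nrm ξ with hx
  have hx0 : 0 ≤ x := mul_nonneg (inv_nonneg.2 hM0.le) (nrm_nonneg ξ)
  have ex1 : nrm ξ = M * x := by rw [hx]; field_simp
  rw [ex1, Real.sqrt_mul hM0.le] at hQ
  set P := ‖ft Θ (ξ.1 / M, ξ.2 / M)‖
  set Q := ‖cav b cp cm (pw αp e) (pw αm e) u (ex ξ) 0‖
  have hP0 : 0 ≤ P := norm_nonneg _
  have hQ0 : 0 ≤ Q := norm_nonneg _
  have hs0 := Real.sqrt_nonneg x
  have hsx := Real.mul_self_sqrt hx0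
  have hsM : 0 < √M := Real.sqrt_pos.2 hM0
  have eM : M ^ (-(1/2) : ℝ) = (√M)⁻¹ := by
    rw [Real.rpow_neg hM0.le, Real.sqrt_eq_rpow]
  have hy : P * Q * √M * √x ≤ C₂ * C₁ * min 1 x := by
    calc P * Q * √M * √x = P * (Q * (√M * √x)) := by ring
      _ ≤ (C₂ * min 1 x) * C₁ := mul_le_mul hP hQ (by positivity) ((norm_nonneg _).trans hP)
      _ = _ := by ring
  set y := P * Q * √M with hyd
  have hy0 : 0 ≤ y := by positivity
  have goal : y ≤ 2 * (C₂ * C₁) * wt x := by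
    have hCC : 0 ≤ C₂ * C₁ := by positivity
    rcases hx0.eq_or_lt with h | h
    · have hP1 : P ≤ 0 := by simpa [← h] using hP
      have : y = 0 := by rw [hyd, le_antisymm hP1 hP0]; simp
      rw [this]
      exact mul_nonneg (by positivity) (wt_nonneg hx0)
    · have hsp : 0 < √x := Real.sqrt_pos.2 h
      have a1 : y * √x ≤ C₂ * C₁ := hy.trans (mul_le_of_le_one_right hCC (min_le_left _ _))
      have a2 : y ≤ C₂ * C₁ * √x := by
        have := hy.trans (mul_le_mul_of_nonneg_left (min_le_right 1 x) hCC)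
        have e1 : C₂ * C₁ * x = C₂ * C₁ * √x * √x := by rw [mul_assoc _ √x, hsx]
        rw [e1] at this
        exact le_of_mul_le_mul_right this hsp
      have a3 : y * x ≤ C₂ * C₁ * √x := by
        have := mul_le_mul_of_nonneg_right a1 hs0
        rwa [mul_assoc, hsx] at this
      rw [wt, ← mul_div_assoc, le_div_iff₀ (by linarith)]
      linarith
  calc P * Q = y * (√M)⁻¹ := by rw [hyd]; field_simp
    _ ≤ (2 * (C₂ * C₁) * wt x) * (√M)⁻¹ := by gcongr
    _ = _ := by rw [eM]; ring

theorem cav_pw_eq_integral_oddQuot {E : Type*} [NormedAddCommGroup E] [NormedSpace ℝ E] (u : ℝ)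
    (f : ℝ × ℝ → E) (x : ℝ × ℝ) :
    cav b cp cm (pw 1 (-1)) (pw (-1) (-1)) u f x = ∫ t in (1:ℝ)..2, oddQuot b cp cm u f x t := by
  refine intervalIntegral.integral_congr fun t ht => ?_
  rw [uIcc_of_le one_le_two] at ht
  simp only [pw_of_one_le _ _ ht.1, Real.rpow_neg_one, crv, oddQuot, one_mul, neg_one_mul, neg_smul,
    sub_eq_add_neg, smul_add, smul_neg]

theorem oddQuot_ex_eq (u : ℝ) (ξ : ℝ × ℝ) (t : ℝ) :
    oddQuot b cp cm u (ex ξ) 0 t = oddQuot b cp cm 1 (ex (ξ.1, u * ξ.2)) 0 t := by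
  simp only [oddQuot, ex, zero_sub, Prod.neg_mk]
  congr 6 <;> ring

theorem exists_norm_ft_cav_le (hb : 1 < b) (hcp : cp ≠ 0) (hcm : cm ≠ 0)
    {φ : ℝ × ℝ → ℝ} (hφ : Continuous φ) (hφc : HasCompactSupport φ) :
    ∃ D, 0 ≤ D ∧ ∀ u ∈ Icc (1:ℝ) 2, ∀ ξ,
      ‖ft (cav b cp cm (pw 1 (-1)) (pw (-1) (-1)) u φ) ξ‖ ≤ D * wt (nrm ξ) := by
  obtain ⟨C, hC, H⟩ := exists_norm_sgm_le hb hcp hcm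
  have hI0 : 0 ≤ ∫ y, |φ y| := integral_nonneg fun y => abs_nonneg _
  refine ⟨(∫ y, |φ y|) * (C * 2), by positivity, fun u hu ξ => ?_⟩
  rw [ft_cav hb (continuous_pw _ _) (continuous_pw _ _) u hφ hφc, norm_mul,
    cav_pw_eq_integral_oddQuot]
  have h1 := H 2 (by norm_num) (ξ.1, u * ξ.2)
  simp only [oddQuot_ex_eq u]
  rw [sgm] at h1
  have hx := nrm_nonneg ξ
  have hy1 : nrm ξ ≤ nrm (ξ.1, u * ξ.2) := by
    simp only [nrm, abs_mul, abs_of_nonneg (zero_le_one.trans hu.1)]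
    nlinarith [abs_nonneg ξ.2, hu.1]
  have hy2 : nrm (ξ.1, u * ξ.2) ≤ 2 ^ 2 * nrm ξ := by
    simp only [nrm, abs_mul, abs_of_nonneg (zero_le_one.trans hu.1)]
    nlinarith [abs_nonneg ξ.2, abs_nonneg ξ.1, hu.2]
  have hw : wt (nrm (ξ.1, u * ξ.2)) ≤ 2 * wt (nrm ξ) := by
    rw [wt, wt, ← mul_div_assoc]
    gcongr
    calc √(nrm (ξ.1, u * ξ.2)) ≤ √(2 ^ 2 * nrm ξ) := Real.sqrt_le_sqrt hy2
      _ = 2 * √(nrm ξ) := by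
        rw [Real.sqrt_mul (by positivity), Real.sqrt_sq two_pos.le]
  calc _ ≤ (∫ y, |φ y|) * (C * (2 * wt (nrm ξ))) := by
        refine mul_le_mul (norm_ft_le φ ξ) (h1.trans (by gcongr)) (norm_nonneg _) hI0
    _ = _ := by ring
end

section
variable {b cp cm : ℝ}

theorem integrable_prod_restrict_Ioc {X E : Type*} [TopologicalSpace X] [T2Space X] [MeasurableSpace X]
    [BorelSpace X] [SecondCountableTopology X] {μ : Measure X} [SFinite μ] [IsLocallyFiniteMeasure μ]
    [NormedAddCommGroup E] {G : X × ℝ → E} (hG : Continuous G) {K : Set X} (hK : IsCompact K)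
    {s : Set X} (hs : MeasurableSet s) (a c : ℝ)
    (h0 : ∀ q, q.1 ∈ s → q.2 ∈ Ioc a c → G q ≠ 0 → q.1 ∈ K) :
    Integrable G ((μ.restrict s).prod (volume.restrict (Ioc a c))) := by
  have h1 : IntegrableOn G (K ×ˢ Ioc a c) (μ.prod volume) :=
    (hG.continuousOn.integrableOn_compact (hK.prod isCompact_Icc)).mono_set
      (prod_mono le_rfl Ioc_subset_Icc_self)
  have h2 : IntegrableOn G (s ×ˢ Ioc a c) (μ.prod volume) :=
    h1.of_forall_sdiff_eq_zero (hs.prod measurableSet_Ioc) fun q hq => by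
      by_contra hne
      exact hq.2 ⟨h0 q hq.1.1 hq.1.2 hne, hq.1.2⟩
  rw [Measure.prod_restrict]
  exact h2

theorem hasDerivAt_comp_crv {ψ ψ' : ℝ × ℝ → ℝ}
    (hd : ∀ z : ℝ × ℝ, HasDerivAt (fun s => ψ (z.1, s)) (ψ' z) z.2) (σ c t : ℝ) (z : ℝ × ℝ) (w : ℝ) :
    HasDerivAt (fun w => ψ (z - crv b σ c w t)) (-(c * t ^ b) * ψ' (z - crv b σ c w t)) w := by
  have h1 : HasDerivAt (fun w : ℝ => z.2 - w * (c * t ^ b)) (-(c * t ^ b)) w := by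
    simpa using ((hasDerivAt_id w).mul_const (c * t ^ b)).const_sub z.2
  have h2 := (hd (z - crv b σ c w t)).comp w h1
  exact h2.congr_deriv (mul_comm _ _)

theorem cav_sub_cav (hb : 1 < b) {ψ ψ' : ℝ × ℝ → ℝ} (hψ : Continuous ψ) (hψ' : Continuous ψ')
    (hd : ∀ z : ℝ × ℝ, HasDerivAt (fun s => ψ (z.1, s)) (ψ' z) z.2) {v u : ℝ} (hvu : v ≤ u)
    (z : ℝ × ℝ) :
    cav b cp cm (pw 1 (-1)) (pw (-1) (-1)) u ψ z - cav b cp cm (pw 1 (-1)) (pw (-1) (-1)) v ψ z =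
      ∫ w in Ioc v u, cav b cp cm (pw (-cp) (b - 1)) (pw cm (b - 1)) w ψ' z := by
  have c1 := continuous_pw 1 (-1)
  have c2 := continuous_pw (-1) (-1)
  have c3 := continuous_pw (-cp) (b - 1)
  have c4 := continuous_pw cm (b - 1)
  have hH := (continuous_cav_integrand (cp := cp) (cm := cm) hb c3 c4 hψ').comp
    (by fun_prop : Continuous fun q : ℝ × ℝ => ((q.2, z), q.1))
  have hi := integrable_prod_restrict_Ioc (μ := volume) hH isCompact_Icc
    measurableSet_Ioc v u (s := Ioc (1:ℝ) 2) (fun q hq _ _ => Ioc_subset_Icc_self hq)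
  have hftc : ∀ σ c t : ℝ, ∫ w in Ioc v u, -(c * t ^ b) * ψ' (z - crv b σ c w t) =
      ψ (z - crv b σ c u t) - ψ (z - crv b σ c v t) := fun σ c t => by
    rw [← intervalIntegral.integral_of_le hvu]
    refine intervalIntegral.integral_eq_sub_of_hasDerivAt
      (fun w _ => hasDerivAt_comp_crv hd σ c t z w) (Continuous.intervalIntegrable ?_ _ _)
    have := (continuous_crv hb σ c).comp (by fun_prop : Continuous fun w : ℝ => (w, t))
    simp only [Function.comp_def] at this
    fun_prop
  have hci : ∀ σ c t : ℝ, IntegrableOn (fun w => -(c * t ^ b) * ψ' (z - crv b σ c w t))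
      (Ioc v u) := fun σ c t => by
    refine (Continuous.integrableOn_Icc ?_).mono_set Ioc_subset_Icc_self
    have := (continuous_crv hb σ c).comp (by fun_prop : Continuous fun w : ℝ => (w, t))
    simp only [Function.comp_def] at this
    fun_prop
  rw [cav, cav, ← intervalIntegral.integral_sub (intervalIntegrable_cav hb c1 c2 u hψ z _ _)
    (intervalIntegrable_cav hb c1 c2 v hψ z _ _), intervalIntegral.integral_of_le one_le_two]
  calc _ = ∫ t in Ioc (1:ℝ) 2, ∫ w in Ioc v u, (pw (-cp) (b - 1) t • ψ' (z - crv b 1 cp w t) +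
        pw cm (b - 1) t • ψ' (z - crv b (-1) cm w t)) := by
        refine setIntegral_congr_fun measurableSet_Ioc fun t ht => ?_
        have ht0 : 0 < t := by linarith [ht.1]
        have e1 : t ^ (b - 1) = t⁻¹ * t ^ b := by
          rw [Real.rpow_sub_one ht0.ne', div_eq_inv_mul]
        have e2 : ∀ w, pw (-cp) (b - 1) t • ψ' (z - crv b 1 cp w t) +
            pw cm (b - 1) t • ψ' (z - crv b (-1) cm w t) =
            t⁻¹ * (-(cp * t ^ b) * ψ' (z - crv b 1 cp w t)) -
            t⁻¹ * (-(cm * t ^ b) * ψ' (z - crv b (-1) cm w t)) := fun w => by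
          rw [pw_of_one_le _ _ ht.1.le, pw_of_one_le _ _ ht.1.le, e1, smul_eq_mul, smul_eq_mul]
          ring
        have e3 : ∀ σ c, ∫ w in Ioc v u, t⁻¹ * (-(c * t ^ b) * ψ' (z - crv b σ c w t)) =
            t⁻¹ * (ψ (z - crv b σ c u t) - ψ (z - crv b σ c v t)) := fun σ c => by
          rw [integral_const_mul t⁻¹ fun w => -(c * t ^ b) * ψ' (z - crv b σ c w t), hftc]
        simp only [e2]
        rw [integral_sub ((hci _ _ _).const_mul _) ((hci _ _ _).const_mul _), e3, e3, pw_of_one_le _ _ ht.1.le, pw_of_one_le _ _ ht.1.le,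
          Real.rpow_neg_one]
        simp only [smul_eq_mul]
        ring
    _ = ∫ w in Ioc v u, ∫ t in Ioc (1:ℝ) 2, (pw (-cp) (b - 1) t • ψ' (z - crv b 1 cp w t) +
        pw cm (b - 1) t • ψ' (z - crv b (-1) cm w t)) := integral_integral_swap hi
    _ = _ := by
        simp only [cav, intervalIntegral.integral_of_le one_le_two]

/-- The dyadic sum of the rescaled averages. -/
def kern (b cp cm : ℝ) (ap am : ℝ → ℝ) (F : Finset ℤ) (ψ : ℝ × ℝ → ℝ) (u : ℝ) (x : ℝ × ℝ) : ℝ :=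
  ∑ j ∈ F, kdil b j (cav b cp cm ap am u ψ) x

theorem continuous_kern (hb : 1 < b) {ap am : ℝ → ℝ} (hap : Continuous ap) (ham : Continuous am)
    (F : Finset ℤ) {ψ : ℝ × ℝ → ℝ} (hψ : Continuous ψ) :
    Continuous fun q : ℝ × (ℝ × ℝ) => kern b cp cm ap am F ψ q.1 q.2 := by
  unfold kern kdil scl
  refine continuous_finsetSum _ fun j _ => continuous_const.mul ?_
  have h := (continuous_cav (cp := cp) (cm := cm) hb hap ham hψ).comp
    (by fun_prop : Continuous fun q : ℝ × (ℝ × ℝ) =>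
      (q.1, (((2:ℝ) ^ j)⁻¹ * q.2.1, (((2:ℝ) ^ j) ^ b)⁻¹ * q.2.2)))
  simpa only [Function.comp_def] using h

theorem continuous_kern_right (hb : 1 < b) {ap am : ℝ → ℝ} (hap : Continuous ap)
    (ham : Continuous am) (F : Finset ℤ) {ψ : ℝ × ℝ → ℝ} (hψ : Continuous ψ) (u : ℝ) :
    Continuous (kern b cp cm ap am F ψ u) := by
  have h := (continuous_kern (cp := cp) (cm := cm) hb hap ham F hψ).comp
    (by fun_prop : Continuous fun x : ℝ × ℝ => (u, x))
  simpa only [Function.comp_def] using h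

theorem exists_isCompact_kern (hb : 1 < b) (ap am : ℝ → ℝ) (F : Finset ℤ) {ψ : ℝ × ℝ → ℝ}
    (hψc : HasCompactSupport ψ) : ∃ K : Set (ℝ × ℝ), IsCompact K ∧
      ∀ u ∈ Icc (1:ℝ) 2, ∀ z, kern b cp cm ap am F ψ u z ≠ 0 → z ∈ K := by
  obtain ⟨ρ, hρ0, hρ⟩ := hψc.exists_box
  refine ⟨⋃ j ∈ F, Icc (-(boxR b cp cm ρ * (2:ℝ) ^ j)) (boxR b cp cm ρ * (2:ℝ) ^ j) ×ˢ
    Icc (-(boxR b cp cm ρ * ((2:ℝ) ^ j) ^ b)) (boxR b cp cm ρ * ((2:ℝ) ^ j) ^ b),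
    F.isCompact_biUnion fun j _ => isCompact_Icc.prod isCompact_Icc, fun u hu z hz => ?_⟩
  obtain ⟨j, hj, hne⟩ := Finset.exists_ne_zero_of_sum_ne_zero hz
  obtain ⟨h1, h2⟩ := abs_le_of_kdil_ne_zero
    (fun z hz => abs_le_of_cav_ne_zero hb hρ hu hz) hne
  exact mem_biUnion hj ⟨abs_le.1 h1, abs_le.1 h2⟩

theorem hasCompactSupport_kern (hb : 1 < b) (ap am : ℝ → ℝ) (F : Finset ℤ) {ψ : ℝ × ℝ → ℝ}
    (hψc : HasCompactSupport ψ) {u : ℝ} (hu : u ∈ Icc (1:ℝ) 2) :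
    HasCompactSupport (kern b cp cm ap am F ψ u) := by
  obtain ⟨K, hK, h⟩ := exists_isCompact_kern (cp := cp) (cm := cm) hb ap am F hψc
  exact HasCompactSupport.intro hK fun x hx => by
    by_contra hne
    exact hx (h u hu x hne)

theorem kern_sub_kern (hb : 1 < b) (F : Finset ℤ) {ψ ψ' : ℝ × ℝ → ℝ} (hψ : Continuous ψ)
    (hψ' : Continuous ψ') (hd : ∀ z : ℝ × ℝ, HasDerivAt (fun s => ψ (z.1, s)) (ψ' z) z.2) {v u : ℝ}
    (hvu : v ≤ u) (z : ℝ × ℝ) :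
    kern b cp cm (pw 1 (-1)) (pw (-1) (-1)) F ψ u z - kern b cp cm (pw 1 (-1)) (pw (-1) (-1)) F ψ v z =
      ∫ w in Ioc v u, kern b cp cm (pw (-cp) (b - 1)) (pw cm (b - 1)) F ψ' w z := by
  simp only [kern]
  rw [← Finset.sum_sub_distrib, integral_finsetSum]
  · refine Finset.sum_congr rfl fun j _ => ?_
    simp only [kdil, scl]
    rw [← mul_sub, cav_sub_cav hb hψ hψ' hd hvu, integral_const_mul]
  · intro j _
    refine (Continuous.integrableOn_Icc ?_).mono_set Ioc_subset_Icc_self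
    simp only [kdil, scl]
    refine continuous_const.mul ?_
    have h := (continuous_cav (cp := cp) (cm := cm) hb (continuous_pw (-cp) (b - 1))
      (continuous_pw cm (b - 1)) hψ').comp
      (by fun_prop : Continuous fun w : ℝ => (w, ((2:ℝ) ^ j)⁻¹ * z.1, (((2:ℝ) ^ j) ^ b)⁻¹ * z.2))
    simpa only [Function.comp_def] using h

theorem cv_kern_sub (hb : 1 < b) (F : Finset ℤ) {ψ ψ' : ℝ × ℝ → ℝ} (hψ : Continuous ψ)
    (hψ' : Continuous ψ') (hψc : HasCompactSupport ψ) (hψc' : HasCompactSupport ψ')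
    (hd : ∀ z : ℝ × ℝ, HasDerivAt (fun s => ψ (z.1, s)) (ψ' z) z.2) {v u : ℝ}
    (hv : v ∈ Icc (1:ℝ) 2) (hu : u ∈ Icc (1:ℝ) 2) (hvu : v ≤ u) {f : ℝ × ℝ → ℝ} (hf : Continuous f)
    (x : ℝ × ℝ) :
    cv (kern b cp cm (pw 1 (-1)) (pw (-1) (-1)) F ψ u) f x -
      cv (kern b cp cm (pw 1 (-1)) (pw (-1) (-1)) F ψ v) f x =
      ∫ w in Ioc v u, cv (kern b cp cm (pw (-cp) (b - 1)) (pw cm (b - 1)) F ψ' w) f x := by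
  have hig : ∀ u ∈ Icc (1:ℝ) 2, Integrable fun y =>
      kern b cp cm (pw 1 (-1)) (pw (-1) (-1)) F ψ u (x - y) • f y := fun u hu => by
    have hc := continuous_kern_right (cp := cp) (cm := cm) hb (continuous_pw 1 (-1))
      (continuous_pw (-1) (-1)) F hψ u
    have hc' := hc.comp (by fun_prop : Continuous fun y : ℝ × ℝ => x - y)
    simp only [Function.comp_def] at hc'
    have hs := (hasCompactSupport_kern (cp := cp) (cm := cm) hb (pw 1 (-1)) (pw (-1) (-1)) F hψc
      hu).comp_homeomorph (Homeomorph.subLeft x)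
    exact (hc'.smul hf).integrable_of_hasCompactSupport (HasCompactSupport.smul_right hs)
  obtain ⟨K, hK, h⟩ := exists_isCompact_kern (cp := cp) (cm := cm) hb (pw (-cp) (b - 1))
    (pw cm (b - 1)) F hψc'
  have hcont : Continuous fun q : (ℝ × ℝ) × ℝ =>
      kern b cp cm (pw (-cp) (b - 1)) (pw cm (b - 1)) F ψ' q.2 (x - q.1) • f q.1 := by
    have h := (continuous_kern (cp := cp) (cm := cm) hb (continuous_pw (-cp) (b - 1))
      (continuous_pw cm (b - 1)) F hψ').comp
      (by fun_prop : Continuous fun q : (ℝ × ℝ) × ℝ => (q.2, x - q.1))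
    simp only [Function.comp_def] at h
    exact h.smul (hf.comp (continuous_fst : Continuous fun q : (ℝ × ℝ) × ℝ => q.1))
  have hK' : IsCompact ((fun z => x - z) '' K) := hK.image (by fun_prop : Continuous fun z : ℝ × ℝ => x - z)
  have hi := integrable_prod_restrict_Ioc (μ := (volume : Measure (ℝ × ℝ))) hcont hK'
    MeasurableSet.univ v u (fun q _ hq hne => ⟨x - q.1,
      h q.2 ⟨hv.1.trans hq.1.le, hq.2.trans hu.2⟩ _ (left_ne_zero_of_smul hne), by simp⟩)
  rw [Measure.restrict_univ] at hi
  rw [cv, cv, ← integral_sub (hig u hu) (hig v hv)]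
  simp only [← sub_smul, kern_sub_kern hb F hψ hψ' hd hvu, ← integral_smul_const]
  exact integral_integral_swap hi
end

section
variable {b cp cm : ℝ}

theorem rpow_lintegral_le_mul_lintegral_rpow {X : Type*} [MeasurableSpace X] {μ : Measure X} {p : ℝ}
    (hp : 1 < p) {g : X → ℝ≥0∞} (hg : AEMeasurable g μ) :
    (∫⁻ x, g x ∂μ) ^ p ≤ μ univ ^ (p - 1) * ∫⁻ x, g x ^ p ∂μ := by
  have hp0 : 0 < p := by linarith
  have hq := Real.HolderConjugate.conjExponent hp
  have h := ENNReal.lintegral_mul_le_Lp_mul_Lq μ hq hg (aemeasurable_const (b := (1:ℝ≥0∞)))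
  simp only [Pi.mul_apply, mul_one, ENNReal.one_rpow, lintegral_const, one_mul] at h
  calc _ ≤ ((∫⁻ x, g x ^ p ∂μ) ^ (1 / p) * μ univ ^ (1 / p.conjExponent)) ^ p :=
        ENNReal.rpow_le_rpow h hp0.le
    _ = μ univ ^ (p - 1) * ∫⁻ x, g x ^ p ∂μ := by
        rw [ENNReal.mul_rpow_of_nonneg _ _ hp0.le, ← ENNReal.rpow_mul, ← ENNReal.rpow_mul,
          one_div_mul_cancel hp0.ne', ENNReal.rpow_one, mul_comm]
        congr 2
        have : p - 1 ≠ 0 := by linarith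
        rw [Real.conjExponent]
        field_simp

theorem lintegral_iSup_enorm_rpow_le {X : Type*} [MeasurableSpace X] {μ : Measure X} [SFinite μ]
    {p : ℝ} (hp : 1 < p) {K K' : ℝ → X → ℝ} (hK : ∀ u, Measurable (K u))
    (hK' : Measurable fun q : ℝ × X => K' q.1 q.2)
    (hsub : ∀ v ∈ Icc (1:ℝ) 2, ∀ u ∈ Icc (1:ℝ) 2, v ≤ u → ∀ x,
      K u x - K v x = ∫ w in Ioc v u, K' w x)
    {A B : ℝ≥0∞} (hA : ∀ u ∈ Icc (1:ℝ) 2, ∫⁻ x, ‖K u x‖ₑ ^ p ∂μ ≤ A)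
    (hB : ∀ u ∈ Icc (1:ℝ) 2, ∫⁻ x, ‖K' u x‖ₑ ^ p ∂μ ≤ B) {δ : ℝ} (hδ : 0 < δ) {V : Set ℝ}
    (hV : V ⊆ Icc (1:ℝ) 2) {T : Finset ℝ} (hT : V ⊆ ⋃ a ∈ T, Icc a (a + δ)) :
    ∫⁻ x, (⨆ u ∈ V, ‖K u x‖ₑ) ^ p ∂μ ≤
      T.card * (2 ^ (p - 1) * (A + ENNReal.ofReal (δ ^ p) * B)) := by
  have hp0 : 0 < p := by linarith
  set v : ℝ → ℝ := fun a => min (max a 1) 2 with hv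
  have hv1 : ∀ a, v a ∈ Icc (1:ℝ) 2 := fun a =>
    ⟨le_min (le_max_right _ _) one_le_two, min_le_right _ _⟩
  set J : ℝ → Set ℝ := fun a => Ioc (v a) (min (v a + δ) 2) with hJ
  have hJs : ∀ a, J a ⊆ Icc 1 2 := fun a w hw =>
    ⟨(hv1 a).1.trans hw.1.le, hw.2.trans (min_le_right _ _)⟩
  have hJv : ∀ a, volume (J a) ≤ ENNReal.ofReal δ := fun a => by
    rw [hJ, Real.volume_Ioc]
    exact ENNReal.ofReal_le_ofReal (by linarith [min_le_left (v a + δ) 2])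
  have hm1 : ∀ a, Measurable fun x => ‖K (v a) x‖ₑ := fun a => (hK (v a)).enorm
  have hm2 : ∀ a, Measurable fun x => ∫⁻ w in J a, ‖K' w x‖ₑ := fun a =>
    (hK'.comp measurable_swap).enorm.lintegral_prod_right'
  have hpt : ∀ x, (⨆ u ∈ V, ‖K u x‖ₑ) ^ p ≤
      ∑ a ∈ T, (‖K (v a) x‖ₑ + ∫⁻ w in J a, ‖K' w x‖ₑ) ^ p := fun x => by
    rw [← ENNReal.le_rpow_inv_iff hp0]
    refine iSup₂_le fun u hu => ?_
    rw [ENNReal.le_rpow_inv_iff hp0]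
    obtain ⟨a, ha, hua⟩ := mem_iUnion₂.1 (hT hu)
    have hu2 := hV hu
    have h2 : max a 1 ≤ 2 := (max_le hua.1 hu2.1).trans hu2.2
    have hva : v a = max a 1 := min_eq_left h2
    have hvu : v a ≤ u := hva.trans_le (max_le hua.1 hu2.1)
    have huJ : Ioc (v a) u ⊆ J a := Ioc_subset_Ioc_right
      (le_min (by rw [hva]; linarith [hua.2, le_max_left a 1]) hu2.2)
    refine le_trans (ENNReal.rpow_le_rpow ?_ hp0.le) (Finset.single_le_sum
      (f := fun a => (‖K (v a) x‖ₑ + ∫⁻ w in J a, ‖K' w x‖ₑ) ^ p) (fun _ _ => zero_le) ha)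
    rw [← add_sub_cancel (K (v a) x) (K u x), hsub _ (hv1 a) u hu2 hvu x]
    exact (enorm_add_le _ _).trans (add_le_add le_rfl ((enorm_integral_le_lintegral_enorm _).trans
      (lintegral_mono_set huJ)))
  have hone : ∀ a, ∫⁻ x, (‖K (v a) x‖ₑ + ∫⁻ w in J a, ‖K' w x‖ₑ) ^ p ∂μ ≤
      2 ^ (p - 1) * (A + ENNReal.ofReal (δ ^ p) * B) := fun a => by
    have hT2 : ∫⁻ x, (∫⁻ w in J a, ‖K' w x‖ₑ) ^ p ∂μ ≤ ENNReal.ofReal (δ ^ p) * B := by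
      calc _ ≤ ∫⁻ x, ENNReal.ofReal δ ^ (p - 1) * (∫⁻ w in J a, ‖K' w x‖ₑ ^ p) ∂μ := by
            refine lintegral_mono fun x => (rpow_lintegral_le_mul_lintegral_rpow hp
              (hK'.comp (measurable_id.prodMk measurable_const)).enorm.aemeasurable).trans ?_
            rw [Measure.restrict_apply_univ]
            exact mul_le_mul_left (ENNReal.rpow_le_rpow (hJv a) (by linarith)) _
        _ = ENNReal.ofReal δ ^ (p - 1) * ∫⁻ w in J a, ∫⁻ x, ‖K' w x‖ₑ ^ p ∂μ := by
            rw [lintegral_const_mul' _ _ (ENNReal.rpow_ne_top_of_nonneg (by linarith)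
              ENNReal.ofReal_ne_top)]
            congr 1
            exact lintegral_lintegral_swap
              ((hK'.comp measurable_swap).enorm.pow_const p).aemeasurable
        _ ≤ ENNReal.ofReal δ ^ (p - 1) * (B * ENNReal.ofReal δ) := by
            refine mul_le_mul_right ?_ _
            refine (setLIntegral_mono measurable_const fun w hw => hB w (hJs a hw)).trans ?_
            rw [setLIntegral_const]
            exact mul_le_mul_right (hJv a) _
        _ = ENNReal.ofReal (δ ^ p) * B := by
            rw [ENNReal.ofReal_rpow_of_pos hδ, mul_comm B, ← mul_assoc,
              ← ENNReal.ofReal_mul (by positivity), Real.rpow_sub_one hδ.ne',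
              div_mul_cancel₀ _ hδ.ne']
    calc _ ≤ ∫⁻ x, 2 ^ (p - 1) * (‖K (v a) x‖ₑ ^ p + (∫⁻ w in J a, ‖K' w x‖ₑ) ^ p) ∂μ :=
          lintegral_mono fun x => ENNReal.rpow_add_le_mul_rpow_add_rpow _ _ hp.le
      _ = 2 ^ (p - 1) * ((∫⁻ x, ‖K (v a) x‖ₑ ^ p ∂μ) +
          ∫⁻ x, (∫⁻ w in J a, ‖K' w x‖ₑ) ^ p ∂μ) := by
          rw [lintegral_const_mul' _ _ (by finiteness),
            lintegral_add_left ((hm1 a).pow_const p)]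
      _ ≤ _ := mul_le_mul_right (add_le_add (hA _ (hv1 a)) hT2) _
  calc _ ≤ ∫⁻ x, ∑ a ∈ T, (‖K (v a) x‖ₑ + ∫⁻ w in J a, ‖K' w x‖ₑ) ^ p ∂μ := lintegral_mono hpt
    _ = ∑ a ∈ T, ∫⁻ x, (‖K (v a) x‖ₑ + ∫⁻ w in J a, ‖K' w x‖ₑ) ^ p ∂μ :=
        lintegral_finsetSum _ fun a _ => ((hm1 a).add (hm2 a)).pow_const p
    _ ≤ _ := by
        refine (Finset.sum_le_card_nsmul _ _ _ fun a _ => hone a).trans ?_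
        rw [nsmul_eq_mul]

theorem kern_const_mul (ap am : ℝ → ℝ) (F : Finset ℤ) (M : ℝ) (ψ : ℝ × ℝ → ℝ) (u : ℝ) (x : ℝ × ℝ) :
    kern b cp cm ap am F (fun z => M * ψ z) u x = M * kern b cp cm ap am F ψ u x := by
  have e : ∀ y, cav b cp cm ap am u (fun z => M * ψ z) y = M * cav b cp cm ap am u ψ y := fun y => by
    rw [cav, cav, ← intervalIntegral.integral_const_mul]
    refine intervalIntegral.integral_congr fun t _ => ?_
    simp only [smul_eq_mul]
    ring
  simp only [kern, kdil, scl, Finset.mul_sum, e]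
  exact Finset.sum_congr rfl fun j _ => mul_left_comm _ _ _

theorem measurable_cv_kern (hb : 1 < b) {ap am : ℝ → ℝ} (hap : Continuous ap) (ham : Continuous am)
    (F : Finset ℤ) {ψ : ℝ × ℝ → ℝ} (hψ : Continuous ψ) {f : ℝ × ℝ → ℝ} (hf : Continuous f) :
    Measurable fun q : ℝ × (ℝ × ℝ) => cv (kern b cp cm ap am F ψ q.1) f q.2 := by
  have h := (continuous_kern (cp := cp) (cm := cm) hb hap ham F hψ).comp
    (by fun_prop : Continuous fun q : (ℝ × (ℝ × ℝ)) × (ℝ × ℝ) => (q.1.1, q.1.2 - q.2))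
  simp only [Function.comp_def] at h
  exact ((h.smul (hf.comp (continuous_snd : Continuous fun q : (ℝ × (ℝ × ℝ)) × (ℝ × ℝ) =>
    q.2))).stronglyMeasurable.integral_prod_right').measurable

theorem exists_lintegral_iSup_cv_kern_le (hb : 1 < b) (hcp : cp ≠ 0) (hcm : cm ≠ 0) {p : ℝ}
    (hp1 : 1 < p) (hp2 : p ≤ 2) {ε : ℝ} (h0 : 0 < ε) (h1 : ε ≤ 1) {Θ Θ' : ℝ × ℝ → ℝ}
    (hΘ : ContDiff ℝ 1 Θ) (hΘc : HasCompactSupport Θ) (hΘ' : ContDiff ℝ 1 Θ')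
    (hΘc' : HasCompactSupport Θ') (hΘ0 : ∫ z, Θ' z = 0)
    (hd : ∀ z : ℝ × ℝ, HasDerivAt (fun s => Θ (z.1, s)) (Θ' z) z.2) {D : ℝ} (hD : 0 ≤ D)
    {S : Set ℝ} (hS : S ⊆ Ici 1) {c : ℝ → ℝ} (hc : ∀ M ∈ S, 0 ≤ c M)
    (H : ∀ M ∈ S, ∀ u ∈ Icc (1:ℝ) 2, ∀ ξ,
      ‖ft (cav b cp cm (pw 1 (-1)) (pw (-1) (-1)) u (scl M M Θ)) ξ‖ ≤
        D * M ^ (-(1/2) : ℝ) * wt (c M * nrm ξ)) :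
    ∃ C, 0 ≤ C ∧ ∀ M ∈ S, ∀ V ⊆ Icc (1:ℝ) 2, ∀ T : Finset ℝ, V ⊆ ⋃ a ∈ T, Icc a (a + M⁻¹) →
      ∀ F : Finset ℤ, ∀ f : ℝ × ℝ → ℝ, Continuous f → Integrable f → MemLp f 2 →
        ∫⁻ x, (⨆ u ∈ V, ‖cv (kern b cp cm (pw 1 (-1)) (pw (-1) (-1)) F (scl M M Θ) u) f x‖ₑ) ^ p ≤
          ENNReal.ofReal (C * T.card * M ^ (ε - (p - 1))) * ∫⁻ x, ‖f x‖ₑ ^ p := by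
  have hp0 : 0 < p := by linarith
  obtain ⟨C₁, hC₁, H₁⟩ := exists_lintegral_cv_cav_le (cp := cp) (cm := cm) hb 1 (-1) (-1) hp1 hp2
    h0 h1 hΘ hΘc hD
  obtain ⟨D', hD', HD'⟩ := exists_norm_ft_cav_scl_le hb hcp hcm (-cp) cm (b - 1) hΘ'.continuous
    hΘc' hΘ0
  obtain ⟨C₂, hC₂, H₂⟩ := exists_lintegral_cv_cav_le (cp := cp) (cm := cm) hb (-cp) cm (b - 1) hp1
    hp2 h0 h1 hΘ' hΘc' hD'
  refine ⟨2 ^ (p - 1) * (C₁ + C₂), by positivity, fun M hM V hV T hT F f hf hfi hf2 => ?_⟩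
  have hM1 : 1 ≤ M := hS hM
  have hM0 : 0 < M := by linarith
  obtain ⟨ρ, -, hρ⟩ := hΘc.exists_box
  obtain ⟨ρ', -, hρ'⟩ := hΘc'.exists_box
  have hs := continuous_scl M M hΘ.continuous
  have hs' := continuous_scl M M hΘ'.continuous
  have hsc : HasCompactSupport (scl M M Θ) :=
    hasCompactSupport_of_box fun z hz => abs_le_of_scl_ne_zero hM1 hρ hz
  have hsc' : HasCompactSupport (scl M M Θ') :=
    hasCompactSupport_of_box fun z hz => abs_le_of_scl_ne_zero hM1 hρ' hz
  have hds : ∀ z : ℝ × ℝ, HasDerivAt (fun s => scl M M Θ (z.1, s)) (M * scl M M Θ' z) z.2 := by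
    intro z
    have h := ((hd (M * z.1, M * z.2)).comp z.2 ((hasDerivAt_id z.2).const_mul M)).const_mul (M * M)
    refine h.congr_deriv ?_
    simp only [scl]
    ring
  have hcv : ∀ w x, cv (kern b cp cm (pw (-cp) (b - 1)) (pw cm (b - 1)) F
      (fun z => M * scl M M Θ' z) w) f x =
      M * cv (kern b cp cm (pw (-cp) (b - 1)) (pw cm (b - 1)) F (scl M M Θ') w) f x := by
    intro w x
    simp only [cv, kern_const_mul, smul_eq_mul, mul_assoc]
    rw [integral_const_mul]
  have c1 := continuous_pw 1 (-1)
  have c2 := continuous_pw (-1) (-1)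
  have c3 := continuous_pw (-cp) (b - 1)
  have c4 := continuous_pw cm (b - 1)
  have hsM : Continuous fun z => M * scl M M Θ' z := hs'.const_mul M
  have hscM : HasCompactSupport fun z => M * scl M M Θ' z := hsc'.mul_left
  set K : ℝ → ℝ × ℝ → ℝ :=
    fun u x => cv (kern b cp cm (pw 1 (-1)) (pw (-1) (-1)) F (scl M M Θ) u) f x with hK
  set K₁ : ℝ → ℝ × ℝ → ℝ := fun u x =>
    cv (kern b cp cm (pw (-cp) (b - 1)) (pw cm (b - 1)) F (scl M M Θ') u) f x with hK₁
  set K' : ℝ → ℝ × ℝ → ℝ := fun w x => cv (kern b cp cm (pw (-cp) (b - 1)) (pw cm (b - 1)) F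
      (fun z => M * scl M M Θ' z) w) f x with hK'
  have hKm : ∀ u, Measurable (K u) := fun u => by
    have h := (measurable_cv_kern (cp := cp) (cm := cm) hb c1 c2 F hs hf).comp
      (measurable_const.prodMk measurable_id : Measurable fun x : ℝ × ℝ => (u, x))
    exact h
  have hKm' : Measurable fun q : ℝ × (ℝ × ℝ) => K' q.1 q.2 :=
    measurable_cv_kern hb c3 c4 F hsM hf
  have hsub : ∀ v ∈ Icc (1:ℝ) 2, ∀ u ∈ Icc (1:ℝ) 2, v ≤ u → ∀ x,
      K u x - K v x = ∫ w in Ioc v u, K' w x := fun v hv u hu hvu x =>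
    cv_kern_sub hb F hs hsM hsc hscM hds hv hu hvu hf x
  have hA : ∀ u ∈ Icc (1:ℝ) 2, ∫⁻ x, ‖K u x‖ₑ ^ p ≤
      ENNReal.ofReal (C₁ * M ^ (ε - (p - 1))) * ∫⁻ x, ‖f x‖ₑ ^ p := fun u hu =>
    H₁ M (c M) u F hM1 (hc M hM) hu (H M hM u hu) f hf hfi hf2
  have hB₁ : ∀ u ∈ Icc (1:ℝ) 2, ∫⁻ x, ‖K₁ u x‖ₑ ^ p ≤
      ENNReal.ofReal (C₂ * M ^ (ε - (p - 1))) * ∫⁻ x, ‖f x‖ₑ ^ p := fun u hu =>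
    H₂ M M⁻¹ u F hM1 (inv_nonneg.2 hM0.le) hu (HD' u hu M hM1) f hf hfi hf2
  have hB : ∀ u ∈ Icc (1:ℝ) 2, ∫⁻ x, ‖K' u x‖ₑ ^ p ≤
      ENNReal.ofReal (M ^ p) *
        (ENNReal.ofReal (C₂ * M ^ (ε - (p - 1))) * ∫⁻ x, ‖f x‖ₑ ^ p) := fun u hu => by
    have e : ∀ x, ‖K' u x‖ₑ ^ p = ENNReal.ofReal (M ^ p) * ‖K₁ u x‖ₑ ^ p := fun x => by
      rw [show K' u x = M * K₁ u x from hcv u x, enorm_mul, ENNReal.mul_rpow_of_nonneg _ _ hp0.le,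
        Real.enorm_eq_ofReal hM0.le, ENNReal.ofReal_rpow_of_pos hM0]
    rw [lintegral_congr e, lintegral_const_mul' _ _ ENNReal.ofReal_ne_top]
    exact mul_le_mul_right (hB₁ u hu) _
  refine (lintegral_iSup_enorm_rpow_le hp1 hKm hKm' hsub hA hB (inv_pos.2 hM0) hV hT).trans
    (le_of_eq ?_)
  rw [← mul_assoc (ENNReal.ofReal (M⁻¹ ^ p)), ← ENNReal.ofReal_mul (by positivity),
    ← Real.mul_rpow (by positivity) hM0.le, inv_mul_cancel₀ hM0.ne', Real.one_rpow,
    ENNReal.ofReal_one, one_mul, ← add_mul, ← mul_assoc, ← mul_assoc,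
    ← ENNReal.ofReal_add (by positivity) (by positivity), ← add_mul]
  congr 1
  have e2 : (2:ℝ≥0∞) ^ (p - 1) = ENNReal.ofReal (2 ^ (p - 1)) := by
    rw [← ENNReal.ofReal_rpow_of_pos two_pos, ENNReal.ofReal_ofNat]
  rw [e2, ← ENNReal.ofReal_natCast, ← ENNReal.ofReal_mul (by positivity),
    ← ENNReal.ofReal_mul (by positivity)]
  congr 1
  ring
end

theorem exists_bump : ∃ φ φ' : ℝ × ℝ → ℝ, ContDiff ℝ 1 φ ∧ HasCompactSupport φ ∧ ∫ z, φ z = 1 ∧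
    ContDiff ℝ 1 φ' ∧ HasCompactSupport φ' ∧ ∫ z, φ' z = 0 ∧
    ∀ z : ℝ × ℝ, HasDerivAt (fun s => φ (z.1, s)) (φ' z) z.2 := by
  let B : ContDiffBump (0:ℝ) := default
  set β : ℝ → ℝ := B.normed volume with hβ
  have h2 : ContDiff ℝ 2 β := B.contDiff_normed
  have h1 : ContDiff ℝ 1 β := h2.of_le one_le_two
  have h1' : ContDiff ℝ 1 (deriv β) := (contDiff_succ_iff_deriv.1 (h2 : ContDiff ℝ (1 + 1) β)).2.2
  have hc : HasCompactSupport β := B.hasCompactSupport_normed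
  have hc' : HasCompactSupport (deriv β) := hc.deriv
  have hI : ∫ t, β t = 1 := B.integral_normed
  have hI' : ∫ t, deriv β t = 0 := integral_eq_zero_of_hasDerivAt_of_integrable
    (fun t => (h1.differentiable one_ne_zero t).hasDerivAt)
    (h1'.continuous.integrable_of_hasCompactSupport hc')
    (h1.continuous.integrable_of_hasCompactSupport hc)
  have hprod : ∀ g : ℝ → ℝ, HasCompactSupport g →
      HasCompactSupport fun z : ℝ × ℝ => β z.1 * g z.2 := fun g hg =>
    HasCompactSupport.intro (hc.isCompact.prod hg.isCompact) fun z hz => by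
      by_contra hne
      exact hz ⟨subset_tsupport _ (left_ne_zero_of_mul hne),
        subset_tsupport _ (right_ne_zero_of_mul hne)⟩
  refine ⟨fun z => β z.1 * β z.2, fun z => β z.1 * deriv β z.2, ?_, hprod _ hc, ?_, ?_,
    hprod _ hc', ?_, fun z => ?_⟩
  · exact (h1.comp contDiff_fst).mul (h1.comp contDiff_snd)
  · rw [show (volume : Measure (ℝ × ℝ)) = (volume : Measure ℝ).prod volume from rfl,
      integral_prod_mul, hI, one_mul]
  · exact (h1.comp contDiff_fst).mul (h1'.comp contDiff_snd)
  · rw [show (volume : Measure (ℝ × ℝ)) = (volume : Measure ℝ).prod volume from rfl,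
      integral_prod_mul, hI', mul_zero]
  · exact ((h1.differentiable one_ne_zero z.2).hasDerivAt).const_mul (β z.1)

section
variable {b cp cm : ℝ}

theorem integral_scl {l m : ℝ} (hl : 0 < l) (hm : 0 < m) (g : ℝ × ℝ → ℝ) :
    ∫ z, scl l m g z = ∫ z, g z := by
  simpa using integral_scl_smul hl hm g fun _ => (1:ℝ)

theorem hasCompactSupport_scl {l m : ℝ} (hl : 0 < l) (hm : 0 < m) {g : ℝ × ℝ → ℝ}
    (hg : HasCompactSupport g) : HasCompactSupport (scl l m g) := by
  have hK := hg.isCompact.image (by fun_prop : Continuous fun z : ℝ × ℝ => (z.1 / l, z.2 / m))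
  refine HasCompactSupport.intro hK fun z hz => ?_
  by_contra hne
  refine hz ⟨(l * z.1, m * z.2), subset_tsupport _ (right_ne_zero_of_mul hne), ?_⟩
  ext <;> simp [mul_div_cancel_left₀, hl.ne', hm.ne']

theorem kern_sub (hb : 1 < b) {ap am : ℝ → ℝ} (hap : Continuous ap) (ham : Continuous am)
    (F : Finset ℤ) {ψ χ : ℝ × ℝ → ℝ} (hψ : Continuous ψ) (hχ : Continuous χ) (u : ℝ) (x : ℝ × ℝ) :
    kern b cp cm ap am F (fun z => ψ z - χ z) u x =
      kern b cp cm ap am F ψ u x - kern b cp cm ap am F χ u x := by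
  simp only [kern, kdil, scl, ← Finset.sum_sub_distrib, cav_sub hb hap ham u hψ hχ, mul_sub]

theorem integrable_kern_sub_smul (hb : 1 < b) {ap am : ℝ → ℝ} (hap : Continuous ap)
    (ham : Continuous am) (F : Finset ℤ) {ψ : ℝ × ℝ → ℝ} (hψ : Continuous ψ)
    (hψc : HasCompactSupport ψ) {u : ℝ} (hu : u ∈ Icc (1:ℝ) 2) {f : ℝ × ℝ → ℝ} (hf : Continuous f)
    (x : ℝ × ℝ) : Integrable fun y => kern b cp cm ap am F ψ u (x - y) • f y := by
  have hc := (continuous_kern_right (cp := cp) (cm := cm) hb hap ham F hψ u).comp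
    (by fun_prop : Continuous fun y : ℝ × ℝ => x - y)
  simp only [Function.comp_def] at hc
  have hs := (hasCompactSupport_kern (cp := cp) (cm := cm) hb ap am F hψc
    hu).comp_homeomorph (Homeomorph.subLeft x)
  exact (hc.smul hf).integrable_of_hasCompactSupport (HasCompactSupport.smul_right hs)

theorem measurable_iSup_cv_kern (hb : 1 < b) {ap am : ℝ → ℝ} (hap : Continuous ap)
    (ham : Continuous am) (F : Finset ℤ) {ψ : ℝ × ℝ → ℝ} (hψ : Continuous ψ)
    (hψc : HasCompactSupport ψ) {V : Set ℝ} (hV : V ⊆ Icc 1 2) {f : ℝ × ℝ → ℝ} (hf : Integrable f) :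
    Measurable fun x => ⨆ u ∈ V, ‖cv (kern b cp cm ap am F ψ u) f x‖ₑ :=
  (lowerSemicontinuous_biSup fun u hu => (continuous_cv
    (continuous_kern_right hb hap ham F hψ u) (hasCompactSupport_kern hb ap am F hψc (hV hu))
    hf).enorm.lowerSemicontinuous).measurable

theorem lintegral_sum_range_rpow_le {X : Type*} [MeasurableSpace X] {μ : Measure X} {p : ℝ}
    (hp : 1 ≤ p) {G : ℕ → X → ℝ≥0∞} (hG : ∀ l, Measurable (G l)) {A : ℝ} (hA : 0 ≤ A) {q : ℝ}
    (hq0 : 0 ≤ q) (hq1 : q < 1) {N : ℝ≥0∞}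
    (h : ∀ l, ∫⁻ x, G l x ^ p ∂μ ≤ ENNReal.ofReal (A * q ^ l) * N) (L : ℕ) :
    ∫⁻ x, (∑ l ∈ Finset.range L, G l x) ^ p ∂μ ≤
      ENNReal.ofReal (A * ((1 - q ^ p⁻¹)⁻¹) ^ p) * N := by
  have hp0 : 0 < p := by linarith
  set r := q ^ p⁻¹ with hr
  have hr0 : 0 ≤ r := by positivity
  have hr1 : r < 1 := Real.rpow_lt_one hq0 hq1 (inv_pos.2 hp0)
  have hone : ∀ l, (∫⁻ x, G l x ^ p ∂μ) ^ (1 / p) ≤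
      ENNReal.ofReal (A ^ p⁻¹ * r ^ l) * N ^ (1 / p) := fun l => by
    refine (ENNReal.rpow_le_rpow (h l) (by positivity)).trans (le_of_eq ?_)
    rw [ENNReal.mul_rpow_of_nonneg _ _ (by positivity),
      ENNReal.ofReal_rpow_of_nonneg (by positivity) (by positivity),
      Real.mul_rpow hA (by positivity), one_div, ← Real.rpow_natCast, ← Real.rpow_mul hq0,
      mul_comm (l : ℝ), Real.rpow_mul hq0, Real.rpow_natCast]
  have hsum : ∀ L, (∫⁻ x, (∑ l ∈ Finset.range L, G l x) ^ p ∂μ) ^ (1 / p) ≤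
      ∑ l ∈ Finset.range L, ENNReal.ofReal (A ^ p⁻¹ * r ^ l) * N ^ (1 / p) := fun L => by
    induction L with
    | zero => simp [hp0]
    | succ L ih =>
      simp only [Finset.sum_range_succ]
      exact (ENNReal.lintegral_Lp_add_le
        (Finset.measurable_sum _ fun l _ => hG l).aemeasurable (hG L).aemeasurable hp).trans
        (add_le_add ih (hone L))
  have hgeo : ∑ l ∈ Finset.range L, ENNReal.ofReal (A ^ p⁻¹ * r ^ l) * N ^ (1 / p) ≤
      ENNReal.ofReal (A ^ p⁻¹ * (1 - r)⁻¹) * N ^ (1 / p) := by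
    rw [← Finset.sum_mul, ← ENNReal.ofReal_sum_of_nonneg fun l _ => by positivity,
      ← Finset.mul_sum]
    refine mul_le_mul_left (ENNReal.ofReal_le_ofReal (mul_le_mul_of_nonneg_left ?_
      (by positivity))) _
    rw [← tsum_geometric_of_lt_one hr0 hr1]
    exact (summable_geometric_of_lt_one hr0 hr1).sum_le_tsum _ fun l _ => by positivity
  have h1r : 0 < 1 - r := by linarith
  calc _ = ((∫⁻ x, (∑ l ∈ Finset.range L, G l x) ^ p ∂μ) ^ (1 / p)) ^ p := by
        rw [← ENNReal.rpow_mul, one_div_mul_cancel hp0.ne', ENNReal.rpow_one]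
    _ ≤ (ENNReal.ofReal (A ^ p⁻¹ * (1 - r)⁻¹) * N ^ (1 / p)) ^ p :=
        ENNReal.rpow_le_rpow ((hsum L).trans hgeo) hp0.le
    _ = _ := by
        rw [ENNReal.mul_rpow_of_nonneg _ _ hp0.le, ← ENNReal.rpow_mul, one_div_mul_cancel hp0.ne',
          ENNReal.rpow_one, ENNReal.ofReal_rpow_of_nonneg (by positivity) hp0.le,
          Real.mul_rpow (by positivity) (by positivity), ← Real.rpow_mul hA,
          inv_mul_cancel₀ hp0.ne', Real.rpow_one]
end

section
variable {b cp cm : ℝ}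

theorem scl_one_one (g : ℝ × ℝ → ℝ) : scl 1 1 g = g := by
  funext z
  simp [scl]

theorem contDiff_scl (l m : ℝ) {g : ℝ × ℝ → ℝ} (hg : ContDiff ℝ 1 g) : ContDiff ℝ 1 (scl l m g) :=
  contDiff_const.mul (hg.comp ((contDiff_const.mul contDiff_fst).prodMk
    (contDiff_const.mul contDiff_snd)))

theorem exists_lintegral_iSup_cv_kern_scl_le (hb : 1 < b) (hcp : cp ≠ 0) (hcm : cm ≠ 0) {p : ℝ}
    (hp1 : 1 < p) (hp2 : p ≤ 2) {s : ℝ} (hs0 : 0 ≤ s) (hs : s < p - 1) {A₀ : ℝ} (hA₀ : 0 ≤ A₀)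
    {V : Set ℝ} (hV : V ⊆ Icc 1 2)
    (hcov : ∀ l : ℕ, ∃ T : Finset ℝ, V ⊆ ⋃ a ∈ T, Icc a (a + ((2:ℝ) ^ l)⁻¹) ∧
      (T.card : ℝ) ≤ A₀ * ((2:ℝ) ^ l) ^ s)
    {φ φ' : ℝ × ℝ → ℝ} (hφ : ContDiff ℝ 1 φ) (hφc : HasCompactSupport φ) (hφ' : ContDiff ℝ 1 φ')
    (hφc' : HasCompactSupport φ') (hφ0 : ∫ z, φ' z = 0)
    (hd : ∀ z : ℝ × ℝ, HasDerivAt (fun s => φ (z.1, s)) (φ' z) z.2) :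
    ∃ C, 0 ≤ C ∧ ∀ (F : Finset ℤ) (L : ℕ) (f : ℝ × ℝ → ℝ), Continuous f → Integrable f →
      MemLp f 2 →
        ∫⁻ x, (⨆ u ∈ V, ‖cv (kern b cp cm (pw 1 (-1)) (pw (-1) (-1)) F
          (scl (2 ^ L) (2 ^ L) φ) u) f x‖ₑ) ^ p ≤ ENNReal.ofReal C * ∫⁻ x, ‖f x‖ₑ ^ p := by
  set ε := (p - 1 - s) / 2 with hε
  have hε0 : 0 < ε := by rw [hε]; linarith
  have hε1 : ε ≤ 1 := by rw [hε]; linarith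
  have hh : (0:ℝ) < 2⁻¹ := by norm_num
  set Ψ : ℝ × ℝ → ℝ := fun z => φ z - scl 2⁻¹ 2⁻¹ φ z with hΨdef
  set Ψ' : ℝ × ℝ → ℝ := fun z => φ' z - 2⁻¹ * scl 2⁻¹ 2⁻¹ φ' z with hΨdef'
  have hφs := contDiff_scl 2⁻¹ 2⁻¹ hφ
  have hφs' := contDiff_scl 2⁻¹ 2⁻¹ hφ'
  have hφsc := hasCompactSupport_scl hh hh hφc
  have hφsc' := hasCompactSupport_scl hh hh hφc'
  have hΨ : ContDiff ℝ 1 Ψ := hφ.sub hφs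
  have hΨ' : ContDiff ℝ 1 Ψ' := hφ'.sub (contDiff_const.mul hφs')
  have hΨc : HasCompactSupport Ψ := hφc.sub hφsc
  have hΨc' : HasCompactSupport Ψ' :=
    hφc'.sub (f' := fun z => 2⁻¹ * scl 2⁻¹ 2⁻¹ φ' z) hφsc'.mul_left
  have hΨI : ∫ z, Ψ z = 0 := by
    rw [hΨdef, integral_sub (hφ.continuous.integrable_of_hasCompactSupport hφc)
      (hφs.continuous.integrable_of_hasCompactSupport hφsc), integral_scl hh hh, sub_self]
  have hΨI' : ∫ z, Ψ' z = 0 := by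
    rw [hΨdef', integral_sub (hφ'.continuous.integrable_of_hasCompactSupport hφc')
      ((hφs'.continuous.integrable_of_hasCompactSupport hφsc').const_mul _), integral_const_mul,
      integral_scl hh hh, hφ0, mul_zero, sub_zero]
  have hΨd : ∀ z : ℝ × ℝ, HasDerivAt (fun s => Ψ (z.1, s)) (Ψ' z) z.2 := fun z => by
    have h1 := ((hd (2⁻¹ * z.1, 2⁻¹ * z.2)).comp z.2
      ((hasDerivAt_id z.2).const_mul (2⁻¹:ℝ))).const_mul ((2⁻¹:ℝ) * 2⁻¹)
    refine ((hd z).sub h1).congr_deriv ?_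
    simp only [hΨdef', scl]
    ring
  obtain ⟨D₁, hD₁, HD₁⟩ := exists_norm_ft_cav_le hb hcp hcm hφ.continuous hφc
  obtain ⟨D₂, hD₂, HD₂⟩ := exists_norm_ft_cav_scl_le hb hcp hcm 1 (-1) (-1) hΨ.continuous hΨc hΨI
  obtain ⟨C₁, hC₁, H₁⟩ := exists_lintegral_iSup_cv_kern_le hb hcp hcm hp1 hp2 hε0 hε1 hφ hφc hφ'
    hφc' hφ0 hd hD₁ (S := {1}) (by simp) (c := fun _ => 1) (fun _ _ => zero_le_one)
    (fun M hM u hu ξ => by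
      rw [mem_singleton_iff.1 hM, scl_one_one, Real.one_rpow, mul_one, one_mul]
      exact HD₁ u hu ξ)
  obtain ⟨C₂, hC₂, H₂⟩ := exists_lintegral_iSup_cv_kern_le hb hcp hcm hp1 hp2 hε0 hε1 hΨ hΨc hΨ'
    hΨc' hΨI' hΨd hD₂ (S := Ici 1) le_rfl (c := fun M => M⁻¹)
    (fun M hM => inv_nonneg.2 (zero_le_one.trans hM)) (fun M hM u hu ξ => HD₂ u hu M hM ξ)
  set q : ℝ := 2 ^ (-ε) with hq
  have hq0 : 0 ≤ q := by positivity
  have hq1 : q < 1 := Real.rpow_lt_one_of_one_lt_of_neg one_lt_two (by linarith)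
  refine ⟨(C₁ + C₂) * A₀ * ((1 - q ^ p⁻¹)⁻¹) ^ p, ?_, fun F L f hf hfi hf2 => ?_⟩
  · have : q ^ p⁻¹ ≤ 1 := Real.rpow_le_one hq0 hq1.le (by positivity)
    have : 0 ≤ 1 - q ^ p⁻¹ := by linarith
    positivity
  have c1 := continuous_pw 1 (-1)
  have c2 := continuous_pw (-1) (-1)
  have h2l : ∀ l : ℕ, (0:ℝ) < 2 ^ l := fun l => by positivity
  set θ : ℕ → ℝ × ℝ → ℝ := fun l => if l = 0 then φ else scl (2 ^ l) (2 ^ l) Ψ with hθ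
  have hθcont : ∀ l, Continuous (θ l) := fun l => by
    rcases l with _ | l
    · simpa [hθ] using hφ.continuous
    · simpa [hθ] using continuous_scl _ _ hΨ.continuous
  have hθc : ∀ l, HasCompactSupport (θ l) := fun l => by
    rcases l with _ | l
    · simpa [hθ] using hφc
    · simpa [hθ] using hasCompactSupport_scl (h2l _) (h2l _) hΨc
  set G : ℕ → ℝ × ℝ → ℝ≥0∞ := fun l x =>
    ⨆ u ∈ V, ‖cv (kern b cp cm (pw 1 (-1)) (pw (-1) (-1)) F (θ l) u) f x‖ₑ with hG
  have hGm : ∀ l, Measurable (G l) := fun l =>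
    measurable_iSup_cv_kern hb c1 c2 F (hθcont l) (hθc l) hV hfi
  have hGb : ∀ l, ∫⁻ x, G l x ^ p ≤
      ENNReal.ofReal ((C₁ + C₂) * A₀ * q ^ l) * ∫⁻ x, ‖f x‖ₑ ^ p := fun l => by
    obtain ⟨T, hT, hTc⟩ := hcov l
    rcases l with _ | l
    · have h := H₁ 1 rfl V hV T (by simpa using hT) F f hf hfi hf2
      rw [scl_one_one] at h
      refine h.trans (mul_le_mul_left (ENNReal.ofReal_le_ofReal ?_) _)
      rw [Real.one_rpow, mul_one, pow_zero, mul_one]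
      rw [pow_zero, Real.one_rpow, mul_one] at hTc
      exact mul_le_mul (by linarith) hTc (by positivity) (by positivity)
    · have h := H₂ (2 ^ (l + 1)) (mem_Ici.2 (one_le_pow₀ one_le_two)) V hV T hT F f hf hfi hf2
      refine h.trans (mul_le_mul_left (ENNReal.ofReal_le_ofReal ?_) _)
      have e : q ^ (l + 1) = ((2:ℝ) ^ (l + 1)) ^ s * ((2:ℝ) ^ (l + 1)) ^ (ε - (p - 1)) := by
        rw [← Real.rpow_add (h2l _), hq, ← Real.rpow_natCast, ← Real.rpow_natCast,
          ← Real.rpow_mul zero_le_two, ← Real.rpow_mul zero_le_two]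
        congr 1
        rw [hε]
        ring
      rw [e, ← mul_assoc, mul_assoc _ A₀]
      refine mul_le_mul_of_nonneg_right ?_ (by positivity)
      exact mul_le_mul (by linarith) hTc (by positivity) (by positivity)
  have htel : ∀ (L : ℕ) (u : ℝ), u ∈ V → ∀ x, ‖cv (kern b cp cm (pw 1 (-1)) (pw (-1) (-1)) F
      (scl (2 ^ L) (2 ^ L) φ) u) f x‖ₑ ≤ ∑ l ∈ Finset.range (L + 1), G l x := by
    intro L u hu x
    have hle : ∀ l, ‖cv (kern b cp cm (pw 1 (-1)) (pw (-1) (-1)) F (θ l) u) f x‖ₑ ≤ G l x :=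
      fun l => le_iSup₂ (f := fun u (_ : u ∈ V) =>
        ‖cv (kern b cp cm (pw 1 (-1)) (pw (-1) (-1)) F (θ l) u) f x‖ₑ) u hu
    induction L with
    | zero =>
      rw [pow_zero, scl_one_one, zero_add, Finset.sum_range_one]
      exact hle 0
    | succ L ih =>
      rw [Finset.sum_range_succ]
      have e1 : θ (L + 1) = fun z => scl (2 ^ (L + 1)) (2 ^ (L + 1)) φ z -
          scl (2 ^ L) (2 ^ L) φ z := by
        funext z
        simp only [hθ, Nat.succ_ne_zero, if_false, hΨdef, scl, mul_sub]
        rw [pow_succ]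
        ring_nf
      have e2 : cv (kern b cp cm (pw 1 (-1)) (pw (-1) (-1)) F (θ (L + 1)) u) f x =
          cv (kern b cp cm (pw 1 (-1)) (pw (-1) (-1)) F (scl (2 ^ (L + 1)) (2 ^ (L + 1)) φ) u) f x -
          cv (kern b cp cm (pw 1 (-1)) (pw (-1) (-1)) F (scl (2 ^ L) (2 ^ L) φ) u) f x := by
        have i := fun l : ℕ => integrable_kern_sub_smul (cp := cp) (cm := cm) hb c1 c2 F
          (continuous_scl (2 ^ l) (2 ^ l) hφ.continuous)
          (hasCompactSupport_scl (h2l l) (h2l l) hφc) (hV hu) hf x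
        rw [cv, cv, cv, ← integral_sub (i _) (i _), e1]
        refine integral_congr_ae (Eventually.of_forall fun y => ?_)
        simp only [kern_sub hb c1 c2 F (continuous_scl _ _ hφ.continuous)
          (continuous_scl _ _ hφ.continuous), sub_smul]
      have e3 := sub_add_cancel
        (cv (kern b cp cm (pw 1 (-1)) (pw (-1) (-1)) F (scl (2 ^ (L + 1)) (2 ^ (L + 1)) φ) u) f x)
        (cv (kern b cp cm (pw 1 (-1)) (pw (-1) (-1)) F (scl (2 ^ L) (2 ^ L) φ) u) f x)
      rw [← e2, add_comm] at e3
      rw [← e3]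
      exact (enorm_add_le _ _).trans (add_le_add ih (hle _))
  refine le_trans (lintegral_mono fun x => ENNReal.rpow_le_rpow (iSup₂_le fun u hu => htel L u hu x)
    (by linarith)) ?_
  exact lintegral_sum_range_rpow_le hp1.le hGm (by positivity) hq0 hq1 hGb _
end

section
variable {b cp cm : ℝ}

theorem oddQuot_comp_dil {l t : ℝ} (hl : 0 < l) (ht : 0 ≤ t) (u : ℝ) (f : ℝ × ℝ → ℝ) (x : ℝ × ℝ) :
    oddQuot b cp cm u (fun w => f (x + (l * w.1, l ^ b * w.2))) 0 t =
      l * oddQuot b cp cm u f x (l * t) := by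
  have e : ∀ σ c : ℝ, x + (l * ((0 : ℝ × ℝ) - (σ * t, u * (c * t ^ b))).1,
      l ^ b * ((0 : ℝ × ℝ) - (σ * t, u * (c * t ^ b))).2) =
      x - (σ * (l * t), u * (c * (l * t) ^ b)) := fun σ c => by
    rw [Real.mul_rpow hl.le ht]
    ext <;> simp <;> ring
  have e1 := e 1 cp
  have e2 := e (-1) cm
  simp only [one_mul, neg_one_mul] at e1 e2
  simp only [oddQuot, e1, e2, smul_eq_mul, mul_inv]
  rw [mul_assoc l⁻¹ t⁻¹, mul_inv_cancel_left₀ hl.ne']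

theorem integral_oddQuot_comp_dil {l : ℝ} (hl : 0 < l) (u : ℝ) (f : ℝ × ℝ → ℝ) (x : ℝ × ℝ) :
    ∫ t in (1:ℝ)..2, oddQuot b cp cm u (fun w => f (x + (l * w.1, l ^ b * w.2))) 0 t =
      ∫ t in l..(l * 2), oddQuot b cp cm u f x t := by
  have h := intervalIntegral.smul_integral_comp_mul_left (a := 1) (b := 2)
    (fun t => oddQuot b cp cm u f x t) l
  rw [mul_one] at h
  rw [← h, smul_eq_mul, ← intervalIntegral.integral_const_mul]
  refine intervalIntegral.integral_congr fun t ht => ?_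
  rw [uIcc_of_le one_le_two] at ht
  exact oddQuot_comp_dil hl (zero_le_one.trans ht.1) u f x

theorem cv_kdil_eq {j : ℤ} (k f : ℝ × ℝ → ℝ) (x : ℝ × ℝ) :
    cv (kdil b j k) f x =
      ∫ z, k z • f (x + (2 ^ j * ((0:ℝ × ℝ) - z).1, ((2:ℝ) ^ j) ^ b * ((0:ℝ × ℝ) - z).2)) := by
  have hl : (0:ℝ) < 2 ^ j := by positivity
  rw [cv, ← integral_sub_left_eq_self _ volume x]
  simp only [sub_sub_cancel, kdil]
  rw [integral_scl_smul (by positivity) (by positivity)]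
  refine integral_congr_ae (Eventually.of_forall fun z => ?_)
  simp only
  congr 2
  ext <;> simp <;> ring

theorem tendsto_integral_scl_smul {φ : ℝ × ℝ → ℝ} (hφ : Continuous φ) (hφc : HasCompactSupport φ)
    (hφI : ∫ z, φ z = 1) {H : ℝ × ℝ → ℝ} (hH : Continuous H) :
    Tendsto (fun L : ℕ => ∫ w, scl (2 ^ L) (2 ^ L) φ w • H (0 - w)) atTop (𝓝 (H 0)) := by
  have hcont : ContinuousOn (fun r : ℝ => ∫ w : ℝ × ℝ, φ w * H (0 - (r * w.1, r * w.2))) univ :=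
    continuousOn_integral_of_compact_support (k := tsupport φ) hφc.isCompact
      (Continuous.continuousOn (by simp only [Function.uncurry_def]; fun_prop)) fun r w _ hw => by
        rw [image_eq_zero_of_notMem_tsupport hw, zero_mul]
  have ht : Tendsto (fun L : ℕ => ((2:ℝ) ^ L)⁻¹) atTop (𝓝 0) :=
    tendsto_inv_atTop_zero.comp (tendsto_pow_atTop_atTop_of_one_lt one_lt_two)
  have h := (hcont.continuousAt univ_mem).tendsto.comp ht
  have e0 : ∫ w : ℝ × ℝ, φ w * H (0 - (0 * w.1, 0 * w.2)) = H 0 := by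
    simp only [zero_mul, Prod.mk_zero_zero, sub_zero]
    rw [integral_mul_const, hφI, one_mul]
  rw [e0] at h
  refine h.congr fun L => ?_
  rw [integral_scl_smul (by positivity) (by positivity)]
  simp only [Function.comp_def, smul_eq_mul, div_eq_inv_mul]

theorem tendsto_cv_kern (hb : 1 < b) {φ : ℝ × ℝ → ℝ} (hφ : Continuous φ) (hφc : HasCompactSupport φ)
    (hφI : ∫ z, φ z = 1) {u : ℝ} (hu : u ∈ Icc (1:ℝ) 2) {f : ℝ × ℝ → ℝ} (hf : Continuous f)
    (x : ℝ × ℝ) (J : ℕ) :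
    Tendsto (fun L : ℕ => cv (kern b cp cm (pw 1 (-1)) (pw (-1) (-1)) (Finset.Ico (-(J:ℤ)) J)
      (scl (2 ^ L) (2 ^ L) φ) u) f x) atTop
      (𝓝 (∫ t in ((2:ℝ) ^ (-(J:ℤ)))..(2 ^ (J:ℤ)), oddQuot b cp cm u f x t)) := by
  have c1 := continuous_pw 1 (-1)
  have c2 := continuous_pw (-1) (-1)
  have hs : ∀ L : ℕ, Continuous (scl (2 ^ L) (2 ^ L) φ) := fun L => continuous_scl _ _ hφ
  have hsc : ∀ L : ℕ, HasCompactSupport (scl (2 ^ L) (2 ^ L) φ) := fun L =>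
    hasCompactSupport_scl (by positivity) (by positivity) hφc
  rw [integral_oddQuot_eq_sum hb hf]
  have hsum : ∀ L : ℕ, cv (kern b cp cm (pw 1 (-1)) (pw (-1) (-1)) (Finset.Ico (-(J:ℤ)) J)
      (scl (2 ^ L) (2 ^ L) φ) u) f x = ∑ j ∈ Finset.Ico (-(J:ℤ)) J,
      cv (kdil b j (cav b cp cm (pw 1 (-1)) (pw (-1) (-1)) u (scl (2 ^ L) (2 ^ L) φ))) f x := by
    intro L
    simp only [cv, kern, Finset.sum_smul]
    refine integral_finsetSum _ fun j _ => ?_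
    have h := integrable_kern_sub_smul (cp := cp) (cm := cm) hb c1 c2 {j} (hs L) (hsc L) hu hf x
    simpa only [kern, Finset.sum_singleton] using h
  simp only [hsum]
  refine tendsto_finsetSum _ fun j _ => ?_
  have hl : (0:ℝ) < 2 ^ j := by positivity
  set h : ℝ × ℝ → ℝ := fun w => f (x + (2 ^ j * w.1, ((2:ℝ) ^ j) ^ b * w.2)) with hh
  have hhc : Continuous h := by rw [hh]; fun_prop
  have hlim := tendsto_integral_scl_smul hφ hφc hφI
    (continuous_cav_right (cp := cp) (cm := cm) hb c1 c2 u hhc)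
  rw [cav_pw_eq_integral_oddQuot, hh, integral_oddQuot_comp_dil hl] at hlim
  rw [zpow_add_one₀ two_ne_zero]
  refine hlim.congr fun L => ?_
  rw [cv_kdil_eq]
  exact (integral_cav_smul hb c1 c2 u (hs L) (hsc L) hhc 0).symm

theorem tendsto_integral_oddQuot_dyadic (hb : 1 < b) {u : ℝ} {f : ℝ × ℝ → ℝ} (hf : Tame f)
    (x : ℝ × ℝ) : Tendsto (fun J : ℕ => ∫ t in ((2:ℝ) ^ (-(J:ℤ)))..(2 ^ (J:ℤ)),
      oddQuot b cp cm u f x t) atTop (𝓝 (Hu b cp cm u f x)) := by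
  have hq : Tendsto (fun J : ℕ => (2:ℝ) ^ (J:ℤ)) atTop atTop := by
    simpa only [zpow_natCast] using tendsto_pow_atTop_atTop_of_one_lt (one_lt_two (α := ℝ))
  have hp : Tendsto (fun J : ℕ => (2:ℝ) ^ (-(J:ℤ))) atTop (𝓝 0) := by
    simp only [zpow_neg]
    exact tendsto_inv_atTop_zero.comp hq
  rw [hf.Hu_eq hb x]
  refine (hf.tendsto_integral_Ioo hb x hp (Eventually.of_forall fun J => by positivity) hq).congr
    fun J => ?_
  rw [intervalIntegral.integral_of_le (zpow_le_zpow_right₀ one_le_two (by omega)),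
    integral_Ioc_eq_integral_Ioo]

theorem exists_dominating_Hu (hb : 1 < b) (hcp : cp ≠ 0) (hcm : cm ≠ 0) {p : ℝ}
    (hp1 : 1 < p) (hp2 : p ≤ 2) {s : ℝ} (hs0 : 0 ≤ s) (hs : s < p - 1) {A₀ : ℝ} (hA₀ : 0 ≤ A₀)
    {V : Set ℝ} (hV : V ⊆ Icc 1 2)
    (hcov : ∀ l : ℕ, ∃ T : Finset ℝ, V ⊆ ⋃ a ∈ T, Icc a (a + ((2:ℝ) ^ l)⁻¹) ∧
      (T.card : ℝ) ≤ A₀ * ((2:ℝ) ^ l) ^ s) :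
    ∃ C : ℝ, 0 ≤ C ∧ ∀ f : ℝ × ℝ → ℝ, Tame f → Integrable f → MemLp f 2 →
      ∃ a : ℝ × ℝ → ℝ≥0∞, Measurable a ∧ (∀ u ∈ V, ∀ x, ‖Hu b cp cm u f x‖ₑ ^ p ≤ a x) ∧
        ∫⁻ x, a x ≤ ENNReal.ofReal C * ∫⁻ x, ‖f x‖ₑ ^ p := by
  have hp0 : 0 < p := by linarith
  obtain ⟨φ, φ', hφ, hφc, hφI, hφ', hφc', hφI', hd⟩ := exists_bump
  obtain ⟨C, hC, H⟩ := exists_lintegral_iSup_cv_kern_scl_le hb hcp hcm hp1 hp2 hs0 hs hA₀ hV hcov hφ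
    hφc hφ' hφc' hφI' hd
  refine ⟨C, hC, fun f hf hfi hf2 => ?_⟩
  set k : ℕ → ℕ → ℝ → ℝ × ℝ → ℝ := fun J L u x => cv (kern b cp cm (pw 1 (-1)) (pw (-1) (-1))
    (Finset.Ico (-(J:ℤ)) J) (scl (2 ^ L) (2 ^ L) φ) u) f x with hk
  set G : ℕ → ℕ → ℝ × ℝ → ℝ≥0∞ := fun J L x => (⨆ u ∈ V, ‖k J L u x‖ₑ) ^ p with hG
  have hGm : ∀ J L, Measurable (G J L) := fun J L =>
    (measurable_iSup_cv_kern hb (continuous_pw _ _) (continuous_pw _ _) _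
      (continuous_scl _ _ hφ.continuous)
      (hasCompactSupport_scl (by positivity) (by positivity) hφc) hV hfi).pow_const p
  have hGm' : ∀ J, Measurable fun x => liminf (fun L => G J L x) atTop := fun J =>
    Measurable.liminf (hGm J)
  have hcts : Continuous fun y : ℝ => ‖y‖ₑ ^ p := ENNReal.continuous_rpow_const.comp continuous_enorm
  refine ⟨fun x => liminf (fun J => liminf (fun L => G J L x) atTop) atTop, Measurable.liminf hGm',
    fun u hu x => ?_, ?_⟩
  · have h1 : ∀ J : ℕ, ‖∫ t in ((2:ℝ) ^ (-(J:ℤ)))..(2 ^ (J:ℤ)), oddQuot b cp cm u f x t‖ₑ ^ p ≤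
        liminf (fun L => G J L x) atTop := fun J => by
      have h := (hcts.tendsto _).comp (tendsto_cv_kern (cp := cp) (cm := cm) hb hφ.continuous hφc hφI
        (hV hu) hf.continuous x J)
      rw [← h.liminf_eq]
      exact liminf_le_liminf (Eventually.of_forall fun L => ENNReal.rpow_le_rpow
        (le_iSup₂ (f := fun u (_ : u ∈ V) => ‖k J L u x‖ₑ) u hu) hp0.le)
    have h2 := (hcts.tendsto _).comp
      (tendsto_integral_oddQuot_dyadic (cp := cp) (cm := cm) (u := u) hb hf x)
    rw [← h2.liminf_eq]
    exact liminf_le_liminf (Eventually.of_forall h1)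
  · have hbd : ∀ {g : ℕ → ℝ × ℝ → ℝ≥0∞}, (∀ n, Measurable (g n)) →
        (∀ n, ∫⁻ x, g n x ≤ ENNReal.ofReal C * ∫⁻ x, ‖f x‖ₑ ^ p) →
        ∫⁻ x, liminf (fun n => g n x) atTop ≤ ENNReal.ofReal C * ∫⁻ x, ‖f x‖ₑ ^ p :=
      fun hg h => (lintegral_liminf_le hg).trans (liminf_le_of_le
        (by isBoundedDefault) fun c hc => by
          obtain ⟨n, hn⟩ := hc.exists
          exact hn.trans (h n))
    exact hbd hGm' fun J => hbd (hGm J) fun L => H _ L f hf.continuous hfi hf2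
end

theorem exists_covN_cover {A : Set ℝ} (hA : A ⊆ Icc 1 2) {δ : ℝ} (hδ : 0 < δ) :
    (∃ T : Finset ℝ, A ⊆ (⋃ a ∈ T, Icc a (a + δ)) ∧ T.card = covN A δ) ∧
      (covN A δ : ℝ) ≤ δ⁻¹ + 1 := by
  set T : Finset ℝ := (Finset.range (⌊δ⁻¹⌋₊ + 1)).image fun i : ℕ => 1 + i * δ with hT
  have hcov : A ⊆ ⋃ a ∈ T, Icc a (a + δ) := fun x hx => by
    obtain ⟨h1, h2⟩ := hA hx
    have h0 : 0 ≤ (x - 1) * δ⁻¹ := mul_nonneg (by linarith) (by positivity)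
    have e : x - 1 = (x - 1) * δ⁻¹ * δ := by field_simp
    refine mem_iUnion₂.2 ⟨1 + ⌊(x - 1) * δ⁻¹⌋₊ * δ, Finset.mem_image_of_mem _ (Finset.mem_range.2
      (Nat.lt_succ_of_le (Nat.floor_le_floor (mul_le_of_le_one_left (by positivity)
        (by linarith))))), ?_, ?_⟩
    · have := mul_le_mul_of_nonneg_right (Nat.floor_le h0) hδ.le
      linarith
    · have := mul_le_mul_of_nonneg_right (Nat.lt_floor_add_one ((x - 1) * δ⁻¹)).le hδ.le
      linarith
  have hmem : T.card ∈ {n : ℕ | ∃ F : Finset ℝ, F.card = n ∧ A ⊆ ⋃ a ∈ F, Icc a (a + δ)} :=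
    ⟨T, rfl, hcov⟩
  obtain ⟨F, hF, hFA⟩ := Nat.sInf_mem ⟨_, hmem⟩
  refine ⟨⟨F, hFA, hF⟩, ?_⟩
  have h1 : covN A δ ≤ ⌊δ⁻¹⌋₊ + 1 := (Nat.sInf_le hmem).trans
    (Finset.card_image_le.trans (Finset.card_range _).le)
  calc (covN A δ : ℝ) ≤ (⌊δ⁻¹⌋₊ : ℝ) + 1 := by exact_mod_cast h1
    _ ≤ δ⁻¹ + 1 := by linarith [Nat.floor_le (inv_nonneg.2 hδ.le)]

theorem UrSet_subset (U : Set ℝ) (r : ℝ) : UrSet U r ⊆ Icc 1 2 := fun _ h => h.1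

theorem log_covN_UrSet_le (U : Set ℝ) (r : ℝ) {δ : ℝ} (hδ : 0 < δ) (hδ2 : δ ≤ 2⁻¹) :
    Real.log (covN (UrSet U r) δ) ≤ 2 * Real.log δ⁻¹ := by
  have h2 : 2 ≤ δ⁻¹ := by
    rw [← inv_inv (2:ℝ)]
    exact inv_anti₀ hδ hδ2
  rcases Nat.eq_zero_or_pos (covN (UrSet U r) δ) with h0 | h0
  · rw [h0, Nat.cast_zero, Real.log_zero]
    exact mul_nonneg zero_le_two (Real.log_nonneg (by linarith))
  · rw [← Nat.cast_ofNat (R := ℝ), ← Real.log_pow]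
    refine Real.log_le_log (by exact_mod_cast h0)
      ((exists_covN_cover (UrSet_subset U r) hδ).2.trans ?_)
    nlinarith

theorem exists_covN_UrSet_le {U : Set ℝ} {p : ℝ} (hp1 : 1 < p) (hpcr : pcr U < p) :
    ∃ s, 0 ≤ s ∧ s < p - 1 ∧ ∃ A₀ : ℝ, 0 ≤ A₀ ∧ ∀ r : ℝ, 0 < r → ∀ l : ℕ,
      (covN (UrSet U r) ((2:ℝ) ^ l)⁻¹ : ℝ) ≤ A₀ * ((2:ℝ) ^ l) ^ s := by
  obtain ⟨s, hs1, hs2⟩ := exists_between (max_lt (sub_pos.2 hp1) (sub_lt_sub_right hpcr 1))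
  have hs0 : 0 < s := (le_max_left _ _).trans_lt hs1
  refine ⟨s, hs0.le, hs2, ?_⟩
  have hlim : limsup (fun δ : ℝ =>
      (⨆ r : {r : ℝ // 0 < r}, Real.log (covN (UrSet U (r : ℝ)) δ)) / Real.log δ⁻¹)
      (𝓝[>] (0:ℝ)) < s := by
    have := (le_max_right _ _).trans_lt hs1
    rwa [pcr, add_sub_cancel_left] at this
  have : Nonempty {r : ℝ // 0 < r} := ⟨⟨1, one_pos⟩⟩
  have hlog : ∀ δ : ℝ, 0 < δ → δ ≤ 2⁻¹ → 0 < Real.log δ⁻¹ := fun δ hδ hδ2 =>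
    Real.log_pos ((one_lt_inv₀ hδ).2 (hδ2.trans_lt (by norm_num)))
  have hbdd : IsBoundedUnder (· ≤ ·) (𝓝[>] (0:ℝ)) (fun δ : ℝ =>
      (⨆ r : {r : ℝ // 0 < r}, Real.log (covN (UrSet U (r : ℝ)) δ)) / Real.log δ⁻¹) := by
    refine isBoundedUnder_of_eventually_le (a := 2) ?_
    filter_upwards [Ioc_mem_nhdsGT (by norm_num : (0:ℝ) < 2⁻¹)] with δ hδ
    rw [div_le_iff₀ (hlog δ hδ.1 hδ.2)]
    exact ciSup_le fun r => log_covN_UrSet_le U r hδ.1 hδ.2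
  have hev := eventually_lt_of_limsup_lt hlim hbdd
  have ht : Tendsto (fun l : ℕ => ((2:ℝ) ^ l)⁻¹) atTop (𝓝[>] 0) :=
    tendsto_inv_atTop_nhdsGT_zero.comp (tendsto_pow_atTop_atTop_of_one_lt one_lt_two)
  obtain ⟨l₀, hl₀⟩ := eventually_atTop.1 (ht.eventually
    (hev.and (Ioc_mem_nhdsGT (by norm_num : (0:ℝ) < 2⁻¹))))
  refine ⟨2 ^ l₀ + 1, by positivity, fun r hr l => ?_⟩
  have h2l : (1:ℝ) ≤ 2 ^ l := one_le_pow₀ one_le_two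
  have h2s : (1:ℝ) ≤ ((2:ℝ) ^ l) ^ s := Real.one_le_rpow h2l hs0.le
  rcases le_total l₀ l with h | h
  · obtain ⟨h1, hδ, hδ2⟩ := hl₀ l h
    rw [div_lt_iff₀ (hlog _ hδ hδ2)] at h1
    have h3 : Real.log (covN (UrSet U r) ((2:ℝ) ^ l)⁻¹) ≤ s * Real.log (((2:ℝ) ^ l)⁻¹)⁻¹ :=
      (le_ciSup (f := fun r : {r : ℝ // 0 < r} =>
        Real.log (covN (UrSet U (r : ℝ)) ((2:ℝ) ^ l)⁻¹)) ⟨_, by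
          rintro _ ⟨r, rfl⟩
          exact log_covN_UrSet_le U r hδ hδ2⟩ ⟨r, hr⟩).trans h1.le
    rw [inv_inv, ← Real.log_rpow (by positivity)] at h3
    refine le_trans ?_ (le_mul_of_one_le_left (by positivity)
      (by linarith [pow_pos (two_pos (α := ℝ)) l₀] : (1:ℝ) ≤ 2 ^ l₀ + 1))
    rcases Nat.eq_zero_or_pos (covN (UrSet U r) ((2:ℝ) ^ l)⁻¹) with h0 | h0
    · rw [h0, Nat.cast_zero]
      positivity
    · exact (Real.log_le_log_iff (by exact_mod_cast h0) (by positivity)).1 h3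
  · have h1 := (exists_covN_cover (UrSet_subset U r)
      (by positivity : (0:ℝ) < ((2:ℝ) ^ l)⁻¹)).2
    rw [inv_inv] at h1
    refine h1.trans (le_trans ?_ (le_mul_of_one_le_right (by positivity) h2s))
    linarith [pow_le_pow_right₀ (one_le_two (α := ℝ)) h]

theorem Hu_mul (b cp cm r ρ : ℝ) (f : ℝ × ℝ → ℝ) (x : ℝ × ℝ) :
    Hu b cp cm (r * ρ) f x = Hu b (r * cp) (r * cm) ρ f x := by
  have e : ∀ t, r * ρ * curve b cp cm t = ρ * curve b (r * cp) (r * cm) t := fun t => by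
    unfold curve
    split_ifs <;> ring
  simp only [Hu, e]

theorem exists_lpN_calH_le {b cp cm : ℝ} (hb : 1 < b) (hcp : cp ≠ 0) (hcm : cm ≠ 0) {U : Set ℝ}
    (hU : U ⊆ Ioi (0:ℝ)) {p : ℝ} (hp1 : 1 < p) (hp2 : p ≤ 2) (hpcr : pcr U < p)
    (hN : frakN U ≠ ⊤) : ∃ C : ℝ, ∀ f : SchwartzMap (ℝ × ℝ) ℝ,
      lpN (calH b cp cm U ⇑f) p ≤ ENNReal.ofReal C * eLpNorm ⇑f (eN p) volume := by
  have hp0 : 0 < p := by linarith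
  obtain ⟨s, hs0, hs, A₀, hA₀, hcov⟩ := exists_covN_UrSet_le hp1 hpcr
  set E : Set ℤ := {n : ℤ | (Icc ((2:ℝ) ^ n) ((2:ℝ) ^ (n + 1)) ∩ U).Nonempty} with hE
  have hfin : E.Finite := by
    rw [← Set.encard_ne_top_iff]
    intro h
    rw [frakN, ← hE, h] at hN
    simp at hN
  have hblock := fun n : ℤ => exists_dominating_Hu (b := b) (cp := 2 ^ n * cp) (cm := 2 ^ n * cm) hb
    (mul_ne_zero (by positivity) hcp) (mul_ne_zero (by positivity) hcm) hp1 hp2 hs0 hs hA₀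
    (UrSet_subset U ((2:ℝ) ^ n)) fun l => by
      obtain ⟨⟨T, hT, hTc⟩, -⟩ := exists_covN_cover (UrSet_subset U ((2:ℝ) ^ n))
        (by positivity : (0:ℝ) < ((2:ℝ) ^ l)⁻¹)
      exact ⟨T, hT, hTc ▸ hcov _ (by positivity) l⟩
  choose C hC H using hblock
  refine ⟨(∑ n ∈ hfin.toFinset, C n) ^ (1 / p), fun f => ?_⟩
  choose a ham had hai using fun n => H n f f.tame f.integrable (f.memLp 2)
  have hpt : ∀ x, calH b cp cm U f x ^ p ≤ ∑ n ∈ hfin.toFinset, a n x := fun x => by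
    rw [← ENNReal.le_rpow_inv_iff hp0]
    refine iSup_le fun ⟨u, hu⟩ => ?_
    rw [ENNReal.le_rpow_inv_iff hp0]
    obtain ⟨n, hn1, hn2⟩ := exists_mem_Ico_zpow (show (0:ℝ) < u from hU hu) one_lt_two
    have hn0 : (0:ℝ) < 2 ^ n := by positivity
    have hnE : n ∈ hfin.toFinset := hfin.mem_toFinset.2 ⟨u, ⟨hn1, hn2.le⟩, hu⟩
    have eu : (2:ℝ) ^ n * (u / 2 ^ n) = u := mul_div_cancel₀ _ hn0.ne'
    have hρ : u / 2 ^ n ∈ UrSet U ((2:ℝ) ^ n) := by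
      refine ⟨⟨(one_le_div₀ hn0).2 hn1, (div_le_iff₀ hn0).2 ?_⟩, by rwa [eu]⟩
      rw [zpow_add_one₀ two_ne_zero] at hn2
      linarith
    have h := had n _ hρ x
    rw [← Hu_mul, eu, Real.enorm_eq_ofReal_abs] at h
    exact h.trans (Finset.single_le_sum (f := fun n => a n x) (fun _ _ => zero_le) hnE)
  have hig : ∫⁻ x, calH b cp cm U f x ^ p ≤
      ENNReal.ofReal (∑ n ∈ hfin.toFinset, C n) * ∫⁻ x, ‖f x‖ₑ ^ p := by
    refine (lintegral_mono hpt).trans ?_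
    rw [lintegral_finsetSum _ fun n _ => ham n, ENNReal.ofReal_sum_of_nonneg fun n _ => hC n,
      Finset.sum_mul]
    exact Finset.sum_le_sum fun n _ => hai n
  have heN : eN p ≠ 0 := (ENNReal.ofReal_pos.2 hp0).ne'
  rw [lpN, eLpNorm_eq_lintegral_rpow_enorm_toReal heN ENNReal.ofReal_ne_top, eN,
    ENNReal.toReal_ofReal hp0.le]
  refine (ENNReal.rpow_le_rpow hig (by positivity)).trans (le_of_eq ?_)
  rw [ENNReal.mul_rpow_of_nonneg _ _ (by positivity),
    ENNReal.ofReal_rpow_of_nonneg (Finset.sum_nonneg fun n _ => hC n) (by positivity)]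

theorem statement4 (b cp cm : ℝ) (hb : 1 < b) (hcp : cp ≠ 0) (hcm : cm ≠ 0)
    (U : Set ℝ) (hUne : U.Nonempty) (hUsub : U ⊆ Ioi (0:ℝ)) (p : ℝ) (hp1 : 1 < p) (hp2 : p ≤ 2) (hpcr : pcr U < p) :
    (∃ C : ℝ, ∀ f : SchwartzMap (ℝ × ℝ) ℝ,
        lpN (calH b cp cm U ⇑f) p ≤ ENNReal.ofReal C * eLpNorm ⇑f (eN p) volume)
      ↔ frakN U ≠ ⊤ :=
  ⟨fun ⟨_, hC⟩ => frakN_ne_top_of_bound hb hcp hcm hp1 hp2 hUsub hC,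
    exists_lpN_calH_le hb hcp hcm hUsub hp1 hp2 hpcr⟩

end
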